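/- There exist a constant c > 0 and B₀ (depending on the βⱼ and ηⱼ) such that for all B ≥ B₀: R(B) ≥ c·B(log B)^{−3}, where R(B) = Σ (log p₁)(log p₂)(log p₃)(log p₄), the sum being over quadruples of primes (p₁,p₂,p₃,p₄) with pⱼ ∈ I_j for j = 1,…,4 and β₁p₁ + β₂p₂ + β₃p₃ + β₄p₄ = 0. -/

import Mathlib

/-- The interval `I = [ηB^{1/3} - B^{1/3}/log B, ηB^{1/3} + B^{1/3}/log B]`. -/
noncomputable def shortInterval (η B : ℝ) : Set ℝ :=
  Set.Icc (η * B ^ ((1 : ℝ) / 3) - B ^ ((1 : ℝ) / 3) / Real.log B)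
          (η * B ^ ((1 : ℝ) / 3) + B ^ ((1 : ℝ) / 3) / Real.log B)

/-- Quadruples of primes `(p₁,p₂,p₃,p₄)` with `pⱼ ∈ I_j` and `β₁p₁+β₂p₂+β₃p₃+β₄p₄ = 0`. -/
def primeQuad (β : Fin 4 → ℤ) (η : Fin 4 → ℝ) (B : ℝ) : Set (Fin 4 → ℕ) :=
  {p | (∀ j, (p j).Prime ∧ ((p j : ℝ) ∈ shortInterval (η j) B)) ∧
    β 0 * (p 0 : ℤ) + β 1 * (p 1 : ℤ) + β 2 * (p 2 : ℤ) + β 3 * (p 3 : ℤ) = 0}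

/-- The weighted count `R(B) = Σ (log p₁)(log p₂)(log p₃)(log p₄)`. -/
noncomputable def RB (β : Fin 4 → ℤ) (η : Fin 4 → ℝ) (B : ℝ) : ℝ :=
  ∑ᶠ p ∈ primeQuad β η B,
    Real.log (p 0 : ℝ) * Real.log (p 1 : ℝ) * Real.log (p 2 : ℝ) * Real.log (p 3 : ℝ)

section

open Finset
namespace WCL

/-- `e(x) = exp(2πix)`. -/
noncomputable def ee (x : ℝ) : ℂ := Complex.exp ((2 * Real.pi * x : ℝ) * Complex.I)

lemma ee_norm (x : ℝ) : ‖ee x‖ = 1 := Complex.norm_exp_ofReal_mul_I _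

lemma ee_add (x y : ℝ) : ee (x + y) = ee x * ee y := by
  unfold ee; rw [← Complex.exp_add]; congr 1; push_cast; ring

lemma ee_zero : ee 0 = 1 := by simp [ee]

lemma ee_int (n : ℤ) : ee n = 1 := by
  unfold ee
  have : ((2 * Real.pi * (n : ℝ) : ℝ) : ℂ) * Complex.I = n * (2 * Real.pi * Complex.I) := by
    push_cast; ring
  rw [this, Complex.exp_int_mul_two_pi_mul_I]

lemma ee_nat (n : ℕ) : ee n = 1 := by exact_mod_cast ee_int n

lemma ee_neg (x : ℝ) : ee (-x) = (starRingEnd ℂ) (ee x) := by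
  unfold ee; rw [← Complex.exp_conj]; congr 1
  rw [map_mul, Complex.conj_ofReal, Complex.conj_I]; push_cast; ring

lemma ee_continuous : Continuous ee := by
  unfold ee; fun_prop

lemma ee_nat_mul (n : ℕ) (x : ℝ) : ee (n * x) = ee x ^ n := by
  unfold ee; rw [← Complex.exp_nat_mul]; congr 1; push_cast; ring

/-- distance to the nearest integer -/
noncomputable def nd (x : ℝ) : ℝ := |x - round x|

lemma nd_nonneg (x : ℝ) : 0 ≤ nd x := abs_nonneg _
lemma nd_le_half (x : ℝ) : nd x ≤ 1 / 2 := abs_sub_round x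
lemma nd_le (x : ℝ) (n : ℤ) : nd x ≤ |x - n| := round_le x n
lemma nd_le_add (x y : ℝ) : nd x ≤ nd y + |x - y| := by
  have := nd_le x (round y)
  calc nd x ≤ |x - round y| := this
    _ = |(y - round y) + (x - y)| := by ring_nf
    _ ≤ _ := abs_add_le _ _
lemma nd_eq_of_int (x y : ℝ) (n : ℤ) (h : x - y = n) : nd x = nd y := by
  have : x = y + n := by linarith
  subst this
  unfold nd; simp

lemma nd_neg (x : ℝ) : nd (-x) = nd x := by
  apply le_antisymm
  · have := nd_le (-x) (-round x)
    refine this.trans (le_of_eq ?_)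
    unfold nd; push_cast; rw [← abs_neg]; ring_nf
  · have := nd_le (x) (-round (-x))
    refine this.trans (le_of_eq ?_)
    unfold nd; push_cast; rw [← abs_neg]; ring_nf

lemma norm_ee_sub_one (x : ℝ) : 4 * nd x ≤ ‖ee x - 1‖ := by
  have h1 : ee x = ee (x - round x) := by
    have : ee x = ee ((x - round x) + (round x : ℤ)) := by ring_nf
    rw [this, ee_add, ee_int, mul_one]
  rw [h1]
  set d := x - round x with hd
  have hd2 : |d| ≤ 1 / 2 := abs_sub_round x
  have h2 : ‖ee d - 1‖ = ‖2 * Real.sin (Real.pi * d)‖ := by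
    have := Complex.norm_exp_I_mul_ofReal_sub_one (2 * Real.pi * d)
    unfold ee
    rw [mul_comm, this]; congr 3; ring
  rw [h2]
  change 4 * |d| ≤ _
  rw [Real.norm_eq_abs, abs_mul, abs_two]
  have h3 : |Real.sin (Real.pi * d)| = Real.sin (Real.pi * |d|) := by
    rcases le_total 0 d with h | h
    · rw [abs_of_nonneg h, abs_of_nonneg]
      apply Real.sin_nonneg_of_nonneg_of_le_pi (by positivity)
      rw [abs_of_nonneg h] at hd2
      nlinarith [Real.pi_pos]
    · rw [abs_of_nonpos h, mul_neg, Real.sin_neg, abs_of_nonpos]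
      rw [abs_of_nonpos h] at hd2
      have := Real.sin_nonneg_of_nonneg_of_le_pi (x := Real.pi * (-d)) (by nlinarith [Real.pi_pos])
        (by nlinarith [Real.pi_pos])
      rw [mul_neg, Real.sin_neg] at this; linarith
  rw [h3]
  have h4 := Real.mul_le_sin (x := Real.pi * |d|) (by positivity) (by nlinarith [Real.pi_pos])
  have : 2 / Real.pi * (Real.pi * |d|) = 2 * |d| := by field_simp
  linarith

lemma geo_mul (a b : ℕ) (h : a ≤ b) (θ : ℝ) :
    (∑ n ∈ Ioc a b, ee (n * θ)) * (ee θ - 1) = ee ((b + 1 : ℕ) * θ) - ee ((a + 1 : ℕ) * θ) := by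
  induction b, h using Nat.le_induction with
  | base => simp
  | succ b hb ih =>
    rw [← Finset.insert_Ioc_right_eq_Ioc_add_one (by omega), Finset.sum_insert (by simp), add_mul, ih]
    have : ee ((b + 1 + 1 : ℕ) * θ) = ee ((b + 1 : ℕ) * θ) * ee θ := by
      rw [← ee_add]; congr 1; push_cast; ring
    rw [this]; ring

lemma geo_bound (a b : ℕ) (θ : ℝ) : ‖∑ n ∈ Ioc a b, ee (n * θ)‖ * (2 * nd θ) ≤ 1 := by
  rcases le_total a b with h | h
  · have h1 := congrArg norm (geo_mul a b h θ)
    rw [norm_mul] at h1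
    have h2 : ‖ee ((b + 1 : ℕ) * θ) - ee ((a + 1 : ℕ) * θ)‖ ≤ 2 := by
      refine (norm_sub_le _ _).trans ?_
      rw [ee_norm, ee_norm]; norm_num
    have h3 := norm_ee_sub_one θ
    have h4 := norm_nonneg (∑ n ∈ Ioc a b, ee (n * θ))
    nlinarith
  · rw [Finset.Ioc_eq_empty (by omega)]; simp

lemma geo_trivial (a b : ℕ) (θ : ℝ) : ‖∑ n ∈ Ioc a b, ee (n * θ)‖ ≤ (b - a : ℕ) := by
  refine (norm_sum_le _ _).trans ?_
  simp [ee_norm]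

/-- smooth version of `min (Y, 1/‖θ‖)` -/
noncomputable def GG (Y θ : ℝ) : ℝ := 2 * Y / (1 + 2 * Y * nd θ)

lemma GG_nonneg {Y : ℝ} (hY : 0 ≤ Y) (θ : ℝ) : 0 ≤ GG Y θ := by
  have := nd_nonneg θ
  unfold GG; positivity

lemma GG_le {Y : ℝ} (hY : 0 ≤ Y) (θ : ℝ) : GG Y θ ≤ 2 * Y := by
  have := nd_nonneg θ
  unfold GG
  apply div_le_self (by positivity)
  nlinarith [mul_nonneg hY this]

lemma GG_le' {Y : ℝ} (hY : 0 ≤ Y) (θ : ℝ) {d : ℝ} (hd : 0 < d) (h : d ≤ nd θ) : GG Y θ ≤ 1 / d := by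
  have h0 := nd_nonneg θ
  unfold GG
  rw [div_le_div_iff₀ (by positivity) hd]
  nlinarith [mul_le_mul_of_nonneg_left h hY]

lemma le_GG {Y S θ : ℝ} (hY : 0 ≤ Y) (hS : 0 ≤ S) (h1 : S ≤ Y) (h2 : S * (2 * nd θ) ≤ 1) : S ≤ GG Y θ := by
  have := nd_nonneg θ
  unfold GG
  rw [le_div_iff₀ (by positivity)]
  nlinarith

lemma geo_GG (a b : ℕ) (θ Y : ℝ) (hY : ((b - a : ℕ) : ℝ) ≤ Y) :
    ‖∑ n ∈ Ioc a b, ee (n * θ)‖ ≤ GG Y θ :=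
  le_GG ((Nat.cast_nonneg _).trans hY) (norm_nonneg _) ((geo_trivial a b θ).trans hY) (geo_bound a b θ)

lemma GG_mono {Y Y' θ : ℝ} (hY : 0 ≤ Y) (h : Y ≤ Y') : GG Y θ ≤ GG Y' θ := by
  have := nd_nonneg θ
  unfold GG
  rw [div_le_div_iff₀ (by positivity) (by have := hY.trans h; positivity)]
  nlinarith

/-- separation of the points `αm` inside a half block -/
lemma nd_sep {α : ℝ} {a : ℤ} {q : ℕ} (hq : 0 < q) (hc : IsCoprime a (q : ℤ))
    (hα : |α - a / q| ≤ 1 / (q : ℝ) ^ 2) {l : ℤ} (hl0 : l ≠ 0) (hl : 2 * |l| < q) :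
    1 / (2 * (q : ℝ)) < nd (α * l) := by
  have hq' : (0 : ℝ) < q := by exact_mod_cast hq
  have h1 : 1 / (q : ℝ) ≤ nd ((a / q : ℝ) * l) := by
    set n := round ((a / q : ℝ) * l)
    have h2 : (a : ℤ) * l - n * q ≠ 0 := by
      intro h
      have hd : (q : ℤ) ∣ a * l := ⟨n, by linarith⟩
      have hd2 : (q : ℤ) ∣ l := (IsCoprime.dvd_of_dvd_mul_left hc.symm hd)
      have := Int.le_of_dvd (abs_pos.mpr hl0) ((dvd_abs _ _).mpr hd2)
      have := abs_pos.mpr hl0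
      omega
    have h3 : (1 : ℝ) ≤ |(a : ℝ) * l - n * q| := by
      have := Int.one_le_abs h2
      exact_mod_cast this
    have h4 : (a / q : ℝ) * l - n = (a * l - n * q) / q := by field_simp
    unfold nd
    change _ ≤ |(a / q : ℝ) * l - n|
    rw [h4, abs_div, abs_of_pos hq']
    exact div_le_div_of_nonneg_right h3 hq'.le
  have h5 := nd_le_add ((a / q : ℝ) * l) (α * l)
  have h6 : |(a / q : ℝ) * l - α * l| < 1 / (2 * q) := by
    rw [← sub_mul, abs_mul, abs_sub_comm]
    have hl' : 2 * |(l : ℝ)| < q := by exact_mod_cast hl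
    have h0 : 0 < |(l : ℝ)| := by simpa using hl0
    calc _ ≤ 1 / (q : ℝ) ^ 2 * |(l : ℝ)| := by gcongr
      _ < 1 / (q : ℝ) ^ 2 * (q / 2) := by gcongr; linarith
      _ = _ := by field_simp
  have h7 : 1 / (q : ℝ) = 1 / (2 * q) + 1 / (2 * q) := by field_simp; norm_num
  linarith

end WCL

end

section

open Finset
namespace WCL

lemma sum_inv_range_le (n : ℕ) (hn : 0 < n) : ∑ k ∈ range n, 1 / (k : ℝ) ≤ 1 + Real.log n := by
  obtain ⟨m, rfl⟩ : ∃ m, n = m + 1 := ⟨n - 1, by omega⟩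
  rw [Finset.sum_range_succ']
  simp only [Nat.cast_zero, div_zero, add_zero]
  have h := harmonic_le_one_add_log m
  have h2 : (∑ k ∈ range m, 1 / ((k + 1 : ℕ) : ℝ)) = (harmonic m : ℝ) := by
    simp [harmonic]
  rw [h2]
  rcases Nat.eq_zero_or_pos m with rfl | hm
  · simp
  · refine h.trans ?_
    gcongr; simp

/-- one half block -/
lemma block_sum {α : ℝ} {a : ℤ} {q : ℕ} (hq : 0 < q) (hc : IsCoprime a (q : ℤ))
    (hα : |α - a / q| ≤ 1 / (q : ℝ) ^ 2) (S : Finset ℕ)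
    (hS : ∀ m ∈ S, ∀ m' ∈ S, 2 * |(m : ℤ) - m'| < q) (w : ℕ → ℝ) (Z : ℝ) (hZ : 0 ≤ Z)
    (hw : ∀ m ∈ S, w m ≤ Z) (hw2 : ∀ m ∈ S, ∀ d, 0 < d → d ≤ nd (α * m) → w m ≤ 1 / d) :
    ∑ m ∈ S, w m ≤ 2 * Z + 4 * q * (1 + Real.log (2 * q)) := by
  have hq' : (0 : ℝ) < q := by exact_mod_cast hq
  set κ : ℕ → ℕ := fun m => ⌊2 * q * Int.fract (α * m)⌋₊ with hκ
  have hfl : ∀ m : ℕ, (κ m : ℝ) ≤ 2 * q * Int.fract (α * m) := fun m =>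
    Nat.floor_le (by have := Int.fract_nonneg (α * m); positivity)
  have hfu : ∀ m : ℕ, 2 * q * Int.fract (α * m) < κ m + 1 := fun m => Nat.lt_floor_add_one _
  have hlt : ∀ m : ℕ, κ m < 2 * q := by
    intro m
    have h1 := hfl m
    have h2 := Int.fract_lt_one (α * m)
    have : (κ m : ℝ) < (2 * q : ℕ) := by push_cast; nlinarith
    exact_mod_cast this
  have hinj : Set.InjOn κ S := by
    intro m hm m' hm' h
    by_contra hne
    have hsep := nd_sep hq hc hα (l := (m : ℤ) - m') (by
      intro h0; apply hne; omega) (hS m hm m' hm')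
    have h1 : nd (α * ((m : ℤ) - m' : ℤ)) ≤ |Int.fract (α * m) - Int.fract (α * m')| := by
      have := nd_le (α * ((m : ℤ) - m' : ℤ)) (⌊α * m⌋ - ⌊α * m'⌋)
      refine this.trans (le_of_eq ?_)
      congr 1
      unfold Int.fract; push_cast; ring
    have h2 : |Int.fract (α * m) - Int.fract (α * m')| < 1 / (2 * q) := by
      have e1 := hfl m
      have e2 := hfu m
      have e3 := hfl m'
      have e4 := hfu m'
      rw [h] at e1 e2
      rw [lt_div_iff₀ (by positivity), ← abs_of_pos (show (0 : ℝ) < 2 * q by positivity), ← abs_mul,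
        abs_lt]
      constructor <;> linarith
    linarith
  set g : ℕ → ℝ := fun k => (if k = 0 then Z else 0) + (if k = 2 * q - 1 then Z else 0)
    + 2 * q * (1 / (k : ℝ)) + 2 * q * (1 / ((2 * q - 1 - k : ℕ) : ℝ)) with hg
  have hg0 : ∀ k, 0 ≤ g k := by
    intro k; simp only [hg]; positivity
  have hle : ∀ m ∈ S, w m ≤ g (κ m) := by
    intro m hm
    have n1 : 0 ≤ 2 * (q : ℝ) * (1 / (κ m : ℝ)) := by positivity
    have n2 : 0 ≤ 2 * (q : ℝ) * (1 / ((2 * q - 1 - κ m : ℕ) : ℝ)) := by positivity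
    by_cases h0 : κ m = 0
    · simp only [hg, h0, if_true]
      rw [h0] at n2
      have : 0 ≤ (if 0 = 2 * q - 1 then Z else 0) := by positivity
      have := hw m hm
      simp only [Nat.cast_zero, div_zero, mul_zero]
      linarith
    by_cases h1 : κ m = 2 * q - 1
    · have : 0 ≤ (if κ m = 0 then Z else 0) := by positivity
      have := hw m hm
      simp only [hg, h1, if_true]
      rw [h1] at n1 n2
      have : 0 ≤ (if 2 * q - 1 = 0 then Z else 0) := by positivity
      linarith
    · simp only [hg, if_neg h0, if_neg h1, zero_add]
      have hk0 : (0 : ℝ) < κ m := by exact_mod_cast Nat.pos_of_ne_zero h0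
      have hk := hlt m
      have hk1 : (0 : ℝ) < (2 * q - 1 - κ m : ℕ) := by
        have : 0 < 2 * q - 1 - κ m := by omega
        exact_mod_cast this
      have hk2 : ((2 * q - 1 - κ m : ℕ) : ℝ) = 2 * q - 1 - κ m := by
        rw [Nat.cast_sub (by omega), Nat.cast_sub (by omega)]; push_cast; ring
      have hnd : nd (α * m) = min (Int.fract (α * m)) (1 - Int.fract (α * m)) :=
        abs_sub_round_eq_min _
      have e1 := hfl m
      have e2 := hfu m
      rcases le_total (Int.fract (α * m)) (1 - Int.fract (α * m)) with hc | hc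
      · rw [min_eq_left hc] at hnd
        have := hw2 m hm (κ m / (2 * q)) (by positivity) (by
          rw [hnd, div_le_iff₀ (by positivity)]; linarith)
        have e : 1 / ((κ m : ℝ) / (2 * q)) = 2 * q * (1 / (κ m : ℝ)) := by field_simp
        rw [e] at this; linarith
      · rw [min_eq_right hc] at hnd
        have := hw2 m hm ((2 * q - 1 - κ m : ℕ) / (2 * q)) (by positivity) (by
          rw [hnd, div_le_iff₀ (by positivity), hk2]; linarith)
        have e : 1 / (((2 * q - 1 - κ m : ℕ) : ℝ) / (2 * q)) = 2 * q * (1 / ((2 * q - 1 - κ m : ℕ) : ℝ)) := by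
          field_simp
        rw [e] at this; linarith
  calc ∑ m ∈ S, w m ≤ ∑ m ∈ S, g (κ m) := Finset.sum_le_sum hle
    _ = ∑ k ∈ S.image κ, g k := (Finset.sum_image hinj).symm
    _ ≤ ∑ k ∈ range (2 * q), g k := by
        apply Finset.sum_le_sum_of_subset_of_nonneg
        · intro k hk
          obtain ⟨m, hm, rfl⟩ := Finset.mem_image.mp hk
          exact Finset.mem_range.mpr (hlt m)
        · intro k _ _; exact hg0 k
    _ ≤ _ := by
        simp only [hg, Finset.sum_add_distrib, ← Finset.mul_sum]
        rw [Finset.sum_ite_eq', Finset.sum_ite_eq', if_pos (by simp; omega), if_pos (by simp; omega)]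
        have hr := Finset.sum_range_reflect (fun k : ℕ => 1 / (k : ℝ)) (2 * q)
        rw [hr]
        have := sum_inv_range_le (2 * q) (by omega)
        push_cast at this
        nlinarith

lemma block_split (f : ℕ → ℝ) (h : ℕ) (K : ℕ) :
    ∑ m ∈ Ioc 0 (K * h), f m = ∑ k ∈ range K, ∑ m ∈ Ioc (k * h) ((k + 1) * h), f m := by
  induction K with
  | zero => simp
  | succ K ih =>
    rw [Finset.sum_range_succ, ← ih]
    rw [Finset.sum_Ioc_consecutive]
    · exact Nat.zero_le _
    · nlinarith

lemma typeI_sum {α : ℝ} {a : ℤ} {q : ℕ} (hq : 0 < q) (hc : IsCoprime a (q : ℤ))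
    (hα : |α - a / q| ≤ 1 / (q : ℝ) ^ 2) (x L : ℝ) (hx : 0 ≤ x) (M : ℕ)
    (hL1 : 1 + Real.log (2 * q) ≤ L) (hL2 : 1 + Real.log (M + 1) ≤ L) :
    ∑ m ∈ Ioc 0 M, GG (x / m) (α * m) ≤ 32 * (x / q + M + q) * L := by
  have hq' : (0 : ℝ) < q := by exact_mod_cast hq
  have hq1 : (1 : ℝ) ≤ q := by exact_mod_cast hq
  set h := (q + 1) / 2 with hh
  have hh0 : 0 < h := by omega
  have hh0' : (0 : ℝ) < h := by exact_mod_cast hh0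
  have hhq : (q : ℝ) / 2 ≤ h := by
    have : q ≤ 2 * h := by omega
    have : (q : ℝ) ≤ 2 * h := by exact_mod_cast this
    linarith
  set K := M / h + 1 with hK
  have hKM : M ≤ K * h := by
    rw [hK]; have := Nat.lt_div_mul_add hh0 (a := M); rw [add_mul]; omega
  have hKle : K ≤ M + 1 := by rw [hK]; gcongr; exact Nat.div_le_self _ _
  have hKr : (K : ℝ) ≤ 2 * M / q + 1 := by
    rw [hK]; push_cast
    gcongr
    calc ((M / h : ℕ) : ℝ) ≤ (M : ℝ) / h := Nat.cast_div_le
      _ ≤ M / (q / 2) := by gcongr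
      _ = _ := by field_simp
  have hLpos : 1 ≤ L := by
    have := Real.log_nonneg (show (1 : ℝ) ≤ 2 * q by linarith)
    linarith
  have hnn : ∀ m : ℕ, 0 ≤ GG (x / m) (α * m) := fun m => GG_nonneg (by positivity) _
  calc ∑ m ∈ Ioc 0 M, GG (x / m) (α * m) ≤ ∑ m ∈ Ioc 0 (K * h), GG (x / m) (α * m) := by
        apply Finset.sum_le_sum_of_subset_of_nonneg
        · exact Finset.Ioc_subset_Ioc le_rfl hKM
        · intro m _ _; exact hnn m
    _ = ∑ k ∈ range K, ∑ m ∈ Ioc (k * h) ((k + 1) * h), GG (x / m) (α * m) := block_split _ _ _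
    _ ≤ ∑ k ∈ range K, (2 * ((if k = 0 then 2 * (q : ℝ) else 0) + 4 * x / h * (1 / ((k + 1 : ℕ) : ℝ)))
          + 4 * q * L) := by
        apply Finset.sum_le_sum
        intro k hk
        refine (block_sum hq hc hα _ ?_ _
          ((if k = 0 then 2 * (q : ℝ) else 0) + 4 * x / h * (1 / ((k + 1 : ℕ) : ℝ))) ?_ ?_ ?_).trans ?_
        · intro m hm m' hm'
          rw [Finset.mem_Ioc] at hm hm'
          have : |(m : ℤ) - m'| < h := by
            rw [abs_lt]
            have e : (k + 1) * h = k * h + h := by ring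
            rw [e] at hm hm'
            constructor <;> omega
          omega
        · positivity
        · intro m hm
          rw [Finset.mem_Ioc] at hm
          have p1 : 0 ≤ 4 * x / h * (1 / ((k + 1 : ℕ) : ℝ)) := by positivity
          by_cases hk0 : k = 0
          · subst hk0
            simp only [if_true]
            by_cases h2m : 2 * m < q
            · have := nd_sep hq hc hα (l := (m : ℤ)) (by omega) (by rw [abs_of_nonneg (by positivity)]; exact_mod_cast h2m)
              have h3 := GG_le' (Y := x / m) (by positivity) (α * m) (d := 1 / (2 * (q : ℝ))) (by positivity)
                (by simpa using this.le)
              rw [one_div_one_div] at h3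
              linarith
            · have hm0 : m = h := by omega
              have h3 := GG_le (Y := x / m) (by positivity) (α * m)
              rw [hm0] at h3 ⊢
              simp only [zero_add, Nat.cast_one, div_one, mul_one]
              have : 4 * x / h = 2 * (2 * (x / h)) := by ring
              have : 0 ≤ x / h := by positivity
              nlinarith
          · simp only [if_neg hk0, zero_add]
            refine (GG_le (Y := x / m) (by positivity) (α * m)).trans ?_
            have hm1 : (k : ℝ) * h ≤ m := by exact_mod_cast hm.1.le
            have hk1 : (1 : ℝ) ≤ k := by exact_mod_cast Nat.pos_of_ne_zero hk0
            calc 2 * (x / m) ≤ 2 * (x / (k * h)) := by gcongr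
              _ ≤ 4 * x / h * (1 / ((k + 1 : ℕ) : ℝ)) := by
                have e1 : 2 * (x / (k * h)) = x / h * (2 / k) := by field_simp
                have e2 : 4 * x / h * (1 / ((k + 1 : ℕ) : ℝ)) = x / h * (4 / (k + 1)) := by
                  push_cast; field_simp
                rw [e1, e2]
                apply mul_le_mul_of_nonneg_left _ (by positivity)
                rw [div_le_div_iff₀ (by positivity) (by positivity)]
                linarith
        · intro m hm d hd hdn
          exact GG_le' (by positivity) _ hd hdn
        · gcongr
    _ ≤ _ := by
        rw [Finset.sum_add_distrib, ← Finset.mul_sum, Finset.sum_add_distrib, Finset.sum_ite_eq',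
          if_pos (by simp [hK]), ← Finset.mul_sum]
        simp only [Finset.sum_const, Finset.card_range, nsmul_eq_mul]
        have h5 : ∑ k ∈ range K, 1 / ((k + 1 : ℕ) : ℝ) ≤ L := by
          have h0 := harmonic_le_one_add_log K
          have h2 : (∑ k ∈ range K, 1 / ((k + 1 : ℕ) : ℝ)) = (harmonic K : ℝ) := by
            simp [harmonic]
          rw [h2]
          refine h0.trans (le_trans ?_ hL2)
          have : (K : ℝ) ≤ M + 1 := by exact_mod_cast hKle
          have : (0 : ℝ) < K := by rw [hK]; positivity
          gcongr
        have h6 : 4 * x / h ≤ 8 * x / q := by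
          rw [div_le_div_iff₀ hh0' hq']
          nlinarith
        have h7 : (K : ℝ) * (4 * q * L) ≤ (2 * M / q + 1) * (4 * q * L) := by gcongr
        have h8 : (2 * M / q + 1) * (4 * q * L) = (8 * M + 4 * q) * L := by field_simp; ring
        have h9 : 4 * x / h * ∑ k ∈ range K, 1 / ((k + 1 : ℕ) : ℝ) ≤ 8 * x / q * L := by
          gcongr
        have h10 : 8 * x / q * L = 8 * (x / q * L) := by ring
        have p1 : 0 ≤ x / q * L := by positivity
        have p2 : 0 ≤ (M : ℝ) * L := by positivity
        have p3 : (q : ℝ) ≤ q * L := by nlinarith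
        nlinarith

lemma const_sum {α : ℝ} {a : ℤ} {q : ℕ} (hq : 0 < q) (hc : IsCoprime a (q : ℤ))
    (hα : |α - a / q| ≤ 1 / (q : ℝ) ^ 2) (Y L : ℝ) (hY : 0 ≤ Y) (M : ℕ)
    (hL1 : 1 + Real.log (2 * q) ≤ L) :
    ∑ m ∈ Ioc 0 M, GG Y (α * m) ≤ (2 * M / q + 1) * (4 * Y + 4 * q * L) := by
  have hq' : (0 : ℝ) < q := by exact_mod_cast hq
  have hq1 : (1 : ℝ) ≤ q := by exact_mod_cast hq
  set h := (q + 1) / 2 with hh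
  have hh0 : 0 < h := by omega
  have hhq : (q : ℝ) / 2 ≤ h := by
    have : q ≤ 2 * h := by omega
    have : (q : ℝ) ≤ 2 * h := by exact_mod_cast this
    linarith
  set K := M / h + 1 with hK
  have hKM : M ≤ K * h := by
    rw [hK]; have := Nat.lt_div_mul_add hh0 (a := M); rw [add_mul]; omega
  have hKr : (K : ℝ) ≤ 2 * M / q + 1 := by
    rw [hK]; push_cast
    gcongr
    calc ((M / h : ℕ) : ℝ) ≤ (M : ℝ) / h := Nat.cast_div_le
      _ ≤ M / (q / 2) := by gcongr
      _ = _ := by field_simp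
  have hLpos : 1 ≤ L := by
    have := Real.log_nonneg (show (1 : ℝ) ≤ 2 * q by linarith)
    linarith
  calc ∑ m ∈ Ioc 0 M, GG Y (α * m) ≤ ∑ m ∈ Ioc 0 (K * h), GG Y (α * m) := by
        apply Finset.sum_le_sum_of_subset_of_nonneg
        · exact Finset.Ioc_subset_Ioc le_rfl hKM
        · intro m _ _; exact GG_nonneg hY _
    _ = ∑ k ∈ range K, ∑ m ∈ Ioc (k * h) ((k + 1) * h), GG Y (α * m) := block_split _ _ _
    _ ≤ ∑ k ∈ range K, (4 * Y + 4 * q * L) := by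
        apply Finset.sum_le_sum
        intro k hk
        refine (block_sum hq hc hα _ ?_ _ (2 * Y) (by positivity) ?_ ?_).trans ?_
        · intro m hm m' hm'
          rw [Finset.mem_Ioc] at hm hm'
          have : |(m : ℤ) - m'| < h := by
            rw [abs_lt]
            have e : (k + 1) * h = k * h + h := by ring
            rw [e] at hm hm'
            constructor <;> omega
          omega
        · intro m hm; exact GG_le hY _
        · intro m hm d hd hdn
          exact GG_le' hY _ hd hdn
        · have : 4 * (q : ℝ) * (1 + Real.log (2 * q)) ≤ 4 * q * L := by gcongr
          linarith
    _ ≤ _ := by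
        simp only [Finset.sum_const, Finset.card_range, nsmul_eq_mul]
        gcongr
end WCL

end

section

open Finset
namespace WCL

lemma conv_sum (F : ℕ → ℕ → ℂ) (N : ℕ) :
    ∑ n ∈ Ioc 0 N, ∑ x ∈ n.divisorsAntidiagonal, F x.1 x.2 =
      ∑ m ∈ Ioc 0 N, ∑ k ∈ Ioc 0 (N / m), F m k := by
  trans ∑ n ∈ Ioc 0 N, ∑ x ∈ Ioc 0 N ×ˢ Ioc 0 N with x.1 * x.2 = n, F x.1 x.2
  · refine sum_congr rfl fun n hn ↦ ?_
    simp only [mem_Ioc] at hn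
    rw [Nat.divisorsAntidiagonal_eq_prod_filter_of_le hn.1.ne' hn.2]
  · simp_rw [sum_filter]
    rw [sum_comm, sum_product]
    refine sum_congr rfl fun m hm ↦ ?_
    rw [mem_Ioc] at hm
    have : Ioc 0 (N / m) = (Ioc 0 N).filter (fun k => m * k ≤ N) := by
      ext k
      simp only [mem_filter, mem_Ioc]
      rw [Nat.le_div_iff_mul_le hm.1, mul_comm k m]
      constructor
      · rintro ⟨h1, h2⟩
        exact ⟨⟨h1, le_trans (Nat.le_mul_of_pos_left k hm.1) h2⟩, h2⟩
      · rintro ⟨⟨h1, _⟩, h2⟩; exact ⟨h1, h2⟩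
    rw [this, sum_filter]
    refine sum_congr rfl fun k hk ↦ ?_
    rw [mem_Ioc] at hk
    rw [Finset.sum_ite_eq]
    have : 0 < m * k := Nat.mul_pos hm.1 hk.1
    simp [this]
  
lemma abel_id (g z : ℕ → ℂ) (a : ℕ) (K : ℕ) :
    ∑ k ∈ Ioc a (a + K), g k * z k = g (a + K) * ∑ k ∈ Ioc a (a + K), z k -
      ∑ j ∈ range K, (g (a + j + 1) - g (a + j)) * ∑ k ∈ Ioc a (a + j), z k := by
  induction K with
  | zero => simp
  | succ K ih =>
    rw [← add_assoc, ← Finset.insert_Ioc_right_eq_Ioc_add_one (by omega), Finset.sum_insert (by simp),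
      Finset.sum_insert (by simp), ih, Finset.sum_range_succ]
    ring

lemma abel_bound (g z : ℕ → ℂ) (a b : ℕ) (G : ℝ)
    (hG : ∀ j, a < j → j ≤ b → ‖∑ k ∈ Ioc a j, z k‖ ≤ G) (hG0 : 0 ≤ G) :
    ‖∑ k ∈ Ioc a b, g k * z k‖ ≤ G * (‖g b‖ + ∑ j ∈ Ioo a b, ‖g (j + 1) - g j‖) := by
  rcases le_total b a with h | h
  · rw [Ioc_eq_empty_of_le h]; simp; positivity
  obtain ⟨K, rfl⟩ := Nat.exists_eq_add_of_le h
  rcases Nat.eq_zero_or_pos K with rfl | hK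
  · simp; positivity
  rw [abel_id, mul_add]
  refine (norm_sub_le _ _).trans ?_
  gcongr
  · rw [norm_mul, mul_comm]
    gcongr
    exact hG _ (by omega) le_rfl
  · refine (norm_sum_le _ _).trans ?_
    have : ∑ j ∈ Ioo a (a + K), ‖g (j + 1) - g j‖ = ∑ j ∈ (range K).erase 0, ‖g (a + j + 1) - g (a + j)‖ := by
      symm
      apply Finset.sum_bij (fun j _ => a + j)
      · intro j hj; simp at hj ⊢; omega
      · intro j _ j' _ h; omega
      · intro j hj; simp at hj; exact ⟨j - a, by simp; omega, by omega⟩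
      · intro j _; rfl
    rw [this, Finset.mul_sum, ← Finset.sum_erase_add _ _ (Finset.mem_range.mpr hK)]
    simp only [add_zero, Ioc_self, sum_empty, mul_zero, norm_zero]
    apply Finset.sum_le_sum
    intro j hj
    simp at hj
    rw [norm_mul, mul_comm]
    gcongr
    exact hG _ (by omega) (by omega)

lemma log_geo (K : ℕ) (θ Y : ℝ) (hY : (K : ℝ) ≤ Y) (L : ℝ) (hL : Real.log K ≤ L) :
    ‖∑ k ∈ Ioc 0 K, ((Real.log k : ℝ) : ℂ) * ee (k * θ)‖ ≤ 2 * L * GG Y θ := by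
  have hY0 : 0 ≤ Y := (Nat.cast_nonneg _).trans hY
  rcases Nat.eq_zero_or_pos K with rfl | hK
  · simp at hL ⊢
    have := GG_nonneg hY0 θ
    positivity
  refine (abel_bound (fun k => ((Real.log k : ℝ) : ℂ)) (fun k => ee (k * θ)) 0 K (GG Y θ) ?_
    (GG_nonneg hY0 θ)).trans ?_
  · intro j _ hj
    apply geo_GG
    simp only [tsub_zero]
    exact le_trans (by exact_mod_cast hj) hY
  · rw [mul_comm (2 * L)]
    apply mul_le_mul_of_nonneg_left _ (GG_nonneg hY0 θ)
    have hlog0 : 0 ≤ Real.log K := Real.log_natCast_nonneg K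
    have h2 : ∑ j ∈ Ioo 0 K, ‖((Real.log (j + 1 : ℕ) : ℝ) : ℂ) - ((Real.log j : ℝ) : ℂ)‖ ≤ Real.log K := by
      have : ∀ j ∈ Ioo 0 K, ‖((Real.log (j + 1 : ℕ) : ℝ) : ℂ) - ((Real.log j : ℝ) : ℂ)‖ =
          Real.log (j + 1 : ℕ) - Real.log j := by
        intro j hj
        simp at hj
        rw [← Complex.ofReal_sub, Complex.norm_real, Real.norm_of_nonneg]
        have : (0 : ℝ) < j := by exact_mod_cast hj.1
        rw [sub_nonneg]
        gcongr; simp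
      rw [Finset.sum_congr rfl this]
      have : Ioo 0 K = Ico 1 K := by ext; simp; omega
      rw [this, Finset.sum_Ico_sub (fun j : ℕ => Real.log j) hK]
      simp
    simp only [Complex.norm_real, Real.norm_of_nonneg hlog0]
    linarith
end WCL

end

section

open Finset
namespace WCL

lemma GG_neg (Y θ : ℝ) : GG Y (-θ) = GG Y θ := by unfold GG; rw [nd_neg]

lemma GG_diff_sum (Y α : ℝ) (hY : 0 ≤ Y) (R k : ℕ) (hk : k ∈ Ioc 0 R) :
    ∑ l ∈ Ioc 0 R, GG Y (α * ((k : ℝ) - l)) ≤ 2 * Y + 2 * ∑ m ∈ Ioc 0 R, GG Y (α * m) := by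
  rw [mem_Ioc] at hk
  have h0 : ∀ x, 0 ≤ GG Y x := GG_nonneg hY
  have hsplit : ∀ l ∈ Ioc 0 R, GG Y (α * ((k : ℝ) - l)) ≤ (if l = k then 2 * Y else 0) +
      (if l < k then GG Y (α * (k - l : ℕ)) else 0) + (if k < l then GG Y (α * (l - k : ℕ)) else 0) := by
    intro l _
    rcases lt_trichotomy l k with h | h | h
    · rw [if_neg h.ne, if_pos h, if_neg h.not_gt, Nat.cast_sub h.le]; simp
    · subst h; simp only [if_true, lt_irrefl, if_false, add_zero]; exact GG_le hY _
    · rw [if_neg h.ne', if_neg h.not_gt, if_pos h, Nat.cast_sub h.le, ← GG_neg]; simp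
      rw [← mul_neg, neg_sub]
  refine (Finset.sum_le_sum hsplit).trans ?_
  rw [sum_add_distrib, sum_add_distrib, Finset.sum_ite_eq', if_pos (by simp; omega), ← sum_filter, ← sum_filter]
  have h1 : ∑ l ∈ Ioc 0 R with l < k, GG Y (α * (k - l : ℕ)) ≤ ∑ m ∈ Ioc 0 R, GG Y (α * m) := by
    rw [← Finset.sum_image (f := fun m : ℕ => GG Y (α * m)) (g := fun l => k - l)]
    · apply Finset.sum_le_sum_of_subset_of_nonneg
      · intro m hm; simp at hm ⊢; obtain ⟨a, h, rfl⟩ := hm; omega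
      · intro m _ _; exact h0 _
    · intro x hx y hy h; simp at hx hy h; omega
  have h2 : ∑ l ∈ Ioc 0 R with k < l, GG Y (α * (l - k : ℕ)) ≤ ∑ m ∈ Ioc 0 R, GG Y (α * m) := by
    rw [← Finset.sum_image (f := fun m : ℕ => GG Y (α * m)) (g := fun l => l - k)]
    · apply Finset.sum_le_sum_of_subset_of_nonneg
      · intro m hm; simp at hm ⊢; obtain ⟨a, h, rfl⟩ := hm; omega
      · intro m _ _; exact h0 _
    · intro x hx y hy h; simp at hx hy h; omega
  linarith

lemma normsq_sum (s : Finset ℕ) (f : ℕ → ℂ) :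
    ((‖∑ k ∈ s, f k‖ ^ 2 : ℝ) : ℂ) = ∑ k ∈ s, ∑ l ∈ s, f k * (starRingEnd ℂ) (f l) := by
  rw [← Complex.normSq_eq_norm_sq, ← Complex.mul_conj, map_sum, Finset.sum_mul_sum]

lemma cs_sum (s : Finset ℕ) (a : ℕ → ℝ) (z : ℕ → ℂ) (ha : ∀ m ∈ s, |a m| ≤ 1) :
    ‖∑ m ∈ s, (a m : ℂ) * z m‖ ^ 2 ≤ #s * ∑ m ∈ s, ‖z m‖ ^ 2 := by
  have h1 : ‖∑ m ∈ s, (a m : ℂ) * z m‖ ≤ ∑ m ∈ s, ‖z m‖ := by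
    refine (norm_sum_le _ _).trans (Finset.sum_le_sum ?_)
    intro m hm
    rw [norm_mul, Complex.norm_real, Real.norm_eq_abs]
    have := ha m hm
    have := norm_nonneg (z m)
    nlinarith
  calc _ ≤ (∑ m ∈ s, ‖z m‖) ^ 2 := by gcongr
    _ ≤ _ := sq_sum_le_card_mul_sum_sq

lemma typeII_sq (α : ℝ) (a b : ℕ → ℝ) (N D : ℕ) (hD : 0 < D) (L : ℝ)
    (ha : ∀ m, |a m| ≤ 1) (hb : ∀ k, k ≤ N → |b k| ≤ L) :
    ‖∑ m ∈ Ioc D (2 * D), (a m : ℂ) * ∑ k ∈ Ioc 0 (N / m), (b k : ℂ) * ee ((m * k : ℕ) * α)‖ ^ 2 ≤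
      D * (L ^ 2 * ((N / D : ℕ) * (2 * D + 2 * ∑ m ∈ Ioc 0 (N / D), GG D (α * m)))) := by
  set R := N / D with hR
  set f : ℕ → ℕ → ℂ := fun m k => (if m * k ≤ N then (b k : ℂ) * ee ((m * k : ℕ) * α) else 0) with hf
  have hz : ∀ m ∈ Ioc D (2 * D), ∑ k ∈ Ioc 0 (N / m), (b k : ℂ) * ee ((m * k : ℕ) * α) =
      ∑ k ∈ Ioc 0 R, f m k := by
    intro m hm
    rw [mem_Ioc] at hm
    have hm0 : 0 < m := by omega
    rw [hf, ← sum_filter]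
    apply Finset.sum_congr _ (fun _ _ => rfl)
    ext k
    simp only [mem_filter, mem_Ioc, Nat.le_div_iff_mul_le hm0, hR, Nat.le_div_iff_mul_le hD]
    constructor
    · rintro ⟨h1, h2⟩
      refine ⟨⟨h1, ?_⟩, by linarith⟩
      nlinarith
    · rintro ⟨⟨h1, _⟩, h2⟩; exact ⟨h1, by linarith⟩
  rw [Finset.sum_congr rfl (fun m hm => by rw [hz m hm])]
  refine (cs_sum _ _ _ (fun m _ => ha m)).trans ?_
  have hcard : #(Ioc D (2 * D)) = D := by simp; omega
  rw [hcard]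
  apply mul_le_mul_of_nonneg_left _ (Nat.cast_nonneg _)
  have hL : 0 ≤ L := (abs_nonneg _).trans (hb 0 (Nat.zero_le _))
  have key : ((∑ m ∈ Ioc D (2 * D), ‖∑ k ∈ Ioc 0 R, f m k‖ ^ 2 : ℝ) : ℂ) =
      ∑ k ∈ Ioc 0 R, ∑ l ∈ Ioc 0 R, ((b k * b l : ℝ) : ℂ) *
        ∑ m ∈ Ioc D (min (2 * D) (min (N / k) (N / l))), ee (m * (α * ((k : ℝ) - l))) := by
    rw [Complex.ofReal_sum]
    simp_rw [normsq_sum]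
    rw [Finset.sum_comm]
    refine sum_congr rfl fun k hk => ?_
    rw [Finset.sum_comm]
    refine sum_congr rfl fun l hl => ?_
    rw [mem_Ioc] at hk hl
    rw [Finset.mul_sum]
    have hset : Ioc D (min (2 * D) (min (N / k) (N / l))) =
        (Ioc D (2 * D)).filter (fun m => m * k ≤ N ∧ m * l ≤ N) := by
      ext m
      simp only [mem_filter, mem_Ioc, le_min_iff, Nat.le_div_iff_mul_le hk.1, Nat.le_div_iff_mul_le hl.1]
      tauto
    rw [hset, sum_filter]
    refine sum_congr rfl fun m hm => ?_
    simp only [hf]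
    by_cases h1 : m * k ≤ N <;> by_cases h2 : m * l ≤ N <;> simp only [h1, h2, if_true, if_false, and_self, and_true, and_false, zero_mul, mul_zero, map_zero]
    rw [map_mul, ← ee_neg, Complex.conj_ofReal]
    have : (m : ℝ) * (α * ((k : ℝ) - l)) = (m * k : ℕ) * α + -((m * l : ℕ) * α) := by push_cast; ring
    rw [this, ee_add]
    push_cast; ring
  have hle : ∑ m ∈ Ioc D (2 * D), ‖∑ k ∈ Ioc 0 R, f m k‖ ^ 2 ≤
      ∑ k ∈ Ioc 0 R, ∑ l ∈ Ioc 0 R, L ^ 2 * GG D (α * ((k : ℝ) - l)) := by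
    have h1 : ∑ m ∈ Ioc D (2 * D), ‖∑ k ∈ Ioc 0 R, f m k‖ ^ 2 =
        ‖((∑ m ∈ Ioc D (2 * D), ‖∑ k ∈ Ioc 0 R, f m k‖ ^ 2 : ℝ) : ℂ)‖ := by
      rw [Complex.norm_real, Real.norm_of_nonneg (by positivity)]
    rw [h1, key]
    refine (norm_sum_le _ _).trans (sum_le_sum fun k hk => ?_)
    refine (norm_sum_le _ _).trans (sum_le_sum fun l hl => ?_)
    rw [mem_Ioc] at hk hl
    have hRN : R ≤ N := Nat.div_le_self _ _
    rw [norm_mul, Complex.norm_real, Real.norm_eq_abs, abs_mul, pow_two]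
    gcongr
    · exact hb k (by omega)
    · exact hb l (by omega)
    · apply geo_GG
      have : min (2 * D) (min (N / k) (N / l)) - D ≤ D := by omega
      exact_mod_cast this
  refine hle.trans ?_
  calc ∑ k ∈ Ioc 0 R, ∑ l ∈ Ioc 0 R, L ^ 2 * GG D (α * ((k : ℝ) - l))
      ≤ ∑ k ∈ Ioc 0 R, L ^ 2 * (2 * D + 2 * ∑ m ∈ Ioc 0 R, GG D (α * m)) := by
        refine sum_le_sum fun k hk => ?_
        rw [← Finset.mul_sum]
        gcongr
        exact GG_diff_sum D α (Nat.cast_nonneg _) R k hk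
    _ = _ := by rw [sum_const]; simp; ring

lemma typeII_block {α : ℝ} {q₀ : ℤ} {q : ℕ} (hq : 0 < q) (hc : IsCoprime q₀ (q : ℤ))
    (hα : |α - q₀ / q| ≤ 1 / (q : ℝ) ^ 2) (a b : ℕ → ℝ) (N D U : ℕ) (hU : 0 < U) (hD : U ≤ D)
    (hDN : D * U ≤ N) (L X : ℝ) (hX : (N : ℝ) ≤ X)
    (hL1 : 1 + Real.log (2 * q) ≤ L)
    (ha : ∀ m, |a m| ≤ 1) (hb : ∀ k, k ≤ N → |b k| ≤ L) :
    ‖∑ m ∈ Ioc D (2 * D), (a m : ℂ) * ∑ k ∈ Ioc 0 (N / m), (b k : ℂ) * ee ((m * k : ℕ) * α)‖ ≤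
      4 * L ^ 2 * (2 * X / √U + X / √q + √(X * q)) := by
  have hq' : (0 : ℝ) < q := by exact_mod_cast hq
  have hU' : (0 : ℝ) < U := by exact_mod_cast hU
  have hD0 : 0 < D := by omega
  have hD' : (0 : ℝ) < D := by exact_mod_cast hD0
  have hX0 : 0 ≤ X := (Nat.cast_nonneg _).trans hX
  have hLpos : 1 ≤ L := by
    have := Real.log_nonneg (show (1 : ℝ) ≤ 2 * q by
      have : (1 : ℝ) ≤ q := by exact_mod_cast hq
      linarith)
    linarith
  refine (pow_le_pow_iff_left₀ (norm_nonneg _) (by positivity) two_ne_zero).mp ?_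
  refine (typeII_sq α a b N D hD0 L ha hb).trans ?_
  have h1 := const_sum hq hc hα D L (Nat.cast_nonneg _) (N / D) hL1
  set R : ℝ := ((N / D : ℕ) : ℝ) with hR
  have hR0 : 0 ≤ R := Nat.cast_nonneg _
  have hRX : R * D ≤ X := by
    refine le_trans ?_ hX
    rw [hR]
    exact_mod_cast Nat.div_mul_le_self N D
  have hDU : (D : ℝ) ≤ X / U := by
    rw [le_div_iff₀ hU']; refine le_trans ?_ hX; exact_mod_cast hDN
  have hRU : R ≤ X / U := by
    rw [le_div_iff₀ hU']
    refine le_trans ?_ hRX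
    gcongr
  calc (D : ℝ) * (L ^ 2 * (R * (2 * D + 2 * ∑ m ∈ Ioc 0 (N / D), GG D (α * m))))
      ≤ D * (L ^ 2 * (R * (2 * D + 2 * ((2 * R / q + 1) * (4 * D + 4 * q * L))))) := by gcongr
    _ = L ^ 2 * ((R * D) * (10 * D + 16 * (R * D) / q + 16 * R * L + 8 * q * L)) := by field_simp; ring
    _ ≤ L ^ 2 * (X * (10 * (X / U) + 16 * X / q + 16 * (X / U) * L + 8 * q * L)) := by gcongr
    _ ≤ L ^ 2 * (X * (L * (32 * (X / U) + 16 * X / q + 16 * q))) := by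
        gcongr
        have e1 : X / U ≤ X / U * L := le_mul_of_one_le_right (by positivity) hLpos
        have e2 : X / q ≤ X / q * L := le_mul_of_one_le_right (by positivity) hLpos
        have e3 : 0 ≤ (q : ℝ) * L := by positivity
        have e4 : 16 * X / q = 16 * (X / q) := by ring
        rw [e4]
        nlinarith [show 0 ≤ X / U by positivity]
    _ ≤ L ^ 2 * (L ^ 2 * (32 * (X ^ 2 / U) + 16 * (X ^ 2 / q) + 16 * (X * q))) := by
        gcongr L ^ 2 * ?_
        have e : X * (L * (32 * (X / U) + 16 * X / q + 16 * q)) = L * (32 * (X ^ 2 / U) + 16 * (X ^ 2 / q) + 16 * (X * q)) := by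
          ring
        rw [e]
        gcongr
        nlinarith
    _ ≤ _ := by
        set A := X / √U with hA
        set B := X / √q with hB
        set C := √(X * q) with hC
        have eA : X ^ 2 / U = A ^ 2 := by rw [hA, div_pow, Real.sq_sqrt hU'.le]
        have eB : X ^ 2 / q = B ^ 2 := by rw [hB, div_pow, Real.sq_sqrt hq'.le]
        have eC : X * q = C ^ 2 := by rw [hC, Real.sq_sqrt (by positivity)]
        rw [eA, eB, eC]
        have a0 : 0 ≤ A := by positivity
        have b0 : 0 ≤ B := by positivity
        have c0 : 0 ≤ C := by positivity
        have e5 : 2 * X / √U = 2 * A := by rw [hA]; ring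
        rw [e5]
        have : L ^ 2 * (L ^ 2 * (32 * A ^ 2 + 16 * B ^ 2 + 16 * C ^ 2)) = L ^ 4 * (32 * A ^ 2 + 16 * B ^ 2 + 16 * C ^ 2) := by ring
        rw [this]
        have : (4 * L ^ 2 * (2 * A + B + C)) ^ 2 = L ^ 4 * (16 * (2 * A + B + C) ^ 2) := by ring
        rw [this]
        gcongr
        nlinarith [mul_nonneg a0 b0, mul_nonneg a0 c0, mul_nonneg b0 c0]
end WCL

end

section

open Finset
namespace WCL
open ArithmeticFunction ArithmeticFunction.Moebius ArithmeticFunction.zeta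

noncomputable def mu1 (U : ℕ) : ArithmeticFunction ℝ := ⟨fun n => if n ≤ U then (μ n : ℝ) else 0, by simp⟩
noncomputable def mu2 (U : ℕ) : ArithmeticFunction ℝ := ⟨fun n => if n ≤ U then 0 else (μ n : ℝ), by simp⟩
noncomputable def la1 (U : ℕ) : ArithmeticFunction ℝ := ⟨fun n => if n ≤ U then Λ n else 0, by simp⟩
noncomputable def la2 (U : ℕ) : ArithmeticFunction ℝ := ⟨fun n => if n ≤ U then 0 else Λ n, by simp⟩

lemma mu_split (U : ℕ) : mu1 U + mu2 U = (μ : ArithmeticFunction ℝ) := by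
  ext n; change mu1 U n + mu2 U n = _; simp only [mu1, mu2, coe_mk, intCoe_apply]; split_ifs <;> simp
lemma la_split (U : ℕ) : la1 U + la2 U = Λ := by
  ext n; change la1 U n + la2 U n = _; simp only [la1, la2, coe_mk]; split_ifs <;> simp

lemma vaughan (U : ℕ) : Λ = la1 U + mu1 U * log - (mu1 U * la1 U) * ζ + mu2 U * ((ζ : ArithmeticFunction ℝ) * la2 U) := by
  have h1 : mu2 U = (μ : ArithmeticFunction ℝ) - mu1 U := by rw [← mu_split U]; ring
  have h2 : la2 U = Λ - la1 U := by rw [← la_split U]; ring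
  have h3 : (μ : ArithmeticFunction ℝ) * ζ = 1 := by simp
  have h4 : (ζ : ArithmeticFunction ℝ) * Λ = log := zeta_mul_vonMangoldt
  have h5 : (μ : ArithmeticFunction ℝ) * log = Λ := moebius_mul_log_eq_vonMangoldt
  have : mu2 U * ((ζ : ArithmeticFunction ℝ) * la2 U) = μ * (ζ * Λ) - (μ * ζ) * la1 U - mu1 U * (ζ * Λ) + mu1 U * la1 U * ζ := by
    rw [h1, h2]; ring
  rw [this, h4, h3, h5]; ring

noncomputable def ES (f : ArithmeticFunction ℝ) (α : ℝ) (N : ℕ) : ℂ := ∑ n ∈ Ioc 0 N, (f n : ℂ) * ee (n * α)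

lemma ES_add (f g : ArithmeticFunction ℝ) (α : ℝ) (N : ℕ) : ES (f + g) α N = ES f α N + ES g α N := by
  simp [ES, add_mul, sum_add_distrib]
lemma ES_sub (f g : ArithmeticFunction ℝ) (α : ℝ) (N : ℕ) : ES (f - g) α N = ES f α N - ES g α N := by
  rw [eq_sub_iff_add_eq, ← ES_add]; congr 1; ring

lemma ES_mul (f g : ArithmeticFunction ℝ) (α : ℝ) (N : ℕ) : ES (f * g) α N =
    ∑ m ∈ Ioc 0 N, (f m : ℂ) * ∑ k ∈ Ioc 0 (N / m), (g k : ℂ) * ee ((m * k : ℕ) * α) := by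
  have := conv_sum (fun m k => (f m : ℂ) * ((g k : ℂ) * ee ((m * k : ℕ) * α))) N
  simp_rw [Finset.mul_sum]
  rw [← this]
  unfold ES
  refine sum_congr rfl fun n _ => ?_
  rw [mul_apply, Complex.ofReal_sum, Finset.sum_mul]
  refine sum_congr rfl fun x hx => ?_
  rw [(Nat.mem_divisorsAntidiagonal.mp hx).1]
  push_cast; ring

lemma typeI_gen (f g : ArithmeticFunction ℝ) (α : ℝ) (N M : ℕ) (X C K : ℝ) (hX : (N : ℝ) ≤ X) (hC : 0 ≤ C) (hK : 0 ≤ K)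
    (hf : ∀ m, M < m → f m = 0) (hf2 : ∀ m, m ≤ N → |f m| ≤ C)
    (hg : ∀ m, 0 < m → m ≤ N → ‖∑ k ∈ Ioc 0 (N / m), (g k : ℂ) * ee (k * (α * m))‖ ≤ K * GG (X / m) (α * m)) :
    ‖ES (f * g) α N‖ ≤ C * K * ∑ m ∈ Ioc 0 M, GG (X / m) (α * m) := by
  have hX0 : 0 ≤ X := (Nat.cast_nonneg _).trans hX
  rw [ES_mul]
  refine (norm_sum_le _ _).trans ?_
  have : ∀ m ∈ Ioc 0 N, ‖(f m : ℂ) * ∑ k ∈ Ioc 0 (N / m), (g k : ℂ) * ee ((m * k : ℕ) * α)‖ ≤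
      if m ≤ M then C * K * GG (X / m) (α * m) else 0 := by
    intro m hm
    rw [mem_Ioc] at hm
    split_ifs with h
    · rw [norm_mul, Complex.norm_real, Real.norm_eq_abs, mul_assoc]
      have e : ∑ k ∈ Ioc 0 (N / m), (g k : ℂ) * ee ((m * k : ℕ) * α) = ∑ k ∈ Ioc 0 (N / m), (g k : ℂ) * ee (k * (α * m)) := by
        refine sum_congr rfl fun k _ => ?_
        congr 2; push_cast; ring
      rw [e]
      gcongr
      · exact hf2 m hm.2
      · exact hg m hm.1 hm.2
    · rw [hf m (by omega)]; simp
  refine (sum_le_sum this).trans ?_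
  rw [← sum_filter, ← mul_sum]
  gcongr
  · intro _ _ _; exact GG_nonneg (by positivity) _
  · intro m hm; simp at hm ⊢; omega

lemma mu1_abs (U m : ℕ) : |mu1 U m| ≤ 1 := by
  simp only [mu1, coe_mk]; split_ifs
  · exact_mod_cast abs_moebius_le_one
  · simp
lemma mu2_abs (U m : ℕ) : |mu2 U m| ≤ 1 := by
  simp only [mu2, coe_mk]; split_ifs
  · simp
  · exact_mod_cast abs_moebius_le_one
lemma la1_bd (U m : ℕ) : 0 ≤ la1 U m ∧ la1 U m ≤ Λ m := by
  have := vonMangoldt_nonneg (n := m)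
  simp only [la1, coe_mk]; split_ifs <;> simp [this]
lemma la2_bd (U m : ℕ) : 0 ≤ la2 U m ∧ la2 U m ≤ Λ m := by
  have := vonMangoldt_nonneg (n := m)
  simp only [la2, coe_mk]; split_ifs <;> simp [this]

lemma conv_abs_le (f g : ArithmeticFunction ℝ) (hf : ∀ m, |f m| ≤ 1) (hg : ∀ m, 0 ≤ g m ∧ g m ≤ Λ m) (m : ℕ) :
    |(f * g) m| ≤ Real.log m := by
  rw [mul_apply]
  refine (abs_sum_le_sum_abs _ _).trans ?_
  have h := congrArg (fun f => f m) zeta_mul_vonMangoldt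
  simp only [mul_apply, log_apply] at h
  rw [← h]
  apply sum_le_sum
  intro x hx
  have hx1 : x.1 ≠ 0 := (Nat.ne_zero_of_mem_divisorsAntidiagonal hx).1
  rw [abs_mul, abs_of_nonneg (hg x.2).1]
  simp only [natCoe_apply, zeta_apply, hx1, if_false, Nat.cast_one]
  have := hg x.2
  have := hf x.1
  gcongr
  · exact (hg x.2).1
  · exact (hg x.2).2

lemma typeII_total {α : ℝ} {q₀ : ℤ} {q : ℕ} (hq : 0 < q) (hc : IsCoprime q₀ (q : ℤ))
    (hα : |α - q₀ / q| ≤ 1 / (q : ℝ) ^ 2) (f g : ArithmeticFunction ℝ) (N U : ℕ) (hU : 0 < U)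
    (L X : ℝ) (hX : (N : ℝ) ≤ X)
    (hL1 : 1 + Real.log (2 * q) ≤ L) (J : ℕ) (hJ : N ≤ 2 ^ J)
    (hf : ∀ m, |f m| ≤ 1) (hb : ∀ k, k ≤ N → |g k| ≤ L) (hf0 : ∀ m, m ≤ U → f m = 0)
    (hg0 : ∀ m, m ≤ U → g m = 0) :
    ‖ES (f * g) α N‖ ≤ J * (4 * L ^ 2 * (2 * X / √U + X / √q + √(X * q))) := by
  have hX0 : 0 ≤ X := (Nat.cast_nonneg _).trans hX
  rw [ES_mul]
  set F : ℕ → ℂ := fun m => (f m : ℂ) * ∑ k ∈ Ioc 0 (N / m), (g k : ℂ) * ee ((m * k : ℕ) * α) with hF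
  have hF0 : ∀ m, m ≤ U → F m = 0 := by
    intro m hm; simp only [hF]; rw [hf0 m hm]; simp
  have hF1 : ∀ m, N / m ≤ U → F m = 0 := by
    intro m hm; simp only [hF]
    rw [Finset.sum_eq_zero, mul_zero]
    intro k hk; rw [mem_Ioc] at hk; rw [hg0 k (by omega)]; simp
  have h1 : ∑ m ∈ Ioc 0 N, F m = ∑ m ∈ Ioc U (U * 2 ^ J), F m := by
    have hsub : Ioc U N ⊆ Ioc 0 N := Ioc_subset_Ioc (by omega) le_rfl
    have hsub2 : Ioc U N ⊆ Ioc U (U * 2 ^ J) := Ioc_subset_Ioc le_rfl (hJ.trans (Nat.le_mul_of_pos_left _ hU))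
    rw [← sum_subset hsub, ← sum_subset hsub2]
    · intro m hm hm2; simp at hm hm2
      apply hF1; rw [Nat.div_eq_of_lt (by omega)]; omega
    · intro m hm hm2; simp at hm hm2
      apply hF0; by_contra h; have := hm2 (by omega); omega
  have h2 : ∀ J, ∑ m ∈ Ioc U (U * 2 ^ J), F m = ∑ i ∈ range J, ∑ m ∈ Ioc (U * 2 ^ i) (2 * (U * 2 ^ i)), F m := by
    intro J
    induction J with
    | zero => simp
    | succ J ih =>
      rw [sum_range_succ, ← ih, pow_succ]
      have : 2 * (U * 2 ^ J) = U * (2 ^ J * 2) := by ring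
      rw [this, sum_Ioc_consecutive]
      · exact Nat.le_mul_of_pos_right _ (by positivity)
      · have : 0 < 2 ^ J := by positivity
        nlinarith
  rw [h1, h2]
  refine (norm_sum_le _ _).trans ?_
  refine (sum_le_card_nsmul _ _ (4 * L ^ 2 * (2 * X / √U + X / √q + √(X * q))) ?_).trans ?_
  · intro i _
    by_cases hD : U * 2 ^ i * U ≤ N
    · exact typeII_block hq hc hα f g N (U * 2 ^ i) U hU (Nat.le_mul_of_pos_right _ (by positivity)) hD L X hX hL1 hf hb
    · rw [sum_eq_zero, norm_zero]
      · positivity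
      · intro m hm
        rw [mem_Ioc] at hm
        apply hF1
        apply Nat.le_of_lt
        rw [Nat.div_lt_iff_lt_mul (by omega)]
        push Not at hD
        nlinarith
  · simp

set_option maxHeartbeats 1000000 in
theorem vino {α : ℝ} {q₀ : ℤ} {q : ℕ} (hq : 0 < q) (hc : IsCoprime q₀ (q : ℤ))
    (hα : |α - q₀ / q| ≤ 1 / (q : ℝ) ^ 2) (N : ℕ) (X : ℝ) (hX1 : 1 ≤ X) (hX : (N : ℝ) ≤ X) (hqX : (q : ℝ) ≤ X) :
    ‖∑ n ∈ Ioc 0 N, (Λ n : ℂ) * ee (n * α)‖ ≤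
      1000 * (3 + Real.log X) ^ 3 * (X / √q + X ^ ((5 : ℝ) / 6) + √(X * q)) := by
  have hq' : (0 : ℝ) < q := by exact_mod_cast hq
  have hq1 : (1 : ℝ) ≤ q := by exact_mod_cast hq
  have hlX : 0 ≤ Real.log X := Real.log_nonneg hX1
  set L := 3 + Real.log X with hL
  have hL3 : 3 ≤ L := by linarith
  set U := ⌈X ^ ((1 : ℝ) / 3)⌉₊ with hU
  have hX3 : 1 ≤ X ^ ((1 : ℝ) / 3) := Real.one_le_rpow hX1 (by norm_num)
  have hU1 : X ^ ((1 : ℝ) / 3) ≤ U := Nat.le_ceil _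
  have hU2 : (U : ℝ) ≤ 2 * X ^ ((1 : ℝ) / 3) := by
    have := Nat.ceil_lt_add_one (show 0 ≤ X ^ ((1 : ℝ) / 3) by positivity)
    rw [← hU] at this; linarith
  have hU0 : 0 < U := Nat.ceil_pos.mpr (by linarith)
  have hU0' : (0 : ℝ) < U := by exact_mod_cast hU0
  have hUsq : ((U * U : ℕ) : ℝ) ≤ 4 * X ^ ((5 : ℝ) / 6) := by
    push_cast
    calc (U : ℝ) * U ≤ (2 * X ^ ((1 : ℝ) / 3)) * (2 * X ^ ((1 : ℝ) / 3)) := by gcongr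
      _ = 4 * X ^ ((2 : ℝ) / 3) := by
        rw [show (2 : ℝ) / 3 = 1 / 3 + 1 / 3 by norm_num, Real.rpow_add (by linarith)]; ring
      _ ≤ _ := by gcongr 4 * ?_; exact Real.rpow_le_rpow_of_exponent_le hX1 (by norm_num)
  have h56 : X ^ ((5 : ℝ) / 6) ≤ X := by
    conv_rhs => rw [← Real.rpow_one X]
    exact Real.rpow_le_rpow_of_exponent_le hX1 (by norm_num)
  have hl5 : Real.log 5 ≤ 2 := by
    rw [Real.log_le_iff_le_exp (by norm_num)]
    have := Real.exp_one_gt_d9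
    have e : Real.exp 2 = Real.exp 1 * Real.exp 1 := by rw [← Real.exp_add]; norm_num
    rw [e]; nlinarith
  have hl2 : Real.log 2 ≤ 1 := by
    have := Real.log_two_lt_d9; linarith
  have hLq : 1 + Real.log (2 * q) ≤ L := by
    rw [Real.log_mul (by norm_num) (by positivity)]
    have : Real.log q ≤ Real.log X := by gcongr
    linarith
  have hLM : 1 + Real.log ((U * U : ℕ) + 1) ≤ L := by
    have : Real.log ((U * U : ℕ) + 1) ≤ Real.log (5 * X) := by gcongr; linarith
    rw [Real.log_mul (by norm_num) (by positivity)] at this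
    linarith
  have hlogN : ∀ k : ℕ, k ≤ N → Real.log k ≤ L := by
    intro k hk
    rcases Nat.eq_zero_or_pos k with rfl | hk0
    · simp; linarith
    have : (0 : ℝ) < k := by exact_mod_cast hk0
    have : Real.log k ≤ Real.log X := by gcongr; exact le_trans (by exact_mod_cast hk) hX
    linarith
  set T := X / √q + X ^ ((5 : ℝ) / 6) + √(X * q) with hT
  have hX0 : 0 < X := by linarith
  have t1 : 0 ≤ X / √q := by positivity
  have t2 : 0 ≤ X ^ ((5 : ℝ) / 6) := by positivity
  have t3 : 0 ≤ √(X * q) := by positivity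
  have hqT : (q : ℝ) ≤ √(X * q) := by
    apply Real.le_sqrt_of_sq_le; nlinarith
  have hXq : X / q ≤ X / √q := by
    gcongr
    rw [Real.sqrt_le_left (by positivity)]; nlinarith
  have hXU : X / √U ≤ X ^ ((5 : ℝ) / 6) := by
    have : X ^ ((1 : ℝ) / 6) ≤ √U := by
      apply Real.le_sqrt_of_sq_le
      rw [← Real.rpow_natCast, ← Real.rpow_mul hX0.le]
      norm_num at hU1 ⊢; exact hU1
    calc X / √U ≤ X / X ^ ((1 : ℝ) / 6) := by gcongr
      _ = X ^ ((5 : ℝ) / 6) := by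
        rw [div_eq_iff (by positivity), ← Real.rpow_add hX0]; norm_num
  have hI : ∑ m ∈ Ioc 0 (U * U), GG (X / m) (α * m) ≤ 128 * T * L := by
    refine (typeI_sum hq hc hα X L hX0.le (U * U) hLq hLM).trans ?_
    gcongr ?_ * _
    rw [hT]; linarith
  have hI2 : ∑ m ∈ Ioc 0 U, GG (X / m) (α * m) ≤ 128 * T * L := by
    refine le_trans ?_ hI
    gcongr
    · intro _ _ _; exact GG_nonneg (by positivity) _
    · nlinarith
  have hNm : ∀ m : ℕ, 0 < m → (((N / m : ℕ)) : ℝ) ≤ X / m := fun m hm =>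
    Nat.cast_div_le.trans (by gcongr)
  have B1 : ‖ES (la1 U) α N‖ ≤ 4 * T * L := by
    refine (norm_sum_le _ _).trans ?_
    have : ∀ n ∈ Ioc 0 N, ‖((la1 U n : ℝ) : ℂ) * ee (n * α)‖ ≤ if n ≤ U then L else 0 := by
      intro n hn
      rw [mem_Ioc] at hn
      rw [norm_mul, ee_norm, mul_one, Complex.norm_real, Real.norm_of_nonneg (la1_bd U n).1]
      split_ifs with h
      · exact (la1_bd U n).2.trans (vonMangoldt_le_log.trans (hlogN n hn.2))
      · simp [la1, h]
    refine (sum_le_sum this).trans ?_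
    rw [← sum_filter, sum_const, nsmul_eq_mul]
    gcongr
    have : #{n ∈ Ioc 0 N | n ≤ U} ≤ U * U := by
      calc #{n ∈ Ioc 0 N | n ≤ U} ≤ #(Ioc 0 U) := by
            apply card_le_card; intro n hn; simp at hn ⊢; omega
        _ = U := by simp
        _ ≤ U * U := by nlinarith
    have : ((#{n ∈ Ioc 0 N | n ≤ U} : ℕ) : ℝ) ≤ (U * U : ℕ) := by exact_mod_cast this
    linarith
  have B2 : ‖ES (mu1 U * log) α N‖ ≤ 1 * (2 * L) * (128 * T * L) := by
    refine (typeI_gen (mu1 U) log α N U X 1 (2 * L) hX (by norm_num) (by linarith) ?_ (fun m _ => mu1_abs U m) ?_).trans ?_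
    · intro m hm; simp [mu1, hm.not_ge]
    · intro m hm hmN
      exact log_geo (N / m) (α * m) (X / m) (hNm m hm) L (hlogN _ (Nat.div_le_self _ _))
    · gcongr
  have B3 : ‖ES (mu1 U * la1 U * (ζ : ArithmeticFunction ℝ)) α N‖ ≤ L * 1 * (128 * T * L) := by
    refine (typeI_gen (mu1 U * la1 U) ζ α N (U * U) X L 1 hX (by linarith) (by linarith) ?_ ?_ ?_).trans ?_
    · intro m hm
      rw [mul_apply]
      apply sum_eq_zero
      intro x hx
      have hx := (Nat.mem_divisorsAntidiagonal.mp hx).1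
      simp only [mu1, la1, coe_mk]
      by_cases h1 : x.1 ≤ U
      · have h2 : ¬ x.2 ≤ U := by intro h2; have := Nat.mul_le_mul h1 h2; omega
        simp [h2]
      · simp [h1]
    · intro m hm
      exact (conv_abs_le _ _ (mu1_abs U) (la1_bd U) m).trans (hlogN m hm)
    · intro m hm hmN
      rw [one_mul]
      refine le_trans (le_of_eq ?_) (geo_GG 0 (N / m) (α * m) (X / m) (by simpa using hNm m hm))
      congr 1
      refine sum_congr rfl fun k hk => ?_
      rw [mem_Ioc] at hk
      have : k ≠ 0 := by omega
      simp [this]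
    · gcongr
  have B4 : ‖ES (mu2 U * ((ζ : ArithmeticFunction ℝ) * la2 U)) α N‖ ≤ (2 * L) * (4 * L ^ 2 * (2 * T)) := by
    have hz : ∀ m, |(ζ : ArithmeticFunction ℝ) m| ≤ 1 := by
      intro m; simp only [natCoe_apply, zeta_apply]; split_ifs <;> simp
    refine (typeII_total hq hc hα (mu2 U) _ N U hU0 L X hX hLq (Nat.log 2 N + 1) ?_ (mu2_abs U) ?_ ?_ ?_).trans ?_
    · exact (Nat.lt_pow_succ_log_self (by norm_num) N).le
    · intro k hk
      exact (conv_abs_le _ _ hz (la2_bd U) k).trans (hlogN k hk)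
    · intro m hm; simp [mu2, hm]
    · intro m hm
      rw [mul_apply]
      apply sum_eq_zero
      intro x hx
      have : x.2 ≤ m := Nat.divisor_le (Nat.snd_mem_divisors_of_mem_antidiagonal hx)
      simp [la2, this.trans hm]
    · have hJ : ((Nat.log 2 N + 1 : ℕ) : ℝ) ≤ 2 * L := by
        push_cast
        rcases Nat.eq_zero_or_pos N with rfl | hN
        · simp; linarith
        have h1 : ((2 ^ Nat.log 2 N : ℕ) : ℝ) ≤ X := le_trans (by exact_mod_cast Nat.pow_log_le_self 2 hN.ne') hX
        have h2 : Real.log ((2 ^ Nat.log 2 N : ℕ) : ℝ) ≤ Real.log X := by gcongr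
        push_cast at h2
        rw [Real.log_pow] at h2
        have := Real.log_two_gt_d9
        nlinarith [Nat.cast_nonneg (α := ℝ) (Nat.log 2 N)]
      have h2 : 2 * X / √U + X / √q + √(X * q) ≤ 2 * T := by
        have : 2 * X / √U = 2 * (X / √U) := by ring
        rw [this, hT]; linarith
      gcongr
  have hmain : ∑ n ∈ Ioc 0 N, (Λ n : ℂ) * ee (n * α) = ES (la1 U) α N + ES (mu1 U * log) α N
      - ES (mu1 U * la1 U * (ζ : ArithmeticFunction ℝ)) α N + ES (mu2 U * ((ζ : ArithmeticFunction ℝ) * la2 U)) α N := by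
    rw [← ES_add, ← ES_sub, ← ES_add, ← vaughan]; rfl
  rw [hmain]
  have hT0 : 0 ≤ T := by positivity
  have n1 : ‖ES (la1 U) α N + ES (mu1 U * log) α N
      - ES (mu1 U * la1 U * (ζ : ArithmeticFunction ℝ)) α N + ES (mu2 U * ((ζ : ArithmeticFunction ℝ) * la2 U)) α N‖ ≤
      4 * T * L + 1 * (2 * L) * (128 * T * L) + L * 1 * (128 * T * L) + (2 * L) * (4 * L ^ 2 * (2 * T)) := by
    refine (norm_add_le _ _).trans (add_le_add ((norm_sub_le _ _).trans (add_le_add ((norm_add_le _ _).trans (add_le_add B1 B2)) B3)) B4)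
  refine n1.trans ?_
  have e1 : L * T ≤ L ^ 3 * T := by gcongr; nlinarith
  have e2 : L ^ 2 * T ≤ L ^ 3 * T := by gcongr <;> linarith
  have e3 : 4 * T * L + 1 * (2 * L) * (128 * T * L) + L * 1 * (128 * T * L) + (2 * L) * (4 * L ^ 2 * (2 * T)) =
    4 * (L * T) + 384 * (L ^ 2 * T) + 16 * (L ^ 3 * T) := by ring
  have e4 : 0 ≤ L ^ 3 * T := by positivity
  rw [e3, mul_assoc]
  linarith
end WCL

end

section

open Finset
namespace WCL

lemma cpow_hasDeriv (r : ℂ) {u : ℝ} (hu : 0 < u) :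
    HasDerivAt (fun u : ℝ => (u : ℂ) ^ r) (r * (u : ℂ) ^ (r - 1)) u := by
  have h := ((hasDerivAt_id (u : ℂ)).cpow_const (c := r) (Complex.ofReal_mem_slitPlane.mpr hu)).comp_ofReal
  simpa using h

lemma cpow_diff {a b : ℝ} (ha : 0 < a) (hab : a ≤ b) {s : ℂ} (hs : 0 < s.re) :
    ‖(b : ℂ) ^ (-s) - (a : ℂ) ^ (-s)‖ ≤ ‖s‖ * a ^ (-s.re - 1) * (b - a) := by
  have h := (convex_Icc a b).norm_image_sub_le_of_norm_hasDerivWithin_le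
    (f := fun u : ℝ => (u : ℂ) ^ (-s)) (f' := fun u => (-s) * (u : ℂ) ^ (-s - 1))
    (C := ‖s‖ * a ^ (-s.re - 1)) (fun u hu => (cpow_hasDeriv (-s) (ha.trans_le hu.1)).hasDerivWithinAt) ?_
    (Set.left_mem_Icc.mpr hab) (Set.right_mem_Icc.mpr hab)
  · rwa [Real.norm_of_nonneg (by linarith)] at h
  · intro u hu
    have hu0 : 0 < u := ha.trans_le hu.1
    rw [norm_mul, norm_neg, Complex.norm_cpow_eq_rpow_re_of_pos hu0]
    gcongr
    simp only [Complex.sub_re, Complex.neg_re, Complex.one_re]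
    apply Real.rpow_le_rpow_of_nonpos ha hu.1; linarith

lemma summable_tail (J : ℕ) {σ : ℝ} (hσ : 0 < σ) : Summable (fun j : ℕ => ((J + j : ℕ) : ℝ) ^ (-σ - 1)) := by
  have h : Summable (fun j : ℕ => (j : ℝ) ^ (-σ - 1)) := Real.summable_nat_rpow.mpr (by linarith)
  have := (summable_nat_add_iff J).mpr h
  refine this.congr fun j => ?_
  rw [add_comm]

lemma sq_tele {j : ℝ} (hj : 1 ≤ j) : j ^ (-(3 : ℝ) / 2) ≤ 4 * (1 / √j - 1 / √(j + 1)) := by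
  have hj0 : 0 < j := by linarith
  set x := √j with hx
  set y := √(j + 1) with hy
  have hx0 : 0 < x := Real.sqrt_pos.mpr hj0
  have hy0 : 0 < y := Real.sqrt_pos.mpr (by linarith)
  have hxx : x ^ 2 = j := Real.sq_sqrt hj0.le
  have hyy : y ^ 2 = j + 1 := Real.sq_sqrt (by linarith)
  have e : j ^ (-(3 : ℝ) / 2) = 1 / x ^ 3 := by
    rw [hx, Real.sqrt_eq_rpow, ← Real.rpow_natCast, ← Real.rpow_mul hj0.le, one_div, ← Real.rpow_neg hj0.le]
    norm_num
  have hyx : y ≤ 1.42 * x := by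
    refine (pow_le_pow_iff_left₀ hy0.le (by positivity) two_ne_zero).mp ?_
    rw [mul_pow, hxx, hyy]; linarith
  have hxy : x ≤ y := by
    refine (pow_le_pow_iff_left₀ hx0.le hy0.le two_ne_zero).mp ?_
    rw [hxx, hyy]; linarith
  rw [e]
  have h1 : 1 / x - 1 / y = 1 / (x * y * (x + y)) := by
    field_simp
    nlinarith
  rw [h1, mul_one_div, div_le_div_iff₀ (by positivity) (by positivity)]
  have : x * y * (x + y) ≤ x * (1.42 * x) * (x + 1.42 * x) := by gcongr
  nlinarith [pow_pos hx0 3]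

lemma tsum_tail (J : ℕ) (hJ : 0 < J) {σ : ℝ} (hσ : 1 / 2 ≤ σ) :
    ∑' j : ℕ, ((J + j : ℕ) : ℝ) ^ (-σ - 1) ≤ 4 * (J : ℝ) ^ (-σ) := by
  have hJ1 : (1 : ℝ) ≤ J := by exact_mod_cast hJ
  apply Real.tsum_le_of_sum_range_le
  · intro j; positivity
  · intro n
    have h1 : ∀ j ∈ range n, ((J + j : ℕ) : ℝ) ^ (-σ - 1) ≤
        (J : ℝ) ^ (-σ + 1 / 2) * (4 * (1 / √((J + j : ℕ) : ℝ) - 1 / √((J + (j + 1) : ℕ) : ℝ))) := by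
      intro j _
      have hj1 : (1 : ℝ) ≤ (J + j : ℕ) := by exact_mod_cast (by omega : 1 ≤ J + j)
      have e : ((J + j : ℕ) : ℝ) ^ (-σ - 1) = ((J + j : ℕ) : ℝ) ^ (-σ + 1 / 2) * ((J + j : ℕ) : ℝ) ^ (-(3 : ℝ) / 2) := by
        rw [← Real.rpow_add (by linarith)]; congr 1; ring
      rw [e]
      have h2 := sq_tele hj1
      have e3 : (((J + (j + 1) : ℕ)) : ℝ) = (J + j : ℕ) + 1 := by push_cast; ring
      rw [e3]
      have h3 : ((J + j : ℕ) : ℝ) ^ (-σ + 1 / 2) ≤ (J : ℝ) ^ (-σ + 1 / 2) := by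
        apply Real.rpow_le_rpow_of_nonpos (by linarith)
        · push_cast; linarith [Nat.cast_nonneg (α := ℝ) j]
        · linarith
      gcongr
    refine (sum_le_sum h1).trans ?_
    rw [← mul_sum, ← mul_sum, Finset.sum_range_sub' (fun j : ℕ => 1 / √((J + j : ℕ) : ℝ)) n]
    have e : (J : ℝ) ^ (-σ) = (J : ℝ) ^ (-σ + 1 / 2) * (1 / √(J : ℝ)) := by
      rw [Real.sqrt_eq_rpow, one_div ((J : ℝ) ^ (1 / 2 : ℝ)), ← Real.rpow_neg (by linarith), ← Real.rpow_add (by linarith)]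
      congr 1; ring
    rw [e]
    have : 0 ≤ 1 / √((J + n : ℕ) : ℝ) := by positivity
    have h4 : 0 ≤ (J : ℝ) ^ (-σ + 1 / 2) := by positivity
    simp only [add_zero]
    nlinarith [mul_nonneg h4 this]

lemma tail_diff (J : ℕ) (hJ : 0 < J) (h : ℕ → ℂ → ℂ) (hd : ∀ j, Differentiable ℂ (h j)) (P : ℂ → ℝ) (hP : Continuous P)
    (hb : ∀ j, ∀ s : ℂ, 0 < s.re → ‖h j s‖ ≤ P s * ((J + j : ℕ) : ℝ) ^ (-s.re - 1)) :
    DifferentiableOn ℂ (fun s => ∑' j, h j s) {s | 0 < s.re} := by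
  intro s₀ hs₀
  simp only [Set.mem_setOf_eq] at hs₀
  set U : Set ℂ := {s | s₀.re / 2 < s.re} ∩ {s | P s < P s₀ + 1} with hU
  have hUo : IsOpen U := (isOpen_lt continuous_const Complex.continuous_re).inter (isOpen_lt hP continuous_const)
  have hs₀U : s₀ ∈ U := ⟨by simp; linarith, by simp⟩
  have hP0 : 0 ≤ P s₀ + 1 := by
    have := (norm_nonneg _).trans (hb 0 s₀ hs₀)
    have h2 : 0 < ((J + 0 : ℕ) : ℝ) ^ (-s₀.re - 1) := by
      have : 0 < ((J + 0 : ℕ) : ℝ) := by exact_mod_cast (by omega)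
      positivity
    have := nonneg_of_mul_nonneg_left this h2
    linarith
  have := Complex.differentiableOn_tsum_of_summable_norm
    (u := fun j : ℕ => (P s₀ + 1) * ((J + j : ℕ) : ℝ) ^ (-(s₀.re / 2) - 1)) (F := h) (U := U)
    ((summable_tail J (by linarith)).mul_left _) (fun j => (hd j).differentiableOn) hUo ?_
  · exact ((this s₀ hs₀U).differentiableAt (hUo.mem_nhds hs₀U)).differentiableWithinAt
  · rintro j s ⟨h1, h2⟩
    simp only [Set.mem_setOf_eq] at h1 h2
    refine (hb j s (by linarith)).trans ?_
    have : (1 : ℝ) ≤ (J + j : ℕ) := by exact_mod_cast (by omega : 1 ≤ J + j)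
    gcongr

lemma tail_bound (J : ℕ) (hJ : 0 < J) (h : ℕ → ℂ) (s : ℂ) (P : ℝ) (hs : 1 / 2 ≤ s.re)
    (hb : ∀ j, ‖h j‖ ≤ P * ((J + j : ℕ) : ℝ) ^ (-s.re - 1)) :
    Summable h ∧ ‖∑' j, h j‖ ≤ P * (4 * (J : ℝ) ^ (-s.re)) := by
  have hP0 : 0 ≤ P := by
    have := (norm_nonneg _).trans (hb 0)
    have h2 : 0 < ((J + 0 : ℕ) : ℝ) ^ (-s.re - 1) := by
      have : 0 < ((J + 0 : ℕ) : ℝ) := by exact_mod_cast (by omega)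
      positivity
    exact nonneg_of_mul_nonneg_left this h2
  have hs2 := (summable_tail J (σ := s.re) (by linarith)).mul_left P
  refine ⟨Summable.of_norm_bounded hs2 hb, ?_⟩
  refine (tsum_of_norm_bounded hs2.hasSum hb).trans ?_
  rw [tsum_mul_left]
  gcongr
  exact tsum_tail J hJ hs

lemma head_bound (f : ℕ → ℂ) (B : ℝ) (hf : ∀ n, ‖f n‖ ≤ B) (M : ℕ) (hM : 0 < M) (s : ℂ) (δ : ℝ) (hδ : 0 ≤ δ) (hs : 1 - δ ≤ s.re) :
    ‖∑ n ∈ Ico 1 M, f n * (n : ℂ) ^ (-s)‖ ≤ B * ((M : ℝ) ^ δ * (1 + Real.log M)) := by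
  have hB : 0 ≤ B := (norm_nonneg _).trans (hf 0)
  refine (norm_sum_le _ _).trans ?_
  have h1 : ∀ n ∈ Ico 1 M, ‖f n * (n : ℂ) ^ (-s)‖ ≤ B * ((M : ℝ) ^ δ * (1 / (n : ℝ))) := by
    intro n hn
    rw [mem_Ico] at hn
    have hn0 : (0 : ℝ) < n := by exact_mod_cast hn.1
    have hn1 : (1 : ℝ) ≤ n := by exact_mod_cast hn.1
    rw [norm_mul, Complex.norm_natCast_cpow_of_pos (by omega)]
    have : (n : ℝ) ^ (-s).re ≤ (M : ℝ) ^ δ * (1 / (n : ℝ)) := by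
      calc (n : ℝ) ^ (-s).re ≤ (n : ℝ) ^ (δ + -1) := by
            apply Real.rpow_le_rpow_of_exponent_le hn1; simp; linarith
        _ = (n : ℝ) ^ δ * (1 / n) := by rw [Real.rpow_add hn0, Real.rpow_neg_one, one_div]
        _ ≤ _ := by
            gcongr
            exact_mod_cast hn.2.le
    have := hf n
    gcongr
  refine (sum_le_sum h1).trans ?_
  rw [← mul_sum, ← mul_sum]
  gcongr
  refine le_trans ?_ (sum_inv_range_le M hM)
  apply sum_le_sum_of_subset_of_nonneg
  · intro n; simp
  · intro _ _ _; positivity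
end WCL

end

section

open Finset
namespace WCL

noncomputable def VV (q : ℕ) (t : ℝ) : ℝ := q * (|t| + 3)

lemma VV_ge {q : ℕ} (hq : 0 < q) (t : ℝ) : 3 ≤ VV q t := by
  have : (1 : ℝ) ≤ q := by exact_mod_cast hq
  unfold VV; nlinarith [abs_nonneg t]

noncomputable def hper (f : ℕ → ℂ) (q J j : ℕ) (s : ℂ) : ℂ :=
  ∑ r ∈ range q, f r * ((((J + j) * q + r : ℕ) : ℂ) ^ (-s) - (((J + j) * q : ℕ) : ℂ) ^ (-s))

noncomputable def Gper (f : ℕ → ℂ) (q J : ℕ) (s : ℂ) : ℂ :=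
  ∑ n ∈ Ico 1 (J * q), f n * (n : ℂ) ^ (-s) + ∑' j, hper f q J j s

lemma hper_bound (f : ℕ → ℂ) (B : ℝ) (hf : ∀ n, ‖f n‖ ≤ B) (q J : ℕ) (hq : 0 < q) (hJ : 0 < J) (j : ℕ) (s : ℂ)
    (hs : 0 < s.re) : ‖hper f q J j s‖ ≤ (B * (‖s‖ * (q : ℝ) ^ (1 - s.re))) * ((J + j : ℕ) : ℝ) ^ (-s.re - 1) := by
  have hq' : (0 : ℝ) < q := by exact_mod_cast hq
  have hB : 0 ≤ B := (norm_nonneg _).trans (hf 0)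
  have hJ' : (0 : ℝ) < (J + j : ℕ) := by exact_mod_cast (by omega : 0 < J + j)
  have h1 : ∀ r ∈ range q, ‖f r * ((((J + j) * q + r : ℕ) : ℂ) ^ (-s) - (((J + j) * q : ℕ) : ℂ) ^ (-s))‖ ≤
      B * (‖s‖ * (((J + j) * q : ℕ) : ℝ) ^ (-s.re - 1) * q) := by
    intro r hr
    rw [mem_range] at hr
    rw [norm_mul]
    have h2 := cpow_diff (a := ((J + j) * q : ℕ)) (b := ((J + j) * q + r : ℕ)) (s := s)
      (by exact_mod_cast Nat.mul_pos (by omega) hq) (by exact_mod_cast Nat.le_add_right _ _) hs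
    simp only [Complex.ofReal_natCast] at h2
    have h3 : (((J + j) * q + r : ℕ) : ℝ) - ((J + j) * q : ℕ) ≤ q := by
      push_cast; have : (r : ℝ) ≤ q := by exact_mod_cast hr.le
      linarith
    have := hf r
    gcongr
    refine h2.trans ?_
    gcongr
  refine (norm_sum_le _ _).trans ((sum_le_sum h1).trans (le_of_eq ?_))
  rw [sum_const, card_range, nsmul_eq_mul]
  rw [show (((J + j) * q : ℕ) : ℝ) = (J + j : ℕ) * q by push_cast; ring, Real.mul_rpow hJ'.le hq'.le]
  have : (q : ℝ) ^ (1 - s.re) = (q : ℝ) ^ (-s.re - 1) * (q * q) := by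
    rw [← pow_two, ← Real.rpow_natCast, ← Real.rpow_add hq']; congr 1; norm_num; ring
  rw [this]; ring

lemma hper_diff (f : ℕ → ℂ) (q J : ℕ) (hq : 0 < q) (hJ : 0 < J) (j : ℕ) : Differentiable ℂ (hper f q J j) := by
  unfold hper
  have h1 : ∀ n : ℕ, 0 < n → Differentiable ℂ (fun s : ℂ => (n : ℂ) ^ (-s)) := by
    intro n hn s
    exact (differentiableAt_id.neg).const_cpow (Or.inl (by exact_mod_cast hn.ne'))
  have h0 : 0 < (J + j) * q := Nat.mul_pos (by omega) hq
  apply Differentiable.fun_sum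
  intro r _
  exact (((h1 _ (by omega)).sub (h1 _ h0)).const_mul _)

lemma Gper_diff (f : ℕ → ℂ) (B : ℝ) (hf : ∀ n, ‖f n‖ ≤ B) (q J : ℕ) (hq : 0 < q) (hJ : 0 < J) :
    DifferentiableOn ℂ (Gper f q J) {s | 0 < s.re} := by
  have hq' : (0 : ℝ) < q := by exact_mod_cast hq
  unfold Gper
  apply DifferentiableOn.add
  · apply Differentiable.differentiableOn
    apply Differentiable.fun_sum
    intro n hn s
    rw [mem_Ico] at hn
    have : (n : ℂ) ≠ 0 := by exact_mod_cast (by omega : n ≠ 0)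
    exact ((differentiableAt_id.neg).const_cpow (Or.inl this)).const_mul _
  · refine tail_diff J hJ _ (hper_diff f q J hq hJ) (fun s => B * (‖s‖ * (q : ℝ) ^ (1 - s.re))) ?_
      (fun j s hs => hper_bound f B hf q J hq hJ j s hs)
    refine continuous_const.mul (continuous_norm.mul ?_)
    exact Continuous.rpow continuous_const (continuous_const.sub Complex.continuous_re) (fun _ => Or.inl hq'.ne')

lemma per_mul {f : ℕ → ℂ} {q : ℕ} (hp : ∀ n, f (n + q) = f n) (k r : ℕ) : f (k * q + r) = f r := by
  induction k with
  | zero => simp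
  | succ k ih => rw [show (k + 1) * q + r = (k * q + r) + q by ring, hp, ih]

lemma hper_sum {f : ℕ → ℂ} {q : ℕ} (hp : ∀ n, f (n + q) = f n) (h0 : ∑ r ∈ range q, f r = 0) (J : ℕ) (s : ℂ) (K : ℕ) :
    ∑ j ∈ range K, hper f q J j s = ∑ n ∈ Ico (J * q) ((J + K) * q), f n * (n : ℂ) ^ (-s) := by
  induction K with
  | zero => simp
  | succ K ih =>
    rw [sum_range_succ, ih, ← Finset.sum_Ico_consecutive _ (show J * q ≤ (J + K) * q by gcongr; omega)
      (show (J + K) * q ≤ (J + (K + 1)) * q by gcongr; omega)]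
    congr 1
    unfold hper
    simp_rw [mul_sub]
    rw [sum_sub_distrib, ← Finset.sum_mul, h0, zero_mul, sub_zero, Finset.sum_Ico_eq_sum_range]
    have : (J + (K + 1)) * q - (J + K) * q = q := by
      rw [← Nat.sub_mul]; simp [show J + (K + 1) - (J + K) = 1 by omega]
    rw [this]
    refine sum_congr rfl fun r _ => ?_
    rw [per_mul hp]

lemma LSeries_eq_Gper {f : ℕ → ℂ} {B : ℝ} (hf : ∀ n, ‖f n‖ ≤ B) {q : ℕ} (hq : 0 < q) (hp : ∀ n, f (n + q) = f n)
    (h0 : ∑ r ∈ range q, f r = 0) (J : ℕ) (hJ : 0 < J) {s : ℂ} (hs : 1 < s.re) :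
    LSeries f s = Gper f q J s := by
  have hsum : LSeriesSummable f s := LSeriesSummable_of_bounded_of_one_lt_re (fun n _ => hf n) hs
  have ht : ∀ n : ℕ, n ≠ 0 → LSeries.term f s n = f n * (n : ℂ) ^ (-s) := by
    intro n hn
    rw [LSeries.term_of_ne_zero hn, Complex.cpow_neg, div_eq_mul_inv]
  have h1 : Filter.Tendsto (fun K => ∑ n ∈ range ((J + K) * q), LSeries.term f s n) Filter.atTop (nhds (LSeries f s)) := by
    refine (hsum.hasSum.tendsto_sum_nat).comp ?_
    refine Filter.tendsto_atTop_mono (fun K => ?_) Filter.tendsto_id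
    simp only [id]
    nlinarith
  have hs2 := (tail_bound J hJ (fun j => hper f q J j s) s _ (by linarith) (fun j => hper_bound f B hf q J hq hJ j s (by linarith))).1
  have h2 := (hs2.hasSum.tendsto_sum_nat).const_add (∑ n ∈ Ico 1 (J * q), f n * (n : ℂ) ^ (-s))
  refine tendsto_nhds_unique h1 (h2.congr fun K => ?_)
  have hJq : 1 ≤ J * q := Nat.mul_pos hJ hq
  rw [hper_sum hp h0, Finset.sum_Ico_consecutive _ hJq (by gcongr; omega),
    Finset.range_eq_Ico, Finset.sum_eq_sum_Ico_succ_bot (show 0 < (J + K) * q from Nat.mul_pos (by omega) hq) (fun n => LSeries.term f s n)]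
  simp only [LSeries.term_zero, zero_add]
  refine sum_congr rfl fun n hn => ?_
  rw [mem_Ico] at hn
  rw [ht n (by omega)]

lemma log_absorb {M δ : ℝ} (hM : 1 ≤ M) (hδ : 0 < δ) : M ^ δ * (9 + Real.log M) ≤ (9 + 1 / δ) * M ^ (2 * δ) := by
  have h1 : Real.log M ≤ M ^ δ / δ := Real.log_le_rpow_div (by linarith) hδ
  have h2 : 1 ≤ M ^ δ := Real.one_le_rpow hM hδ.le
  have h3 : M ^ (2 * δ) = M ^ δ * M ^ δ := by rw [← Real.rpow_add (by linarith)]; congr 1; ring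
  rw [h3]
  have h4 : 9 + Real.log M ≤ (9 + 1 / δ) * M ^ δ := by
    have : M ^ δ / δ = 1 / δ * M ^ δ := by ring
    nlinarith
  nlinarith

lemma norm_le_of {s : ℂ} (h1 : 0 ≤ s.re) (h2 : s.re ≤ 3) : ‖s‖ ≤ 3 + |s.im| := by
  refine (Complex.norm_le_abs_re_add_abs_im s).trans ?_
  rw [abs_of_nonneg h1]; linarith

lemma Gper_bound (f : ℕ → ℂ) (B : ℝ) (hf : ∀ n, ‖f n‖ ≤ B) (q : ℕ) (hq : 0 < q) (δ : ℝ) (hδ : 0 < δ) (hδ2 : δ ≤ 1 / 2)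
    (s : ℂ) (hs : 1 - δ ≤ s.re) (hs3 : s.re ≤ 3) :
    ‖Gper f q ⌈|s.im| + 2⌉₊ s‖ ≤ B * ((9 + 1 / δ) * VV q s.im ^ (2 * δ)) := by
  have hq' : (0 : ℝ) < q := by exact_mod_cast hq
  have hB : 0 ≤ B := (norm_nonneg _).trans (hf 0)
  have ht := abs_nonneg s.im
  set J := ⌈|s.im| + 2⌉₊ with hJ
  have hJ0 : 0 < J := Nat.ceil_pos.mpr (by linarith)
  have hJ0' : (0 : ℝ) < J := by exact_mod_cast hJ0
  have hJ1 : |s.im| + 2 ≤ J := Nat.le_ceil _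
  have hJ2 : (J : ℝ) ≤ |s.im| + 3 := by
    have := Nat.ceil_lt_add_one (show 0 ≤ |s.im| + 2 by linarith)
    rw [← hJ] at this; linarith
  have hM0 : 0 < J * q := Nat.mul_pos hJ0 hq
  have hM1 : (1 : ℝ) ≤ (J * q : ℕ) := by exact_mod_cast hM0
  have hMV : ((J * q : ℕ) : ℝ) ≤ VV q s.im := by
    unfold VV; push_cast; rw [mul_comm]; gcongr
  have h1 := head_bound f B hf (J * q) hM0 s δ hδ.le hs
  have h2 := (tail_bound J hJ0 (fun j => hper f q J j s) s _ (by linarith) (fun j => hper_bound f B hf q J hq hJ0 j s (by linarith))).2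
  have h3 : B * (‖s‖ * (q : ℝ) ^ (1 - s.re)) * (4 * (J : ℝ) ^ (-s.re)) ≤ B * (8 * ((J * q : ℕ) : ℝ) ^ δ) := by
    have e : B * (‖s‖ * (q : ℝ) ^ (1 - s.re)) * (4 * (J : ℝ) ^ (-s.re)) = B * (4 * (‖s‖ / J) * ((J * q : ℕ) : ℝ) ^ (1 - s.re)) := by
      push_cast
      rw [Real.mul_rpow hJ0'.le hq'.le, show (1 - s.re) = 1 + -s.re by ring, Real.rpow_add hJ0', Real.rpow_one]
      field_simp
    rw [e]
    have h4 : ‖s‖ / J ≤ 2 := by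
      rw [div_le_iff₀ hJ0']
      have := norm_le_of (s := s) (by linarith) hs3
      linarith
    have h5 : ((J * q : ℕ) : ℝ) ^ (1 - s.re) ≤ ((J * q : ℕ) : ℝ) ^ δ :=
      Real.rpow_le_rpow_of_exponent_le hM1 (by linarith)
    have : 4 * (‖s‖ / J) * ((J * q : ℕ) : ℝ) ^ (1 - s.re) ≤ 4 * 2 * ((J * q : ℕ) : ℝ) ^ δ := by gcongr
    gcongr
    linarith
  have h6 := log_absorb hM1 hδ
  have h7 : ((J * q : ℕ) : ℝ) ^ (2 * δ) ≤ VV q s.im ^ (2 * δ) := by gcongr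
  unfold Gper
  refine (norm_add_le _ _).trans ((add_le_add h1 (h2.trans h3)).trans ?_)
  rw [← mul_add]
  gcongr
  calc _ = ((J * q : ℕ) : ℝ) ^ δ * (9 + Real.log (J * q : ℕ)) := by ring
    _ ≤ _ := h6
    _ ≤ _ := by gcongr

lemma isPreconnected_halfplane : IsPreconnected {s : ℂ | 0 < s.re} :=
  (convex_halfSpace_re_gt 0).isPreconnected

lemma isOpen_halfplane : IsOpen {s : ℂ | 0 < s.re} := isOpen_lt continuous_const Complex.continuous_re

lemma eqOn_half {f g : ℂ → ℂ} (hf : DifferentiableOn ℂ f {s | 0 < s.re}) (hg : DifferentiableOn ℂ g {s | 0 < s.re})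
    (h : ∀ s : ℂ, 1 < s.re → f s = g s) : ∀ s : ℂ, 0 < s.re → f s = g s := by
  have := (hf.analyticOnNhd isOpen_halfplane).eqOn_of_preconnected_of_eventuallyEq (hg.analyticOnNhd isOpen_halfplane)
    isPreconnected_halfplane (z₀ := 2) (by simp) ?_
  · intro s hs; exact this hs
  · have : {s : ℂ | 1 < s.re} ∈ nhds (2 : ℂ) := (isOpen_lt continuous_const Complex.continuous_re).mem_nhds (by simp)
    filter_upwards [this] with s hs using h s hs

lemma chi_sum_zero {q : ℕ} [NeZero q] {χ : DirichletCharacter ℂ q} (hχ : χ ≠ 1) : ∑ r ∈ range q, χ (r : ℕ) = 0 := by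
  have h := MulChar.sum_eq_zero_of_ne_one hχ
  rw [← h]
  apply Finset.sum_bij (fun (r : ℕ) _ => (r : ZMod q))
  · intro _ _; exact mem_univ _
  · intro a ha b hb hab
    rw [mem_range] at ha hb
    have := congrArg ZMod.val hab
    rwa [ZMod.val_cast_of_lt ha, ZMod.val_cast_of_lt hb] at this
  · intro b _
    exact ⟨b.val, mem_range.mpr (ZMod.val_lt b), ZMod.natCast_zmod_val b⟩
  · intro _ _; rfl

lemma LFunction_eq_Gper {q : ℕ} [NeZero q] {χ : DirichletCharacter ℂ q} (hχ : χ ≠ 1) (J : ℕ) (hJ : 0 < J) (s : ℂ)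
    (hs : 0 < s.re) : χ.LFunction s = Gper (fun n => χ n) q J s := by
  have hq : 0 < q := Nat.pos_of_ne_zero (NeZero.ne q)
  refine eqOn_half (DirichletCharacter.differentiable_LFunction hχ).differentiableOn
    (Gper_diff _ 1 (fun n => χ.norm_le_one n) q J hq hJ) ?_ s hs
  intro s hs
  rw [χ.LFunction_eq_LSeries hs]
  exact LSeries_eq_Gper (B := 1) (fun n => χ.norm_le_one n) hq (fun n => by simp) (chi_sum_zero hχ) J hJ hs

theorem LFunction_bound {q : ℕ} [NeZero q] {χ : DirichletCharacter ℂ q} (hχ : χ ≠ 1) (δ : ℝ) (hδ : 0 < δ) (hδ2 : δ ≤ 1 / 2)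
    (s : ℂ) (hs : 1 - δ ≤ s.re) (hs3 : s.re ≤ 3) :
    ‖χ.LFunction s‖ ≤ (9 + 1 / δ) * VV q s.im ^ (2 * δ) := by
  have hq : 0 < q := Nat.pos_of_ne_zero (NeZero.ne q)
  rw [LFunction_eq_Gper hχ ⌈|s.im| + 2⌉₊ (Nat.ceil_pos.mpr (by have := abs_nonneg s.im; linarith)) s (by linarith)]
  have := Gper_bound (fun n => χ n) 1 (fun n => χ.norm_le_one n) q hq δ hδ hδ2 s hs hs3
  rwa [one_mul] at this
end WCL

end

section

open Finset
namespace WCL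

/-- `(s-1)ζ(s)`, entire. -/
noncomputable def ZZ : ℂ → ℂ := DirichletCharacter.LFunctionTrivChar₁ 1

lemma ZZ_diff : Differentiable ℂ ZZ := DirichletCharacter.differentiable_LFunctionTrivChar₁ 1

lemma ZZ_one : ZZ 1 = 1 := by simp [ZZ]

lemma ZZ_eq {s : ℂ} (hs : s ≠ 1) : ZZ s = (s - 1) * riemannZeta s := by
  unfold ZZ DirichletCharacter.LFunctionTrivChar₁
  rw [Function.update_of_ne hs, DirichletCharacter.LFunctionTrivChar, DirichletCharacter.LFunction_modOne_eq]

noncomputable def gz (n : ℕ) (s : ℂ) : ℂ :=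
  (s - 1) * (n : ℂ) ^ (-s) + ((n + 1 : ℕ) : ℂ) ^ (1 - s) - (n : ℂ) ^ (1 - s)

lemma gz_bound (n : ℕ) (hn : 0 < n) (s : ℂ) (hs : 0 < s.re) :
    ‖gz n s‖ ≤ (‖s - 1‖ * ‖s‖) * (n : ℝ) ^ (-s.re - 1) := by
  have hn' : (0 : ℝ) < n := by exact_mod_cast hn
  have h := (convex_Icc (n : ℝ) (n + 1)).norm_image_sub_le_of_norm_hasDerivWithin_le
    (f := fun u : ℝ => (u : ℂ) ^ (1 - s) + (s - 1) * (n : ℂ) ^ (-s) * (u : ℂ))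
    (f' := fun u => (1 - s) * (u : ℂ) ^ (1 - s - 1) + (s - 1) * (n : ℂ) ^ (-s) * 1)
    (C := (‖s - 1‖ * ‖s‖) * (n : ℝ) ^ (-s.re - 1))
    (fun u hu => ((cpow_hasDeriv (1 - s) (hn'.trans_le hu.1)).add
      ((Complex.ofRealCLM.hasDerivAt (x := u)).const_mul _)).hasDerivWithinAt) ?_
    (Set.left_mem_Icc.mpr (by linarith)) (Set.right_mem_Icc.mpr (by linarith))
  · rw [Real.norm_of_nonneg (by linarith)] at h
    have e : gz n s = (((n : ℝ) + 1 : ℝ) : ℂ) ^ (1 - s) + (s - 1) * (n : ℂ) ^ (-s) * (((n : ℝ) + 1 : ℝ) : ℂ) -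
        ((((n : ℝ) : ℂ)) ^ (1 - s) + (s - 1) * (n : ℂ) ^ (-s) * ((n : ℝ) : ℂ)) := by
      unfold gz; push_cast; ring
    rw [e]
    simpa using h
  · intro u hu
    have e : (1 - s) * (u : ℂ) ^ (1 - s - 1) + (s - 1) * (n : ℂ) ^ (-s) * 1 =
        -((s - 1) * ((u : ℂ) ^ (-s) - ((n : ℝ) : ℂ) ^ (-s))) := by
      rw [show 1 - s - 1 = -s by ring]; push_cast; ring
    rw [e, norm_neg, norm_mul, mul_assoc]
    have h2 := cpow_diff hn' hu.1 hs
    have h3 : u - n ≤ 1 := by linarith [hu.2]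
    have h4 : 0 ≤ u - n := by linarith [hu.1]
    gcongr
    refine h2.trans ?_
    calc _ ≤ ‖s‖ * (n : ℝ) ^ (-s.re - 1) * 1 := by gcongr
      _ = _ := mul_one _

noncomputable def Hz (N : ℕ) (s : ℂ) : ℂ :=
  (s - 1) * ∑ n ∈ Ico 1 N, 1 * (n : ℂ) ^ (-s) + (N : ℂ) ^ (1 - s) + ∑' j, gz (N + j) s

lemma cpow_diff' (n : ℕ) (hn : 0 < n) (a : ℂ) : Differentiable ℂ (fun s : ℂ => (n : ℂ) ^ (a - s)) := by
  intro s
  exact ((differentiableAt_const a).sub differentiableAt_id).const_cpow (Or.inl (by exact_mod_cast hn.ne'))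

lemma cpow_diff0 (n : ℕ) (hn : 0 < n) : Differentiable ℂ (fun s : ℂ => (n : ℂ) ^ (-s)) := by
  intro s
  exact (differentiableAt_id.neg).const_cpow (Or.inl (by exact_mod_cast hn.ne'))

lemma Hz_diff (N : ℕ) (hN : 0 < N) : DifferentiableOn ℂ (Hz N) {s | 0 < s.re} := by
  unfold Hz
  apply DifferentiableOn.add
  · apply Differentiable.differentiableOn
    apply Differentiable.add
    · apply Differentiable.mul (by fun_prop)
      apply Differentiable.fun_sum
      intro n hn
      rw [mem_Ico] at hn
      exact (cpow_diff0 n (by omega)).const_mul _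
    · exact cpow_diff' N hN 1
  · refine tail_diff N hN (fun j s => gz (N + j) s) ?_ (fun s => ‖s - 1‖ * ‖s‖) (by fun_prop) ?_
    · intro j
      unfold gz
      refine ((Differentiable.mul (by fun_prop) (cpow_diff0 (N + j) (by omega))).add (cpow_diff' _ (by omega) 1)).sub
        (cpow_diff' _ (by omega) 1)
    · intro j s hs
      exact gz_bound (N + j) (by omega) s hs

lemma gz_sum (N : ℕ) (s : ℂ) (K : ℕ) : ∑ j ∈ range K, gz (N + j) s =
    (s - 1) * ∑ n ∈ Ico N (N + K), 1 * (n : ℂ) ^ (-s) + ((N + K : ℕ) : ℂ) ^ (1 - s) - (N : ℂ) ^ (1 - s) := by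
  induction K with
  | zero => simp
  | succ K ih =>
    rw [sum_range_succ, ih, ← add_assoc N K 1, Finset.sum_Ico_succ_top (by omega)]
    unfold gz; ring

lemma ZZ_eq_Hz_aux (N : ℕ) (hN : 0 < N) {s : ℂ} (hs : 1 < s.re) : ZZ s = Hz N s := by
  have hs1 : s ≠ 1 := by rintro rfl; simp at hs
  rw [ZZ_eq hs1]
  have hsum : LSeriesSummable (fun _ => (1 : ℂ)) s := LSeriesSummable_of_bounded_of_one_lt_re (m := 1) (fun n _ => by simp) hs
  have hz : riemannZeta s = LSeries (fun _ => (1 : ℂ)) s := (LSeries_one_eq_riemannZeta hs).symm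
  have h1 : Filter.Tendsto (fun K => (s - 1) * ∑ n ∈ range (N + K), LSeries.term (fun _ => (1 : ℂ)) s n +
      ((N + K : ℕ) : ℂ) ^ (1 - s)) Filter.atTop (nhds ((s - 1) * riemannZeta s + 0)) := by
    rw [hz]
    have hNK : Filter.Tendsto (fun K => N + K) Filter.atTop Filter.atTop :=
      Filter.tendsto_atTop_mono (fun K => by simp) Filter.tendsto_id
    refine Filter.Tendsto.add (((hsum.hasSum.tendsto_sum_nat).comp hNK).const_mul (s - 1)) ?_
    rw [tendsto_zero_iff_norm_tendsto_zero]
    have h2 : Filter.Tendsto (fun K : ℕ => (K : ℝ) ^ (-(s.re - 1))) Filter.atTop (nhds 0) :=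
      (tendsto_rpow_neg_atTop (by linarith)).comp tendsto_natCast_atTop_atTop
    refine (h2.comp hNK).congr fun K => ?_
    simp only [Function.comp]
    rw [Complex.norm_natCast_cpow_of_pos (by omega)]
    congr 1; simp
  have hs2 := (tail_bound N hN (fun j => gz (N + j) s) s _ (by linarith) (fun j => gz_bound (N + j) (by omega) s (by linarith))).1
  have h2 := (hs2.hasSum.tendsto_sum_nat).const_add ((s - 1) * ∑ n ∈ Ico 1 N, 1 * (n : ℂ) ^ (-s) + (N : ℂ) ^ (1 - s))
  rw [add_zero] at h1
  refine tendsto_nhds_unique h1 (h2.congr fun K => ?_)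
  rw [gz_sum, Finset.range_eq_Ico, Finset.sum_eq_sum_Ico_succ_bot (show 0 < N + K by omega) (fun n => LSeries.term (fun _ => (1 : ℂ)) s n)]
  simp only [LSeries.term_zero, zero_add]
  have ht : ∑ n ∈ Ico 1 (N + K), LSeries.term (fun _ => (1 : ℂ)) s n = ∑ n ∈ Ico 1 (N + K), 1 * (n : ℂ) ^ (-s) := by
    refine sum_congr rfl fun n hn => ?_
    rw [mem_Ico] at hn
    rw [LSeries.term_of_ne_zero (by omega), Complex.cpow_neg, div_eq_mul_inv]
  rw [ht, ← Finset.sum_Ico_consecutive _ (show 1 ≤ N from hN) (show N ≤ N + K by omega)]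
  ring

lemma ZZ_eq_Hz (N : ℕ) (hN : 0 < N) {s : ℂ} (hs : 0 < s.re) : ZZ s = Hz N s :=
  eqOn_half ZZ_diff.differentiableOn (Hz_diff N hN) (fun _ hs => ZZ_eq_Hz_aux N hN hs) s hs

theorem ZZ_bound (δ : ℝ) (hδ : 0 < δ) (hδ2 : δ ≤ 1 / 2)
    (s : ℂ) (hs : 1 - δ ≤ s.re) (hs3 : s.re ≤ 3) :
    ‖ZZ s‖ ≤ VV 1 s.im ^ (2 * δ) * ((9 + 1 / δ) * ‖s - 1‖ + 1) := by
  have ht := abs_nonneg s.im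
  set J := ⌈|s.im| + 2⌉₊ with hJ
  have hJ0 : 0 < J := Nat.ceil_pos.mpr (by linarith)
  have hJ0' : (0 : ℝ) < J := by exact_mod_cast hJ0
  have hJ1' : (1 : ℝ) ≤ J := by exact_mod_cast hJ0
  have hJ1 : |s.im| + 2 ≤ J := Nat.le_ceil _
  have hJ2 : (J : ℝ) ≤ VV 1 s.im := by
    have := Nat.ceil_lt_add_one (show 0 ≤ |s.im| + 2 by linarith)
    unfold VV
    rw [← hJ] at this; push_cast; linarith
  rw [ZZ_eq_Hz J hJ0 (by linarith)]
  have h1 := head_bound (fun _ => 1) 1 (by simp) J hJ0 s δ hδ.le hs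
  have h2 := (tail_bound J hJ0 (fun j => gz (J + j) s) s _ (by linarith) (fun j => gz_bound (J + j) (by omega) s (by linarith))).2
  have h3 : ‖s - 1‖ * ‖s‖ * (4 * (J : ℝ) ^ (-s.re)) ≤ ‖s - 1‖ * (8 * (J : ℝ) ^ δ) := by
    have e : ‖s - 1‖ * ‖s‖ * (4 * (J : ℝ) ^ (-s.re)) = ‖s - 1‖ * (4 * (‖s‖ / J) * (J : ℝ) ^ (1 - s.re)) := by
      rw [show (1 - s.re) = 1 + -s.re by ring, Real.rpow_add hJ0', Real.rpow_one]
      field_simp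
    rw [e]
    have h4 : ‖s‖ / J ≤ 2 := by
      rw [div_le_iff₀ hJ0']
      have := norm_le_of (s := s) (by linarith) hs3
      linarith
    have h5 : (J : ℝ) ^ (1 - s.re) ≤ (J : ℝ) ^ δ :=
      Real.rpow_le_rpow_of_exponent_le hJ1' (by linarith)
    have : 4 * (‖s‖ / J) * (J : ℝ) ^ (1 - s.re) ≤ 4 * 2 * (J : ℝ) ^ δ := by gcongr
    gcongr
    linarith
  have h5 : ‖(J : ℂ) ^ (1 - s)‖ ≤ (J : ℝ) ^ (2 * δ) := by
    rw [Complex.norm_natCast_cpow_of_pos hJ0]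
    apply Real.rpow_le_rpow_of_exponent_le hJ1'
    simp; linarith
  have h6 := log_absorb hJ1' hδ
  have h7 : (J : ℝ) ^ (2 * δ) ≤ VV 1 s.im ^ (2 * δ) := by gcongr
  have hk : 0 ≤ 9 + 1 / δ := by positivity
  unfold Hz
  calc _ ≤ ‖s - 1‖ * (1 * ((J : ℝ) ^ δ * (1 + Real.log J))) + (J : ℝ) ^ (2 * δ) + ‖s - 1‖ * (8 * (J : ℝ) ^ δ) := by
        refine (norm_add_le _ _).trans (add_le_add ((norm_add_le _ _).trans (add_le_add ?_ h5)) (h2.trans h3))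
        rw [norm_mul]
        gcongr
    _ = ‖s - 1‖ * ((J : ℝ) ^ δ * (9 + Real.log J)) + (J : ℝ) ^ (2 * δ) := by ring
    _ ≤ ‖s - 1‖ * ((9 + 1 / δ) * VV 1 s.im ^ (2 * δ)) + VV 1 s.im ^ (2 * δ) := by
        have := h6.trans (mul_le_mul_of_nonneg_left h7 hk)
        exact add_le_add (mul_le_mul_of_nonneg_left this (norm_nonneg _)) h7
    _ = _ := by ring

lemma prod_ratio_le (S : Finset ℕ) (hS : ∀ p ∈ S, 2 ≤ p) : ∏ p ∈ S, ((p : ℝ) / (p - 1)) ≤ S.card + 1 := by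
  induction S using Finset.induction_on_max with
  | empty => simp
  | insert a s hmax ih =>
    have ha : a ∉ s := fun h => lt_irrefl _ (hmax a h)
    rw [prod_insert ha, card_insert_of_notMem ha]
    have ih' := ih (fun p hp => hS p (mem_insert_of_mem hp))
    have hc : s.card + 2 ≤ a := by
      have : s ⊆ Ico 2 a := by
        intro p hp
        rw [mem_Ico]; exact ⟨hS p (mem_insert_of_mem hp), hmax p hp⟩
      have h2 := card_le_card this
      have ha2 : 2 ≤ a := hS a (mem_insert_self _ _)
      rw [Nat.card_Ico] at h2
      omega
    have hc' : (s.card : ℝ) + 2 ≤ a := by exact_mod_cast hc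
    have hs0 : (0 : ℝ) ≤ s.card := by positivity
    have h3 : (a : ℝ) / (a - 1) ≤ (s.card + 2) / (s.card + 1) := by
      rw [div_le_div_iff₀ (by linarith) (by linarith)]; nlinarith
    calc (a : ℝ) / (a - 1) * ∏ p ∈ s, ((p : ℝ) / (p - 1)) ≤ (s.card + 2) / (s.card + 1) * (s.card + 1) := by
          gcongr
          apply prod_nonneg
          intro p hp
          have : (2 : ℝ) ≤ p := by exact_mod_cast hS p (mem_insert_of_mem hp)
          exact div_nonneg (by linarith) (by linarith)
      _ = _ := by field_simp; push_cast; ring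

lemma card_pf_le (q : ℕ) (hq : 0 < q) : (q.primeFactors.card : ℝ) ≤ 2 * Real.log q := by
  have h1 : 2 ^ q.primeFactors.card ≤ q := by
    calc 2 ^ q.primeFactors.card ≤ ∏ p ∈ q.primeFactors, p := by
          rw [← prod_const]
          exact prod_le_prod (fun _ _ => by norm_num) (fun p hp => (Nat.prime_of_mem_primeFactors hp).two_le)
      _ ≤ q := Nat.le_of_dvd hq (Nat.prod_primeFactors_dvd q)
  have h2 : ((2 : ℝ) ^ q.primeFactors.card) ≤ q := by exact_mod_cast h1
  have h3 := Real.log_le_log (by positivity) h2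
  rw [Real.log_pow] at h3
  have := Real.log_two_gt_d9
  nlinarith [Nat.cast_nonneg (α := ℝ) q.primeFactors.card]

/-- `∏_{p∣q} p/(p-1) ≤ 1 + 2 log q` -/
lemma prod_pf_le (q : ℕ) (hq : 0 < q) : ∏ p ∈ q.primeFactors, ((p : ℝ) / (p - 1)) ≤ 1 + 2 * Real.log q := by
  have := prod_ratio_le q.primeFactors (fun p hp => (Nat.prime_of_mem_primeFactors hp).two_le)
  have := card_pf_le q hq
  linarith

lemma zeta_le {x : ℝ} (hx : 0 < x) (hx2 : x ≤ 1) : ‖riemannZeta (1 + x)‖ ≤ 9 / x := by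
  have hne : (1 + x : ℂ) ≠ 1 := by
    intro h; have := congrArg Complex.re h; simp at this; linarith
  have h := ZZ_eq_Hz 1 one_pos (s := 1 + x) (by simp; linarith)
  have h2 := (tail_bound 1 one_pos (fun j => gz (1 + j) (1 + x)) (1 + x) _ (by simp; linarith)
    (fun j => gz_bound (1 + j) (by omega) (1 + x) (by simp; linarith))).2
  have e1 : ‖(1 + x : ℂ) - 1‖ = x := by rw [add_sub_cancel_left, Complex.norm_real, Real.norm_of_nonneg hx.le]
  have e2 : ‖(1 + x : ℂ)‖ = 1 + x := by
    rw [show (1 + x : ℂ) = ((1 + x : ℝ) : ℂ) by push_cast; ring, Complex.norm_real, Real.norm_of_nonneg (by linarith)]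
  rw [e1, e2] at h2
  have h3 : ‖ZZ (1 + x)‖ ≤ 9 := by
    rw [h]; unfold Hz
    refine (norm_add_le _ _).trans ?_
    simp only [Ico_self, sum_empty, mul_zero, zero_add, Nat.cast_one, Complex.one_cpow, norm_one] at h2 ⊢
    simp only [Real.one_rpow] at h2
    nlinarith
  rw [ZZ_eq hne, norm_mul, e1] at h3
  rw [le_div_iff₀ hx]; linarith

lemma norm_one_sub_le {p : ℕ} (hp : 2 ≤ p) {s : ℂ} (hs : 1 ≤ s.re) : ‖1 - (p : ℂ) ^ (-s)‖ ≤ (p : ℝ) / (p - 1) := by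
  have hp' : (2 : ℝ) ≤ p := by exact_mod_cast hp
  have h1 : ‖(p : ℂ) ^ (-s)‖ ≤ 1 / p := by
    rw [Complex.norm_natCast_cpow_of_pos (by omega), one_div, ← Real.rpow_neg_one]
    apply Real.rpow_le_rpow_of_exponent_le (by linarith); simp; linarith
  calc ‖1 - (p : ℂ) ^ (-s)‖ ≤ 1 + 1 / p := by
        refine (norm_sub_le _ _).trans ?_
        rw [norm_one]; linarith
    _ ≤ _ := by
        rw [le_div_iff₀ (by linarith)]; field_simp; nlinarith

lemma trivChar_bound (q : ℕ) [NeZero q] (s : ℂ) (hs : 1 ≤ s.re) (hs1 : s ≠ 1) :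
    ‖DirichletCharacter.LFunctionTrivChar q s‖ ≤ (1 + 2 * Real.log q) * ‖riemannZeta s‖ := by
  have hq : 0 < q := Nat.pos_of_ne_zero (NeZero.ne q)
  rw [DirichletCharacter.LFunctionTrivChar_eq_mul_riemannZeta hs1, norm_mul, norm_prod]
  gcongr
  refine le_trans ?_ (prod_pf_le q hq)
  exact prod_le_prod (fun _ _ => norm_nonneg _)
    (fun p hp => norm_one_sub_le (Nat.prime_of_mem_primeFactors hp).two_le hs)

lemma trivChar_le (q : ℕ) [NeZero q] {x : ℝ} (hx : 0 < x) (hx2 : x ≤ 1) :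
    ‖DirichletCharacter.LFunctionTrivChar q (1 + x)‖ ≤ 9 / x := by
  have hne : (1 + x : ℂ) ≠ 1 := by
    intro h; have := congrArg Complex.re h; simp at this; linarith
  rw [DirichletCharacter.LFunctionTrivChar_eq_mul_riemannZeta hne, norm_mul, norm_prod]
  have h1 : ∏ p ∈ q.primeFactors, ‖1 - (p : ℂ) ^ (-(1 + x : ℂ))‖ ≤ 1 := by
    apply prod_le_one (fun _ _ => norm_nonneg _)
    intro p hp
    have hp2 : (2 : ℝ) ≤ p := by exact_mod_cast (Nat.prime_of_mem_primeFactors hp).two_le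
    have e : 1 - (p : ℂ) ^ (-(1 + x : ℂ)) = ((1 - (p : ℝ) ^ (-(1 + x)) : ℝ) : ℂ) := by
      push_cast
      rw [Complex.ofReal_cpow (by positivity)]; push_cast; ring
    rw [e, Complex.norm_real, Real.norm_eq_abs, abs_le]
    have h0 : 0 < (p : ℝ) ^ (-(1 + x)) := by positivity
    have h1 : (p : ℝ) ^ (-(1 + x)) ≤ 1 := Real.rpow_le_one_of_one_le_of_nonpos (by linarith) (by linarith)
    constructor <;> linarith
  calc _ ≤ 1 * (9 / x) := by gcongr; exact zeta_le hx hx2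
    _ = _ := one_mul _
end WCL

end

section

open Finset
namespace WCL

/-- abstract 3-4-1 lemma -/
lemma abs341 (f : ℝ → ℂ) (A : ℝ) (hA : 1 ≤ A)
    (hL : ∀ x y : ℝ, 0 < x → x ≤ y → y ≤ 1 → ‖f y - f x‖ ≤ A * (y - x))
    (h : ∀ x : ℝ, 0 < x → x ≤ 1 → 1 ≤ (9 / x) ^ 3 * ‖f x‖ ^ 4 * A) :
    ∀ x : ℝ, 0 < x → x ≤ 1 → (1 / 20736) / A ^ 4 ≤ ‖f x‖ := by
  have hA0 : 0 < A := by linarith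
  have key : ∀ x : ℝ, (1 / 20736) / A ^ 5 ≤ x → x ≤ 1 → (1 / 10368) / A ^ 4 ≤ ‖f x‖ := by
    intro x hx hx1
    have hx0 : 0 < x := lt_of_lt_of_le (by positivity) hx
    have h1 := h x hx0 hx1
    by_contra hc
    push Not at hc
    have h2 : ‖f x‖ ^ 4 < ((1 / 10368) / A ^ 4) ^ 4 := by gcongr
    have h3 : (9 / x) ^ 3 ≤ (9 / ((1 / 20736) / A ^ 5)) ^ 3 := by gcongr
    have h4 : (9 / x) ^ 3 * ‖f x‖ ^ 4 * A < (9 / ((1 / 20736) / A ^ 5)) ^ 3 * ((1 / 10368) / A ^ 4) ^ 4 * A := by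
      have : 0 < (9 / x) ^ 3 := by positivity
      exact mul_lt_mul_of_pos_right (mul_lt_mul' h3 h2 (by positivity) (by positivity)) hA0
    have h5 : (9 / ((1 / 20736) / A ^ 5)) ^ 3 * ((1 / 10368) / A ^ 4) ^ 4 * A = (9 * 20736) ^ 3 / 10368 ^ 4 := by
      field_simp
    rw [h5] at h4
    norm_num at h4
    linarith
  intro x hx hx1
  set x0 := (1 / 20736) / A ^ 5 with hx0
  have hx01 : x0 ≤ 1 := by
    rw [hx0, div_le_one (by positivity)]
    have : 1 ≤ A ^ 5 := one_le_pow₀ hA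
    linarith
  have e : (1 / 10368) / A ^ 4 = (1 / 20736) / A ^ 4 + A * x0 := by
    rw [hx0]; field_simp; norm_num
  rcases le_total x0 x with h1 | h1
  · have := key x h1 hx1
    have : 0 ≤ A * x0 := by positivity
    linarith
  · have h2 := key x0 le_rfl hx01
    have h3 := hL x x0 hx h1 hx01
    have h4 := norm_sub_norm_le (f x0) (f x)
    have : A * (x0 - x) ≤ A * x0 := by nlinarith
    linarith

lemma VV_le_two {q : ℕ} {t t' : ℝ} (h : |t' - t| ≤ 1) : VV q t' ≤ 2 * VV q t := by
  unfold VV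
  have : |t'| ≤ |t| + 1 := by
    have := abs_sub_abs_le_abs_sub t' t; linarith
  have hq : (0 : ℝ) ≤ q := by positivity
  nlinarith [abs_nonneg t]

lemma VV_two_mul {q : ℕ} (t : ℝ) : VV q (2 * t) ≤ 2 * VV q t := by
  unfold VV
  rw [abs_mul, abs_of_pos (by norm_num : (0 : ℝ) < 2)]
  have hq : (0 : ℝ) ≤ q := by positivity
  nlinarith [abs_nonneg t]

lemma two_rpow_le {V V' ε : ℝ} (hV : 0 < V) (hV' : 0 ≤ V') (h : V' ≤ 2 * V) (hε : 0 < ε) (hε1 : ε ≤ 1) : V' ^ ε ≤ 2 * V ^ ε := by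
  calc V' ^ ε ≤ (2 * V) ^ ε := by gcongr
    _ = 2 ^ ε * V ^ ε := Real.mul_rpow (by norm_num) hV.le
    _ ≤ 2 * V ^ ε := by
      gcongr
      calc (2 : ℝ) ^ ε ≤ 2 ^ (1 : ℝ) := Real.rpow_le_rpow_of_exponent_le (by norm_num) hε1
        _ = 2 := Real.rpow_one _

/-- upper bound in a fixed neighbourhood of `1 ≤ σ ≤ 2`. -/
lemma UB1 (ε : ℝ) (hε : 0 < ε) (hε1 : ε ≤ 1) : ∃ C : ℝ, 1 ≤ C ∧ ∀ (q : ℕ) [NeZero q] (χ : DirichletCharacter ℂ q), χ ≠ 1 →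
    ∀ s : ℂ, 1 ≤ s.re → s.re ≤ 2 → ∀ z : ℂ, ‖z - s‖ ≤ ε / 2 → ‖χ.LFunction z‖ ≤ C * VV q s.im ^ ε := by
  refine ⟨2 * (9 + 1 / (ε / 2)), ?_, ?_⟩
  · have : 0 ≤ 1 / (ε / 2) := by positivity
    linarith
  intro q _ χ hχ s hs1 hs2 z hz
  have hq : 0 < q := Nat.pos_of_ne_zero (NeZero.ne q)
  have hre := (Complex.abs_re_le_norm (z - s)).trans hz
  have him := (Complex.abs_im_le_norm (z - s)).trans hz
  rw [Complex.sub_re, abs_le] at hre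
  rw [Complex.sub_im] at him
  have h := LFunction_bound hχ (ε / 2) (by positivity) (by linarith) z (by linarith) (by linarith)
  rw [show 2 * (ε / 2) = ε by ring] at h
  have hV := VV_ge hq s.im
  have hV' := VV_ge hq z.im
  have h2 := two_rpow_le (V := VV q s.im) (V' := VV q z.im) (by linarith) (by linarith) (VV_le_two (by linarith)) hε hε1
  have : 0 ≤ 9 + 1 / (ε / 2) := by positivity
  nlinarith

lemma UB1' (ε : ℝ) (hε : 0 < ε) (hε1 : ε ≤ 1) : ∃ C : ℝ, 1 ≤ C ∧ ∀ (q : ℕ) [NeZero q] (χ : DirichletCharacter ℂ q), χ ≠ 1 →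
    ∀ s : ℂ, 1 ≤ s.re → s.re ≤ 2 → ‖χ.LFunction s‖ ≤ C * VV q s.im ^ ε ∧ ‖deriv χ.LFunction s‖ ≤ C * VV q s.im ^ ε := by
  obtain ⟨C, hC, h⟩ := UB1 ε hε hε1
  refine ⟨C / (ε / 2), ?_, ?_⟩
  · rw [le_div_iff₀ (by positivity)]; linarith
  intro q _ χ hχ s hs1 hs2
  have hq : 0 < q := Nat.pos_of_ne_zero (NeZero.ne q)
  have hV := VV_ge hq s.im
  have h1 := h q χ hχ s hs1 hs2
  constructor
  · refine (h1 s (by simp; positivity)).trans ?_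
    gcongr
    rw [le_div_iff₀ (by positivity)]; nlinarith
  · have := Complex.norm_deriv_le_of_forall_mem_sphere_norm_le (c := s) (R := ε / 2) (C := C * VV q s.im ^ ε) (f := χ.LFunction)
      (by positivity) (DirichletCharacter.differentiable_LFunction hχ).diffContOnCl
      (fun z hz => h1 z (by rw [mem_sphere_iff_norm] at hz; exact hz.le))
    refine this.trans (le_of_eq (by ring))

lemma norm_sub_one_ge (s : ℂ) : |s.im| ≤ ‖s - 1‖ ∧ |s.re - 1| ≤ ‖s - 1‖ := by
  constructor
  · simpa using Complex.abs_im_le_norm (s - 1)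
  · simpa using Complex.abs_re_le_norm (s - 1)

lemma ne_one_of_re {s : ℂ} (h : 1 < s.re) : s ≠ 1 := by rintro rfl; simp at h

lemma zeta_UB (ε : ℝ) (hε : 0 < ε) (hε1 : ε ≤ 1) : ∃ C : ℝ, 1 ≤ C ∧
    ∀ s : ℂ, 1 - ε / 2 ≤ s.re → s.re ≤ 3 → s ≠ 1 → ‖riemannZeta s‖ ≤ C * VV 1 s.im ^ ε * (1 + 1 / ‖s - 1‖) := by
  refine ⟨9 + 1 / (ε / 2), ?_, ?_⟩
  · have : 0 ≤ 1 / (ε / 2) := by positivity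
    linarith
  intro s hs1 hs3 hs
  have h := ZZ_bound (ε / 2) (by positivity) (by linarith) s (by linarith) hs3
  rw [ZZ_eq hs, norm_mul, show 2 * (ε / 2) = ε by ring] at h
  have hn : 0 < ‖s - 1‖ := by rw [norm_pos_iff]; exact sub_ne_zero.mpr hs
  have h9 : 1 ≤ 9 + 1 / (ε / 2) := by
    have : 0 ≤ 1 / (ε / 2) := by positivity
    linarith
  have hV := VV_ge one_pos s.im
  have hVp : 0 < VV 1 s.im ^ ε := Real.rpow_pos_of_pos (by linarith) _
  have e : (9 + 1 / (ε / 2)) * VV 1 s.im ^ ε * (1 + 1 / ‖s - 1‖) = (VV 1 s.im ^ ε * ((9 + 1 / (ε / 2)) * ‖s - 1‖ + (9 + 1 / (ε / 2)))) / ‖s - 1‖ := by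
    field_simp
  rw [e, le_div_iff₀ hn, mul_comm]
  refine h.trans ?_
  gcongr

lemma triv_UB (ε : ℝ) (hε : 0 < ε) (hε1 : ε ≤ 1) : ∃ C : ℝ, 1 ≤ C ∧ ∀ (q : ℕ) [NeZero q],
    ∀ s : ℂ, 1 < s.re → s.re ≤ 2 → ‖DirichletCharacter.LFunctionTrivChar q s‖ ≤ C * VV q s.im ^ ε * (1 + 1 / ‖s - 1‖) := by
  obtain ⟨C, hC, h⟩ := zeta_UB (ε / 2) (by linarith) (by linarith)
  refine ⟨(1 + 2 / (ε / 2)) * C, ?_, ?_⟩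
  · have : 0 ≤ 2 / (ε / 2) := by positivity
    nlinarith
  intro q _ s hs1 hs2
  have hq : 0 < q := Nat.pos_of_ne_zero (NeZero.ne q)
  have hq' : (1 : ℝ) ≤ q := by exact_mod_cast hq
  have h1 := trivChar_bound q s hs1.le (ne_one_of_re hs1)
  have h2 := h s (by linarith) (by linarith) (ne_one_of_re hs1)
  have h3 : Real.log q ≤ (q : ℝ) ^ (ε / 2) / (ε / 2) := Real.log_le_rpow_div (by linarith) (by positivity)
  have h4 : (q : ℝ) ^ (ε / 2) ≤ VV q s.im ^ (ε / 2) := by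
    gcongr; unfold VV; nlinarith [abs_nonneg s.im]
  have h5 : VV 1 s.im ^ (ε / 2) ≤ VV q s.im ^ (ε / 2) := by
    have : 0 ≤ VV 1 s.im := by linarith [VV_ge one_pos s.im]
    gcongr; unfold VV; push_cast; nlinarith [abs_nonneg s.im]
  have hV := VV_ge hq s.im
  have h6 : 1 ≤ VV q s.im ^ (ε / 2) := Real.one_le_rpow (by linarith) (by positivity)
  have h7 : 1 + 2 * Real.log q ≤ (1 + 2 / (ε / 2)) * VV q s.im ^ (ε / 2) := by
    have : (q : ℝ) ^ (ε / 2) / (ε / 2) ≤ VV q s.im ^ (ε / 2) / (ε / 2) := by gcongr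
    have e : (1 + 2 / (ε / 2)) * VV q s.im ^ (ε / 2) = VV q s.im ^ (ε / 2) + 2 * (VV q s.im ^ (ε / 2) / (ε / 2)) := by ring
    rw [e]; linarith
  have e : VV q s.im ^ ε = VV q s.im ^ (ε / 2) * VV q s.im ^ (ε / 2) := by
    rw [← Real.rpow_add (by linarith)]; congr 1; ring
  have hl : 0 ≤ Real.log q := Real.log_nonneg hq'
  calc _ ≤ _ := h1
    _ ≤ ((1 + 2 / (ε / 2)) * VV q s.im ^ (ε / 2)) * (C * VV q s.im ^ (ε / 2) * (1 + 1 / ‖s - 1‖)) := by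
        gcongr
        refine h2.trans ?_
        gcongr
    _ = _ := by rw [e]; ring
end WCL

end

section

open Finset
namespace WCL

def SiegelHyp : Prop := ∀ ε : ℝ, 0 < ε → ∃ c : ℝ, 0 < c ∧ c ≤ 1 ∧ ∀ (q : ℕ) [NeZero q] (χ : DirichletCharacter ℂ q), χ ≠ 1 → χ ^ 2 = 1 →
  c * (q : ℝ) ^ (-ε) ≤ ‖χ.LFunction 1‖

lemma convex_box (t : ℝ) : Convex ℝ {s : ℂ | 1 ≤ s.re ∧ s.re ≤ 2 ∧ |s.im - t| ≤ 1} := by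
  intro z hz w hw a b ha hb hab
  obtain ⟨h1, h2, h3⟩ := hz
  obtain ⟨k1, k2, k3⟩ := hw
  rw [abs_le] at h3 k3
  refine ⟨?_, ?_, ?_⟩
  · simp; nlinarith
  · simp; nlinarith
  · have e : (a • z + b • w).im - t = a * (z.im - t) + b * (w.im - t) := by
      simp; linear_combination t * hab
    rw [e, abs_le]
    constructor <;> nlinarith [h3.1, h3.2, k3.1, k3.2]

lemma box_lip (f : ℂ → ℂ) (t A : ℝ) (hd : ∀ s : ℂ, 1 ≤ s.re → s.re ≤ 2 → |s.im - t| ≤ 1 → DifferentiableAt ℂ f s)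
    (hA : ∀ s : ℂ, 1 ≤ s.re → s.re ≤ 2 → |s.im - t| ≤ 1 → ‖deriv f s‖ ≤ A) (z w : ℂ)
    (hz : 1 ≤ z.re ∧ z.re ≤ 2 ∧ |z.im - t| ≤ 1) (hw : 1 ≤ w.re ∧ w.re ≤ 2 ∧ |w.im - t| ≤ 1) : ‖f w - f z‖ ≤ A * ‖w - z‖ :=
  (convex_box t).norm_image_sub_le_of_norm_deriv_le (fun s hs => hd s hs.1 hs.2.1 hs.2.2)
    (fun s hs => hA s hs.1 hs.2.1 hs.2.2) hz hw

lemma A_to_V {A C V ε' ε : ℝ} {k : ℝ} (hV : 1 ≤ V) (hC : 0 < C) (hA : A = C * V ^ (k * ε')) (hk : 4 * k * ε' ≤ ε) :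
    (1 / 20736) / C ^ 4 * V ^ (-ε) ≤ (1 / 20736) / A ^ 4 := by
  have hV0 : 0 < V := by linarith
  have e : (1 / 20736) / A ^ 4 = (1 / 20736) / C ^ 4 * V ^ (-(4 * k * ε')) := by
    rw [hA, mul_pow, ← Real.rpow_natCast (V ^ (k * ε')), ← Real.rpow_mul hV0.le, Real.rpow_neg hV0.le,
      show k * ε' * ((4 : ℕ) : ℝ) = 4 * k * ε' by push_cast; ring]
    field_simp
  rw [e]
  gcongr

set_option maxHeartbeats 800000 in
theorem LB (hS : SiegelHyp) (ε : ℝ) (hε : 0 < ε) (hε1 : ε ≤ 1) : ∃ c : ℝ, 0 < c ∧ c ≤ 1 ∧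
    ∀ (q : ℕ) [NeZero q] (χ : DirichletCharacter ℂ q), χ ≠ 1 →
    ∀ s : ℂ, 1 < s.re → s.re ≤ 2 → c * VV q s.im ^ (-ε) ≤ ‖χ.LFunction s‖ := by
  set ε' := ε / 12 with hε'
  have hε'0 : 0 < ε' := by positivity
  have hε'1 : ε' ≤ 1 := by linarith
  obtain ⟨C1, hC1, hU⟩ := UB1' ε' hε'0 hε'1
  obtain ⟨C2, hC2, hT⟩ := triv_UB ε' hε'0 hε'1
  obtain ⟨cS, hcS, hcS1, hSi⟩ := hS ε' hε'0
  set C := max C1 C2 with hC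
  have hC1' : C1 ≤ C := le_max_left _ _
  have hC2' : C2 ≤ C := le_max_right _ _
  have hC0 : 1 ≤ C := hC1.trans hC1'
  set κ := cS / (8 * C) with hκ
  have hκ0 : 0 < κ := by positivity
  have hκ1 : κ ≤ 1 := by rw [hκ, div_le_one (by positivity)]; linarith
  set D := 4 * C / κ with hD
  have hD1 : 1 ≤ D := by rw [hD, le_div_iff₀ hκ0]; linarith
  have hD2 : 2 * C ≤ D := by rw [hD, le_div_iff₀ hκ0]; nlinarith
  refine ⟨(1 / 20736) / D ^ 4 * cS, by positivity, ?_, ?_⟩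
  · have : (1 / 20736) / D ^ 4 ≤ 1 := by
      rw [div_le_one (by positivity)]
      have : 1 ≤ D ^ 4 := one_le_pow₀ hD1
      linarith
    calc _ ≤ 1 * (1 : ℝ) := by gcongr
      _ = 1 := one_mul 1
  intro q _ χ hχ s hs1 hs2
  have hq : 0 < q := Nat.pos_of_ne_zero (NeZero.ne q)
  set t := s.im with ht
  set V := VV q t with hVdef
  have hV3 : 3 ≤ V := VV_ge hq t
  have hV0 : 0 < V := by linarith
  have hV1 : 1 ≤ V := by linarith
  have hVe : 1 ≤ V ^ ε' := Real.one_le_rpow hV1 hε'0.le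
  have hpos : 0 ≤ V ^ (-ε) := by positivity
  -- it suffices to bound by the other constants
  have hder : ∀ z : ℂ, 1 ≤ z.re → z.re ≤ 2 → |z.im - t| ≤ 1 → ‖deriv χ.LFunction z‖ ≤ 2 * C * V ^ ε' := by
    intro z h1 h2 h3
    have h4 := (hU q χ hχ z h1 h2).2
    have hV' := VV_ge hq z.im
    have h5 := two_rpow_le (V := V) (V' := VV q z.im) hV0 (by linarith) (VV_le_two h3) hε'0 hε'1
    calc _ ≤ _ := h4
      _ ≤ C * (2 * V ^ ε') := by gcongr
      _ = _ := by ring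
  have hlip := box_lip χ.LFunction t _ (fun z _ _ _ => DirichletCharacter.differentiable_LFunction hχ z) hder
  have hres : ∀ x : ℝ, (1 + x + Complex.I * t : ℂ).re = 1 + x := by intro x; simp
  have hims : ∀ x : ℝ, (1 + x + Complex.I * t : ℂ).im = t := by intro x; simp
  have hre2 : ∀ x : ℝ, (1 + x + 2 * Complex.I * t : ℂ).re = 1 + x := by intro x; simp
  have him2 : ∀ x : ℝ, (1 + x + 2 * Complex.I * t : ℂ).im = 2 * t := by intro x; simp
  have hseq : s = 1 + ((s.re - 1 : ℝ) : ℂ) + Complex.I * t := by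
    apply Complex.ext
    · rw [hres]; ring
    · rw [hims]
  have hV2 : VV q (2 * t) ^ ε' ≤ 2 * V ^ ε' :=
    two_rpow_le hV0 (by linarith [VV_ge hq (2 * t)]) (VV_two_mul t) hε'0 hε'1
  set f : ℝ → ℂ := fun x => χ.LFunction (1 + x + Complex.I * t) with hf
  have h341 : ∀ A x : ℝ, 0 < x → x ≤ 1 → ‖(χ ^ 2).LFunction (1 + x + 2 * Complex.I * t)‖ ≤ A →
      1 ≤ (9 / x) ^ 3 * ‖f x‖ ^ 4 * A := by
    intro A x hx hx1 hA
    have h1 := χ.norm_LFunction_product_ge_one hx t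
    rw [norm_mul, norm_mul, norm_pow, norm_pow] at h1
    refine h1.le.trans ?_
    have := trivChar_le q hx hx1
    gcongr
  have hflip : ∀ x y : ℝ, 0 < x → x ≤ y → y ≤ 1 → ‖f y - f x‖ ≤ 2 * C * V ^ ε' * (y - x) := by
    intro x y hx hxy hy
    have := hlip (1 + x + Complex.I * t) (1 + y + Complex.I * t)
      (by rw [hres, hims]; simp; constructor <;> linarith) (by rw [hres, hims]; simp; constructor <;> linarith)
    rw [show (1 + y + Complex.I * t : ℂ) - (1 + x + Complex.I * t) = ((y - x : ℝ) : ℂ) by push_cast; ring,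
      Complex.norm_real, Real.norm_of_nonneg (by linarith)] at this
    exact this
  have hx0 : 0 < s.re - 1 := by linarith
  have hx1 : s.re - 1 ≤ 1 := by linarith
  have hfs : χ.LFunction s = f (s.re - 1) := by rw [hf]; simp only; rw [← hseq]
  set A := D * V ^ (3 * ε') with hA
  have hVe3 : V ^ ε' ≤ V ^ (3 * ε') := Real.rpow_le_rpow_of_exponent_le hV1 (by linarith)
  have hA2 : 2 * C * V ^ ε' ≤ A := by rw [hA]; gcongr
  have hA1 : 1 ≤ A := le_trans (by nlinarith) hA2
  have hfin : (1 / 20736) / A ^ 4 ≤ ‖f (s.re - 1)‖ → (1 / 20736) / D ^ 4 * cS * V ^ (-ε) ≤ ‖χ.LFunction s‖ := by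
    intro h
    rw [hfs]
    refine le_trans ?_ h
    refine le_trans ?_ (A_to_V hV1 (by linarith) hA (by rw [hε']; linarith : 4 * 3 * ε' ≤ ε))
    calc (1 / 20736) / D ^ 4 * cS * V ^ (-ε) ≤ (1 / 20736) / D ^ 4 * 1 * V ^ (-ε) := by gcongr
      _ = _ := by ring
  have hflipA : ∀ x y : ℝ, 0 < x → x ≤ y → y ≤ 1 → ‖f y - f x‖ ≤ A * (y - x) := by
    intro x y hx hxy hy
    refine (hflip x y hx hxy hy).trans ?_
    have : 0 ≤ y - x := by linarith
    gcongr
  by_cases hχ2 : χ ^ 2 = 1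
  · set τ := κ * V ^ (-(2 * ε')) with hτ
    have hτ0 : 0 < τ := by positivity
    have hτ1 : τ ≤ 1 := by
      have : V ^ (-(2 * ε')) ≤ 1 := Real.rpow_le_one_of_one_le_of_nonpos hV1 (by linarith)
      calc τ ≤ 1 * 1 := by rw [hτ]; gcongr
        _ = 1 := one_mul 1
    have hAτ : 2 * C * V ^ ε' * (1 + 1 / τ) ≤ A := by
      have h1 : 1 + 1 / τ ≤ 2 / τ := by rw [le_div_iff₀ hτ0]; field_simp; linarith
      calc _ ≤ 2 * C * V ^ ε' * (2 / τ) := by gcongr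
        _ = A := by
          rw [hA, hD, hτ, Real.rpow_neg hV0.le, show 3 * ε' = ε' + 2 * ε' by ring, Real.rpow_add hV0]
          field_simp
          norm_num
    have hL2 : ∀ x : ℝ, 0 < x → x ≤ 1 → (τ ≤ |t| ∨ τ ≤ x) → ‖(χ ^ 2).LFunction (1 + x + 2 * Complex.I * t)‖ ≤ A := by
      intro x hx hx1 hor
      rw [hχ2]
      have h1 := hT q (1 + x + 2 * Complex.I * t) (by rw [hre2]; linarith) (by rw [hre2]; linarith)
      rw [him2] at h1
      refine h1.trans (le_trans ?_ hAτ)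
      have h2 := norm_sub_one_ge (1 + x + 2 * Complex.I * t)
      rw [him2, hre2] at h2
      have h3 : τ ≤ ‖(1 + x + 2 * Complex.I * t : ℂ) - 1‖ := by
        rcases hor with h | h
        · refine le_trans ?_ h2.1
          rw [abs_mul, abs_two]; linarith
        · refine le_trans ?_ h2.2
          rw [add_sub_cancel_left, abs_of_pos hx]; exact h
      calc C2 * VV q (2 * t) ^ ε' * (1 + 1 / ‖(1 + x + 2 * Complex.I * t : ℂ) - 1‖) ≤ C * (2 * V ^ ε') * (1 + 1 / τ) := by
            have : 0 ≤ VV q (2 * t) ^ ε' := Real.rpow_nonneg (by linarith [VV_ge hq (2 * t)]) _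
            gcongr
        _ = _ := by ring
    by_cases h1 : τ ≤ |t|
    · apply hfin
      exact abs341 f A hA1 hflipA (fun x hx hx1 => h341 A x hx hx1 (hL2 x hx hx1 (Or.inl h1))) _ hx0 hx1
    · by_cases h2 : τ ≤ s.re - 1
      · apply hfin
        have h3 := h341 A _ hx0 hx1 (hL2 _ hx0 hx1 (Or.inr h2))
        have hτA : 1 / τ ≤ A := by
          refine le_trans ?_ hAτ
          have h0 : 0 < 1 / τ := by positivity
          have h00 : 1 ≤ 2 * C * V ^ ε' := by nlinarith
          nlinarith
        have h4 : 9 / (s.re - 1) ≤ 9 * A := by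
          calc 9 / (s.re - 1) ≤ 9 / τ := by gcongr
            _ = 9 * (1 / τ) := by ring
            _ ≤ _ := by gcongr
        have h5 : 1 ≤ (9 * A) ^ 3 * ‖f (s.re - 1)‖ ^ 4 * A := by
          refine h3.trans ?_
          gcongr
        by_contra hc
        push Not at hc
        have h6 : (9 * A) ^ 3 * ‖f (s.re - 1)‖ ^ 4 * A ≤ (9 * A) ^ 3 * ((1 / 20736) / A ^ 4) ^ 4 * A := by
          gcongr
        have h7 : (9 * A) ^ 3 * ((1 / 20736) / A ^ 4) ^ 4 * A = 9 ^ 3 * (1 / 20736) ^ 4 / A ^ 12 := by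
          field_simp
        have h8 : 9 ^ 3 * (1 / 20736) ^ 4 / A ^ 12 < (1 : ℝ) := by
          rw [div_lt_one (by positivity)]
          have : 1 ≤ A ^ 12 := one_le_pow₀ hA1
          norm_num; linarith
        linarith
      · push Not at h1 h2
        have hS1 := hSi q χ hχ hχ2
        have h3 := hlip s 1 ⟨hs1.le, hs2, by simp [ht]⟩ ⟨by simp, by simp, by simp; linarith⟩
        have h4 : ‖(1 : ℂ) - s‖ ≤ 2 * τ := by
          refine (Complex.norm_le_abs_re_add_abs_im _).trans ?_
          simp only [Complex.sub_re, Complex.one_re, Complex.sub_im, Complex.one_im, zero_sub, abs_neg]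
          rw [abs_sub_comm, abs_of_pos hx0]; linarith
        have h5 : 2 * C * V ^ ε' * ‖(1 : ℂ) - s‖ ≤ (cS / 2) * V ^ (-ε') := by
          calc _ ≤ 2 * C * V ^ ε' * (2 * τ) := by gcongr
            _ = _ := by
              rw [hτ, hκ, show -(2 * ε') = -ε' + -ε' by ring, Real.rpow_add hV0, Real.rpow_neg hV0.le]
              field_simp
              norm_num
        have h6 : V ^ (-ε') ≤ (q : ℝ) ^ (-ε') := by
          have hq' : (0 : ℝ) < q := by exact_mod_cast hq
          apply Real.rpow_le_rpow_of_nonpos hq'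
          · have h61 : 1 ≤ |t| + 3 := by linarith [abs_nonneg t]
            exact le_mul_of_one_le_right hq'.le h61
          · linarith
        have h7 : cS * V ^ (-ε') ≤ cS * (q : ℝ) ^ (-ε') := by gcongr
        have h8 := norm_sub_norm_le (χ.LFunction 1) (χ.LFunction s)
        have h9 : (cS / 2) * V ^ (-ε') ≤ ‖χ.LFunction s‖ := by linarith
        refine le_trans ?_ h9
        have h10 : V ^ (-ε) ≤ V ^ (-ε') := Real.rpow_le_rpow_of_exponent_le hV1 (by linarith)
        have h11 : (1 / 20736) / D ^ 4 ≤ 1 / 2 := by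
          rw [div_le_iff₀ (by positivity)]
          have : 1 ≤ D ^ 4 := one_le_pow₀ hD1
          linarith
        calc _ ≤ 1 / 2 * cS * V ^ (-ε') := by gcongr
          _ = _ := by ring
  · apply hfin
    refine abs341 f A hA1 hflipA (fun x hx hx1 => h341 A x hx hx1 ?_) _ hx0 hx1
    have h1 := (hU q (χ ^ 2) hχ2 (1 + x + 2 * Complex.I * t) (by rw [hre2]; linarith) (by rw [hre2]; linarith)).1
    rw [him2] at h1
    refine h1.trans (le_trans ?_ hA2)
    calc C1 * VV q (2 * t) ^ ε' ≤ C * (2 * V ^ ε') := by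
          have : 0 ≤ VV q (2 * t) ^ ε' := Real.rpow_nonneg (by linarith [VV_ge hq (2 * t)]) _
          gcongr
      _ = _ := by ring
end WCL

end

section

open Finset
namespace WCL

lemma logder_aux (f : ℂ → ℂ) (hf : Differentiable ℂ f) (s₀ : ℂ) (δ A m : ℝ) (hδ : 0 < δ) (hδ1 : δ ≤ 1) (hA : 1 ≤ A) (hm : 0 < m)
    (hu : ∀ z, ‖z - s₀‖ ≤ δ → ‖f z‖ ≤ A * m) (hl : m / A ≤ ‖f s₀‖) (k : ℕ) :
    ‖iteratedDeriv k (fun s => deriv f s / f s) s₀‖ ≤ k.factorial * (4 * A ^ 2 / δ) ^ (k + 1) := by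
  have hA0 : 0 < A := by linarith
  set r := δ / (4 * A ^ 2) with hr
  have hr0 : 0 < r := by positivity
  have hA2 : 1 ≤ A ^ 2 := one_le_pow₀ hA
  have hr2 : r ≤ δ / 2 := by
    rw [hr]; gcongr; linarith
  have hder : ∀ z, ‖z - s₀‖ ≤ r → ‖deriv f z‖ ≤ 2 * A * m / δ := by
    intro z hz
    have := Complex.norm_deriv_le_of_forall_mem_sphere_norm_le (c := z) (R := δ / 2) (C := A * m) (f := f)
      (by positivity) hf.diffContOnCl (fun w hw => hu w (by
        rw [mem_sphere_iff_norm] at hw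
        calc ‖w - s₀‖ = ‖(w - z) + (z - s₀)‖ := by ring_nf
          _ ≤ δ / 2 + r := (norm_add_le _ _).trans (add_le_add hw.le hz)
          _ ≤ δ := by linarith))
    refine this.trans (le_of_eq (by field_simp))
  have hlow : ∀ z, ‖z - s₀‖ ≤ r → m / (2 * A) ≤ ‖f z‖ := by
    intro z hz
    have h1 := (convex_closedBall s₀ r).norm_image_sub_le_of_norm_deriv_le (f := f) (C := 2 * A * m / δ)
      (fun w _ => hf w) (fun w hw => hder w (by rwa [mem_closedBall_iff_norm] at hw))
      (x := z) (y := s₀) (by rwa [mem_closedBall_iff_norm]) (Metric.mem_closedBall_self hr0.le)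
    have h2 := norm_sub_norm_le (f s₀) (f z)
    have h3 : 2 * A * m / δ * ‖s₀ - z‖ ≤ m / (2 * A) := by
      rw [norm_sub_rev]
      calc _ ≤ 2 * A * m / δ * r := by gcongr
        _ = _ := by rw [hr]; field_simp; norm_num
    have h4 : m / A = m / (2 * A) + m / (2 * A) := by field_simp; norm_num
    linarith
  have hne : ∀ z, ‖z - s₀‖ ≤ r → f z ≠ 0 := by
    intro z hz h0
    have := hlow z hz
    rw [h0, norm_zero] at this
    have : 0 < m / (2 * A) := by positivity
    linarith
  have hdc : DiffContOnCl ℂ (fun s => deriv f s / f s) (Metric.ball s₀ r) := by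
    apply DifferentiableOn.diffContOnCl
    rw [closure_ball _ hr0.ne']
    intro z hz
    rw [mem_closedBall_iff_norm] at hz
    have hd : Differentiable ℂ (deriv f) := hf.deriv
    exact ((hd z).div (hf z) (hne z hz)).differentiableWithinAt
  have := Complex.norm_iteratedDeriv_le_of_forall_mem_sphere_norm_le (C := 4 * A ^ 2 / δ) k hr0 hdc (by
    intro z hz
    rw [mem_sphere_iff_norm] at hz
    have h1 := hder z hz.le
    have h2 := hlow z hz.le
    rw [norm_div]
    calc _ ≤ (2 * A * m / δ) / (m / (2 * A)) := by gcongr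
      _ = _ := by field_simp; norm_num)
  refine this.trans (le_of_eq ?_)
  have e : r = (4 * A ^ 2 / δ)⁻¹ := by rw [hr, inv_div]
  rw [e, inv_pow, div_inv_eq_mul, pow_succ]
  ring

theorem LD1 (hS : SiegelHyp) (k : ℕ) (ε : ℝ) (hε : 0 < ε) (hε1 : ε ≤ 1) : ∃ K : ℝ, 0 < K ∧
    ∀ (q : ℕ) [NeZero q] (χ : DirichletCharacter ℂ q), χ ≠ 1 →
    ∀ s : ℂ, 1 < s.re → s.re ≤ 2 → ‖iteratedDeriv k (fun s => deriv χ.LFunction s / χ.LFunction s) s‖ ≤ K * VV q s.im ^ ε := by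
  set ε' := ε / (2 * (k + 1)) with hε'
  have hk : (0 : ℝ) ≤ k := by positivity
  have hε'0 : 0 < ε' := by positivity
  have hε'1 : ε' ≤ 1 := by
    rw [hε', div_le_one (by positivity)]; linarith
  obtain ⟨C, hC, hU⟩ := UB1 ε' hε'0 hε'1
  obtain ⟨c, hc, hc1, hL⟩ := LB hS ε' hε'0 hε'1
  set D := max C (1 / c) with hD
  have hD1 : 1 ≤ D := hC.trans (le_max_left _ _)
  refine ⟨k.factorial * (4 * D ^ 2 / (ε' / 2)) ^ (k + 1), by positivity, ?_⟩
  intro q _ χ hχ s hs1 hs2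
  have hq : 0 < q := Nat.pos_of_ne_zero (NeZero.ne q)
  have hV3 : 3 ≤ VV q s.im := VV_ge hq _
  have hV0 : 0 < VV q s.im := by linarith
  set V := VV q s.im
  have hVe : 1 ≤ V ^ ε' := Real.one_le_rpow (by linarith) hε'0.le
  have h := logder_aux χ.LFunction (DirichletCharacter.differentiable_LFunction hχ) s (ε' / 2) (D * V ^ ε') 1 (by positivity)
    (by linarith) (by nlinarith) one_pos ?_ ?_ k
  · refine h.trans (le_of_eq ?_)
    rw [mul_pow, show 4 * (D ^ 2 * (V ^ ε') ^ 2) / (ε' / 2) = (4 * D ^ 2 / (ε' / 2)) * (V ^ ε') ^ 2 by ring, mul_pow, ← pow_mul,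
      ← Real.rpow_natCast (V ^ ε'), ← Real.rpow_mul hV0.le]
    have : ε' * ((2 * (k + 1) : ℕ) : ℝ) = ε := by rw [hε']; push_cast; field_simp
    rw [this]; ring
  · intro z hz
    rw [mul_one]
    refine (hU q χ hχ s hs1.le hs2 z hz).trans ?_
    gcongr
    exact le_max_left _ _
  · refine le_trans ?_ (hL q χ hχ s hs1 hs2)
    rw [Real.rpow_neg hV0.le, ← div_eq_mul_inv, div_le_div_iff₀ (by positivity) (by positivity), one_mul, ← mul_assoc]
    have : 1 ≤ c * D := by
      calc 1 = c * (1 / c) := by field_simp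
        _ ≤ c * D := by gcongr; exact le_max_right _ _
    nlinarith

/-- `ζ(s) - 1/(s-1)`. -/
noncomputable def hz : ℂ → ℂ := dslope ZZ 1

lemma hz_diff : Differentiable ℂ hz := by
  have := (Complex.differentiableOn_dslope (f := ZZ) (c := 1) (Filter.univ_mem)).mpr ZZ_diff.differentiableOn
  rwa [differentiableOn_univ] at this

lemma hz_eq {s : ℂ} (hs : s ≠ 1) : hz s = riemannZeta s - 1 / (s - 1) := by
  have h0 : s - 1 ≠ 0 := sub_ne_zero.mpr hs
  rw [hz, dslope_of_ne _ hs, slope_def_field, ZZ_one, ZZ_eq hs]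
  field_simp

lemma hz_bound (ε : ℝ) (hε : 0 < ε) (hε1 : ε ≤ 1) : ∃ C : ℝ, 1 ≤ C ∧
    ∀ s : ℂ, 1 - ε / 2 ≤ s.re → s.re ≤ 3 → ‖hz s‖ ≤ C * VV 1 s.im ^ ε := by
  obtain ⟨C, hC, h⟩ := zeta_UB ε hε hε1
  obtain ⟨M, hM⟩ := (isCompact_closedBall (1 : ℂ) 1).exists_bound_of_continuousOn hz_diff.continuous.continuousOn
  refine ⟨max M (2 * C + 1), by refine le_trans ?_ (le_max_right _ _); linarith, ?_⟩
  intro s hs1 hs3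
  have hV3 := VV_ge one_pos s.im
  have hVe : 1 ≤ VV 1 s.im ^ ε := Real.one_le_rpow (by linarith) hε.le
  by_cases hs : ‖s - 1‖ ≤ 1
  · have h1 := hM s (by rwa [mem_closedBall_iff_norm])
    calc _ ≤ M := h1
      _ ≤ max M (2 * C + 1) * 1 := by rw [mul_one]; exact le_max_left _ _
      _ ≤ _ := by gcongr
  · push Not at hs
    have hne : s ≠ 1 := by rintro rfl; simp at hs; linarith
    have h2 : 1 / ‖s - 1‖ ≤ 1 := by rw [div_le_one (by linarith)]; exact hs.le
    rw [hz_eq hne]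
    calc _ ≤ ‖riemannZeta s‖ + ‖1 / (s - 1)‖ := norm_sub_le _ _
      _ ≤ C * VV 1 s.im ^ ε * (1 + 1) + VV 1 s.im ^ ε := by
          refine add_le_add ((h s hs1 hs3 hne).trans (by gcongr)) ?_
          rw [norm_div, norm_one]; linarith
      _ = (2 * C + 1) * VV 1 s.im ^ ε := by ring
      _ ≤ _ := by gcongr; exact le_max_right _ _

lemma hz_der (k : ℕ) (ε : ℝ) (hε : 0 < ε) (hε1 : ε ≤ 1) : ∃ K : ℝ, 0 < K ∧
    ∀ s : ℂ, 1 ≤ s.re → s.re ≤ 2 → ‖iteratedDeriv k hz s‖ ≤ K * VV 1 s.im ^ ε := by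
  obtain ⟨C, hC, h⟩ := hz_bound ε hε hε1
  refine ⟨k.factorial * (2 * C) / (ε / 2) ^ k, by positivity, ?_⟩
  intro s hs1 hs2
  have hV := VV_ge one_pos s.im
  have := Complex.norm_iteratedDeriv_le_of_forall_mem_sphere_norm_le (c := s) (R := ε / 2) (f := hz) (C := C * (2 * VV 1 s.im ^ ε)) k (by positivity)
    hz_diff.diffContOnCl (by
    intro z hz
    rw [mem_sphere_iff_norm] at hz
    have hre := (Complex.abs_re_le_norm (z - s)).trans hz.le
    have him := (Complex.abs_im_le_norm (z - s)).trans hz.le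
    rw [Complex.sub_re, abs_le] at hre
    rw [Complex.sub_im] at him
    refine (h z (by linarith) (by linarith)).trans ?_
    have hV' := VV_ge one_pos z.im
    have h2 := two_rpow_le (V := VV 1 s.im) (V' := VV 1 z.im) (by linarith) (by linarith) (VV_le_two (by linarith)) hε hε1
    gcongr)
  refine this.trans (le_of_eq (by ring))

lemma ZZ_ne_zero {s : ℂ} (hs : 1 ≤ s.re) : ZZ s ≠ 0 := by
  by_cases h : s = 1
  · rw [h, ZZ_one]; exact one_ne_zero
  · rw [ZZ_eq h]
    exact mul_ne_zero (sub_ne_zero.mpr h) (riemannZeta_ne_zero_of_one_le_re hs)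

lemma zeta_LB_far (ε : ℝ) (hε : 0 < ε) (hε1 : ε ≤ 1) : ∃ c : ℝ, 0 < c ∧
    ∀ s : ℂ, 1 < s.re → s.re ≤ 2 → 3 ≤ |s.im| → c * VV 1 s.im ^ (-ε) ≤ ‖riemannZeta s‖ := by
  set ε' := ε / 4 with hε'
  have hε'0 : 0 < ε' := by positivity
  have hε'1 : ε' ≤ 1 := by linarith
  obtain ⟨C, hC, h⟩ := zeta_UB ε' hε'0 hε'1
  set D := 4 * C / (ε' / 2) with hD
  have hD1 : 4 * C ≤ D := by rw [hD, le_div_iff₀ (by positivity)]; nlinarith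
  refine ⟨(1 / 20736) / D ^ 4, by positivity, ?_⟩
  intro s hs1 hs2 ht3
  set t := s.im with ht
  set V := VV 1 t with hVdef
  have hV3 : 3 ≤ V := VV_ge one_pos t
  have hV0 : 0 < V := by linarith
  have hVe : 1 ≤ V ^ ε' := Real.one_le_rpow (by linarith) hε'0.le
  have hub : ∀ z : ℂ, 1 - ε' / 2 ≤ z.re → z.re ≤ 3 → |z.im - t| ≤ 1 → ‖riemannZeta z‖ ≤ 4 * C * V ^ ε' := by
    intro z h1 h2 h3
    have h4 : 1 ≤ |z.im| := by
      have := abs_sub_abs_le_abs_sub t z.im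
      rw [abs_sub_comm] at this; linarith
    have hn := (norm_sub_one_ge z).1
    have hne : z ≠ 1 := by rintro rfl; simp at h4; linarith
    have hV' := VV_ge one_pos z.im
    have h5 := two_rpow_le (V := V) (V' := VV 1 z.im) hV0 (by linarith) (VV_le_two h3) hε'0 hε'1
    have h6 : 1 / ‖z - 1‖ ≤ 1 := by rw [div_le_one (by linarith)]; linarith
    calc _ ≤ _ := h z h1 h2 hne
      _ ≤ C * (2 * V ^ ε') * (1 + 1) := by gcongr
      _ = _ := by ring
  have hdiff : ∀ z : ℂ, |z.im - t| ≤ 2 → DifferentiableAt ℂ riemannZeta z := by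
    intro z hz
    apply differentiableAt_riemannZeta
    rintro rfl
    simp only [Complex.one_im, zero_sub, abs_neg] at hz
    linarith
  have hder : ∀ z : ℂ, 1 ≤ z.re → z.re ≤ 2 → |z.im - t| ≤ 0 → ‖deriv riemannZeta z‖ ≤ D * V ^ ε' := by
    intro z h1 h2 h3
    have h0 : ∀ w : ℂ, ‖w - z‖ ≤ ε' / 2 → 1 - ε' / 2 ≤ w.re ∧ w.re ≤ 3 ∧ |w.im - t| ≤ 1 := by
      intro w hw
      have hre := (Complex.abs_re_le_norm (w - z)).trans hw
      have him := (Complex.abs_im_le_norm (w - z)).trans hw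
      rw [Complex.sub_re, abs_le] at hre
      rw [Complex.sub_im] at him
      refine ⟨by linarith, by linarith, ?_⟩
      have := abs_add_le (w.im - z.im) (z.im - t)
      rw [sub_add_sub_cancel] at this; linarith
    have := Complex.norm_deriv_le_of_forall_mem_sphere_norm_le (c := z) (R := ε' / 2) (C := 4 * C * V ^ ε') (f := riemannZeta)
      (by positivity) (by
        apply DifferentiableOn.diffContOnCl
        rw [closure_ball _ (by positivity)]
        intro w hw
        rw [mem_closedBall_iff_norm] at hw
        exact (hdiff w (by linarith [(h0 w hw).2.2])).differentiableWithinAt)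
      (fun w hw => by
        rw [mem_sphere_iff_norm] at hw
        have := h0 w hw.le
        exact hub w this.1 this.2.1 this.2.2)
    refine this.trans (le_of_eq (by rw [hD]; ring))
  have hres : ∀ x : ℝ, (1 + x + Complex.I * t : ℂ).re = 1 + x := by intro x; simp
  have hims : ∀ x : ℝ, (1 + x + Complex.I * t : ℂ).im = t := by intro x; simp
  have hre2 : ∀ x : ℝ, (1 + x + 2 * Complex.I * t : ℂ).re = 1 + x := by intro x; simp
  have him2 : ∀ x : ℝ, (1 + x + 2 * Complex.I * t : ℂ).im = 2 * t := by intro x; simp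
  have hseq : s = 1 + ((s.re - 1 : ℝ) : ℂ) + Complex.I * t := by
    apply Complex.ext
    · rw [hres]; ring
    · rw [hims]
  have hV2 : VV 1 (2 * t) ^ ε' ≤ 2 * V ^ ε' :=
    two_rpow_le hV0 (by linarith [VV_ge one_pos (2 * t)]) (VV_two_mul t) hε'0 hε'1
  set f : ℝ → ℂ := fun x => riemannZeta (1 + x + Complex.I * t) with hf
  have hconv : Convex ℝ {z : ℂ | 1 ≤ z.re ∧ z.re ≤ 2 ∧ |z.im - t| ≤ 0} := by
    intro z hz w hw a b ha hb hab
    obtain ⟨h1, h2, h3⟩ := hz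
    obtain ⟨k1, k2, k3⟩ := hw
    refine ⟨by simp; nlinarith, by simp; nlinarith, ?_⟩
    rw [abs_nonpos_iff] at h3 k3 ⊢
    have e : (a • z + b • w).im - t = a * (z.im - t) + b * (w.im - t) := by
      simp; linear_combination t * hab
    rw [e, h3, k3]; ring
  have hfs : riemannZeta s = f (s.re - 1) := by rw [hf]; simp only; rw [← hseq]
  have hA1 : 1 ≤ D * V ^ ε' := by nlinarith
  have hmain := abs341 f (D * V ^ ε') hA1 ?_ ?_ (s.re - 1) (by linarith) (by linarith)
  · rw [hfs]
    refine le_trans ?_ hmain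
    exact A_to_V (k := 1) (ε' := ε') (by linarith) (by linarith) (by rw [one_mul]) (by rw [hε']; linarith)
  · intro x y hx hxy hy
    have := hconv.norm_image_sub_le_of_norm_deriv_le (f := riemannZeta) (fun z hz => hdiff z (by linarith [hz.2.2]))
      (fun z hz => hder z hz.1 hz.2.1 hz.2.2) (x := 1 + x + Complex.I * t) (y := 1 + y + Complex.I * t)
      (by simp only [Set.mem_setOf_eq]; rw [hres, hims]; simp; constructor <;> linarith)
      (by simp only [Set.mem_setOf_eq]; rw [hres, hims]; simp; constructor <;> linarith)
    rw [show (1 + y + Complex.I * t : ℂ) - (1 + x + Complex.I * t) = ((y - x : ℝ) : ℂ) by push_cast; ring,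
      Complex.norm_real, Real.norm_of_nonneg (by linarith)] at this
    exact this
  · intro x hx hx1
    have h1 := (1 : DirichletCharacter ℂ 1).norm_LFunction_product_ge_one hx t
    rw [norm_mul, norm_mul, norm_pow, norm_pow] at h1
    refine h1.le.trans ?_
    have h2 := trivChar_le 1 hx hx1
    have h3 : ‖DirichletCharacter.LFunction ((1 : DirichletCharacter ℂ 1) ^ 2) (1 + x + 2 * Complex.I * t)‖ ≤ D * V ^ ε' := by
      rw [DirichletCharacter.LFunction_modOne_eq]
      have hn := (norm_sub_one_ge (1 + x + 2 * Complex.I * t)).1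
      rw [him2, abs_mul, abs_two] at hn
      have h4 := h (1 + x + 2 * Complex.I * t) (by rw [hre2]; linarith) (by rw [hre2]; linarith)
        (by apply ne_one_of_re; rw [hre2]; linarith)
      rw [him2] at h4
      have h6 : 1 / ‖(1 + x + 2 * Complex.I * t : ℂ) - 1‖ ≤ 1 := by rw [div_le_one (by linarith)]; linarith
      calc _ ≤ _ := h4
        _ ≤ C * (2 * V ^ ε') * (1 + 1) := by
          have : 0 ≤ VV 1 (2 * t) ^ ε' := Real.rpow_nonneg (by linarith [VV_ge one_pos (2 * t)]) _
          gcongr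
        _ = 4 * C * V ^ ε' := by ring
        _ ≤ _ := by gcongr
    rw [DirichletCharacter.LFunction_modOne_eq] at h1 ⊢
    gcongr

theorem LDz (k : ℕ) (ε : ℝ) (hε : 0 < ε) (hε1 : ε ≤ 1) : ∃ K : ℝ, 0 < K ∧
    ∀ s : ℂ, 1 < s.re → s.re ≤ 2 → ‖iteratedDeriv k (fun s => deriv ZZ s / ZZ s) s‖ ≤ K * VV 1 s.im ^ ε := by
  set ε' := ε / (2 * (k + 1)) with hε'
  have hk : (0 : ℝ) ≤ k := by positivity
  have hε'0 : 0 < ε' := by positivity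
  have hε'1 : ε' ≤ 1 := by
    rw [hε', div_le_one (by positivity)]; linarith
  obtain ⟨c1, hc1, hL⟩ := zeta_LB_far ε' hε'0 hε'1
  have hcomp : IsCompact (Set.Icc (1 : ℝ) 2 ×ℂ Set.Icc (-3 : ℝ) 3) := isCompact_Icc.reProdIm isCompact_Icc
  obtain ⟨s₁, hs₁, hmin⟩ := hcomp.exists_isMinOn ⟨1, by constructor <;> simp⟩ (f := fun s => ‖ZZ s‖)
    ZZ_diff.continuous.norm.continuousOn
  set c2 := ‖ZZ s₁‖ with hc2
  have hc20 : 0 < c2 := norm_pos_iff.mpr (ZZ_ne_zero hs₁.1.1)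
  set C := 9 + 1 / (ε' / 2) with hC
  have hC0 : 9 ≤ C := by
    have : 0 ≤ 1 / (ε' / 2) := by positivity
    linarith
  -- lower bound
  have hlow : ∀ s : ℂ, 1 < s.re → s.re ≤ 2 → min (c1 / 6) (c2 / 6) * VV 1 s.im ^ (-ε') * (|s.im| + 3) ≤ ‖ZZ s‖ := by
    intro s hs1 hs2
    have hV3 := VV_ge one_pos s.im
    have hp : 0 < VV 1 s.im ^ (-ε') := Real.rpow_pos_of_pos (by linarith) _
    by_cases h3 : 3 ≤ |s.im|
    · have h4 := hL s hs1 hs2 h3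
      rw [ZZ_eq (ne_one_of_re hs1), norm_mul]
      have h5 := (norm_sub_one_ge s).1
      calc _ ≤ (c1 / 6) * VV 1 s.im ^ (-ε') * (6 * ‖s - 1‖) := by
            gcongr
            · exact min_le_left _ _
            · linarith
        _ = ‖s - 1‖ * (c1 * VV 1 s.im ^ (-ε')) := by ring
        _ ≤ _ := by gcongr
    · push Not at h3
      rw [abs_lt] at h3
      have h4 := hmin (a := s) ⟨⟨hs1.le, hs2⟩, ⟨h3.1.le, h3.2.le⟩⟩
      have h5 : VV 1 s.im ^ (-ε') ≤ 1 := Real.rpow_le_one_of_one_le_of_nonpos (by linarith) (by linarith)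
      have h6 : |s.im| + 3 ≤ 6 := by
        have := abs_le.mpr ⟨h3.1.le, h3.2.le⟩
        linarith
      calc _ ≤ (c2 / 6) * 1 * 6 := by
            gcongr
            exact min_le_right _ _
        _ = c2 := by ring
        _ ≤ _ := h4
  set D := max (6 * C) (1 / min (c1 / 6) (c2 / 6)) with hD
  have hD1 : 6 * C ≤ D := le_max_left _ _
  have hD0 : 1 ≤ D := by linarith
  have hcmin : 0 < min (c1 / 6) (c2 / 6) := lt_min (by positivity) (by positivity)
  refine ⟨k.factorial * (4 * D ^ 2 / (ε' / 2)) ^ (k + 1), by positivity, ?_⟩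
  intro s hs1 hs2
  have hV3 : 3 ≤ VV 1 s.im := VV_ge one_pos _
  have hV0 : 0 < VV 1 s.im := by linarith
  have hVe : 1 ≤ VV 1 s.im ^ ε' := Real.one_le_rpow (by linarith) hε'0.le
  have ht0 := abs_nonneg s.im
  have h := logder_aux ZZ ZZ_diff s (ε' / 2) (D * VV 1 s.im ^ ε') (|s.im| + 3) (by positivity)
    (by linarith) (by nlinarith) (by linarith) ?_ ?_ k
  · refine h.trans (le_of_eq ?_)
    rw [mul_pow, show 4 * (D ^ 2 * (VV 1 s.im ^ ε') ^ 2) / (ε' / 2) = (4 * D ^ 2 / (ε' / 2)) * (VV 1 s.im ^ ε') ^ 2 by ring, mul_pow, ← pow_mul,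
      ← Real.rpow_natCast (VV 1 s.im ^ ε'), ← Real.rpow_mul hV0.le]
    have : ε' * ((2 * (k + 1) : ℕ) : ℝ) = ε := by rw [hε']; push_cast; field_simp
    rw [this]; ring
  · intro z hz
    have hre := (Complex.abs_re_le_norm (z - s)).trans hz
    have him := (Complex.abs_im_le_norm (z - s)).trans hz
    rw [Complex.sub_re, abs_le] at hre
    rw [Complex.sub_im] at him
    have h1 := ZZ_bound (ε' / 2) (by positivity) (by linarith) z (by linarith) (by linarith)
    rw [show 2 * (ε' / 2) = ε' by ring] at h1
    have hV' := VV_ge one_pos z.im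
    have h2 := two_rpow_le (V := VV 1 s.im) (V' := VV 1 z.im) hV0 (by linarith) (VV_le_two (by linarith)) hε'0 hε'1
    have h3 : ‖z - 1‖ ≤ |s.im| + 3 - 1 / 2 := by
      refine (Complex.norm_le_abs_re_add_abs_im _).trans ?_
      have : |z.im| ≤ |s.im| + 1 / 2 := by
        have := abs_sub_abs_le_abs_sub z.im s.im; linarith
      have h4 : |z.re - 1| ≤ 2 := by rw [abs_le]; constructor <;> linarith
      simp only [Complex.sub_re, Complex.one_re, Complex.sub_im, Complex.one_im, sub_zero]
      linarith
    have h5 : C * ‖z - 1‖ + 1 ≤ C * (|s.im| + 3) := by nlinarith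
    calc _ ≤ _ := h1
      _ ≤ (2 * VV 1 s.im ^ ε') * (C * (|s.im| + 3)) := by gcongr
      _ = 2 * C * VV 1 s.im ^ ε' * (|s.im| + 3) := by ring
      _ ≤ _ := by gcongr; linarith
  · refine le_trans ?_ (hlow s hs1 hs2)
    rw [Real.rpow_neg hV0.le, div_le_iff₀ (by positivity)]
    have : 1 ≤ min (c1 / 6) (c2 / 6) * D := by
      calc 1 = min (c1 / 6) (c2 / 6) * (1 / min (c1 / 6) (c2 / 6)) := by field_simp
        _ ≤ _ := by gcongr; exact le_max_right _ _
    have e : min (c1 / 6) (c2 / 6) * (VV 1 s.im ^ ε')⁻¹ * (|s.im| + 3) * (D * VV 1 s.im ^ ε') = (min (c1 / 6) (c2 / 6) * D) * (|s.im| + 3) := by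
      field_simp
    rw [e]; nlinarith
end WCL

end

section

open Finset
namespace WCL

open scoped ComplexOrder
open Complex in
/-- nonnegativity of alternating derivatives from the logarithmic derivative -/
lemma alt_of_logder (F h : ℂ → ℂ) (hF : DifferentiableOn ℂ F {s : ℂ | 1 < s.re}) (hh : DifferentiableOn ℂ h {s : ℂ | 1 < s.re})
    (hd : ∀ s : ℂ, 1 < s.re → deriv F s = -(F s * h s)) (h0 : 0 ≤ F 2)
    (halt : ∀ k : ℕ, 0 ≤ (-1) ^ k * iteratedDeriv k h 2) (m : ℕ) : 0 ≤ (-1) ^ m * iteratedDeriv m F 2 := by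
  have hop : IsOpen {s : ℂ | 1 < s.re} := isOpen_lt continuous_const continuous_re
  have h2 : (2 : ℂ) ∈ {s : ℂ | 1 < s.re} := by simp
  have hnh := hop.mem_nhds h2
  have cF : ∀ n : ℕ, ContDiffAt ℂ n F 2 := fun n => ((hF.contDiffOn hop).contDiffAt hnh)
  have ch : ∀ n : ℕ, ContDiffAt ℂ n h 2 := fun n => ((hh.contDiffOn hop).contDiffAt hnh)
  induction m using Nat.strong_induction_on with
  | _ m ih =>
    rcases m with _ | m
    · simpa using h0
    · have e : iteratedDeriv (m + 1) F 2 = - ∑ i ∈ range (m + 1), (m.choose i : ℂ) * iteratedDeriv i F 2 * iteratedDeriv (m - i) h 2 := by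
        rw [iteratedDeriv_succ', ← iteratedDeriv_mul (cF m) (ch m), ← iteratedDeriv_neg]
        apply Filter.EventuallyEq.iteratedDeriv_eq
        filter_upwards [hnh] with s hs
        rw [hd s hs]; rfl
      rw [e, mul_neg, mul_sum, ← sum_neg_distrib]
      refine sum_nonneg (fun i hi => ?_)
      have hi' : i < m + 1 := mem_range.mp hi
      have h1 := ih i hi'
      have h3 := halt (m - i)
      have e2 : -((-1 : ℂ) ^ (m + 1) * ((m.choose i : ℂ) * iteratedDeriv i F 2 * iteratedDeriv (m - i) h 2))
          = (m.choose i : ℂ) * (((-1) ^ i * iteratedDeriv i F 2) * ((-1) ^ (m - i) * iteratedDeriv (m - i) h 2)) := by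
        have : (-1 : ℂ) ^ m = (-1) ^ i * (-1) ^ (m - i) := by rw [← pow_add]; congr 1; omega
        rw [pow_succ, this]; ring
      rw [e2]
      have h5 : (0 : ℂ) ≤ (m.choose i : ℂ) := Nat.cast_nonneg _
      exact mul_nonneg h5 (mul_nonneg h1 h3)

lemma estermann_abs (G : ℂ → ℂ) (hG : Differentiable ℂ G) (l : ℂ) (F : ℂ → ℂ)
    (hGF : ∀ s : ℂ, 1 < s.re → G s = F s - l / (s - 1)) (hF : DifferentiableOn ℂ F {s : ℂ | 1 < s.re})
    (halt : ∀ m : ℕ, 0 ≤ (-1) ^ m * iteratedDeriv m F 2)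
    (A : ℝ) (hA : 0 ≤ A) (hGA : ∀ s ∈ Metric.sphere (2 : ℂ) (4 / 3), ‖G s‖ ≤ A) (σ : ℝ) (h1 : 7 / 8 ≤ σ) (h2 : σ < 1) (M : ℕ) (hM : 0 < M) :
    (F 2).re - 7 * A * (27 / 32) ^ M - ‖l‖ * (2 - σ) ^ M / (1 - σ) ≤ (G σ + l / (σ - 1)).re := by
  have hop : IsOpen {s : ℂ | 1 < s.re} := isOpen_lt continuous_const Complex.continuous_re
  have hnh : {s : ℂ | 1 < s.re} ∈ nhds (2 : ℂ) := hop.mem_nhds (by simp)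
  set x : ℝ := 2 - σ with hx
  set b : ℕ → ℂ := fun m => (-1) ^ m * iteratedDeriv m F 2 / m.factorial with hb
  set g : ℕ → ℂ := fun m => (-1) ^ m * iteratedDeriv m G 2 / m.factorial with hg
  have hgb : ∀ m, g m = b m - l := by
    intro m
    have e1 : iteratedDeriv m (fun s : ℂ => l / (s - 1)) 2 = l * ((-1) ^ m * m.factorial) := by
      have : (fun s : ℂ => l / (s - 1)) = fun s => l * (fun z : ℂ => z⁻¹) (s - 1) := by ext s; simp [div_eq_mul_inv]
      rw [this, iteratedDeriv_const_mul_field, iteratedDeriv_comp_sub_const]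
      simp only []
      rw [iteratedDeriv_eq_iterate, iter_deriv_inv]
      norm_num
    have e2 : iteratedDeriv m G 2 = iteratedDeriv m F 2 - iteratedDeriv m (fun s : ℂ => l / (s - 1)) 2 := by
      rw [← iteratedDeriv_sub]
      · apply Filter.EventuallyEq.iteratedDeriv_eq
        filter_upwards [hnh] with s hs
        rw [hGF s hs]; rfl
      · exact (hF.contDiffOn hop).contDiffAt hnh
      · refine ContDiffAt.div contDiffAt_const (contDiffAt_id.sub contDiffAt_const) ?_
        norm_num
    have h0 : ((m.factorial : ℕ) : ℂ) ≠ 0 := by exact_mod_cast m.factorial_ne_zero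
    have h3 : ((-1 : ℂ) ^ m) * (-1) ^ m = 1 := by rw [← mul_pow]; norm_num
    simp only [hg, hb]
    rw [e2, e1, mul_sub, sub_div, show (-1 : ℂ) ^ m * (l * ((-1) ^ m * (m.factorial : ℂ))) = l * m.factorial * ((-1) ^ m * (-1) ^ m) by ring, h3]
    field_simp
  have hgn : ∀ m, ‖g m‖ ≤ A * (3 / 4) ^ m := by
    intro m
    have := Complex.norm_iteratedDeriv_le_of_forall_mem_sphere_norm_le (c := (2 : ℂ)) (R := 4 / 3) (f := G) (C := A) m (by norm_num)
      hG.diffContOnCl hGA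
    have hf : (0 : ℝ) < m.factorial := by exact_mod_cast m.factorial_pos
    simp only [hg]
    rw [norm_div, norm_mul, norm_pow, norm_neg, norm_one, one_pow, one_mul, Complex.norm_natCast, div_le_iff₀ hf]
    refine this.trans (le_of_eq ?_)
    rw [show (3 / 4 : ℝ) = (4 / 3)⁻¹ by norm_num, inv_pow]
    field_simp
  have hsum : HasSum (fun m => g m * (x : ℂ) ^ m) (G σ) := by
    have := Complex.hasSum_taylorSeries_of_entire hG (2 : ℂ) (σ : ℂ)
    refine Eq.mp ?_ this
    congr 1
    funext m
    simp only [hg, smul_eq_mul]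
    rw [show (σ : ℂ) - 2 = (-1) * (x : ℂ) by rw [hx]; push_cast; ring, mul_pow]
    field_simp
  have hx1 : 1 < x := by rw [hx]; linarith
  have hx2 : x ≤ 9 / 8 := by rw [hx]; linarith
  -- split
  have htail : ‖G σ - ∑ m ∈ range M, g m * (x : ℂ) ^ m‖ ≤ 7 * A * (27 / 32) ^ M := by
    have hs := (hasSum_nat_add_iff' M).mpr hsum
    have hgeo : HasSum (fun m : ℕ => A * (27 / 32) ^ M * (27 / 32 : ℝ) ^ m) (A * (27 / 32) ^ M * (1 - 27 / 32)⁻¹) :=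
      (hasSum_geometric_of_lt_one (by norm_num) (by norm_num)).mul_left _
    rw [← hs.tsum_eq]
    refine (tsum_of_norm_bounded hgeo ?_).trans ?_
    · intro m
      rw [norm_mul, norm_pow, Complex.norm_real, Real.norm_of_nonneg (by linarith)]
      calc _ ≤ A * (3 / 4) ^ (m + M) * (9 / 8) ^ (m + M) := by
            gcongr
            exact hgn _
        _ = _ := by rw [mul_assoc, ← mul_pow, pow_add]; norm_num; ring
    · have : 0 ≤ A * (27 / 32) ^ M := by positivity
      nlinarith
  have hmain : ∑ m ∈ range M, g m * (x : ℂ) ^ m = ∑ m ∈ range M, b m * (x : ℂ) ^ m - l * (((x : ℂ) ^ M - 1) / (x - 1)) := by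
    have hxc : (x : ℂ) ≠ 1 := by exact_mod_cast hx1.ne'
    rw [← geom_sum_eq hxc, mul_sum, ← sum_sub_distrib]
    refine sum_congr rfl (fun m _ => ?_)
    rw [hgb]; ring
  have hbpos : ∀ m, 0 ≤ b m := by
    intro m
    simp only [hb]
    have h5 : (0 : ℂ) ≤ ((m.factorial : ℂ))⁻¹ := by
      have : (0 : ℝ) ≤ ((m.factorial : ℝ))⁻¹ := by positivity
      have h6 := Complex.zero_le_real.mpr this
      rwa [Complex.ofReal_inv, Complex.ofReal_natCast] at h6
    rw [div_eq_mul_inv]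
    exact mul_nonneg (halt m) h5
  have hb0 : (F 2).re ≤ (∑ m ∈ range M, b m * (x : ℂ) ^ m).re := by
    rw [Complex.re_sum]
    have e0 : (b 0 * (x : ℂ) ^ 0).re = (F 2).re := by simp [hb]
    rw [← e0]
    refine single_le_sum (f := fun m => (b m * (x : ℂ) ^ m).re) (fun m _ => ?_) (mem_range.mpr hM)
    rw [← Complex.ofReal_pow, Complex.re_mul_ofReal]
    exact mul_nonneg (Complex.nonneg_iff.mp (hbpos m)).1 (by positivity)
  have e3 : G σ + l / (σ - 1) = (G σ - ∑ m ∈ range M, g m * (x : ℂ) ^ m) + ∑ m ∈ range M, b m * (x : ℂ) ^ m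
      - l * ((x : ℂ) ^ M / (x - 1)) := by
    have hxc : (x : ℂ) - 1 ≠ 0 := sub_ne_zero.mpr (by exact_mod_cast hx1.ne')
    rw [hmain, show (σ : ℂ) - 1 = -((x : ℂ) - 1) by rw [hx]; push_cast; ring]
    field_simp
    ring
  rw [e3, Complex.sub_re, Complex.add_re]
  have t1 := (abs_le.mp ((Complex.abs_re_le_norm _).trans htail)).1
  have t2 : (l * ((x : ℂ) ^ M / (x - 1))).re ≤ ‖l‖ * x ^ M / (1 - σ) := by
    refine (Complex.re_le_norm _).trans (le_of_eq ?_)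
    rw [norm_mul, norm_div, norm_pow, Complex.norm_real, Real.norm_of_nonneg (by linarith), ← Complex.ofReal_one, ← Complex.ofReal_sub,
      Complex.norm_real, Real.norm_of_nonneg (by linarith), show x - 1 = 1 - σ by rw [hx]; ring, mul_div_assoc]
  linarith
end WCL

end

section

open Finset
namespace WCL
open scoped ComplexOrder

lemma zeta_est : ∃ K : ℝ, 1 ≤ K ∧ ∀ (P : ℂ → ℂ) (_ : Differentiable ℂ P) (A : ℝ) (_ : 0 ≤ A)
    (_ : ∀ s ∈ Metric.closedBall (2 : ℂ) (4 / 3), ‖P s‖ ≤ A) (_ : ∀ s : ℂ, 1 < s.re → P s ≠ 0)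
    (a : ℕ → ℂ) (_ : 0 ≤ a) (_ : ∀ s : ℂ, 1 < s.re → LSeriesSummable a s)
    (_ : ∀ s : ℂ, 1 < s.re → LSeries a s = -deriv riemannZeta s / riemannZeta s - deriv P s / P s)
    (r : ℝ) (_ : 0 ≤ r) (_ : P 2 = r) (σ : ℝ) (_ : 7 / 8 ≤ σ) (_ : σ < 1) (M : ℕ) (_ : 0 < M),
    r - K * A * (27 / 32) ^ M - ‖P 1‖ * (2 - σ) ^ M / (1 - σ) ≤ (riemannZeta σ * P σ).re := by
  obtain ⟨Kz, hKz⟩ := (isCompact_closedBall (2 : ℂ) (4 / 3)).exists_bound_of_continuousOn ZZ_diff.continuous.continuousOn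
  have hKz0 : 0 ≤ Kz := (norm_nonneg _).trans (hKz 2 (by simp; norm_num))
  refine ⟨21 * (Kz + 1), by linarith, ?_⟩
  intro P hP A hA hPA hP0 a ha hsum hL r hr hPr σ h1 h2 M hM
  have hop : IsOpen {s : ℂ | 1 < s.re} := isOpen_lt continuous_const Complex.continuous_re
  have hne : ∀ s : ℂ, 1 < s.re → s ≠ 1 := by
    rintro s hs rfl; simp at hs
  have hF : DifferentiableOn ℂ (fun s => riemannZeta s * P s) {s : ℂ | 1 < s.re} := fun s hs =>
    ((differentiableAt_riemannZeta (hne s hs)).mul (hP s)).differentiableWithinAt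
  have habs : LSeries.abscissaOfAbsConv a ≤ 1 :=
    LSeries.abscissaOfAbsConv_le_of_forall_lt_LSeriesSummable (fun y hy => hsum y (by simpa using hy))
  have habs2 : LSeries.abscissaOfAbsConv a < ((2 : ℝ) : EReal) := lt_of_le_of_lt habs (by norm_cast)
  have hh : DifferentiableOn ℂ (LSeries a) {s : ℂ | 1 < s.re} := by
    refine (LSeries_differentiableOn a).mono (fun s hs => ?_)
    exact lt_of_le_of_lt habs (by exact_mod_cast hs)
  have h2z : riemannZeta 2 = ((Real.pi ^ 2 / 6 : ℝ) : ℂ) := by rw [riemannZeta_two]; push_cast; rfl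
  have hF2 : riemannZeta 2 * P 2 = ((Real.pi ^ 2 / 6 * r : ℝ) : ℂ) := by rw [h2z, hPr]; push_cast; rfl
  have halt := alt_of_logder (fun s => riemannZeta s * P s) (LSeries a) hF hh (by
    intro s hs
    have hz0 := riemannZeta_ne_zero_of_one_le_re (s := s) (le_of_lt hs)
    have hp0 := hP0 s hs
    rw [deriv_fun_mul (differentiableAt_riemannZeta (hne s hs)) (hP s), hL s hs]
    field_simp
    ring) (by
    rw [hF2]
    exact Complex.zero_le_real.mpr (by positivity)) (fun k => by
    have := LSeries.iteratedDeriv_alternating ha habs2 k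
    simpa using this)
  set H : ℂ → ℂ := fun s => ZZ s * P s with hH
  have hHd : Differentiable ℂ H := ZZ_diff.mul hP
  have hH1 : H 1 = P 1 := by simp [hH, ZZ_one]
  have hGd : Differentiable ℂ (dslope H 1) := by
    have := (Complex.differentiableOn_dslope (f := H) (c := 1) (Filter.univ_mem)).mpr hHd.differentiableOn
    rwa [differentiableOn_univ] at this
  have hGe : ∀ s : ℂ, s ≠ 1 → dslope H 1 s = riemannZeta s * P s - P 1 / (s - 1) := by
    intro s hs
    have h0 : s - 1 ≠ 0 := sub_ne_zero.mpr hs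
    rw [dslope_of_ne _ hs, slope_def_field, hH1, hH]
    simp only []
    rw [ZZ_eq hs]
    field_simp
  have hsph : ∀ s ∈ Metric.sphere (2 : ℂ) (4 / 3), ‖dslope H 1 s‖ ≤ 3 * (Kz + 1) * A := by
    intro s hs
    rw [mem_sphere_iff_norm] at hs
    have h3 : 1 / 3 ≤ ‖s - 1‖ := by
      have : ‖s - 2‖ ≤ ‖s - 1‖ + ‖(1 : ℂ)‖ := by
        rw [show s - 2 = (s - 1) - 1 by ring]; exact norm_sub_le _ _
      rw [norm_one] at this; linarith
    have hs1 : s ≠ 1 := by rintro rfl; norm_num at h3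
    have hb : s ∈ Metric.closedBall (2 : ℂ) (4 / 3) := by rw [mem_closedBall_iff_norm]; exact hs.le
    have hb1 : (1 : ℂ) ∈ Metric.closedBall (2 : ℂ) (4 / 3) := by rw [mem_closedBall_iff_norm]; norm_num
    rw [dslope_of_ne _ hs1, slope_def_field, hH1, norm_div, div_le_iff₀ (by linarith)]
    calc _ ≤ ‖H s‖ + ‖P 1‖ := norm_sub_le _ _
      _ ≤ Kz * A + A := by
          refine add_le_add ?_ (hPA 1 hb1)
          rw [hH]; simp only []
          rw [norm_mul]
          exact mul_le_mul (hKz s hb) (hPA s hb) (norm_nonneg _) hKz0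
      _ = 3 * (Kz + 1) * A * (1 / 3) := by ring
      _ ≤ _ := by gcongr
  have key := estermann_abs (dslope H 1) hGd (P 1) (fun s => riemannZeta s * P s) (fun s hs => hGe s (hne s hs)) hF halt
    (3 * (Kz + 1) * A) (by positivity) hsph σ h1 h2 M hM
  have hσ1 : (σ : ℂ) ≠ 1 := by exact_mod_cast h2.ne
  rw [hGe σ hσ1, sub_add_cancel] at key
  refine le_trans ?_ key
  rw [hF2, Complex.ofReal_re]
  have : r ≤ Real.pi ^ 2 / 6 * r := by
    have := Real.pi_gt_three
    have : 1 ≤ Real.pi ^ 2 / 6 := by nlinarith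
    nlinarith
  have e : 7 * (3 * (Kz + 1) * A) * (27 / 32 : ℝ) ^ M = 21 * (Kz + 1) * A * (27 / 32) ^ M := by ring
  linarith

lemma real_vals {q : ℕ} (χ : DirichletCharacter ℂ q) (h : χ ^ 2 = 1) (a : ZMod q) : χ a = 0 ∨ χ a = 1 ∨ χ a = -1 :=
  MulChar.isQuadratic_iff_sq_eq_one.mpr h a

lemma zeta_est' : ∃ K : ℝ, 1 ≤ K ∧ ∀ (P : ℂ → ℂ) (_ : Differentiable ℂ P) (A : ℝ) (_ : 1 ≤ A)
    (_ : ∀ s ∈ Metric.closedBall (2 : ℂ) (4 / 3), ‖P s‖ ≤ A) (_ : ∀ s : ℂ, 1 < s.re → P s ≠ 0)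
    (a : ℕ → ℂ) (_ : 0 ≤ a) (_ : ∀ s : ℂ, 1 < s.re → LSeriesSummable a s)
    (_ : ∀ s : ℂ, 1 < s.re → LSeries a s = -deriv riemannZeta s / riemannZeta s - deriv P s / P s)
    (r : ℝ) (_ : 27 / 1000 ≤ r) (_ : P 2 = r) (σ : ℝ) (_ : 7 / 8 ≤ σ) (_ : σ < 1) (_ : (riemannZeta σ * P σ).re ≤ 0),
    1 - σ ≤ K * A ^ (7 * (1 - σ)) * ‖P 1‖ := by
  obtain ⟨K, hK, h⟩ := zeta_est
  set D : ℝ := 100 * K with hD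
  refine ⟨100 * (9 * D), by linarith, ?_⟩
  intro P hP A hA hPA hP0 a ha hsum hL r hr hPr σ h1 h2 hneg
  have hDA : 1 ≤ D * A := by nlinarith
  set M : ℕ := ⌈7 * Real.log (D * A)⌉₊ + 1 with hM
  have hlog0 : 0 ≤ Real.log (D * A) := Real.log_nonneg hDA
  have hM1 : 7 * Real.log (D * A) ≤ M := by
    rw [hM]; push_cast; linarith [Nat.le_ceil (7 * Real.log (D * A))]
  have hM2 : (M : ℝ) ≤ 7 * Real.log (D * A) + 2 := by
    rw [hM]; push_cast; linarith [Nat.ceil_lt_add_one (show 0 ≤ 7 * Real.log (D * A) by positivity)]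
  have key := h P hP A (by linarith) hPA hP0 a ha hsum hL r (by linarith) hPr σ h1 h2 M (by rw [hM]; omega)
  -- tail
  have ht : (27 / 32 : ℝ) ^ M ≤ 1 / (D * A) := by
    have e1 : (27 / 32 : ℝ) ≤ Real.exp (-(1 / 7)) := by
      have := Real.add_one_le_exp (-(1 / 7) : ℝ)
      linarith
    calc (27 / 32 : ℝ) ^ M ≤ Real.exp (-(1 / 7)) ^ M := by gcongr
      _ = Real.exp (-(M / 7)) := by rw [← Real.exp_nat_mul]; congr 1; ring
      _ ≤ Real.exp (-Real.log (D * A)) := by gcongr; linarith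
      _ = _ := by rw [Real.exp_neg, Real.exp_log (by linarith), one_div]
  have ht2 : K * A * (27 / 32) ^ M ≤ 1 / 100 := by
    calc _ ≤ K * A * (1 / (D * A)) := by gcongr
      _ = 1 / 100 := by rw [hD]; field_simp
  have hp : (2 - σ) ^ M ≤ 9 * D * A ^ (7 * (1 - σ)) := by
    have e1 : 2 - σ ≤ Real.exp (1 - σ) := by linarith [Real.add_one_le_exp (1 - σ)]
    calc (2 - σ) ^ M ≤ Real.exp (1 - σ) ^ M := by gcongr; linarith
      _ = Real.exp (M * (1 - σ)) := by rw [← Real.exp_nat_mul]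
      _ ≤ Real.exp ((7 * Real.log (D * A) + 2) * (1 - σ)) := by
          gcongr
      _ ≤ Real.exp (2 + Real.log D + Real.log A * (7 * (1 - σ))) := by
          rw [Real.log_mul (by positivity) (by positivity)]
          gcongr
          have : 0 ≤ Real.log D := Real.log_nonneg (by linarith)
          nlinarith
      _ = Real.exp 2 * D * A ^ (7 * (1 - σ)) := by
          rw [Real.exp_add, Real.exp_add, Real.exp_log (by positivity), Real.rpow_def_of_pos (by linarith)]
      _ ≤ _ := by
          gcongr
          have := Real.exp_one_lt_d9
          rw [show (2 : ℝ) = 1 + 1 by norm_num, Real.exp_add]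
          nlinarith [Real.exp_pos 1]
  have h3 : 1 / 100 ≤ ‖P 1‖ * (2 - σ) ^ M / (1 - σ) := by linarith
  rw [le_div_iff₀ (by linarith)] at h3
  have h4 : ‖P 1‖ * (2 - σ) ^ M ≤ ‖P 1‖ * (9 * D * A ^ (7 * (1 - σ))) := by gcongr
  nlinarith

lemma L_near_one {q : ℕ} [NeZero q] (χ : DirichletCharacter ℂ q) (s : ℂ) (hs : 2 ≤ s.re) : ‖χ.LFunction s - 1‖ ≤ 7 / 10 := by
  have hs1 : 1 < s.re := by linarith
  rw [χ.LFunction_eq_LSeries hs1]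
  have hS : HasSum (fun n : ℕ => LSeries.term (fun n => χ n) s n) (LSeries (fun n => χ n) s) :=
    (χ.LSeriesSummable_of_one_lt_re hs1).hasSum
  have h1 : HasSum (fun n : ℕ => if n = 1 then (1 : ℂ) else 0) 1 := hasSum_ite_eq 1 1
  have h1' : HasSum (fun n : ℕ => if n = 1 then (1 : ℝ) else 0) 1 := hasSum_ite_eq 1 1
  have h2 := hasSum_zeta_two.sub h1'
  have h3 := hS.sub h1
  rw [← h3.tsum_eq]
  refine (tsum_of_norm_bounded h2 ?_).trans ?_
  · intro n
    rcases eq_or_ne n 0 with rfl | hn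
    · simp
    rcases eq_or_ne n 1 with rfl | hn1
    · simp [LSeries.term]
    rw [if_neg hn1, if_neg hn1, sub_zero, sub_zero, LSeries.term_of_ne_zero hn, norm_div]
    have hn0 : 0 < n := Nat.pos_of_ne_zero hn
    have hn1 : (1 : ℝ) ≤ n := by exact_mod_cast hn0
    rw [Complex.norm_natCast_cpow_of_pos hn0]
    have : (n : ℝ) ^ 2 ≤ (n : ℝ) ^ s.re := by
      rw [← Real.rpow_natCast]; exact Real.rpow_le_rpow_of_exponent_le hn1 (by exact_mod_cast hs)
    exact div_le_div₀ zero_le_one (χ.norm_le_one _) (by positivity) this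
  · have := Real.pi_lt_d2
    nlinarith [Real.pi_pos]

lemma L_bd {q : ℕ} [NeZero q] (χ : DirichletCharacter ℂ q) (hχ : χ ≠ 1) (s : ℂ) (hs : s ∈ Metric.closedBall (2 : ℂ) (4 / 3)) :
    ‖χ.LFunction s‖ ≤ 60 * q := by
  have hq : (1 : ℝ) ≤ q := by exact_mod_cast Nat.pos_of_ne_zero (NeZero.ne q)
  rw [mem_closedBall_iff_norm] at hs
  have hre := (Complex.abs_re_le_norm (s - 2)).trans hs
  have him := (Complex.abs_im_le_norm (s - 2)).trans hs
  rw [Complex.sub_re, abs_le] at hre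
  rw [Complex.sub_im] at him
  norm_num at hre him
  rcases le_total 2 s.re with h | h
  · have h1 := L_near_one χ s h
    have h2 : ‖χ.LFunction s‖ ≤ ‖χ.LFunction s - 1‖ + ‖(1 : ℂ)‖ := by
      have := norm_add_le (χ.LFunction s - 1) 1
      rwa [sub_add_cancel] at this
    rw [norm_one] at h2
    linarith
  · refine (LFunction_bound hχ (1 / 3) (by norm_num) (by norm_num) s (by linarith) (by linarith)).trans ?_
    have hV := VV_ge (Nat.pos_of_ne_zero (NeZero.ne q)) s.im
    have hV2 : VV q s.im ≤ 5 * q := by unfold VV; nlinarith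
    have : VV q s.im ^ (2 * (1 / 3) : ℝ) ≤ VV q s.im ^ (1 : ℝ) :=
      Real.rpow_le_rpow_of_exponent_le (by linarith) (by norm_num)
    rw [Real.rpow_one] at this
    norm_num at this ⊢
    linarith

lemma L_real {q : ℕ} [NeZero q] (χ : DirichletCharacter ℂ q) (hχ : χ ≠ 1) (h2 : χ ^ 2 = 1) (σ : ℝ) (hσ : 0 < σ) :
    (χ.LFunction σ).im = 0 := by
  have hd := DirichletCharacter.differentiable_LFunction hχ
  have key := eqOn_half (f := χ.LFunction) (g := fun s => (starRingEnd ℂ) (χ.LFunction ((starRingEnd ℂ) s)))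
    hd.differentiableOn (fun s _ => by
      have := (hd ((starRingEnd ℂ) s)).conj_conj
      rw [Complex.conj_conj] at this
      exact this.differentiableWithinAt) (by
    intro s hs
    have hs' : 1 < ((starRingEnd ℂ) s).re := by simpa using hs
    rw [χ.LFunction_eq_LSeries hs, χ.LFunction_eq_LSeries hs', LSeries, LSeries, Complex.conj_tsum]
    refine tsum_congr (fun n => ?_)
    rcases eq_or_ne n 0 with rfl | hn
    · simp
    rw [LSeries.term_of_ne_zero hn, LSeries.term_of_ne_zero hn, map_div₀]
    congr 1
    · rcases real_vals χ h2 (n : ZMod q) with h | h | h <;> rw [h] <;> simp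
    · rw [Complex.cpow_conj]
      · simp
      · rw [Complex.natCast_arg]; exact Real.pi_pos.ne) σ (by simpa using hσ)
  simp only [Complex.conj_ofReal] at key
  exact Complex.conj_eq_iff_im.mp key.symm

lemma L_two {q : ℕ} [NeZero q] (χ : DirichletCharacter ℂ q) : 3 / 10 ≤ (χ.LFunction 2).re := by
  have h := (Complex.abs_re_le_norm _).trans (L_near_one χ 2 (by simp))
  rw [Complex.sub_re, Complex.one_re, abs_le] at h
  linarith [h.1]

lemma L_pos {q : ℕ} [NeZero q] (χ : DirichletCharacter ℂ q) (hχ : χ ≠ 1) (h2 : χ ^ 2 = 1) (σ : ℝ) (hσ : 0 < σ) (hσ2 : σ ≤ 2)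
    (hz : ∀ x : ℝ, σ ≤ x → x < 1 → χ.LFunction x ≠ 0) : 0 < (χ.LFunction σ).re := by
  by_contra hneg
  push Not at hneg
  have hc : ContinuousOn (fun x : ℝ => (χ.LFunction x).re) (Set.Icc σ 2) :=
    (Complex.continuous_re.comp ((DirichletCharacter.differentiable_LFunction hχ).continuous.comp Complex.continuous_ofReal)).continuousOn
  have h22 := L_two χ
  obtain ⟨x, hx, hx0⟩ := intermediate_value_Icc hσ2 hc (show (0 : ℝ) ∈ _ from ⟨hneg, by push_cast; linarith⟩)
  have hx00 : χ.LFunction x = 0 := Complex.ext hx0 (L_real χ hχ h2 x (by linarith [hx.1]))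
  rcases lt_or_ge x 1 with h | h
  · exact hz x hx.1 h hx00
  · exact DirichletCharacter.LFunction_ne_zero_of_one_le_re χ (Or.inl hχ) (by simpa using h) hx00
end WCL

end

section

open Finset
namespace WCL
open scoped ComplexOrder

lemma L_logder {q : ℕ} [NeZero q] (χ : DirichletCharacter ℂ q) {s : ℂ} (hs : 1 < s.re) :
    LSeries ((fun n : ℕ => χ (n : ZMod q)) * fun n : ℕ => ((ArithmeticFunction.vonMangoldt n : ℝ) : ℂ)) s = -(deriv χ.LFunction s / χ.LFunction s) := by
  rw [χ.LSeries_twist_vonMangoldt_eq hs, χ.deriv_LFunction_eq_deriv_LSeries hs, χ.LFunction_eq_LSeries hs, neg_div]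

lemma L_ne {q : ℕ} [NeZero q] {χ : DirichletCharacter ℂ q} (hχ : χ ≠ 1) {s : ℂ} (hs : 1 < s.re) : χ.LFunction s ≠ 0 :=
  DirichletCharacter.LFunction_ne_zero_of_one_le_re χ (Or.inl hχ) hs.le

lemma L_two_real {q : ℕ} [NeZero q] {χ : DirichletCharacter ℂ q} (hχ : χ ≠ 1) (h2 : χ ^ 2 = 1) :
    χ.LFunction 2 = (((χ.LFunction 2).re : ℝ) : ℂ) := by
  refine Complex.ext (by simp) ?_
  have := L_real χ hχ h2 2 (by norm_num)
  push_cast at this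
  simpa using this

lemma siegel_A : ∃ K : ℝ, 1 ≤ K ∧ ∀ (q : ℕ) [NeZero q] (χ : DirichletCharacter ℂ q), χ ≠ 1 → χ ^ 2 = 1 → ∀ σ : ℝ, 7 / 8 ≤ σ → σ < 1 →
    (riemannZeta σ * χ.LFunction σ).re ≤ 0 → 1 - σ ≤ K * (60 * (q : ℝ)) ^ (7 * (1 - σ)) * ‖χ.LFunction 1‖ := by
  obtain ⟨K, hK, h⟩ := zeta_est'
  refine ⟨K, hK, ?_⟩
  intro q _ χ hχ h2 σ h1 hσ hneg
  have hq : (1 : ℝ) ≤ q := by exact_mod_cast Nat.pos_of_ne_zero (NeZero.ne q)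
  refine h χ.LFunction (DirichletCharacter.differentiable_LFunction hχ) (60 * q) (by linarith) (fun s hs => L_bd χ hχ s hs)
    (fun s hs => L_ne hχ hs) ((fun n : ℕ => ((ArithmeticFunction.vonMangoldt n : ℝ) : ℂ)) + (fun n : ℕ => χ (n : ZMod q)) * fun n : ℕ => ((ArithmeticFunction.vonMangoldt n : ℝ) : ℂ))
    ?_ ?_ ?_ ((χ.LFunction 2).re) (by linarith [L_two χ]) (L_two_real hχ h2) σ h1 hσ hneg
  · intro n
    simp only [Pi.add_apply, Pi.mul_apply, Pi.zero_apply]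
    have hL : (0 : ℂ) ≤ ((ArithmeticFunction.vonMangoldt n : ℝ) : ℂ) := Complex.zero_le_real.mpr ArithmeticFunction.vonMangoldt_nonneg
    rcases real_vals χ h2 (n : ZMod q) with h | h | h <;> rw [h]
    · simpa using hL
    · simpa using add_nonneg hL hL
    · simp
  · intro s hs
    exact (ArithmeticFunction.LSeriesSummable_vonMangoldt hs).add (χ.LSeriesSummable_twist_vonMangoldt hs)
  · intro s hs
    rw [LSeries_add (ArithmeticFunction.LSeriesSummable_vonMangoldt hs) (χ.LSeriesSummable_twist_vonMangoldt hs), L_logder χ hs,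
      ArithmeticFunction.LSeries_vonMangoldt_eq_deriv_riemannZeta_div hs, ← sub_eq_add_neg]

lemma siegel_B : ∃ K : ℝ, 1 ≤ K ∧ ∀ (q : ℕ) [NeZero q] (χ ψ : DirichletCharacter ℂ q), χ ≠ 1 → χ ^ 2 = 1 → ψ ≠ 1 → ψ ^ 2 = 1 → χ * ψ ≠ 1 →
    ∀ σ : ℝ, 7 / 8 ≤ σ → σ < 1 → χ.LFunction σ = 0 →
    1 - σ ≤ K * ((60 * (q : ℝ)) ^ 3) ^ (7 * (1 - σ)) * (‖χ.LFunction 1‖ * ‖ψ.LFunction 1‖ * ‖(χ * ψ).LFunction 1‖) := by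
  obtain ⟨K, hK, h⟩ := zeta_est'
  refine ⟨K, hK, ?_⟩
  intro q _ χ ψ hχ hχ2 hψ hψ2 hχψ σ h1 hσ hzero
  have hq : (1 : ℝ) ≤ q := by exact_mod_cast Nat.pos_of_ne_zero (NeZero.ne q)
  have hχψ2 : (χ * ψ) ^ 2 = 1 := by rw [mul_pow, hχ2, hψ2, one_mul]
  have d1 := DirichletCharacter.differentiable_LFunction hχ
  have d2 := DirichletCharacter.differentiable_LFunction hψ
  have d3 := DirichletCharacter.differentiable_LFunction hχψ
  rw [← norm_mul, ← norm_mul]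
  have t1 := L_two χ
  have t2 := L_two ψ
  have t3 := L_two (χ * ψ)
  refine h (fun s => χ.LFunction s * ψ.LFunction s * (χ * ψ).LFunction s) ((d1.mul d2).mul d3) ((60 * q) ^ 3) (one_le_pow₀ (by linarith)) ?_
    (fun s hs => mul_ne_zero (mul_ne_zero (L_ne hχ hs) (L_ne hψ hs)) (L_ne hχψ hs))
    (((fun n : ℕ => ((ArithmeticFunction.vonMangoldt n : ℝ) : ℂ)) + (fun n : ℕ => χ (n : ZMod q)) * fun n : ℕ => ((ArithmeticFunction.vonMangoldt n : ℝ) : ℂ)) +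
      ((fun n : ℕ => ψ (n : ZMod q)) * (fun n : ℕ => ((ArithmeticFunction.vonMangoldt n : ℝ) : ℂ)) + (fun n : ℕ => (χ * ψ) (n : ZMod q)) * fun n : ℕ => ((ArithmeticFunction.vonMangoldt n : ℝ) : ℂ)))
    ?_ ?_ ?_ ((χ.LFunction 2).re * (ψ.LFunction 2).re * ((χ * ψ).LFunction 2).re) ?_ ?_ σ h1 hσ ?_
  · intro s hs
    rw [norm_mul, norm_mul, pow_succ, pow_two]
    have := L_bd χ hχ s hs
    have := L_bd ψ hψ s hs
    have := L_bd (χ * ψ) hχψ s hs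
    gcongr
  · intro n
    simp only [Pi.add_apply, Pi.mul_apply, Pi.zero_apply, MulChar.mul_apply]
    have hL : (0 : ℂ) ≤ ((ArithmeticFunction.vonMangoldt n : ℝ) : ℂ) := Complex.zero_le_real.mpr ArithmeticFunction.vonMangoldt_nonneg
    have h2L := add_nonneg hL hL
    rcases real_vals χ hχ2 (n : ZMod q) with h | h | h <;> rw [h] <;>
    rcases real_vals ψ hψ2 (n : ZMod q) with h' | h' | h' <;> rw [h'] <;> simp [hL, h2L, add_nonneg h2L h2L]
  · intro s hs
    exact ((ArithmeticFunction.LSeriesSummable_vonMangoldt hs).add (χ.LSeriesSummable_twist_vonMangoldt hs)).add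
      ((ψ.LSeriesSummable_twist_vonMangoldt hs).add ((χ * ψ).LSeriesSummable_twist_vonMangoldt hs))
  · intro s hs
    rw [LSeries_add ((ArithmeticFunction.LSeriesSummable_vonMangoldt hs).add (χ.LSeriesSummable_twist_vonMangoldt hs))
      ((ψ.LSeriesSummable_twist_vonMangoldt hs).add ((χ * ψ).LSeriesSummable_twist_vonMangoldt hs)),
      LSeries_add (ArithmeticFunction.LSeriesSummable_vonMangoldt hs) (χ.LSeriesSummable_twist_vonMangoldt hs),
      LSeries_add (ψ.LSeriesSummable_twist_vonMangoldt hs) ((χ * ψ).LSeriesSummable_twist_vonMangoldt hs), L_logder χ hs, L_logder ψ hs,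
      L_logder (χ * ψ) hs, ArithmeticFunction.LSeries_vonMangoldt_eq_deriv_riemannZeta_div hs,
      deriv_fun_mul ((d1 s).fun_mul (d2 s)) (d3 s), deriv_fun_mul (d1 s) (d2 s)]
    have n1 := L_ne hχ hs
    have n2 := L_ne hψ hs
    have n3 := L_ne hχψ hs
    have n0 := riemannZeta_ne_zero_of_one_le_re (s := s) (le_of_lt hs)
    field_simp
    ring
  · calc (27 / 1000 : ℝ) = 3 / 10 * (3 / 10) * (3 / 10) := by norm_num
      _ ≤ _ := by gcongr
  · rw [L_two_real hχ hχ2, L_two_real hψ hψ2, L_two_real hχψ hχψ2]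
    push_cast
    simp
  · rw [hzero]; simp

lemma euler_bd {q : ℕ} (χ : DirichletCharacter ℂ q) (Q : ℕ) (hQ : 0 < Q) :
    ‖∏ p ∈ Q.primeFactors, (1 - χ p * (p : ℂ) ^ (-(1 : ℂ)))‖ ≤ 1 + 2 * Real.log Q ∧
    (1 + 2 * Real.log Q)⁻¹ ≤ ‖∏ p ∈ Q.primeFactors, (1 - χ p * (p : ℂ) ^ (-(1 : ℂ)))‖ := by
  have hlog : 0 ≤ Real.log Q := Real.log_natCast_nonneg Q
  have h0 := prod_pf_le Q hQ
  have hb : ∀ p ∈ Q.primeFactors, ‖χ p * (p : ℂ) ^ (-(1 : ℂ))‖ ≤ 1 / (p : ℝ) := by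
    intro p hp
    rw [norm_mul, Complex.cpow_neg_one, norm_inv, Complex.norm_natCast, one_div]
    have := χ.norm_le_one p
    have : (0 : ℝ) ≤ (p : ℝ)⁻¹ := by positivity
    nlinarith
  have hp2 : ∀ p ∈ Q.primeFactors, (2 : ℝ) ≤ p := fun p hp => by exact_mod_cast (Nat.prime_of_mem_primeFactors hp).two_le
  rw [norm_prod]
  constructor
  · refine le_trans (prod_le_prod (fun _ _ => norm_nonneg _) (fun p hp => ?_)) h0
    have h2 := hp2 p hp
    calc ‖1 - χ p * (p : ℂ) ^ (-(1 : ℂ))‖ ≤ ‖(1 : ℂ)‖ + ‖χ p * (p : ℂ) ^ (-(1 : ℂ))‖ := norm_sub_le _ _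
      _ ≤ 1 + 1 / (p : ℝ) := by rw [norm_one]; linarith [hb p hp]
      _ ≤ _ := by
        rw [show 1 + 1 / (p : ℝ) = (p + 1) / p by field_simp, div_le_div_iff₀ (by linarith) (by linarith)]; nlinarith
  · have h3 : (1 + 2 * Real.log Q)⁻¹ ≤ (∏ p ∈ Q.primeFactors, (p : ℝ) / (p - 1))⁻¹ := by
      refine inv_anti₀ (prod_pos (fun p hp => ?_)) h0
      have h2 := hp2 p hp
      exact div_pos (by linarith) (by linarith)
    refine h3.trans ?_
    rw [← prod_inv_distrib]
    refine prod_le_prod (fun p hp => ?_) (fun p hp => ?_)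
    · have h2 := hp2 p hp
      exact inv_nonneg.mpr (div_nonneg (by linarith) (by linarith))
    · have h2 := hp2 p hp
      have := norm_sub_norm_le (1 : ℂ) (χ p * (p : ℂ) ^ (-(1 : ℂ)))
      rw [norm_one] at this
      have e : ((p : ℝ) / (p - 1))⁻¹ = 1 - 1 / p := by rw [inv_div]; field_simp
      rw [e]
      linarith [hb p hp]

lemma log_le_pow {ε : ℝ} (hε : 0 < ε) (hε1 : ε ≤ 1) {x : ℝ} (hx : 1 ≤ x) : 1 + 2 * Real.log x ≤ 3 / ε * x ^ ε := by
  have h1 := Real.log_le_rpow_div (by linarith : 0 ≤ x) hε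
  have h2 : 1 ≤ x ^ ε := Real.one_le_rpow hx hε.le
  have h3 : 1 ≤ x ^ ε / ε := by rw [le_div_iff₀ hε]; linarith
  have : 3 / ε * x ^ ε = 3 * (x ^ ε / ε) := by ring
  linarith

set_option maxHeartbeats 1000000 in
theorem siegel_lt (ε : ℝ) (hε : 0 < ε) (hε1 : ε ≤ 1) : ∃ c : ℝ, 0 < c ∧ ∀ (q : ℕ) [NeZero q] (χ : DirichletCharacter ℂ q), χ ≠ 1 → χ ^ 2 = 1 →
    c * (q : ℝ) ^ (-ε) ≤ ‖χ.LFunction 1‖ := by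
  -- a neighbourhood of 1 where ζ has negative real part to the left
  have hcont : Filter.Tendsto (fun x : ℝ => (ZZ ((1 - x : ℝ) : ℂ)).re) (nhds 0) (nhds 1) := by
    have : Continuous (fun x : ℝ => (ZZ ((1 - x : ℝ) : ℂ)).re) := by
      have := ZZ_diff.continuous
      fun_prop
    have h := this.tendsto 0
    simpa [ZZ_one] using h
  obtain ⟨η, hη, hη1⟩ := Metric.eventually_nhds_iff.mp (hcont.eventually (lt_mem_nhds (zero_lt_one)))
  set e : ℝ := min (ε / 100) (η / 2) with he
  have he0 : 0 < e := by rw [he]; exact lt_min (by linarith) (by linarith)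
  have heε : e ≤ ε / 100 := min_le_left _ _
  have heη : e < η := lt_of_le_of_lt (min_le_right _ _) (by linarith)
  have hzneg : (riemannZeta ((1 - e : ℝ) : ℂ)).re ≤ 0 := by
    have h1 := hη1 (show dist e 0 < η by rw [Real.dist_eq, sub_zero, abs_of_pos he0]; exact heη)
    have hne : (((1 - e : ℝ)) : ℂ) ≠ 1 := by
      have : (1 - e : ℝ) ≠ 1 := by linarith
      exact_mod_cast this
    rw [ZZ_eq hne, show (((1 - e : ℝ)) : ℂ) - 1 = ((-e : ℝ) : ℂ) by push_cast; ring, Complex.re_ofReal_mul] at h1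
    by_contra hc
    push Not at hc
    nlinarith
  by_cases hcase : ∀ (q : ℕ) [NeZero q] (χ : DirichletCharacter ℂ q), χ ≠ 1 → χ ^ 2 = 1 → ∀ x : ℝ, 1 - e ≤ x → x < 1 → χ.LFunction x ≠ 0
  · obtain ⟨K, hK, h⟩ := siegel_A
    refine ⟨e / (K * 60), by positivity, ?_⟩
    intro q _ χ hχ h2
    have hq : (1 : ℝ) ≤ q := by exact_mod_cast Nat.pos_of_ne_zero (NeZero.ne q)
    have hpos := L_pos χ hχ h2 (1 - e) (by linarith) (by linarith) (hcase q χ hχ h2)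
    have him := L_real χ hχ h2 (1 - e) (by linarith)
    have := h q χ hχ h2 (1 - e) (by linarith) (by linarith) (by rw [Complex.mul_re, him, mul_zero, sub_zero]; nlinarith)
    rw [sub_sub_cancel] at this
    have h60 : (60 * (q : ℝ)) ^ (7 * e) ≤ 60 * (q : ℝ) ^ ε := by
      rw [Real.mul_rpow (by norm_num) (by linarith)]
      gcongr
      · calc (60 : ℝ) ^ (7 * e) ≤ 60 ^ (1 : ℝ) := Real.rpow_le_rpow_of_exponent_le (by norm_num) (by linarith)
          _ = 60 := Real.rpow_one _
      · linarith
    rw [Real.rpow_neg (by linarith), ← div_eq_mul_inv, div_div, div_le_iff₀ (by positivity)]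
    calc e ≤ K * (60 * (q : ℝ)) ^ (7 * e) * ‖χ.LFunction 1‖ := this
      _ ≤ K * (60 * (q : ℝ) ^ ε) * ‖χ.LFunction 1‖ := by gcongr
      _ = _ := by ring
  · push Not at hcase
    obtain ⟨q₁, hq1, χ₁, hχ1, hχ12, x, hx1, hx2, hzero⟩ := hcase
    obtain ⟨K, hK, h⟩ := siegel_B
    obtain ⟨C, hC, hub⟩ := UB1 e he0 (by linarith)
    have hq1' : (1 : ℝ) ≤ q₁ := by exact_mod_cast Nat.pos_of_ne_zero (NeZero.ne q₁)
    set l₁ : ℝ := ‖χ₁.LFunction 1‖ with hl1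
    have hl1pos : 0 < l₁ := norm_pos_iff.mpr (DirichletCharacter.LFunction_ne_zero_of_one_le_re χ₁ (Or.inl hχ1) (by simp))
    set D : ℝ := 3 / e with hD
    have hD1 : 1 ≤ D := by rw [hD, le_div_iff₀ he0]; linarith
    set c₀ : ℝ := min (l₁ / D) ((1 - x) / (K * 60 ^ 3 * (C * 3) ^ 2)) with hc0
    have hc0pos : 0 < c₀ := by
      rw [hc0]; exact lt_min (by positivity) (div_pos (by linarith) (by positivity))
    refine ⟨c₀ / D * (q₁ : ℝ) ^ (-ε), by positivity, ?_⟩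
    intro q _ χ hχ h2
    have hq : (1 : ℝ) ≤ q := by exact_mod_cast Nat.pos_of_ne_zero (NeZero.ne q)
    set Q : ℕ := q₁ * q with hQ
    haveI : NeZero Q := ⟨mul_ne_zero (NeZero.ne q₁) (NeZero.ne q)⟩
    have hQ1 : (1 : ℝ) ≤ Q := by exact_mod_cast Nat.pos_of_ne_zero (NeZero.ne Q)
    have hQ0 : 0 < Q := Nat.pos_of_ne_zero (NeZero.ne Q)
    have d1 : q₁ ∣ Q := dvd_mul_right _ _
    have d2 : q ∣ Q := dvd_mul_left _ _
    set χ' := DirichletCharacter.changeLevel d2 χ with hχ'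
    set χ₁' := DirichletCharacter.changeLevel d1 χ₁ with hχ1'
    have n1 : χ₁' ≠ 1 := fun hh => hχ1 ((DirichletCharacter.changeLevel_eq_one_iff d1).mp hh)
    have n2 : χ' ≠ 1 := fun hh => hχ ((DirichletCharacter.changeLevel_eq_one_iff d2).mp hh)
    have s1 : χ₁' ^ 2 = 1 := by rw [hχ1', ← map_pow, hχ12, map_one]
    have s2 : χ' ^ 2 = 1 := by rw [hχ', ← map_pow, h2, map_one]
    have E1 := DirichletCharacter.LFunction_changeLevel d1 χ₁ (s := 1) (Or.inl hχ1)
    have E2 := DirichletCharacter.LFunction_changeLevel d2 χ (s := 1) (Or.inl hχ)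
    have b1 := euler_bd χ₁ Q hQ0
    have b2 := euler_bd χ Q hQ0
    have hlog := log_le_pow he0 (by linarith) hQ1
    have hlog0 : 0 ≤ Real.log Q := Real.log_natCast_nonneg Q
    have hQe : 1 ≤ (Q : ℝ) ^ e := Real.one_le_rpow hQ1 he0.le
    have F2 : ‖χ'.LFunction 1‖ ≤ ‖χ.LFunction 1‖ * (D * (Q : ℝ) ^ e) := by
      rw [E2, norm_mul]; gcongr; exact b2.1.trans hlog
    have Qpow : ∀ n : ℕ, ((Q : ℝ) ^ e) ^ n = (Q : ℝ) ^ (n * e) := by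
      intro n; rw [← Real.rpow_natCast, ← Real.rpow_mul (by linarith)]; congr 1; ring
    have main : c₀ ≤ ‖χ'.LFunction 1‖ * ((Q : ℝ) ^ e) ^ 23 := by
      by_cases hp : χ₁' * χ' = 1
      · have heq : χ' = χ₁' := by
          calc χ' = χ₁' ^ 2 * χ' := by rw [s1, one_mul]
            _ = χ₁' * (χ₁' * χ') := by rw [pow_two, mul_assoc]
            _ = χ₁' := by rw [hp, mul_one]
        rw [heq, E1, norm_mul, ← hl1]
        have h5 : (D * (Q : ℝ) ^ e)⁻¹ ≤ ‖∏ p ∈ Q.primeFactors, (1 - χ₁ p * (p : ℂ) ^ (-(1 : ℂ)))‖ :=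
          (inv_anti₀ (by linarith) hlog).trans b1.2
        calc c₀ ≤ l₁ / D := min_le_left _ _
          _ = l₁ * (D * (Q : ℝ) ^ e)⁻¹ * (Q : ℝ) ^ e := by field_simp
          _ ≤ l₁ * ‖∏ p ∈ Q.primeFactors, (1 - χ₁ p * (p : ℂ) ^ (-(1 : ℂ)))‖ * ((Q : ℝ) ^ e) ^ 23 := by
              gcongr
              exact le_self_pow₀ hQe (by norm_num)
      · have hz' : χ₁'.LFunction x = 0 := by
          rw [DirichletCharacter.LFunction_changeLevel d1 χ₁ (s := x) (Or.inl hχ1), hzero, zero_mul]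
        have key := h Q χ₁' χ' n1 s1 n2 s2 hp x (by linarith) hx2 hz'
        have hV : VV Q (1 : ℂ).im ^ e ≤ 3 * (Q : ℝ) ^ e := by
          have : VV Q (1 : ℂ).im = 3 * Q := by unfold VV; simp; ring
          rw [this, Real.mul_rpow (by norm_num) (by linarith)]
          gcongr
          calc (3 : ℝ) ^ e ≤ 3 ^ (1 : ℝ) := Real.rpow_le_rpow_of_exponent_le (by norm_num) (by linarith)
            _ = 3 := Real.rpow_one _
        have u1 : ‖χ₁'.LFunction 1‖ ≤ C * (3 * (Q : ℝ) ^ e) :=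
          (hub Q χ₁' n1 1 (by simp) (by simp) 1 (by simp; linarith)).trans (by gcongr)
        have u3 : ‖(χ₁' * χ').LFunction 1‖ ≤ C * (3 * (Q : ℝ) ^ e) :=
          (hub Q (χ₁' * χ') hp 1 (by simp) (by simp) 1 (by simp; linarith)).trans (by gcongr)
        have hA : ((60 * (Q : ℝ)) ^ 3) ^ (7 * (1 - x)) ≤ 60 ^ 3 * ((Q : ℝ) ^ e) ^ 21 := by
          rw [mul_pow, Real.mul_rpow (by positivity) (by positivity), Qpow 21]
          gcongr
          · calc ((60 : ℝ) ^ 3) ^ (7 * (1 - x)) ≤ ((60 : ℝ) ^ 3) ^ (1 : ℝ) := Real.rpow_le_rpow_of_exponent_le (by norm_num) (by linarith)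
              _ = 60 ^ 3 := Real.rpow_one _
          · rw [← Real.rpow_natCast, ← Real.rpow_mul (by linarith)]
            exact Real.rpow_le_rpow_of_exponent_le hQ1 (by push_cast; linarith)
        refine (min_le_right _ _).trans ?_
        rw [div_le_iff₀ (by positivity)]
        calc 1 - x ≤ K * ((60 * (Q : ℝ)) ^ 3) ^ (7 * (1 - x)) * (‖χ₁'.LFunction 1‖ * ‖χ'.LFunction 1‖ * ‖(χ₁' * χ').LFunction 1‖) := key
          _ ≤ K * (60 ^ 3 * ((Q : ℝ) ^ e) ^ 21) * ((C * (3 * (Q : ℝ) ^ e)) * ‖χ'.LFunction 1‖ * (C * (3 * (Q : ℝ) ^ e))) := by gcongr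
          _ = _ := by ring
    have h24 : ((Q : ℝ) ^ e) ^ 24 ≤ (q₁ : ℝ) ^ ε * (q : ℝ) ^ ε := by
      rw [Qpow 24, ← Real.mul_rpow (by linarith) (by linarith), hQ]
      push_cast
      refine Real.rpow_le_rpow_of_exponent_le (by nlinarith) (by linarith)
    rw [Real.rpow_neg (by linarith), Real.rpow_neg (by linarith)]
    rw [show c₀ / D * ((q₁ : ℝ) ^ ε)⁻¹ * ((q : ℝ) ^ ε)⁻¹ = c₀ / (D * ((q₁ : ℝ) ^ ε * (q : ℝ) ^ ε)) by field_simp, div_le_iff₀ (by positivity)]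
    calc c₀ ≤ ‖χ'.LFunction 1‖ * ((Q : ℝ) ^ e) ^ 23 := main
      _ ≤ ‖χ.LFunction 1‖ * (D * (Q : ℝ) ^ e) * ((Q : ℝ) ^ e) ^ 23 := by gcongr
      _ = ‖χ.LFunction 1‖ * (D * ((Q : ℝ) ^ e) ^ 24) := by ring
      _ ≤ _ := by gcongr

theorem siegel : SiegelHyp := by
  intro ε hε
  obtain ⟨c, hc, h⟩ := siegel_lt (min ε 1) (lt_min hε one_pos) (min_le_right _ _)
  refine ⟨min c 1, lt_min hc one_pos, min_le_right _ _, ?_⟩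
  intro q _ χ hχ h2
  have hq : (1 : ℝ) ≤ q := by exact_mod_cast Nat.pos_of_ne_zero (NeZero.ne q)
  refine le_trans ?_ (h q χ hχ h2)
  gcongr
  · exact min_le_left _ _
  · exact min_le_left _ _
end WCL

end

section

open Finset
namespace WCL
open MeasureTheory

noncomputable def pf : ℝ → ℂ := fun y => (Set.Ioc (0 : ℝ) 1).indicator (fun _ => (1 : ℂ)) y - (Set.Ioc (0 : ℝ) 1).indicator (fun t : ℝ => (t : ℂ) ^ (1 : ℂ)) y

noncomputable def pk (s : ℂ) : ℂ := 1 / s - 1 / (s + 1)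

lemma pf_mellin {s : ℂ} (hs : 0 < s.re) : HasMellin pf s (pk s) := by
  have h1 := hasMellin_one_Ioc hs
  have h2 := hasMellin_cpow_Ioc 1 (s := s) (by simp; linarith)
  have := hasMellin_sub h1.1 h2.1
  rw [h1.2, h2.2] at this
  exact this

lemma pf_eq {y : ℝ} (hy : 0 < y) : pf y = ((max (1 - y) 0 : ℝ) : ℂ) := by
  unfold pf
  by_cases h : y ≤ 1
  · have hm : y ∈ Set.Ioc (0 : ℝ) 1 := ⟨hy, h⟩
    rw [Set.indicator_of_mem hm, Set.indicator_of_mem hm, max_eq_left (by linarith), Complex.cpow_one]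
    push_cast; rfl
  · have hm : y ∉ Set.Ioc (0 : ℝ) 1 := fun hh => h hh.2
    push Not at h
    rw [Set.indicator_of_notMem hm, Set.indicator_of_notMem hm, max_eq_right (by linarith)]
    simp

lemma pk_bound (σ t : ℝ) (hσ : 1 ≤ σ) : ‖pk (σ + t * Complex.I)‖ ≤ (1 + t ^ 2)⁻¹ := by
  set s : ℂ := σ + t * Complex.I with hs
  have hre : s.re = σ := by simp [hs]
  have him : s.im = t := by simp [hs]
  have hs0 : s ≠ 0 := by intro h; rw [h] at hre; simp at hre; linarith
  have hs1 : s + 1 ≠ 0 := by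
    intro h
    have := congrArg Complex.re h
    rw [Complex.add_re, hre] at this; simp at this; linarith
  have e : pk s = 1 / (s * (s + 1)) := by unfold pk; field_simp; ring
  have hp : 0 < 1 + t ^ 2 := by positivity
  rw [e, norm_div, norm_one, norm_mul, ← one_div]
  refine one_div_le_one_div_of_le hp ?_
  have h1 : Real.sqrt (1 + t ^ 2) ≤ ‖s‖ := by
    rw [Complex.norm_eq_sqrt_sq_add_sq, hre, him]
    exact Real.sqrt_le_sqrt (by nlinarith)
  have h2 : Real.sqrt (1 + t ^ 2) ≤ ‖s + 1‖ := by
    rw [Complex.norm_eq_sqrt_sq_add_sq, Complex.add_re, Complex.add_im, hre, him, Complex.one_re, Complex.one_im, add_zero]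
    exact Real.sqrt_le_sqrt (by nlinarith)
  calc 1 + t ^ 2 = Real.sqrt (1 + t ^ 2) * Real.sqrt (1 + t ^ 2) := (Real.mul_self_sqrt hp.le).symm
    _ ≤ _ := by gcongr

lemma pk_cont (σ : ℝ) (hσ : 1 ≤ σ) : Continuous (fun t : ℝ => pk (σ + t * Complex.I)) := by
  unfold pk
  have h0 : ∀ t : ℝ, (σ : ℂ) + t * Complex.I ≠ 0 := by
    intro t h
    have := congrArg Complex.re h
    simp at this; linarith
  have h1 : ∀ t : ℝ, (σ : ℂ) + t * Complex.I + 1 ≠ 0 := by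
    intro t h
    have := congrArg Complex.re h
    simp at this; linarith
  refine Continuous.sub (Continuous.div continuous_const (by fun_prop) h0) (Continuous.div continuous_const (by fun_prop) h1)

lemma pk_int (σ : ℝ) (hσ : 1 ≤ σ) : Integrable (fun t : ℝ => pk (σ + t * Complex.I)) := by
  refine Integrable.mono' integrable_inv_one_add_sq (pk_cont σ hσ).aestronglyMeasurable ?_
  filter_upwards with t
  exact pk_bound σ t hσ

lemma perron_one (σ : ℝ) (hσ : 1 ≤ σ) {x : ℝ} (hx : 0 < x) :
    (1 / (2 * Real.pi)) • ∫ t : ℝ, (x : ℂ) ^ (-((σ : ℂ) + t * Complex.I)) * pk (σ + t * Complex.I) = ((max (1 - x) 0 : ℝ) : ℂ) := by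
  have hm : ∀ t : ℝ, mellin pf (σ + t * Complex.I) = pk (σ + t * Complex.I) := fun t => (pf_mellin (by simp; linarith)).2
  have hca : ContinuousAt pf x := by
    have : pf =ᶠ[nhds x] fun y => ((max (1 - y) 0 : ℝ) : ℂ) := by
      filter_upwards [lt_mem_nhds hx] with y hy
      exact pf_eq hy
    refine ContinuousAt.congr ?_ this.symm
    have : Continuous (fun y : ℝ => ((max (1 - y) 0 : ℝ) : ℂ)) := by fun_prop
    exact this.continuousAt
  have key := mellinInv_mellin_eq σ pf hx (pf_mellin (s := σ) (by simp; linarith)).1 (by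
    unfold Complex.VerticalIntegrable
    simp only [hm]
    exact pk_int σ hσ) hca
  rw [pf_eq hx] at key
  rw [← key, mellinInv]
  simp only [hm, smul_eq_mul]

noncomputable def C0 : ℝ := 8 * (1 + ∫ t : ℝ, (1 + ‖t‖ ^ 2) ^ (-(3 / 2 : ℝ) / 2))

lemma C0_int : Integrable (fun t : ℝ => (1 + ‖t‖ ^ 2) ^ (-(3 / 2 : ℝ) / 2)) :=
  integrable_rpow_neg_one_add_norm_sq (by simp; norm_num)

lemma C0_ge : 8 ≤ C0 := by
  unfold C0
  have : 0 ≤ ∫ t : ℝ, (1 + ‖t‖ ^ 2) ^ (-(3 / 2 : ℝ) / 2) := integral_nonneg (fun t => by positivity)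
  linarith

lemma weight_le (t : ℝ) : (|t| + 3) ^ ((1 : ℝ) / 2) * (1 + t ^ 2)⁻¹ ≤ 2 * (1 + ‖t‖ ^ 2) ^ (-(3 / 2 : ℝ) / 2) := by
  have hp : (1 : ℝ) ≤ 1 + t ^ 2 := by nlinarith [sq_nonneg t]
  have h1 : |t| ≤ (1 + t ^ 2) ^ ((1 : ℝ) / 2) := by
    rw [← Real.sqrt_eq_rpow]
    exact Real.abs_le_sqrt (by linarith)
  have h2 : 1 ≤ (1 + t ^ 2) ^ ((1 : ℝ) / 2) := Real.one_le_rpow hp (by norm_num)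
  have h3 : |t| + 3 ≤ 4 * (1 + t ^ 2) ^ ((1 : ℝ) / 2) := by linarith
  have h4 : (|t| + 3) ^ ((1 : ℝ) / 2) ≤ 2 * (1 + t ^ 2) ^ ((1 : ℝ) / 4) := by
    calc _ ≤ (4 * (1 + t ^ 2) ^ ((1 : ℝ) / 2)) ^ ((1 : ℝ) / 2) := by gcongr
      _ = 2 * (1 + t ^ 2) ^ ((1 : ℝ) / 4) := by
        rw [Real.mul_rpow (by norm_num) (by positivity), ← Real.rpow_mul (by linarith), show (4 : ℝ) = 2 ^ (2 : ℝ) by norm_num, ← Real.rpow_mul (by norm_num)]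
        norm_num
  rw [Real.norm_eq_abs, sq_abs]
  calc _ ≤ 2 * (1 + t ^ 2) ^ ((1 : ℝ) / 4) * (1 + t ^ 2) ^ (-1 : ℝ) := by
        rw [Real.rpow_neg_one]; gcongr
    _ = _ := by rw [mul_assoc, ← Real.rpow_add (by linarith)]; norm_num

end WCL

end

section

open Finset
namespace WCL
open MeasureTheory

lemma ratio_cpow {n N : ℕ} (hn : 0 < n) (hN : 0 < N) (s : ℂ) :
    (((n : ℝ) / N : ℝ) : ℂ) ^ (-s) = (N : ℂ) ^ s / (n : ℂ) ^ s := by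
  have hn0 : (0 : ℝ) < n := by exact_mod_cast hn
  have hN0 : (0 : ℝ) < N := by exact_mod_cast hN
  rw [Complex.cpow_neg]
  have e : (n : ℂ) ^ s = (((n : ℝ) / N : ℝ) : ℂ) ^ s * (N : ℂ) ^ s := by
    rw [← Complex.ofReal_natCast N, ← Complex.mul_cpow_ofReal_nonneg (by positivity) hN0.le, ← Complex.ofReal_mul, div_mul_cancel₀ _ hN0.ne',
      Complex.ofReal_natCast]
  have h1 : (((n : ℝ) / N : ℝ) : ℂ) ^ s ≠ 0 := by
    rw [Complex.cpow_ne_zero_iff]; left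
    exact_mod_cast (div_pos hn0 hN0).ne'
  have h2 : (N : ℂ) ^ s ≠ 0 := by
    rw [Complex.cpow_ne_zero_iff]; left
    exact_mod_cast hN.ne'
  rw [e]; field_simp

theorem perron_bound (b : ℕ → ℂ) (hsum : ∀ s : ℂ, 1 < s.re → LSeriesSummable b s) (R : ℝ) (hR0 : 0 ≤ R)
    (hR : ∀ s : ℂ, 1 < s.re → s.re ≤ 2 → ‖LSeries b s‖ ≤ R * (|s.im| + 3) ^ ((1 : ℝ) / 2)) (N : ℕ) (hN : 3 ≤ N) :
    ‖∑ n ∈ Ioc 0 N, b n * ((N : ℂ) - n)‖ ≤ C0 * R * (N : ℝ) ^ 2 := by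
  have hN0 : (0 : ℝ) < N := by positivity
  have hN1 : 0 < N := by omega
  have hlog : 1 < Real.log N := by
    rw [Real.lt_log_iff_exp_lt hN0]
    have : (3 : ℝ) ≤ N := by exact_mod_cast hN
    linarith [Real.exp_one_lt_d9]
  set σ : ℝ := 1 + 1 / Real.log N with hσ
  have hσ1 : 1 < σ := by rw [hσ]; have : 0 < 1 / Real.log N := by positivity
                         linarith
  have hσ2 : σ ≤ 2 := by
    have : 1 / Real.log N ≤ 1 := by rw [div_le_one (by linarith)]; linarith
    rw [hσ]; linarith
  have hNσ : (N : ℝ) ^ σ ≤ 3 * N := by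
    rw [hσ, Real.rpow_add hN0, Real.rpow_one, Real.rpow_def_of_pos hN0, mul_one_div_cancel (by linarith)]
    nlinarith [Real.exp_one_lt_d9]
  set sv : ℝ → ℂ := fun t => (σ : ℂ) + t * Complex.I with hsv
  have hre : ∀ t, (sv t).re = σ := fun t => by simp [hsv]
  have him : ∀ t, (sv t).im = t := fun t => by simp [hsv]
  have hsc : Continuous sv := by rw [hsv]; fun_prop
  have hNn : ∀ t, ‖(N : ℂ) ^ sv t‖ = (N : ℝ) ^ σ := fun t => by rw [Complex.norm_natCast_cpow_of_pos hN1, hre]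
  have hNc : Continuous (fun t => (N : ℂ) ^ sv t) := by
    refine Continuous.const_cpow hsc (Or.inl ?_)
    exact_mod_cast hN1.ne'
  set F : ℕ → ℝ → ℂ := fun n t => LSeries.term b (sv t) n * (N : ℂ) ^ sv t * pk (sv t) with hF
  have hFc : ∀ n, Continuous (F n) := by
    intro n
    rw [hF]
    refine Continuous.mul (Continuous.mul ?_ hNc) (pk_cont σ hσ1.le)
    rcases eq_or_ne n 0 with rfl | hn
    · simp only [LSeries.term_zero]; exact continuous_const
    · simp only [LSeries.term_of_ne_zero hn]
      have hn' : (n : ℂ) ≠ 0 := by exact_mod_cast hn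
      refine Continuous.div continuous_const (Continuous.const_cpow hsc (Or.inl hn')) (fun t => ?_)
      rw [Complex.cpow_ne_zero_iff]; left; exact hn'
  have hterm : ∀ n t, ‖LSeries.term b (sv t) n‖ = ‖LSeries.term b σ n‖ := by
    intro n t
    rw [LSeries.norm_term_eq, LSeries.norm_term_eq, hre, Complex.ofReal_re]
  have hFn : ∀ n t, ‖F n t‖ ≤ ‖LSeries.term b σ n‖ * (N : ℝ) ^ σ * (1 + t ^ 2)⁻¹ := by
    intro n t
    rw [hF]; simp only []
    rw [norm_mul, norm_mul, hterm, hNn]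
    gcongr
    exact pk_bound σ t hσ1.le
  have hFi : ∀ n, Integrable (F n) := by
    intro n
    refine Integrable.mono' (integrable_inv_one_add_sq.const_mul (‖LSeries.term b σ n‖ * (N : ℝ) ^ σ)) (hFc n).aestronglyMeasurable ?_
    filter_upwards with t
    exact hFn n t
  have hsσ : Summable (fun n => ‖LSeries.term b σ n‖) := (hsum σ (by simpa using hσ1)).norm
  have hsI : Summable (fun n => ∫ t, ‖F n t‖) := by
    refine Summable.of_nonneg_of_le (fun n => integral_nonneg (fun t => norm_nonneg _)) (fun n => ?_) (hsσ.mul_right ((N : ℝ) ^ σ * Real.pi))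
    calc ∫ t, ‖F n t‖ ≤ ∫ t : ℝ, ‖LSeries.term b σ n‖ * (N : ℝ) ^ σ * (1 + t ^ 2)⁻¹ :=
          integral_mono (hFi n).norm (integrable_inv_one_add_sq.const_mul _) (hFn n)
      _ = _ := by rw [integral_const_mul, integral_univ_inv_one_add_sq]; ring
  have hS := hasSum_integral_of_summable_integral_norm hFi hsI
  have hval : ∀ n, ∫ t, F n t = if n ∈ Ioc 0 N then (2 * Real.pi : ℂ) * (b n * ((N : ℂ) - n)) / N else 0 := by
    intro n
    rcases Nat.eq_zero_or_pos n with rfl | hn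
    · simp [hF]
    have hn0 : (0 : ℝ) < n := by exact_mod_cast hn
    have p1 := perron_one σ hσ1.le (x := (n : ℝ) / N) (by positivity)
    have e1 : ∀ t, F n t = b n * ((((n : ℝ) / N : ℝ) : ℂ) ^ (-((σ : ℂ) + t * Complex.I)) * pk (σ + t * Complex.I)) := by
      intro t
      rw [ratio_cpow hn hN1, hF]
      simp only []
      rw [LSeries.term_of_ne_zero hn.ne', hsv]
      simp only []
      ring
    simp only [e1]
    rw [integral_const_mul]
    have p2 : ∫ t : ℝ, (((n : ℝ) / N : ℝ) : ℂ) ^ (-((σ : ℂ) + t * Complex.I)) * pk (σ + t * Complex.I) =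
        (2 * Real.pi : ℂ) * ((max (1 - (n : ℝ) / N) 0 : ℝ) : ℂ) := by
      rw [← p1, Complex.real_smul]
      generalize (∫ t : ℝ, (((n : ℝ) / N : ℝ) : ℂ) ^ (-((σ : ℂ) + t * Complex.I)) * pk (σ + t * Complex.I)) = J
      have : (Real.pi : ℂ) ≠ 0 := by exact_mod_cast Real.pi_ne_zero
      push_cast
      field_simp
    rw [p2]
    have hNc0 : (N : ℂ) ≠ 0 := by exact_mod_cast hN1.ne'
    by_cases h : n ≤ N
    · have h' : (n : ℝ) / N ≤ 1 := by rw [div_le_one hN0]; exact_mod_cast h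
      rw [if_pos (mem_Ioc.mpr ⟨hn, h⟩), max_eq_left (by linarith)]
      push_cast
      field_simp
    · have h' : 1 ≤ (n : ℝ) / N := by rw [le_div_iff₀ hN0, one_mul]; exact_mod_cast (by omega : N ≤ n)
      rw [if_neg (fun hh => h (mem_Ioc.mp hh).2), max_eq_right (by linarith)]
      simp
  have hfin : HasSum (fun n => ∫ t, F n t) (∑ n ∈ Ioc 0 N, (2 * Real.pi : ℂ) * (b n * ((N : ℂ) - n)) / N) := by
    have h0 : HasSum (fun n => ∫ t, F n t) (∑ n ∈ Ioc 0 N, ∫ t, F n t) :=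
      hasSum_sum_of_ne_finset_zero (fun n hn => by rw [hval, if_neg hn])
    have h1 : ∑ n ∈ Ioc 0 N, (2 * Real.pi : ℂ) * (b n * ((N : ℂ) - n)) / N = ∑ n ∈ Ioc 0 N, ∫ t, F n t :=
      sum_congr rfl (fun n hn => by rw [hval, if_pos hn])
    rw [h1]; exact h0
  have heq := hfin.unique hS
  have h_int_bd : ‖∫ t, ∑' n, F n t‖ ≤ R * (3 * N) * (2 * ∫ t : ℝ, (1 + ‖t‖ ^ 2) ^ (-(3 / 2 : ℝ) / 2)) := by
    rw [← integral_const_mul, ← integral_const_mul]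
    refine norm_integral_le_of_norm_le ((C0_int.const_mul 2).const_mul _) ?_
    filter_upwards with t
    have e : ∑' n, F n t = LSeries b (sv t) * (N : ℂ) ^ sv t * pk (sv t) := by
      rw [hF]; simp only []
      rw [tsum_mul_right, tsum_mul_right]; rfl
    rw [e, norm_mul, norm_mul, hNn]
    have h1 := hR (sv t) (by rw [hre]; exact hσ1) (by rw [hre]; exact hσ2)
    rw [him] at h1
    calc _ ≤ (R * (|t| + 3) ^ ((1 : ℝ) / 2)) * (3 * N) * (1 + t ^ 2)⁻¹ := by
          gcongr
          exact pk_bound σ t hσ1.le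
      _ = R * (3 * N) * ((|t| + 3) ^ ((1 : ℝ) / 2) * (1 + t ^ 2)⁻¹) := by ring
      _ ≤ _ := mul_le_mul_of_nonneg_left (weight_le t) (by positivity)
  rw [← heq, ← sum_div, ← mul_sum, norm_div, norm_mul, Complex.norm_natCast, div_le_iff₀ hN0] at h_int_bd
  have h2pi : (6 : ℝ) ≤ ‖(2 * Real.pi : ℂ)‖ := by
    rw [← Complex.ofReal_ofNat, ← Complex.ofReal_mul, Complex.norm_real, Real.norm_of_nonneg (by positivity)]
    linarith [Real.pi_gt_three]
  unfold C0
  set I0 := ∫ t : ℝ, (1 + ‖t‖ ^ 2) ^ (-(3 / 2 : ℝ) / 2) with hI0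
  have hI0' : 0 ≤ I0 := integral_nonneg (fun t => by positivity)
  set S := ‖∑ n ∈ Ioc 0 N, b n * ((N : ℂ) - n)‖ with hSdef
  have hS0 : 0 ≤ S := norm_nonneg _
  have h7 : 6 * S ≤ R * (3 * N) * (2 * I0) * N := le_trans (by gcongr) h_int_bd
  have h8 : 0 ≤ R * (N : ℝ) ^ 2 := by positivity
  have h9 : 0 ≤ R * (N : ℝ) ^ 2 * I0 := by positivity
  nlinarith

end WCL

end

section

open Finset
namespace WCL

lemma logpow_le (m : ℕ) (r c : ℝ) (hr : 0 < r) : ∃ X0 : ℝ, 3 ≤ X0 ∧ ∀ X, X0 ≤ X →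
    c ≤ Real.log X ∧ 1 ≤ Real.log X ∧ Real.log X ^ m ≤ X ^ r := by
  have h1 := (isLittleO_log_rpow_atTop (r := r / (m + 1)) (by positivity)).bound (c := 1) one_pos
  have h2 := Real.tendsto_log_atTop.eventually_ge_atTop (max c 1)
  obtain ⟨X0, h⟩ := Filter.eventually_atTop.mp (h1.and h2)
  refine ⟨max X0 3, le_max_right _ _, fun X hX => ?_⟩
  obtain ⟨h3, h4⟩ := h X ((le_max_left _ _).trans hX)
  have hX0 : (0 : ℝ) < X := by linarith [(le_max_right X0 3).trans hX]
  have hX1 : (1 : ℝ) ≤ X := by linarith [(le_max_right X0 3).trans hX]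
  have h5 : 1 ≤ Real.log X := (le_max_right _ _).trans h4
  refine ⟨(le_max_left _ _).trans h4, h5, ?_⟩
  rw [Real.norm_of_nonneg (by linarith), Real.norm_of_nonneg (by positivity), one_mul] at h3
  calc Real.log X ^ m ≤ (X ^ (r / (m + 1))) ^ m := by gcongr
    _ = X ^ (r / (m + 1) * m) := by rw [← Real.rpow_mul_natCast hX0.le]
    _ ≤ X ^ r := by
        apply Real.rpow_le_rpow_of_exponent_le hX1
        rw [div_mul_eq_mul_div, div_le_iff₀ (by positivity)]
        nlinarith

lemma absc_le (a : ℕ → ℂ) (ha : ∀ n, 1 ≤ n → ‖a n‖ ≤ Real.log n + 1) : LSeries.abscissaOfAbsConv a ≤ (1 : ℝ) := by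
  apply LSeries.abscissaOfAbsConv_le_of_forall_lt_LSeriesSummable
  intro y hy
  apply LSeriesSummable_of_le_const_mul_rpow (x := (1 + y) / 2) (by simp; linarith)
  refine ⟨1 / ((1 + y) / 2 - 1) + 1, fun n hn => (ha n (by omega)).trans ?_⟩
  have hn1 : (1 : ℝ) ≤ n := by exact_mod_cast (by omega : 1 ≤ n)
  have h0 : 0 < (1 + y) / 2 - 1 := by linarith
  have h1 := Real.log_le_rpow_div (x := (n : ℝ)) (by linarith) h0
  have h2 := Real.one_le_rpow hn1 h0.le
  rw [add_mul, one_mul, one_div_mul_eq_div]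
  linarith

lemma logMul_iter (a : ℕ → ℂ) (k n : ℕ) : LSeries.logMul^[k] a n = ((Real.log n : ℝ) : ℂ) ^ k * a n := by
  induction k generalizing a with
  | zero => simp
  | succ k ih =>
    rw [Function.iterate_succ_apply, ih]
    simp only [LSeries.logMul]
    rw [Complex.natCast_log]; ring

lemma tauber1 (b : ℕ → ℂ) (T W : ℝ) (N H : ℕ) (hN : 3 ≤ N) (hH : 1 ≤ H) (hHN : H ≤ N)
    (hT : ∀ N, 3 ≤ N → ‖∑ n ∈ Ioc 0 N, b n * ((N : ℂ) - n)‖ ≤ T * (N : ℝ) ^ 2)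
    (hW : ∀ n, 1 ≤ n → n ≤ 2 * N → ‖b n‖ ≤ W) :
    ‖∑ n ∈ Ioc 0 N, b n‖ ≤ 5 * T * (N : ℝ) ^ 2 / H + H * W := by
  have h1 := hT N hN
  have h2 := hT (N + H) (by omega)
  have hT0 : 0 ≤ T := by
    by_contra hh
    push Not at hh
    have : (0 : ℝ) < (N : ℝ) ^ 2 := by positivity
    nlinarith [norm_nonneg (∑ n ∈ Ioc 0 N, b n * ((N : ℂ) - n))]
  have hW0 : 0 ≤ W := (norm_nonneg _).trans (hW 1 le_rfl (by omega))
  have hH0 : (0 : ℝ) < H := by exact_mod_cast hH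
  have e : (∑ n ∈ Ioc 0 N, b n) * H = (∑ n ∈ Ioc 0 (N + H), b n * (((N + H : ℕ) : ℂ) - n)) - ∑ n ∈ Ioc 0 N, b n * ((N : ℂ) - n)
      - ∑ n ∈ Ioc N (N + H), b n * (((N + H : ℕ) : ℂ) - n) := by
    rw [← sum_Ioc_consecutive _ (Nat.zero_le N) (Nat.le_add_right N H), sum_mul]
    have : ∑ n ∈ Ioc 0 N, b n * (((N + H : ℕ) : ℂ) - n) = ∑ n ∈ Ioc 0 N, b n * ((N : ℂ) - n) + ∑ n ∈ Ioc 0 N, b n * H := by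
      rw [← sum_add_distrib]
      refine sum_congr rfl (fun n _ => ?_)
      push_cast; ring
    rw [this]; ring
  have h3 : ‖∑ n ∈ Ioc N (N + H), b n * (((N + H : ℕ) : ℂ) - n)‖ ≤ H * (W * H) := by
    refine (norm_sum_le_of_le (f := fun n => b n * (((N + H : ℕ) : ℂ) - n)) (n := fun _ => W * H) _ (fun n hn => ?_)).trans ?_
    · rw [mem_Ioc] at hn
      rw [norm_mul]
      gcongr
      · exact hW n (by omega) (by omega)
      · rw [← Nat.cast_sub hn.2, Complex.norm_natCast]
        exact_mod_cast (by omega)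
    · simp
  have h4 : ‖∑ n ∈ Ioc 0 N, b n‖ * H ≤ 5 * T * (N : ℝ) ^ 2 + H * (W * H) := by
    have : ‖(∑ n ∈ Ioc 0 N, b n) * H‖ = ‖∑ n ∈ Ioc 0 N, b n‖ * H := by rw [norm_mul, Complex.norm_natCast]
    rw [← this, e]
    refine (norm_sub_le _ _).trans (add_le_add ((norm_sub_le _ _).trans ?_) h3)
    have h5 : (((N + H : ℕ) : ℝ)) ≤ 2 * N := by exact_mod_cast (by omega : N + H ≤ 2 * N)
    have h6 : T * (((N + H : ℕ) : ℝ)) ^ 2 ≤ T * (2 * N) ^ 2 := by gcongr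
    linarith
  rw [← mul_le_mul_iff_left₀ hH0]
  calc _ ≤ _ := h4
    _ = _ := by field_simp

theorem tauber (A : ℕ) (K : ℝ) (hK : 0 < K) : ∃ K' X0 : ℝ, 0 < K' ∧ 3 ≤ X0 ∧ ∀ (a : ℕ → ℂ), (∀ n, 1 ≤ n → ‖a n‖ ≤ Real.log n + 1) →
    ∀ X, X0 ≤ X → (∀ s : ℂ, 1 < s.re → s.re ≤ 2 →
      ‖iteratedDeriv (2 * A + 2) (LSeries a) s‖ ≤ K * Real.log X * (|s.im| + 3) ^ ((1 : ℝ) / 2)) →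
    ∀ N : ℕ, (N : ℝ) ≤ X → ‖∑ n ∈ Ioc 0 N, a n‖ ≤ K' * X / Real.log X ^ A := by
  obtain ⟨X0, hX0, hX0'⟩ := logpow_le (2 * A + 3) (1 / 2) 1 (by norm_num)
  set K1 : ℝ := 5 * C0 * K + 2 * 3 ^ (2 * A + 3) with hK1
  have hC0 := C0_ge
  have hK1p : 0 < K1 := by positivity
  refine ⟨2 + 2 * K1 * 2 ^ (2 * A + 2), max X0 9, by positivity, hX0.trans (le_max_left _ _), fun a ha X hX hF N hN => ?_⟩
  obtain ⟨-, hL1, hLp⟩ := hX0' X ((le_max_left _ _).trans hX)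
  have hX9 : 9 ≤ X := (le_max_right _ _).trans hX
  set L := Real.log X with hL
  have hX0p : 0 < X := by linarith
  rw [← Real.sqrt_eq_rpow] at hLp
  have hsq : √X * √X = X := Real.mul_self_sqrt hX0p.le
  have hs3 : 3 ≤ √X := Real.le_sqrt_of_sq_le (by linarith)
  have hlogle : ∀ n : ℕ, 1 ≤ n → (n : ℝ) ≤ X → Real.log n ≤ L := fun n h1 h2 =>
    Real.log_le_log (by exact_mod_cast h1) h2
  -- trivial range
  have triv : ∀ M : ℕ, (M : ℝ) ≤ √X → ‖∑ n ∈ Ioc 0 M, a n‖ ≤ 2 * X / L ^ A := by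
    intro M hM
    have h1 : ‖∑ n ∈ Ioc 0 M, a n‖ ≤ M * (2 * L) := by
      refine (norm_sum_le_of_le (n := fun _ => 2 * L) _ (fun n hn => ?_)).trans (by simp)
      rw [mem_Ioc] at hn
      have hnM : (n : ℝ) ≤ M := by exact_mod_cast hn.2
      have := hlogle n hn.1 (by nlinarith)
      linarith [ha n hn.1]
    refine h1.trans ?_
    rw [le_div_iff₀ (by positivity)]
    have h2 : L ^ (A + 1) ≤ L ^ (2 * A + 3) := pow_le_pow_right₀ hL1 (by omega)
    calc M * (2 * L) * L ^ A = 2 * (M * L ^ (A + 1)) := by ring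
      _ ≤ 2 * (√X * √X) := by gcongr; exact h2.trans hLp
      _ = 2 * X := by rw [hsq]
  rcases le_or_gt (N : ℝ) (√X) with hNs | hNs
  · refine (triv N hNs).trans ?_
    gcongr
    linarith [show 0 ≤ 2 * K1 * 2 ^ (2 * A + 2) by positivity]
  -- weighted sums
  set k := 2 * A + 2 with hk
  set b : ℕ → ℂ := LSeries.logMul^[k] a with hb
  have habs := absc_le a ha
  have hbs : ∀ s : ℂ, 1 < s.re → LSeriesSummable b s := by
    intro s hs
    apply LSeriesSummable_of_abscissaOfAbsConv_lt_re
    rw [LSeries.absicssaOfAbsConv_logPowMul]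
    exact lt_of_le_of_lt habs (by exact_mod_cast hs)
  have hT := perron_bound b hbs (K * L) (by positivity) (fun s h1 h2 => by
    have := hF s h1 h2
    rw [LSeries_iteratedDeriv _ (lt_of_le_of_lt habs (by exact_mod_cast h1)), norm_mul, norm_pow, norm_neg, norm_one, one_pow, one_mul] at this
    exact this)
  have hbn : ∀ n : ℕ, 1 ≤ n → (n : ℝ) ≤ 2 * X → ‖b n‖ ≤ (3 * L) ^ (k + 1) := by
    intro n h1 h2
    have hn0 : (1 : ℝ) ≤ n := by exact_mod_cast h1
    have hl : Real.log n ≤ 1 + L := by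
      calc Real.log n ≤ Real.log (2 * X) := Real.log_le_log (by linarith) h2
        _ = Real.log 2 + L := Real.log_mul (by norm_num) hX0p.ne'
        _ ≤ _ := by linarith [Real.log_two_lt_d9]
    have hl0 := Real.log_nonneg hn0
    rw [hb, logMul_iter, norm_mul, norm_pow, Complex.norm_real, Real.norm_of_nonneg hl0, pow_succ (3 * L) k]
    exact mul_le_mul (pow_le_pow_left₀ hl0 (by linarith) k) (by linarith [ha n h1]) (norm_nonneg _) (by positivity)
  have hB : ∀ j : ℕ, √X < j → (j : ℝ) ≤ X → ‖∑ n ∈ Ioc 0 j, b n‖ ≤ K1 * X * L ^ (A + 2) := by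
    intro j h1 h2
    have hj0 : (0 : ℝ) < j := by linarith
    set H := ⌈(j : ℝ) / L ^ (A + 1)⌉₊ with hH
    have hLA : L ^ (A + 1) ≤ j := (pow_le_pow_right₀ hL1 (by omega)).trans (hLp.trans h1.le)
    have hLA1 : 1 ≤ L ^ (A + 1) := one_le_pow₀ hL1
    have q1 : 1 ≤ (j : ℝ) / L ^ (A + 1) := by rw [le_div_iff₀ (by positivity)]; linarith
    have q2 : (j : ℝ) / L ^ (A + 1) ≤ H := Nat.le_ceil _
    have q3 : (H : ℝ) ≤ 2 * (j / L ^ (A + 1)) := by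
      have := (Nat.ceil_lt_add_one (show 0 ≤ (j : ℝ) / L ^ (A + 1) by positivity)).le
      linarith
    have q4 : H ≤ j := by
      rw [hH, Nat.ceil_le, div_le_iff₀ (by positivity)]; nlinarith
    have q5 : 1 ≤ H := by exact_mod_cast q1.trans q2
    have q5' : (0 : ℝ) < H := by exact_mod_cast q5
    have := tauber1 b (C0 * (K * L)) ((3 * L) ^ (k + 1)) j H (by
      have : (3 : ℝ) < j := lt_of_le_of_lt hs3 h1
      have : 3 < j := by exact_mod_cast this
      omega) q5 q4 hT (fun n h3 h4 => hbn n h3 (by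
        have : (n : ℝ) ≤ 2 * j := by exact_mod_cast h4
        linarith))
    refine this.trans ?_
    have r1 : 5 * (C0 * (K * L)) * (j : ℝ) ^ 2 / H ≤ 5 * C0 * K * j * L ^ (A + 2) := by
      rw [div_le_iff₀ q5']
      rw [div_le_iff₀ (by positivity)] at q2
      calc 5 * (C0 * (K * L)) * (j : ℝ) ^ 2 = 5 * C0 * K * L * j * j := by ring
        _ ≤ 5 * C0 * K * L * j * (H * L ^ (A + 1)) := by gcongr
        _ = _ := by ring
    have r2 : H * (3 * L) ^ (k + 1) ≤ 2 * 3 ^ (2 * A + 3) * j * L ^ (A + 2) := by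
      calc H * (3 * L) ^ (k + 1) ≤ 2 * (j / L ^ (A + 1)) * (3 * L) ^ (k + 1) := by gcongr
        _ = _ := by
          have e2 : L ^ (k + 1) = L ^ (A + 1) * L ^ (A + 2) := by rw [← pow_add]; congr 1; omega
          have e3 : (3 : ℝ) ^ (k + 1) = 3 ^ (2 * A + 3) := rfl
          rw [mul_pow, e2, e3]
          field_simp
    calc _ ≤ K1 * j * L ^ (A + 2) := by rw [hK1]; linarith
      _ ≤ _ := by gcongr
  set M := ⌊√X⌋₊ with hM
  have hMle : (M : ℝ) ≤ √X := Nat.floor_le (Real.sqrt_nonneg _)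
  have hMlt : √X < M + 1 := Nat.lt_floor_add_one _
  have hMN : M < N := by exact_mod_cast lt_of_le_of_lt hMle hNs
  have hBM : ‖∑ n ∈ Ioc 0 M, b n‖ ≤ K1 * X * L ^ (A + 2) := by
    refine (norm_sum_le_of_le (n := fun _ => (3 * L) ^ (k + 1)) _ (fun n hn => ?_)).trans ?_
    · rw [mem_Ioc] at hn
      have hnM : (n : ℝ) ≤ M := by exact_mod_cast hn.2
      exact hbn n hn.1 (by nlinarith)
    · simp only [sum_const, Nat.card_Ioc, nsmul_eq_mul, tsub_zero]
      rw [mul_pow]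
      calc (M : ℝ) * (3 ^ (k + 1) * L ^ (k + 1)) ≤ √X * (3 ^ (k + 1) * √X) := by gcongr
        _ = 3 ^ (k + 1) * X * 1 := by linear_combination 3 ^ (k + 1) * hsq
        _ ≤ K1 * X * L ^ (A + 2) := by
          gcongr
          · rw [hK1, hk]
            have : (0 : ℝ) ≤ 5 * C0 * K := by positivity
            have : (0 : ℝ) ≤ 3 ^ (2 * A + 3) := by positivity
            have e3 : (3 : ℝ) ^ (2 * A + 2 + 1) = 3 ^ (2 * A + 3) := rfl
            rw [e3]
            linarith
          · exact one_le_pow₀ hL1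
  have hM1 : (1 : ℝ) ≤ M := by
    have : (3 : ℝ) < M + 1 := lt_of_le_of_lt hs3 hMlt
    linarith
  have hlogpos : ∀ n : ℕ, M < n → L / 2 ≤ Real.log n := by
    intro n hn
    have h1 : √X ≤ n := hMlt.le.trans (by exact_mod_cast hn)
    calc L / 2 = Real.log (√X) := by rw [Real.log_sqrt hX0p.le]
      _ ≤ _ := Real.log_le_log (by linarith) h1
  have hab := abel_bound (fun n => ((((Real.log n) ^ k)⁻¹ : ℝ) : ℂ)) b M N (2 * (K1 * X * L ^ (A + 2))) (fun j h1 h2 => by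
    have hj : ∑ n ∈ Ioc M j, b n = ∑ n ∈ Ioc 0 j, b n - ∑ n ∈ Ioc 0 M, b n := by
      rw [← sum_Ioc_consecutive _ (Nat.zero_le M) h1.le]; ring
    rw [hj]
    refine (norm_sub_le _ _).trans ?_
    have hjM : √X < j := lt_of_lt_of_le hMlt (by exact_mod_cast h1)
    have := hB j hjM (le_trans (by exact_mod_cast h2) hN)
    linarith) (by positivity)
  have hmono : ∀ j ∈ Ioo M N, ‖((((Real.log (j + 1 : ℕ)) ^ k)⁻¹ : ℝ) : ℂ) - ((((Real.log j) ^ k)⁻¹ : ℝ) : ℂ)‖ =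
      -(((Real.log (j + 1 : ℕ)) ^ k)⁻¹ - ((Real.log j) ^ k)⁻¹) := by
    intro j hj
    rw [mem_Ioo] at hj
    have h1 := hlogpos j hj.1
    rw [← Complex.ofReal_sub, Complex.norm_real, Real.norm_of_nonpos]
    have : Real.log j ≤ Real.log (j + 1 : ℕ) := Real.log_le_log (by exact_mod_cast (by omega : 0 < j)) (by exact_mod_cast (by omega : j ≤ j + 1))
    have h3 : (0 : ℝ) < Real.log j := by linarith
    have : ((Real.log (j + 1 : ℕ)) ^ k)⁻¹ ≤ ((Real.log j) ^ k)⁻¹ := by gcongr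
    linarith
  rw [sum_congr rfl hmono, sum_neg_distrib] at hab
  have hIco : Ioo M N = Ico (M + 1) N := by ext; simp [mem_Ioo, mem_Ico, Nat.succ_le_iff]
  rw [hIco, sum_Ico_sub (fun j : ℕ => ((Real.log j) ^ k)⁻¹) (by omega), Complex.norm_real, Real.norm_of_nonneg (by
    have := hlogpos N hMN
    have : 0 ≤ Real.log N := by linarith
    positivity)] at hab
  have hsum : ∑ n ∈ Ioc M N, a n = ∑ n ∈ Ioc M N, ((((Real.log n) ^ k)⁻¹ : ℝ) : ℂ) * b n := by
    refine sum_congr rfl (fun n hn => ?_)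
    rw [mem_Ioc] at hn
    have h1 := hlogpos n hn.1
    have h3 : ((Real.log n : ℝ) : ℂ) ≠ 0 := by
      have : Real.log n ≠ 0 := by linarith
      exact_mod_cast this
    rw [hb, logMul_iter]
    rw [Complex.ofReal_inv, Complex.ofReal_pow, ← mul_assoc, inv_mul_cancel₀ (pow_ne_zero _ h3), one_mul]
  rw [← sum_Ioc_consecutive _ (Nat.zero_le M) hMN.le]
  refine (norm_add_le _ _).trans ?_
  have e1 : (2 + 2 * K1 * 2 ^ (2 * A + 2)) * X / L ^ A = 2 * X / L ^ A + 2 * (K1 * X * L ^ (A + 2)) * ((L / 2) ^ k)⁻¹ := by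
    have e2 : L ^ k = L ^ (A + 2) * L ^ A := by rw [← pow_add]; congr 1; omega
    rw [div_pow, inv_div, e2, ← hk]
    field_simp
  rw [e1]
  refine add_le_add (triv M hMle) ?_
  rw [hsum]
  refine hab.trans ?_
  gcongr
  rw [show ∀ x y : ℝ, x + -(x - y) = y by intros; ring]
  have := hlogpos (M + 1) (by omega)
  gcongr

end WCL

end

section

open Finset
namespace WCL

lemma ev_re {s : ℂ} (hs : 1 < s.re) : ∀ᶠ z in nhds s, 1 < z.re :=
  (isOpen_lt continuous_const Complex.continuous_re).mem_nhds hs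

theorem sw_char (A C : ℕ) : ∃ K X0 : ℝ, 0 < K ∧ 3 ≤ X0 ∧ ∀ X, X0 ≤ X → ∀ (q : ℕ) [NeZero q], (q : ℝ) ≤ Real.log X ^ C →
    ∀ χ : DirichletCharacter ℂ q, χ ≠ 1 → ∀ N : ℕ, (N : ℝ) ≤ X →
    ‖∑ n ∈ Ioc 0 N, χ (n : ZMod q) * ((ArithmeticFunction.vonMangoldt n : ℝ) : ℂ)‖ ≤ K * X / Real.log X ^ A := by
  set ε : ℝ := 1 / (C + 2) with hε
  have hε0 : 0 < ε := by positivity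
  have hε2 : ε ≤ 1 / 2 := by
    rw [hε]; apply one_div_le_one_div_of_le (by norm_num)
    have : (0 : ℝ) ≤ C := by positivity
    linarith
  obtain ⟨K, hK, h1⟩ := LD1 siegel (2 * A + 2) ε hε0 (by linarith)
  obtain ⟨K', X0, hK', hX0, h2⟩ := tauber A K hK
  obtain ⟨X1, hX1, h3⟩ := logpow_le 0 1 1 one_pos
  refine ⟨K', max X0 X1, hK', hX0.trans (le_max_left _ _), fun X hX q _ hq χ hχ N hN => ?_⟩
  obtain ⟨-, hL1, -⟩ := h3 X ((le_max_right _ _).trans hX)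
  have := h2 ((fun n : ℕ => χ (n : ZMod q)) * fun n : ℕ => ((ArithmeticFunction.vonMangoldt n : ℝ) : ℂ)) (fun n _ => ?_) X ((le_max_left _ _).trans hX) (fun s hs hs2 => ?_) N hN
  · simpa using this
  · simp only [Pi.mul_apply, norm_mul, Complex.norm_real]
    rw [Real.norm_of_nonneg ArithmeticFunction.vonMangoldt_nonneg]
    have a1 := DirichletCharacter.norm_le_one χ (n : ZMod q)
    have a2 := ArithmeticFunction.vonMangoldt_le_log (n := n)
    have a3 := ArithmeticFunction.vonMangoldt_nonneg (n := n)
    nlinarith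
  · have e : iteratedDeriv (2 * A + 2) (LSeries ((fun n : ℕ => χ (n : ZMod q)) * fun n : ℕ => ((ArithmeticFunction.vonMangoldt n : ℝ) : ℂ))) s =
        iteratedDeriv (2 * A + 2) (fun s => -(deriv χ.LFunction s / χ.LFunction s)) s := by
      apply Filter.EventuallyEq.iteratedDeriv_eq
      filter_upwards [ev_re hs] with z hz
      exact L_logder χ hz
    rw [e, iteratedDeriv_fun_neg, norm_neg]
    refine (h1 q χ hχ s hs hs2).trans ?_
    rw [mul_assoc]
    gcongr
    unfold VV
    rw [Real.mul_rpow (by positivity) (by positivity)]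
    have a0 : (1 : ℝ) ≤ |s.im| + 3 := by linarith [abs_nonneg s.im]
    gcongr
    calc (q : ℝ) ^ ε ≤ (Real.log X ^ C) ^ ε := by gcongr
      _ = Real.log X ^ (C * ε) := by rw [← Real.rpow_natCast_mul (by linarith)]
      _ ≤ Real.log X ^ (1 : ℝ) := by
          apply Real.rpow_le_rpow_of_exponent_le hL1
          rw [hε, mul_one_div, div_le_one (by positivity)]; linarith
      _ = _ := Real.rpow_one _

theorem sw_psi (A : ℕ) : ∃ K X0 : ℝ, 0 < K ∧ 3 ≤ X0 ∧ ∀ X, X0 ≤ X → ∀ N : ℕ, (N : ℝ) ≤ X →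
    ‖∑ n ∈ Ioc 0 N, (((ArithmeticFunction.vonMangoldt n : ℝ) : ℂ) - 1)‖ ≤ K * X / Real.log X ^ A := by
  obtain ⟨K, hK, h1⟩ := LDz (2 * A + 2) (1 / 2) (by norm_num) (by norm_num)
  obtain ⟨K2, hK2, h1'⟩ := hz_der (2 * A + 2) (1 / 2) (by norm_num) (by norm_num)
  obtain ⟨K', X0, hK', hX0, h2⟩ := tauber A (K + K2) (by positivity)
  obtain ⟨X1, hX1, h3⟩ := logpow_le 0 1 1 one_pos
  refine ⟨K', max X0 X1, hK', hX0.trans (le_max_left _ _), fun X hX N hN => ?_⟩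
  obtain ⟨-, hL1, -⟩ := h3 X ((le_max_right _ _).trans hX)
  have := h2 ((fun n : ℕ => ((ArithmeticFunction.vonMangoldt n : ℝ) : ℂ)) - 1) (fun n hn => ?_) X ((le_max_left _ _).trans hX) (fun s hs hs2 => ?_) N hN
  · simpa using this
  · simp only [Pi.sub_apply, Pi.one_apply]
    refine (norm_sub_le _ _).trans ?_
    rw [Complex.norm_real, Real.norm_of_nonneg ArithmeticFunction.vonMangoldt_nonneg, norm_one]
    linarith [ArithmeticFunction.vonMangoldt_le_log (n := n)]
  · have e : iteratedDeriv (2 * A + 2) (LSeries ((fun n : ℕ => ((ArithmeticFunction.vonMangoldt n : ℝ) : ℂ)) - 1)) s =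
        iteratedDeriv (2 * A + 2) (fun s => -((deriv ZZ s / ZZ s) + hz s)) s := by
      apply Filter.EventuallyEq.iteratedDeriv_eq
      filter_upwards [ev_re hs] with z hz1
      have z1 : z ≠ 1 := by rintro rfl; simp at hz1
      have z1' : z - 1 ≠ 0 := sub_ne_zero.mpr z1
      have zn : riemannZeta z ≠ 0 := riemannZeta_ne_zero_of_one_lt_re hz1
      rw [LSeries_sub (ArithmeticFunction.LSeriesSummable_vonMangoldt hz1) (LSeriesSummable_one_iff.mpr hz1),
        ArithmeticFunction.LSeries_vonMangoldt_eq_deriv_riemannZeta_div hz1, LSeries_one_eq_riemannZeta hz1, hz_eq z1]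
      have d : deriv ZZ z = riemannZeta z + (z - 1) * deriv riemannZeta z := by
        have : ZZ =ᶠ[nhds z] fun w => (w - 1) * riemannZeta w := by
          filter_upwards [isOpen_ne.mem_nhds z1] with w hw
          exact ZZ_eq hw
        rw [this.deriv_eq]
        have := ((hasDerivAt_id z).sub_const 1).fun_mul (differentiableAt_riemannZeta z1).hasDerivAt
        simpa using this.deriv
      rw [d, ZZ_eq z1]
      field_simp
      ring
    have c1 : ContDiffAt ℂ (2 * A + 2 : ℕ) (fun s => deriv ZZ s / ZZ s) s := by
      apply ContDiffAt.div
      · exact (ZZ_diff.contDiff.differentiable_deriv_two.contDiff (n := ((2 * A + 2 : ℕ) : WithTop ℕ∞))).contDiffAt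
      · exact ZZ_diff.contDiff.contDiffAt
      · exact ZZ_ne_zero hs.le
    rw [e, iteratedDeriv_fun_neg, norm_neg, iteratedDeriv_fun_add c1 hz_diff.contDiff.contDiffAt]
    refine (norm_add_le _ _).trans ?_
    have q1 := h1 s hs hs2
    have q2 := h1' s hs.le hs2
    have e3 : VV 1 s.im = |s.im| + 3 := by simp [VV]
    rw [e3] at q1 q2
    have : 0 ≤ (K + K2) * (|s.im| + 3) ^ ((1 : ℝ) / 2) := by positivity
    nlinarith

end WCL

end

section

open Finset
namespace WCL

lemma sum_nthRoots (n : ℕ) (hn : 0 < n) : ∑ z ∈ Polynomial.nthRootsFinset n (1 : ℂ), z = if n = 1 then 1 else 0 := by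
  split_ifs with h
  · subst h
    have : Polynomial.nthRootsFinset 1 (1 : ℂ) = {1} := by
      ext z; rw [Polynomial.mem_nthRootsFinset one_pos]; simp
    rw [this]; simp
  · have hp := Complex.isPrimitiveRoot_exp n hn.ne'
    set ζ := Complex.exp (2 * Real.pi * Complex.I / n) with hζ
    have hne : ζ ≠ 1 := hp.ne_one (by omega)
    have hz0 : ζ ≠ 0 := hp.ne_zero hn.ne'
    have : ∑ z ∈ Polynomial.nthRootsFinset n (1 : ℂ), z = ∑ z ∈ Polynomial.nthRootsFinset n (1 : ℂ), ζ * z := by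
      symm
      refine sum_nbij' (fun z => ζ * z) (fun z => ζ⁻¹ * z) ?_ ?_ ?_ ?_ ?_
      · intro z hz
        rw [Polynomial.mem_nthRootsFinset hn] at hz ⊢
        rw [mul_pow, hz, hp.pow_eq_one, one_mul]
      · intro z hz
        rw [Polynomial.mem_nthRootsFinset hn] at hz ⊢
        rw [mul_pow, hz, inv_pow, hp.pow_eq_one, inv_one, one_mul]
      · intro z _; field_simp
      · intro z _; field_simp
      · intro z _; rfl
    rw [← mul_sum] at this
    have h2 : (1 - ζ) * ∑ z ∈ Polynomial.nthRootsFinset n (1 : ℂ), z = 0 := by linear_combination this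
    rcases mul_eq_zero.mp h2 with h3 | h3
    · exact absurd (sub_eq_zero.mp h3).symm hne
    · exact h3

lemma sum_primRoots (n : ℕ) (hn : 0 < n) : ∑ z ∈ primitiveRoots n ℂ, z = (ArithmeticFunction.moebius n : ℂ) := by
  have key : ∀ n > 0, ∑ i ∈ n.divisors, (∑ z ∈ primitiveRoots i ℂ, z) = if n = 1 then (1 : ℂ) else 0 := by
    intro n hn
    rw [← sum_nthRoots n hn, IsPrimitiveRoot.nthRoots_one_eq_biUnion_primitiveRoots, sum_biUnion]
    intro i _ j _ hij
    exact IsPrimitiveRoot.disjoint hij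
  have := ArithmeticFunction.sum_eq_iff_sum_mul_moebius_eq.mp key n hn
  rw [← this]
  rw [sum_eq_single (n, 1)]
  · simp
  · rintro ⟨x, y⟩ hxy hne
    rw [Nat.mem_divisorsAntidiagonal] at hxy
    have : y ≠ 1 := by
      rintro rfl; apply hne; simp at hxy; rw [hxy.1]
    simp [this]
  · intro h; exfalso; apply h; simp [hn.ne']

noncomputable def EE (q : ℕ) (a : ℤ) (x : ZMod q) : ℂ := ee (a * x.val / q)

lemma EE_nat (q : ℕ) [NeZero q] (a : ℤ) (n : ℕ) : EE q a (n : ZMod q) = ee (n * ((a : ℝ) / q)) := by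
  unfold EE
  rw [ZMod.val_natCast]
  have hq : (q : ℝ) ≠ 0 := by exact_mod_cast NeZero.ne q
  have h : (n : ℝ) = (n % q : ℕ) + q * (n / q : ℕ) := by exact_mod_cast (Nat.mod_add_div n q).symm
  have e : (n : ℝ) * ((a : ℝ) / q) = a * (n % q : ℕ) / q + ((a * ((n / q : ℕ) : ℤ) : ℤ) : ℝ) := by
    rw [Int.cast_mul, Int.cast_natCast]
    nth_rewrite 1 [h]
    field_simp
  rw [e, ee_add, ee_int, mul_one]

lemma ee_prim (q : ℕ) [NeZero q] (a : ℤ) (ha : IsCoprime a (q : ℤ)) : IsPrimitiveRoot (ee ((a : ℝ) / q)) q := by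
  have hp := Complex.isPrimitiveRoot_exp q (NeZero.ne q)
  have : ee ((a : ℝ) / q) = (Complex.exp (2 * Real.pi * Complex.I / q)) ^ a := by
    unfold ee
    rw [← Complex.exp_int_mul]
    congr 1; push_cast; ring
  rw [this]
  exact hp.zpow_of_gcd_eq_one _ (Int.isCoprime_iff_gcd_eq_one.mp ha)

lemma ramanujan (q : ℕ) [NeZero q] (a : ℤ) (ha : IsCoprime a (q : ℤ)) :
    ∑ u : (ZMod q)ˣ, EE q a (u : ZMod q) = (ArithmeticFunction.moebius q : ℂ) := by
  have hp := ee_prim q a ha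
  have hq := Nat.pos_of_ne_zero (NeZero.ne q)
  rw [← sum_primRoots q hq]
  have hE : ∀ x : ZMod q, EE q a x = ee ((a : ℝ) / q) ^ x.val := by
    intro x
    unfold EE
    rw [← ee_nat_mul]; congr 1; ring
  refine sum_nbij (fun u : (ZMod q)ˣ => EE q a (u : ZMod q)) ?_ ?_ ?_ ?_
  · intro u _
    rw [mem_primitiveRoots hq, hE]
    exact hp.pow_of_coprime _ (ZMod.val_coe_unit_coprime u)
  · intro u _ v _ huv
    simp only [hE] at huv
    have := hp.pow_inj (ZMod.val_lt _) (ZMod.val_lt _) huv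
    exact Units.ext (ZMod.val_injective q this)
  · intro z hz
    rw [mem_coe, mem_primitiveRoots hq] at hz
    obtain ⟨i, hi, hc, rfl⟩ := hp.isPrimitiveRoot_iff.mp hz
    refine ⟨ZMod.unitOfCoprime i hc, by simp, ?_⟩
    simp only [hE]
    rw [ZMod.coe_unitOfCoprime, ZMod.val_natCast, Nat.mod_eq_of_lt hi]
  · intro u _; rfl

lemma noncop_bound (q N : ℕ) (hq : 0 < q) (X : ℝ) (hX : 3 ≤ X) (hL : 1 ≤ Real.log X) (hN : (N : ℝ) ≤ X) :
    ∑ n ∈ (Ioc 0 N).filter (fun n => ¬ Nat.Coprime n q), ArithmeticFunction.vonMangoldt n ≤ 6 * q * Real.log X ^ 2 := by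
  classical
  set S := (Ioc 0 N).filter (fun n => ¬ Nat.Coprime n q) with hS
  set T := ((range (q + 1)) ×ˢ (range (Nat.log 2 N + 1))).image (fun x : ℕ × ℕ => x.1 ^ x.2) with hT
  have h1 : ∑ n ∈ S, ArithmeticFunction.vonMangoldt n ≤ ∑ n ∈ T, Real.log X := by
    have e1 : ∑ n ∈ S.filter (fun n => n ∈ T), ArithmeticFunction.vonMangoldt n = ∑ n ∈ S, ArithmeticFunction.vonMangoldt n := by
      apply sum_subset (filter_subset _ _)
      intro n hn hn2
      rw [hS, mem_filter, mem_Ioc] at hn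
      by_contra h0
      apply hn2
      rw [mem_filter]
      refine ⟨by rw [hS, mem_filter, mem_Ioc]; exact hn, ?_⟩
      rw [← Ne, ArithmeticFunction.vonMangoldt_ne_zero_iff, isPrimePow_nat_iff] at h0
      obtain ⟨p, k, hp, hk, rfl⟩ := h0
      rw [hT, mem_image]
      refine ⟨(p, k), ?_, rfl⟩
      rw [mem_product, mem_range, mem_range]
      constructor
      · have : p ∣ q := by
          by_contra h
          exact hn.2 (Nat.Coprime.pow_left _ ((Nat.Prime.coprime_iff_not_dvd hp).mpr h))
        exact Nat.lt_succ_of_le (Nat.le_of_dvd hq this)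
      · apply Nat.lt_succ_of_le
        apply Nat.le_log_of_pow_le (by norm_num)
        exact (Nat.pow_le_pow_left hp.two_le k).trans hn.1.2
    rw [← e1]
    calc _ ≤ ∑ n ∈ S.filter (fun n => n ∈ T), Real.log X := by
          apply sum_le_sum
          intro n hn
          rw [mem_filter, hS, mem_filter, mem_Ioc] at hn
          refine ArithmeticFunction.vonMangoldt_le_log.trans (Real.log_le_log (by exact_mod_cast hn.1.1.1) ?_)
          exact le_trans (by exact_mod_cast hn.1.1.2) hN
      _ ≤ _ := by
          apply sum_le_sum_of_subset_of_nonneg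
          · intro n hn; exact (mem_filter.mp hn).2
          · intros; linarith
  have h2 : (T.card : ℝ) ≤ (q + 1) * (Nat.log 2 N + 1) := by
    have := card_image_le (s := (range (q + 1)) ×ˢ (range (Nat.log 2 N + 1))) (f := fun x : ℕ × ℕ => x.1 ^ x.2)
    rw [card_product, card_range, card_range] at this
    exact_mod_cast this
  have h3 : (Nat.log 2 N : ℝ) ≤ 2 * Real.log X := by
    rcases Nat.eq_zero_or_pos N with rfl | hN0
    · simp; linarith
    have h4 : ((2 : ℕ) ^ Nat.log 2 N : ℝ) ≤ N := by exact_mod_cast Nat.pow_log_le_self 2 hN0.ne'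
    have h5 := Real.log_le_log (by positivity) (h4.trans hN)
    rw [Real.log_pow] at h5
    have h6 := Real.log_two_gt_d9
    push_cast at h5
    have : (0 : ℝ) ≤ Nat.log 2 N := by positivity
    nlinarith
  rw [sum_const, nsmul_eq_mul] at h1
  have hq1 : (1 : ℝ) ≤ q := by exact_mod_cast hq
  calc _ ≤ _ := h1
    _ ≤ ((q + 1) * (Nat.log 2 N + 1)) * Real.log X := by gcongr
    _ ≤ ((2 * q) * (3 * Real.log X)) * Real.log X := by gcongr <;> linarith
    _ = _ := by ring

end WCL

end

section

open Finset
namespace WCL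

noncomputable def kap (q : ℕ) : ℝ := (ArithmeticFunction.moebius q : ℝ) / (q.totient : ℝ)

lemma char_expand (q : ℕ) [NeZero q] (a : ℤ) (x : ZMod q) (hx : IsUnit x) :
    EE q a x = (q.totient : ℂ)⁻¹ * ∑ u : (ZMod q)ˣ, EE q a u * ∑ χ : DirichletCharacter ℂ q, χ ((u : ZMod q)⁻¹) * χ x := by
  have hφ : (q.totient : ℂ) ≠ 0 := by
    have := Nat.totient_pos.mpr (Nat.pos_of_ne_zero (NeZero.ne q))
    exact_mod_cast this.ne'
  obtain ⟨v, rfl⟩ := hx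
  rw [sum_eq_single v]
  · rw [DirichletCharacter.sum_char_inv_mul_char_eq ℂ v.isUnit, if_pos rfl]; field_simp
  · intro u _ hu
    rw [DirichletCharacter.sum_char_inv_mul_char_eq ℂ u.isUnit, if_neg (fun h => hu (Units.ext h)), mul_zero]
  · simp

theorem sw_add (A C : ℕ) : ∃ K X0 : ℝ, 0 < K ∧ 3 ≤ X0 ∧ ∀ X, X0 ≤ X → ∀ (q : ℕ), 0 < q → (q : ℝ) ≤ Real.log X ^ C →
    ∀ a : ℤ, IsCoprime a (q : ℤ) → ∀ N : ℕ, (N : ℝ) ≤ X →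
    ‖∑ n ∈ Ioc 0 N, (((ArithmeticFunction.vonMangoldt n : ℝ) : ℂ) * ee (n * ((a : ℝ) / q)) - (kap q : ℂ))‖ ≤ K * X / Real.log X ^ A := by
  obtain ⟨K1, X1, hK1, hX1, h1⟩ := sw_char (A + C) C
  obtain ⟨K2, X2, hK2, hX2, h2⟩ := sw_psi A
  obtain ⟨X3, hX3, h3⟩ := logpow_le (A + C + 2) 1 1 one_pos
  refine ⟨K1 + K2 + 12, max X1 (max X2 X3), by positivity, hX1.trans (le_max_left _ _), fun X hX q hq hqC a ha N hN => ?_⟩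
  have hXX1 : X1 ≤ X := (le_max_left _ _).trans hX
  have hXX2 : X2 ≤ X := (le_max_left _ _).trans ((le_max_right _ _).trans hX)
  have hXX3 : X3 ≤ X := (le_max_right _ _).trans ((le_max_right _ _).trans hX)
  obtain ⟨-, hL1, hLp⟩ := h3 X hXX3
  rw [Real.rpow_one] at hLp
  have hX3' : 3 ≤ X := hX3.trans hXX3
  haveI : NeZero q := ⟨hq.ne'⟩
  have b1 := fun χ hχ => h1 X hXX1 q hqC χ hχ N hN
  have b2 := h2 X hXX2 N hN
  have b3 := noncop_bound q N hq X hX3' hL1 hN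
  set L := Real.log X with hL
  set Lam : ℕ → ℂ := fun n => ((ArithmeticFunction.vonMangoldt n : ℝ) : ℂ) with hLam
  set NC := ∑ n ∈ (Ioc 0 N).filter (fun n => ¬ Nat.Coprime n q), ArithmeticFunction.vonMangoldt n with hNC
  set S : DirichletCharacter ℂ q → ℂ := fun χ => ∑ n ∈ Ioc 0 N, χ (n : ZMod q) * Lam n with hS
  have hLn : ∀ n, ‖Lam n‖ = ArithmeticFunction.vonMangoldt n := fun n => by
    rw [hLam]; simp only []; rw [Complex.norm_real, Real.norm_of_nonneg ArithmeticFunction.vonMangoldt_nonneg]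
  have hφ : (q.totient : ℂ) ≠ 0 := by
    have := Nat.totient_pos.mpr hq
    exact_mod_cast this.ne'
  have hφ0 : (0 : ℝ) < q.totient := by exact_mod_cast Nat.totient_pos.mpr hq
  -- principal character
  have p1 : ‖S 1 - N‖ ≤ K2 * X / L ^ A + NC := by
    have e : S 1 - N = ∑ n ∈ Ioc 0 N, (Lam n - 1) - ∑ n ∈ (Ioc 0 N).filter (fun n => ¬ Nat.Coprime n q), Lam n := by
      rw [sum_sub_distrib, hS]
      simp only [sum_const, Nat.card_Ioc, tsub_zero, nsmul_eq_mul, mul_one]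
      rw [← sum_filter_add_sum_filter_not (Ioc 0 N) (fun n => Nat.Coprime n q) Lam, sum_filter]
      have : ∀ n ∈ Ioc 0 N, (1 : DirichletCharacter ℂ q) (n : ZMod q) * Lam n = if Nat.Coprime n q then Lam n else 0 := by
        intro n _
        split_ifs with h
        · rw [MulChar.one_apply ((ZMod.isUnit_iff_coprime n q).mpr h), one_mul]
        · rw [MulChar.map_nonunit _ (fun h' => h ((ZMod.isUnit_iff_coprime n q).mp h')), zero_mul]
      rw [sum_congr rfl this]
      ring
    rw [e]
    refine (norm_sub_le _ _).trans (add_le_add b2 ?_)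
    refine (norm_sum_le _ _).trans ?_
    simp only [hLn]; exact le_rfl
  -- expansion
  have p2 : ∑ n ∈ Ioc 0 N, Lam n * ee (n * ((a : ℝ) / q)) = (q.totient : ℂ)⁻¹ * ∑ u : (ZMod q)ˣ, EE q a u * ∑ χ : DirichletCharacter ℂ q, χ ((u : ZMod q)⁻¹) * S χ
      + ∑ n ∈ (Ioc 0 N).filter (fun n => ¬ Nat.Coprime n q), Lam n * ee (n * ((a : ℝ) / q)) := by
    rw [← sum_filter_add_sum_filter_not (Ioc 0 N) (fun n => Nat.Coprime n q)]
    congr 1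
    have e1 : ∑ u : (ZMod q)ˣ, EE q a u * ∑ χ : DirichletCharacter ℂ q, χ ((u : ZMod q)⁻¹) * S χ =
        ∑ n ∈ Ioc 0 N, Lam n * ∑ u : (ZMod q)ˣ, EE q a u * ∑ χ : DirichletCharacter ℂ q, χ ((u : ZMod q)⁻¹) * χ n := by
      simp only [hS, mul_sum]
      rw [sum_comm' (t' := univ) (s' := fun _ => univ) (by simp)]
      conv_rhs => rw [sum_comm]
      rw [sum_comm]
      refine sum_congr rfl fun u _ => ?_
      rw [sum_comm]
      refine sum_congr rfl fun n _ => sum_congr rfl fun χ _ => ?_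
      ring
    rw [e1, mul_sum, sum_filter]
    refine sum_congr rfl fun n _ => ?_
    split_ifs with h
    · rw [← EE_nat, char_expand q a _ ((ZMod.isUnit_iff_coprime n q).mpr h)]; ring
    · have : ∀ χ : DirichletCharacter ℂ q, χ (n : ZMod q) = 0 := fun χ =>
        MulChar.map_nonunit _ (fun h' => h ((ZMod.isUnit_iff_coprime n q).mp h'))
      simp [this]
  have p3 : ∑ n ∈ Ioc 0 N, (Lam n * ee (n * ((a : ℝ) / q)) - (kap q : ℂ)) =
      (q.totient : ℂ)⁻¹ * ∑ u : (ZMod q)ˣ, EE q a u * (S 1 - N + ∑ χ ∈ univ.erase (1 : DirichletCharacter ℂ q), χ ((u : ZMod q)⁻¹) * S χ)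
      + ∑ n ∈ (Ioc 0 N).filter (fun n => ¬ Nat.Coprime n q), Lam n * ee (n * ((a : ℝ) / q)) := by
    rw [sum_sub_distrib, p2]
    simp only [sum_const, Nat.card_Ioc, tsub_zero, nsmul_eq_mul]
    have e1 : ∀ u : (ZMod q)ˣ, EE q a u * ∑ χ : DirichletCharacter ℂ q, χ ((u : ZMod q)⁻¹) * S χ =
        EE q a u * (S 1 - N + ∑ χ ∈ univ.erase (1 : DirichletCharacter ℂ q), χ ((u : ZMod q)⁻¹) * S χ) + EE q a u * N := by
      intro u
      rw [← add_sum_erase univ _ (mem_univ (1 : DirichletCharacter ℂ q))]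
      have : (1 : DirichletCharacter ℂ q) ((u : ZMod q)⁻¹) = 1 := by
        rw [ZMod.inv_coe_unit]
        exact MulChar.one_apply_coe _
      rw [this]; ring
    rw [sum_congr rfl (fun u _ => e1 u), sum_add_distrib, ← sum_mul, ramanujan q a ha]
    generalize ∑ u : (ZMod q)ˣ, EE q a u * (S 1 - N + ∑ χ ∈ univ.erase (1 : DirichletCharacter ℂ q), χ ((u : ZMod q)⁻¹) * S χ) = Y1
    generalize ∑ n ∈ (Ioc 0 N).filter (fun n => ¬ Nat.Coprime n q), Lam n * ee (n * ((a : ℝ) / q)) = Y2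
    unfold kap
    push_cast
    field_simp
    ring
  rw [p3]
  have hcard : (Fintype.card (ZMod q)ˣ : ℝ) = q.totient := by rw [ZMod.card_units_eq_totient]
  have hEn : ∀ x, ‖EE q a x‖ = 1 := fun x => ee_norm _
  have p4 : ∀ u : (ZMod q)ˣ, ‖EE q a u * (S 1 - N + ∑ χ ∈ univ.erase (1 : DirichletCharacter ℂ q), χ ((u : ZMod q)⁻¹) * S χ)‖ ≤
      K2 * X / L ^ A + NC + K1 * X / L ^ A := by
    intro u
    rw [norm_mul, hEn, one_mul]
    refine (norm_add_le _ _).trans (add_le_add p1 ?_)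
    have : ∀ χ ∈ univ.erase (1 : DirichletCharacter ℂ q), ‖χ ((u : ZMod q)⁻¹) * S χ‖ ≤ K1 * X / L ^ (A + C) := by
      intro χ hχ
      rw [norm_mul]
      have := b1 χ (ne_of_mem_erase hχ)
      have a1 := DirichletCharacter.norm_le_one χ ((u : ZMod q)⁻¹)
      have : ‖S χ‖ ≤ K1 * X / L ^ (A + C) := this
      nlinarith [norm_nonneg (S χ), norm_nonneg (χ ((u : ZMod q)⁻¹))]
    refine (norm_sum_le_of_le _ this).trans ?_
    rw [sum_const, nsmul_eq_mul]
    have c1 : ((univ.erase (1 : DirichletCharacter ℂ q)).card : ℝ) ≤ L ^ C := by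
      have c2 : (univ.erase (1 : DirichletCharacter ℂ q)).card ≤ q := by
        refine (card_le_card (erase_subset _ _)).trans ?_
        rw [card_univ, ← Nat.card_eq_fintype_card, DirichletCharacter.card_eq_totient_of_hasEnoughRootsOfUnity]
        exact Nat.totient_le q
      exact le_trans (by exact_mod_cast c2) hqC
    calc _ ≤ L ^ C * (K1 * X / L ^ (A + C)) := by gcongr
      _ = _ := by rw [pow_add]; field_simp
  have hNCb : NC ≤ 6 * X / L ^ A := by
    refine b3.trans ?_
    rw [le_div_iff₀ (by positivity)]
    calc 6 * q * L ^ 2 * L ^ A ≤ 6 * L ^ C * L ^ 2 * L ^ A := by gcongr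
      _ = 6 * L ^ (A + C + 2) := by ring
      _ ≤ _ := by gcongr
  refine (norm_add_le _ _).trans ?_
  have p5 : ‖(q.totient : ℂ)⁻¹ * ∑ u : (ZMod q)ˣ, EE q a u * (S 1 - N + ∑ χ ∈ univ.erase (1 : DirichletCharacter ℂ q), χ ((u : ZMod q)⁻¹) * S χ)‖ ≤
      K2 * X / L ^ A + NC + K1 * X / L ^ A := by
    rw [norm_mul, norm_inv, Complex.norm_natCast, inv_mul_le_iff₀ hφ0]
    refine (norm_sum_le_of_le _ (fun u _ => p4 u)).trans ?_
    rw [sum_const, nsmul_eq_mul, card_univ, hcard]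
  have p6 : ‖∑ n ∈ (Ioc 0 N).filter (fun n => ¬ Nat.Coprime n q), Lam n * ee (n * ((a : ℝ) / q))‖ ≤ NC := by
    refine (norm_sum_le _ _).trans ?_
    simp only [norm_mul, hLn, ee_norm, mul_one]; exact le_rfl
  have : (K1 + K2 + 12) * X / L ^ A = K2 * X / L ^ A + K1 * X / L ^ A + 2 * (6 * X / L ^ A) := by ring
  rw [this]
  linarith

end WCL

end

section

open Finset
namespace WCL

lemma nd_zero_int {x : ℝ} (h : nd x = 0) : ∃ k : ℤ, x = k := ⟨round x, by
  have := abs_eq_zero.mp h; linarith⟩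

lemma orth (M : ℕ) (hM : 0 < M) (m : ℤ) :
    ∑ k ∈ range M, ee ((m : ℝ) * (k / M)) = if (M : ℤ) ∣ m then (M : ℂ) else 0 := by
  have hM0 : (M : ℝ) ≠ 0 := by exact_mod_cast hM.ne'
  have e : ∀ k : ℕ, ee ((m : ℝ) * (k / M)) = ee ((m : ℝ) / M) ^ k := by
    intro k; rw [← ee_nat_mul]; congr 1; ring
  simp only [e]
  have hz : ee ((m : ℝ) / M) ^ M = 1 := by
    rw [← ee_nat_mul, mul_div_cancel₀ _ hM0, ee_int]
  split_ifs with h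
  · obtain ⟨t, rfl⟩ := h
    have : ee (((M * t : ℤ) : ℝ) / M) = 1 := by
      rw [← ee_int t]; congr 1; push_cast; field_simp
    rw [this]; simp
  · have hne : ee ((m : ℝ) / M) ≠ 1 := by
      intro h1
      have h2 := norm_ee_sub_one ((m : ℝ) / M)
      rw [h1, sub_self, norm_zero] at h2
      obtain ⟨t, ht⟩ := nd_zero_int (le_antisymm (by linarith) (nd_nonneg _))
      apply h
      refine ⟨t, ?_⟩
      rw [div_eq_iff hM0] at ht
      have : (m : ℝ) = ((M * t : ℤ) : ℝ) := by rw [ht]; push_cast; ring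
      exact_mod_cast this
    rw [geom_sum_eq hne, hz, sub_self, zero_div]

noncomputable def TT (β : Fin 4 → ℤ) (I : Fin 4 → Finset ℕ) (c : Fin 4 → ℕ → ℂ) : ℂ :=
  ∑ n ∈ Fintype.piFinset I, if ∑ j, β j * (n j : ℤ) = 0 then ∏ j, c j (n j) else 0

noncomputable def ft (s : Finset ℕ) (c : ℕ → ℂ) (α : ℝ) : ℂ := ∑ n ∈ s, c n * ee (n * α)

lemma ee_sum {ι : Type*} (s : Finset ι) (f : ι → ℝ) : ee (∑ i ∈ s, f i) = ∏ i ∈ s, ee (f i) := by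
  classical
  induction s using Finset.induction_on with
  | empty => simp [ee_zero]
  | insert a s ha ih => rw [sum_insert ha, prod_insert ha, ee_add, ih]

lemma TT_fourier (β : Fin 4 → ℤ) (hβ : ∀ j, β j = 1 ∨ β j = -1) (I : Fin 4 → Finset ℕ) (c : Fin 4 → ℕ → ℂ) (N : ℕ)
    (hI : ∀ j, I j ⊆ Ioc 0 N) :
    ((4 * N + 1 : ℕ) : ℂ) * TT β I c = ∑ k ∈ range (4 * N + 1), ∏ j, ft (I j) (c j) (β j * (k / (4 * N + 1 : ℕ))) := by
  unfold ft
  simp only [prod_univ_sum]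
  rw [sum_comm, TT, mul_sum]
  refine sum_congr rfl fun n hn => ?_
  have e : ∀ k : ℕ, ∏ j, c j (n j) * ee (n j * (β j * ((k : ℝ) / (4 * N + 1 : ℕ)))) =
      (∏ j, c j (n j)) * ee (((∑ j, β j * (n j : ℤ) : ℤ) : ℝ) * ((k : ℝ) / (4 * N + 1 : ℕ))) := by
    intro k
    rw [prod_mul_distrib, ← ee_sum]
    congr 2
    push_cast
    rw [sum_mul]
    refine sum_congr rfl fun j _ => ?_
    ring
  simp only [e]
  rw [← mul_sum, orth _ (by omega)]
  have hb : ∀ j, |β j * (n j : ℤ)| ≤ N := by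
    intro j
    have := mem_Ioc.mp (hI j ((Fintype.mem_piFinset.mp hn) j))
    rcases hβ j with h | h <;> rw [h, abs_le] <;> constructor <;> omega
  have hsum : |∑ j, β j * (n j : ℤ)| < (4 * N + 1 : ℕ) := by
    refine lt_of_le_of_lt (abs_sum_le_sum_abs _ _) ?_
    refine lt_of_le_of_lt (sum_le_sum fun j _ => hb j) ?_
    simp
  have hiff : (((4 * N + 1 : ℕ) : ℤ) ∣ ∑ j, β j * (n j : ℤ)) ↔ ∑ j, β j * (n j : ℤ) = 0 :=
    ⟨fun h => Int.eq_zero_of_abs_lt_dvd h hsum, fun h => h ▸ dvd_zero _⟩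
  by_cases h : ∑ j, β j * (n j : ℤ) = 0
  · rw [if_pos h, if_pos (hiff.mpr h)]; ring
  · rw [if_neg h, if_neg (fun h' => h (hiff.mp h'))]; simp

lemma ft_parseval (b : ℤ) (hb : b = 1 ∨ b = -1) (s : Finset ℕ) (c : ℕ → ℂ) (N : ℕ) (hs : s ⊆ Ioc 0 N) :
    ∑ k ∈ range (4 * N + 1), ‖ft s c (b * (k / (4 * N + 1 : ℕ)))‖ ^ 2 = ((4 * N + 1 : ℕ) : ℝ) * ∑ n ∈ s, ‖c n‖ ^ 2 := by
  rw [← Complex.ofReal_inj]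
  push_cast
  have e : ∀ k : ℕ, ((‖ft s c (b * (k / (4 * N + 1 : ℕ)))‖ : ℝ) : ℂ) ^ 2 =
      ∑ n ∈ s, ∑ m ∈ s, c n * (starRingEnd ℂ) (c m) * ee (((b * ((n : ℤ) - m) : ℤ) : ℝ) * ((k : ℝ) / (4 * N + 1 : ℕ))) := by
    intro k
    rw [← Complex.mul_conj']
    unfold ft
    rw [map_sum, sum_mul_sum]
    refine sum_congr rfl fun n _ => sum_congr rfl fun m _ => ?_
    rw [map_mul, ← ee_neg]
    have : ((b * ((n : ℤ) - m) : ℤ) : ℝ) * ((k : ℝ) / (4 * N + 1 : ℕ)) =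
      n * (b * ((k : ℝ) / (4 * N + 1 : ℕ))) + -(m * (b * ((k : ℝ) / (4 * N + 1 : ℕ)))) := by push_cast; ring
    rw [this, ee_add]; ring
  push_cast at e
  simp only [e]
  rw [sum_comm, mul_sum]
  refine sum_congr rfl fun n hn => ?_
  rw [sum_comm]
  have e2 : ∀ m ∈ s, ∑ k ∈ range (4 * N + 1), c n * (starRingEnd ℂ) (c m) * ee (b * ((n : ℝ) - m) * ((k : ℝ) / (4 * N + 1))) =
      if m = n then ((4 * N + 1 : ℕ) : ℂ) * (‖c n‖ : ℂ) ^ 2 else 0 := by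
    intro m hm
    have o := orth (4 * N + 1) (by omega) (b * ((n : ℤ) - m))
    push_cast at o
    rw [← mul_sum, o]
    have hn' := mem_Ioc.mp (hs hn)
    have hm' := mem_Ioc.mp (hs hm)
    by_cases h : m = n
    · subst h
      rw [if_pos rfl, if_pos (by simp), ← Complex.mul_conj']; push_cast; ring
    · rw [if_neg h, if_neg, mul_zero]
      intro hd
      have := Int.eq_zero_of_abs_lt_dvd hd (by rcases hb with h | h <;> rw [h, abs_lt] <;> constructor <;> omega)
      rcases hb with h | h <;> rw [h] at this <;> omega
  rw [sum_congr rfl e2, sum_ite_eq' s n, if_pos hn]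
  push_cast; ring

lemma four_le {a b c d S D : ℝ} (ha : 0 ≤ a) (hb : 0 ≤ b) (h1 : a ≤ S) (h2 : b ≤ D) :
    a * b * (c * d) ≤ S * D * ((c ^ 2 + d ^ 2) / 2) := by
  have h3 : c * d ≤ (c ^ 2 + d ^ 2) / 2 := by nlinarith [sq_nonneg (c - d)]
  have h4 : a * b ≤ S * D := mul_le_mul h1 h2 hb (ha.trans h1)
  calc a * b * (c * d) ≤ a * b * ((c ^ 2 + d ^ 2) / 2) := mul_le_mul_of_nonneg_left h3 (by positivity)
    _ ≤ _ := mul_le_mul_of_nonneg_right h4 (by positivity)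

theorem TT_bound (β : Fin 4 → ℤ) (hβ : ∀ j, β j = 1 ∨ β j = -1) (I : Fin 4 → Finset ℕ) (c : Fin 4 → ℕ → ℂ) (N : ℕ)
    (hI : ∀ j, I j ⊆ Ioc 0 N) (D S : ℝ) (hD : ∀ j, ∑ n ∈ I j, ‖c j n‖ ^ 2 ≤ D) (hN : (N : ℝ) ≤ D) (i : Fin 4)
    (hS : ∀ α : ℝ, ‖ft (I i) (c i) α‖ ≤ S) : ‖TT β I c‖ ≤ S * D ^ 2 := by
  set M : ℕ := 4 * N + 1 with hM
  have hM0 : (0 : ℝ) < M := by rw [hM]; positivity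
  have hD0 : 0 ≤ D := le_trans (by positivity) hN
  have hS0 : 0 ≤ S := (norm_nonneg _).trans (hS 0)
  have hsup : ∀ j α, ‖ft (I j) (c j) α‖ ≤ D := by
    intro j α
    unfold ft
    refine (norm_sum_le _ _).trans ?_
    have : ∀ n ∈ I j, ‖c j n * ee (n * α)‖ ≤ 1 / 2 + ‖c j n‖ ^ 2 / 2 := by
      intro n _
      rw [norm_mul, ee_norm]
      nlinarith [sq_nonneg (‖c j n‖ - 1)]
    refine (sum_le_sum this).trans ?_
    rw [sum_add_distrib, sum_const, nsmul_eq_mul, ← sum_div]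
    have h1 : ((I j).card : ℝ) ≤ N := by
      have := card_le_card (hI j)
      rw [Nat.card_Ioc] at this
      exact_mod_cast this
    linarith [hD j]
  have hP : ∀ j, ∑ k ∈ range M, ‖ft (I j) (c j) (β j * (k / (M : ℕ)))‖ ^ 2 ≤ M * D := by
    intro j
    rw [hM, ft_parseval _ (hβ j) _ _ _ (hI j)]
    exact mul_le_mul_of_nonneg_left (hD j) (by positivity)
  have key : ∀ a b d e : Fin 4, (∀ f : Fin 4 → ℝ, ∏ j, f j = f a * f b * (f d * f e)) → a = i →
      ‖TT β I c‖ ≤ S * D ^ 2 := by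
    intro a b d e hf hai
    subst hai
    have h1 : (M : ℝ) * ‖TT β I c‖ ≤ M * (S * D ^ 2) := by
      have := TT_fourier β hβ I c N hI
      have h2 : (M : ℝ) * ‖TT β I c‖ = ‖((4 * N + 1 : ℕ) : ℂ) * TT β I c‖ := by
        rw [norm_mul, Complex.norm_natCast]
      rw [h2, this]
      refine (norm_sum_le _ _).trans ?_
      have h3 : ∀ k ∈ range M, ‖∏ j, ft (I j) (c j) (β j * ((k : ℝ) / (M : ℕ)))‖ ≤
          S * D * ((‖ft (I d) (c d) (β d * (k / (M : ℕ)))‖ ^ 2 + ‖ft (I e) (c e) (β e * (k / (M : ℕ)))‖ ^ 2) / 2) := by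
        intro k _
        rw [norm_prod, hf]
        exact four_le (norm_nonneg _) (norm_nonneg _) (hS _) (hsup _ _)
      refine (sum_le_sum h3).trans ?_
      rw [← mul_sum, ← sum_div, sum_add_distrib]
      have h4 := hP d
      have h5 := hP e
      calc _ ≤ S * D * ((M * D + M * D) / 2) := by gcongr
        _ = _ := by ring
    exact le_of_mul_le_mul_left h1 hM0
  fin_cases i
  · exact key 0 1 2 3 (fun f => by rw [Fin.prod_univ_four]; ring) rfl
  · exact key 1 0 2 3 (fun f => by rw [Fin.prod_univ_four]; ring) rfl
  · exact key 2 1 0 3 (fun f => by rw [Fin.prod_univ_four]; ring) rfl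
  · exact key 3 1 2 0 (fun f => by rw [Fin.prod_univ_four]; ring) rfl

lemma TT_tele (β : Fin 4 → ℤ) (I : Fin 4 → Finset ℕ) (c d : ℕ → ℂ) :
    TT β I (fun _ => c) - TT β I (fun _ => d) =
    TT β I ![c - d, c, c, c] + TT β I ![d, c - d, c, c] + TT β I ![d, d, c - d, c] + TT β I ![d, d, d, c - d] := by
  unfold TT
  rw [← sum_sub_distrib, ← sum_add_distrib, ← sum_add_distrib, ← sum_add_distrib]
  refine sum_congr rfl fun n _ => ?_
  split_ifs with h
  · simp only [Fin.prod_univ_four]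
    simp
    ring
  · simp

theorem TT_diff (β : Fin 4 → ℤ) (hβ : ∀ j, β j = 1 ∨ β j = -1) (I : Fin 4 → Finset ℕ) (c d : ℕ → ℂ) (N : ℕ)
    (hI : ∀ j, I j ⊆ Ioc 0 N) (D S : ℝ) (hc : ∀ j, ∑ n ∈ I j, ‖c n‖ ^ 2 ≤ D) (hd : ∀ j, ∑ n ∈ I j, ‖d n‖ ^ 2 ≤ D)
    (hN : (N : ℝ) ≤ D)
    (hS : ∀ j, ∀ α : ℝ, ‖ft (I j) (c - d) α‖ ≤ S) : ‖TT β I (fun _ => c) - TT β I (fun _ => d)‖ ≤ 64 * (S * D ^ 2) := by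
  have hD0 : 0 ≤ D := le_trans (by positivity) hN
  have hcd : ∀ j, ∑ n ∈ I j, ‖(c - d) n‖ ^ 2 ≤ 4 * D := by
    intro j
    have : ∀ n ∈ I j, ‖(c - d) n‖ ^ 2 ≤ 2 * ‖c n‖ ^ 2 + 2 * ‖d n‖ ^ 2 := by
      intro n _
      have h1 : ‖(c - d) n‖ ≤ ‖c n‖ + ‖d n‖ := norm_sub_le _ _
      nlinarith [norm_nonneg ((c - d) n), norm_nonneg (c n), norm_nonneg (d n), sq_nonneg (‖c n‖ - ‖d n‖)]
    refine (sum_le_sum this).trans ?_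
    rw [sum_add_distrib, ← mul_sum, ← mul_sum]
    linarith [hc j, hd j]
  have hc4 : ∀ j, ∑ n ∈ I j, ‖c n‖ ^ 2 ≤ 4 * D := fun j => (hc j).trans (by linarith)
  have hd4 : ∀ j, ∑ n ∈ I j, ‖d n‖ ^ 2 ≤ 4 * D := fun j => (hd j).trans (by linarith)
  rw [TT_tele]
  have k : ∀ (f : Fin 4 → ℕ → ℂ) (i : Fin 4), (∀ j, f j = c ∨ f j = d ∨ f j = c - d) → f i = c - d → ‖TT β I f‖ ≤ S * (4 * D) ^ 2 := by
    intro f i h1 h2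
    refine TT_bound β hβ I f N hI (4 * D) S (fun j => ?_) (by linarith) i (fun α => by rw [h2]; exact hS i α)
    rcases h1 j with h | h | h <;> rw [h]
    exacts [hc4 j, hd4 j, hcd j]
  have k0 := k ![c - d, c, c, c] 0 (fun j => by fin_cases j <;> simp) rfl
  have k1 := k ![d, c - d, c, c] 1 (fun j => by fin_cases j <;> simp) rfl
  have k2 := k ![d, d, c - d, c] 2 (fun j => by fin_cases j <;> simp) rfl
  have k3 := k ![d, d, d, c - d] 3 (fun j => by fin_cases j <;> simp) rfl
  refine (norm_add_le _ _).trans ?_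
  refine (add_le_add ((norm_add_le _ _).trans (add_le_add ((norm_add_le _ _).trans (add_le_add k0 k1)) k2)) k3).trans ?_
  linarith

end WCL

end

section

open Finset
namespace WCL

def FF (p : ℕ) : Finset (ℕ × ℕ) := (Icc 1 p ×ˢ range p).filter fun x => x.2 < x.1 ∧ Nat.Coprime x.2 x.1

noncomputable def gam (x : ℕ × ℕ) : ℝ := (x.2 : ℝ) / x.1

noncomputable def lamP (p : ℕ) (n : ℕ) : ℂ := ∑ x ∈ FF p, (kap x.1 : ℂ) * ee (-(n * gam x))

lemma mem_FF {p : ℕ} {x : ℕ × ℕ} (h : x ∈ FF p) : 0 < x.1 ∧ x.1 ≤ p ∧ x.2 < x.1 ∧ Nat.Coprime x.2 x.1 := by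
  unfold FF at h
  rw [mem_filter, mem_product, mem_Icc] at h
  exact ⟨h.1.1.1, h.1.1.2, h.2.1, h.2.2⟩

lemma card_FF (p : ℕ) : (FF p).card ≤ p ^ 2 := by
  refine (card_filter_le _ _).trans ?_
  rw [card_product]; simp [sq]

lemma kap_abs (q : ℕ) : |kap q| ≤ 1 := by
  unfold kap
  have h1 : |(ArithmeticFunction.moebius q : ℝ)| ≤ 1 := by
    exact_mod_cast ArithmeticFunction.abs_moebius_le_one (n := q)
  rw [abs_div, Nat.abs_cast]
  rcases Nat.eq_zero_or_pos q.totient with h | h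
  · rw [h]; simp
  · rw [div_le_one (by exact_mod_cast h)]
    exact h1.trans (by exact_mod_cast h)

lemma sep_aux {p : ℕ} {x y : ℕ × ℕ} (hx : x ∈ FF p) (hy : y ∈ FF p) (s : ℤ)
    (h : ¬ ∃ k : ℤ, gam x - s * gam y = k) : 1 / ((x.1 : ℝ) * y.1) ≤ nd (gam x - s * gam y) := by
  obtain ⟨h1, -, -, -⟩ := mem_FF hx
  obtain ⟨h2, -, -, -⟩ := mem_FF hy
  have h1' : (0 : ℝ) < x.1 := by exact_mod_cast h1
  have h2' : (0 : ℝ) < y.1 := by exact_mod_cast h2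
  unfold nd
  set k := round (gam x - s * gam y) with hk
  have e : gam x - s * gam y - k = (((x.2 : ℤ) * y.1 - s * (y.2 * x.1) - k * (x.1 * y.1) : ℤ) : ℝ) / (x.1 * y.1) := by
    unfold gam; push_cast; field_simp
  have hne : ((x.2 : ℤ) * y.1 - s * (y.2 * x.1) - k * (x.1 * y.1) : ℤ) ≠ 0 := by
    intro h0
    rw [h0] at e
    exact h ⟨k, by simp at e; linarith⟩
  rw [e, abs_div, abs_of_pos (mul_pos h1' h2')]
  gcongr
  exact_mod_cast Int.one_le_abs hne

lemma same_q {p : ℕ} {x y : ℕ × ℕ} (hx : x ∈ FF p) (hy : y ∈ FF p) (s : ℤ) (hs : s = 1 ∨ s = -1)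
    {k : ℤ} (h : gam x - s * gam y = k) : x.1 = y.1 := by
  obtain ⟨h1, -, -, c1⟩ := mem_FF hx
  obtain ⟨h2, -, -, c2⟩ := mem_FF hy
  have h1' : (0 : ℝ) < x.1 := by exact_mod_cast h1
  have h2' : (0 : ℝ) < y.1 := by exact_mod_cast h2
  have e : ((x.2 : ℤ) * y.1 - s * (y.2 * x.1) : ℤ) = k * (x.1 * y.1) := by
    unfold gam at h
    field_simp at h
    have : (((x.2 : ℤ) * y.1 - s * (y.2 * x.1) : ℤ) : ℝ) = ((k * (x.1 * y.1) : ℤ) : ℝ) := by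
      push_cast; linarith
    exact_mod_cast this
  apply Nat.dvd_antisymm
  · have : (x.1 : ℤ) ∣ x.2 * y.1 := ⟨s * y.2 + k * y.1, by linarith⟩
    have h3 : x.1 ∣ x.2 * y.1 := by exact_mod_cast this
    exact c1.symm.dvd_of_dvd_mul_left h3
  · have : (y.1 : ℤ) ∣ s * (y.2 * x.1) := ⟨x.2 - k * x.1, by linarith⟩
    have h3 : (y.1 : ℤ) ∣ y.2 * x.1 := by
      rcases hs with rfl | rfl
      · simpa using this
      · simpa using this
    have h4 : y.1 ∣ y.2 * x.1 := by exact_mod_cast h3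
    exact c2.symm.dvd_of_dvd_mul_left h4

lemma conv_Ioc (s t : ℤ) (hs : s = 1 ∨ s = -1) (u v u' v' : ℕ) : ∃ a b : ℕ, ∀ m : ℕ,
    (m ∈ Ioc u v ∧ (u' : ℤ) < s * m + t ∧ s * m + t ≤ v') ↔ m ∈ Ioc a b := by
  simp only [mem_Ioc]
  rcases hs with rfl | rfl
  · refine ⟨max u (u' - t).toNat, min v (v' - t).toNat, fun m => ?_⟩
    omega
  · refine ⟨max u (t - v' - 1).toNat, min v (t - u' - 1).toNat, fun m => ?_⟩
    by_cases h : t - v' - 1 < 0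
    · omega
    · omega

lemma off_aux (β : Fin 4 → ℤ) (hβ : ∀ j, β j = 1 ∨ β j = -1) (u v : Fin 4 → ℕ) (N : ℕ) (hv : ∀ j, v j ≤ N)
    (g : Fin 4 → ℝ) (E : ℝ) (hE0 : 0 ≤ E) (i k l : Fin 4)
    (hik : i ≠ k) (hil : i ≠ l) (hkl : k ≠ l) (hi3 : i ≠ 3) (hk3 : k ≠ 3) (hl3 : l ≠ 3)
    (hcov : ∀ j, j = i ∨ j = k ∨ j = l ∨ j = 3)
    (hsum : ∀ f : Fin 4 → ℤ, ∑ j, f j = f i + f k + f l + f 3)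
    (hprod : ∀ f : Fin 4 → ℂ, ∏ j, f j = f i * f k * f l * f 3)
    (hE : 1 ≤ E * (2 * nd (g i - (β i * β 3 : ℤ) * g 3))) :
    ‖TT β (fun j => Ioc (u j) (v j)) (fun j n => ee (-(n * g j)))‖ ≤ E * N ^ 2 := by
  classical
  have hb2 : ∀ j, β j * β j = 1 := by intro j; rcases hβ j with h | h <;> rw [h] <;> rfl
  unfold TT
  set I : Fin 4 → Finset ℕ := fun j => Ioc (u j) (v j) with hI
  have hnd : 0 < nd (g i - (β i * β 3 : ℤ) * g 3) := by
    rcases (nd_nonneg (g i - (β i * β 3 : ℤ) * g 3)).lt_or_eq with h | h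
    · exact h
    · rw [← h] at hE; norm_num at hE
  rw [← sum_fiberwise_of_maps_to (s := Fintype.piFinset I) (t := I k ×ˢ I l) (g := fun n => (n k, n l))
    (fun n hn => by
      rw [Fintype.mem_piFinset] at hn
      exact mem_product.mpr ⟨hn k, hn l⟩)]
  refine (norm_sum_le _ _).trans ?_
  have hcard : ∀ j, ((I j).card : ℝ) ≤ N := by
    intro j
    have : (I j).card ≤ N := by rw [hI]; simp; have := hv j; omega
    exact_mod_cast this
  have hfib : ∀ w ∈ I k ×ˢ I l, ‖∑ n ∈ (Fintype.piFinset I).filter (fun n => (n k, n l) = w),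
      (if ∑ j, β j * (n j : ℤ) = 0 then ∏ j, ee (-(n j * g j)) else 0)‖ ≤ E := by
    rintro ⟨y, z⟩ hw
    rw [mem_product] at hw
    rw [← sum_filter, filter_filter]
    obtain ⟨a, b, hab⟩ := conv_Ioc (-(β i * β 3)) (-(β 3 * (β k * y + β l * z)))
      (by rcases hβ i with h | h <;> rcases hβ 3 with h' | h' <;> rw [h, h'] <;> decide) (u i) (v i) (u 3) (v 3)
    have hC : ∑ n ∈ (Fintype.piFinset I).filter (fun n => (n k, n l) = (y, z) ∧ ∑ j, β j * (n j : ℤ) = 0),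
        ∏ j, ee (-(n j * g j)) = ∑ m ∈ Ioc a b, ee (-(y * g k)) * ee (-(z * g l)) * ee (β 3 * (β k * y + β l * z) * g 3) *
          ee (m * (-(g i - (β i * β 3 : ℤ) * g 3))) := by
      have h3 : ∀ n : Fin 4 → ℕ, ∑ j, β j * (n j : ℤ) = 0 → (n 3 : ℤ) = -(β i * β 3) * n i + -(β 3 * (β k * n k + β l * n l)) := by
        intro n hn
        rw [hsum] at hn
        have := hb2 3
        linear_combination (β 3) * hn - (n 3 : ℤ) * this
      refine sum_nbij (fun n => n i) ?_ ?_ ?_ ?_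
      · intro n hn
        rw [mem_filter, Fintype.mem_piFinset] at hn
        obtain ⟨hn1, hn2, hn3⟩ := hn
        rw [Prod.mk.injEq] at hn2
        rw [← hab]
        have := h3 n hn3
        rw [hn2.1, hn2.2] at this
        rw [← this]
        have h4 := mem_Ioc.mp (hn1 3)
        exact ⟨hn1 i, by exact_mod_cast h4.1, by exact_mod_cast h4.2⟩
      · intro n hn n' hn' hnn
        rw [mem_coe, mem_filter] at hn hn'
        simp only [Prod.mk.injEq] at hn hn' hnn
        funext j
        have e1 := h3 n hn.2.2
        have e2 := h3 n' hn'.2.2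
        rw [hn.2.1.1, hn.2.1.2, hnn, ← hn'.2.1.1, ← hn'.2.1.2, ← e2] at e1
        rcases hcov j with rfl | rfl | rfl | rfl
        · exact hnn
        · rw [hn.2.1.1, hn'.2.1.1]
        · rw [hn.2.1.2, hn'.2.1.2]
        · exact_mod_cast e1
      · intro m hm
        rw [mem_coe, ← hab] at hm
        obtain ⟨m1, m2, m3⟩ := hm
        set t : ℤ := -(β i * β 3) * m + -(β 3 * (β k * y + β l * z)) with ht
        have ht0 : ((t.toNat : ℕ) : ℤ) = t := Int.toNat_of_nonneg (by omega)
        refine ⟨fun j => if j = i then m else if j = k then y else if j = l then z else t.toNat, ?_, by simp⟩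
        rw [mem_coe, mem_filter, Fintype.mem_piFinset]
        refine ⟨fun j => ?_, ?_, ?_⟩
        · rcases hcov j with rfl | rfl | rfl | rfl
          · simp only [if_true]; exact m1
          · simpa [hik.symm] using hw.1
          · simpa [hil.symm, hkl.symm] using hw.2
          · simp only [hi3.symm, hk3.symm, hl3.symm, if_false]
            rw [hI, mem_Ioc]; omega
        · simp [hik.symm, hil.symm, hkl.symm]
        · rw [hsum]
          simp only [hik.symm, hil.symm, hkl.symm, hi3.symm, hk3.symm, hl3.symm, if_false, if_true]
          rw [ht0, ht]
          have := hb2 3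
          linear_combination -(β i * m + β k * y + β l * z) * this
      · intro n hn
        rw [mem_filter] at hn
        simp only [Prod.mk.injEq] at hn
        rw [hprod]
        have e := h3 n hn.2.2
        have e' : (n 3 : ℝ) = -(β i * β 3) * n i + -(β 3 * (β k * n k + β l * n l)) := by exact_mod_cast e
        rw [e', hn.2.1.1, hn.2.1.2, ← ee_add, ← ee_add, ← ee_add, ← ee_add, ← ee_add, ← ee_add]
        congr 1
        push_cast; ring
    rw [hC, ← mul_sum, norm_mul, norm_mul, norm_mul, ee_norm, ee_norm, ee_norm, one_mul, one_mul, one_mul]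
    have hg := geo_bound a b (-(g i - (β i * β 3 : ℤ) * g 3))
    rw [nd_neg] at hg
    exact le_of_mul_le_mul_right (hg.trans hE) (by positivity)
  refine (sum_le_sum hfib).trans ?_
  rw [sum_const, card_product, nsmul_eq_mul]
  push_cast
  have := mul_le_mul (hcard k) (hcard l) (by positivity) (by positivity)
  nlinarith

noncomputable def Cnt (β : Fin 4 → ℤ) (I : Fin 4 → Finset ℕ) : ℝ :=
  ∑ n ∈ Fintype.piFinset I, if ∑ j, β j * (n j : ℤ) = 0 then 1 else 0

lemma Cnt_nonneg (β : Fin 4 → ℤ) (I : Fin 4 → Finset ℕ) : 0 ≤ Cnt β I :=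
  sum_nonneg fun n _ => by split_ifs <;> norm_num

lemma TT_diag (β : Fin 4 → ℤ) (hβ : ∀ j, β j = 1 ∨ β j = -1) (I : Fin 4 → Finset ℕ) (g : Fin 4 → ℝ)
    (h : ∀ j, ∃ k : ℤ, g j - (β j * β 3 : ℤ) * g 3 = k) :
    TT β I (fun j n => ee (-(n * g j))) = (Cnt β I : ℂ) := by
  unfold TT Cnt
  push_cast
  refine sum_congr rfl fun n _ => ?_
  split_ifs with h0
  · choose k hk using h
    rw [← ee_sum]
    have : ∑ j, (-((n j : ℝ) * g j)) = ((∑ j, (-((n j : ℤ) * k j)) : ℤ) : ℝ) := by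
      have e : ∀ j, -((n j : ℝ) * g j) = -((n j : ℝ) * k j) - (β 3 * g 3) * (β j * n j) := by
        intro j
        have := hk j
        push_cast at this
        rw [← this]; ring
      simp only [e]
      rw [sum_sub_distrib, ← mul_sum]
      have h0' : ∑ j, (β j : ℝ) * n j = 0 := by exact_mod_cast h0
      rw [h0']; push_cast; ring
    rw [this, ee_int]
    norm_num
  · norm_num

theorem TT_lamP_lower (β : Fin 4 → ℤ) (hβ : ∀ j, β j = 1 ∨ β j = -1) (u v : Fin 4 → ℕ) (N : ℕ) (hv : ∀ j, v j ≤ N)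
    (p : ℕ) (hp : 0 < p) :
    Cnt β (fun j => Ioc (u j) (v j)) - (p : ℝ) ^ 10 * N ^ 2 ≤ (TT β (fun j => Ioc (u j) (v j)) (fun _ => lamP p)).re := by
  classical
  set I : Fin 4 → Finset ℕ := fun j => Ioc (u j) (v j) with hI
  have hexp : TT β I (fun _ => lamP p) = ∑ x ∈ Fintype.piFinset (fun _ : Fin 4 => FF p),
      ((∏ j, kap (x j).1 : ℝ) : ℂ) * TT β I (fun j n => ee (-(n * gam (x j)))) := by
    unfold TT
    simp only [mul_sum]
    rw [sum_comm]
    refine sum_congr rfl fun n _ => ?_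
    split_ifs with h
    · simp only [lamP]
      rw [prod_univ_sum]
      refine sum_congr rfl fun x _ => ?_
      rw [prod_mul_distrib]
      push_cast; rfl
    · simp
  rw [hexp, Complex.re_sum]
  have hx0 : (fun _ => (1, 0)) ∈ Fintype.piFinset (fun _ : Fin 4 => FF p) := by
    rw [Fintype.mem_piFinset]
    intro _
    simp [FF]; omega
  have hterm : ∀ x ∈ Fintype.piFinset (fun _ : Fin 4 => FF p),
      (if x = (fun _ => (1, 0)) then Cnt β I else 0) - (p : ℝ) ^ 2 * N ^ 2 ≤
      (((∏ j, kap (x j).1 : ℝ) : ℂ) * TT β I (fun j n => ee (-(n * gam (x j))))).re := by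
    intro x hx
    rw [Fintype.mem_piFinset] at hx
    rw [Complex.re_ofReal_mul]
    have hpN : (0 : ℝ) ≤ (p : ℝ) ^ 2 * N ^ 2 := by positivity
    have hCnt := Cnt_nonneg β I
    by_cases hd : ∀ j, ∃ k : ℤ, gam (x j) - (β j * β 3 : ℤ) * gam (x 3) = k
    · rw [TT_diag β hβ I (fun j => gam (x j)) hd, Complex.ofReal_re]
      have hq : ∀ j, (x j).1 = (x 3).1 := by
        intro j
        obtain ⟨k, hk⟩ := hd j
        exact same_q (hx j) (hx 3) _ (by rcases hβ j with h | h <;> rcases hβ 3 with h' | h' <;> rw [h, h'] <;> decide) hk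
      split_ifs with h0
      · rw [h0]
        simp [kap]
        linarith
      · simp only [hq]
        rw [prod_const, card_univ, Fintype.card_fin]
        have : 0 ≤ kap (x 3).1 ^ 4 * Cnt β I := mul_nonneg (by positivity) hCnt
        linarith
    · have hne : x ≠ (fun _ => (1, 0)) := by
        rintro rfl
        exact hd fun j => ⟨0, by simp [gam]⟩
      rw [if_neg hne]
      push Not at hd
      obtain ⟨i, hi⟩ := hd
      have hb3 : β 3 * β 3 = 1 := by rcases hβ 3 with h | h <;> rw [h] <;> rfl
      have hi3 : i ≠ 3 := by
        rintro rfl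
        exact hi 0 (by rw [hb3]; simp)
      have hsep := sep_aux (hx i) (hx 3) (β i * β 3) (by push Not; exact hi)
      have hE : 1 ≤ (p : ℝ) ^ 2 * (2 * nd (gam (x i) - (β i * β 3 : ℤ) * gam (x 3))) := by
        obtain ⟨a1, a2, -, -⟩ := mem_FF (hx i)
        obtain ⟨b1, b2, -, -⟩ := mem_FF (hx 3)
        have a1' : (0 : ℝ) < (x i).1 := by exact_mod_cast a1
        have b1' : (0 : ℝ) < (x 3).1 := by exact_mod_cast b1
        have a2' : ((x i).1 : ℝ) ≤ p := by exact_mod_cast a2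
        have b2' : ((x 3).1 : ℝ) ≤ p := by exact_mod_cast b2
        have h1 : ((x i).1 : ℝ) * (x 3).1 ≤ p ^ 2 := by rw [sq]; exact mul_le_mul a2' b2' b1'.le (by positivity)
        rw [div_le_iff₀ (by positivity)] at hsep
        nlinarith [nd_nonneg (gam (x i) - (β i * β 3 : ℤ) * gam (x 3))]
      have hT : ‖TT β I (fun j n => ee (-(n * gam (x j))))‖ ≤ (p : ℝ) ^ 2 * N ^ 2 := by
        have key := fun i k l => off_aux β hβ u v N hv (fun j => gam (x j)) ((p : ℝ) ^ 2) (by positivity) i k l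
        fin_cases i
        · exact key 0 1 2 (by decide) (by decide) (by decide) (by decide) (by decide) (by decide) (by decide)
            (fun f => by rw [Fin.sum_univ_four]) (fun f => by rw [Fin.prod_univ_four]) hE
        · exact key 1 0 2 (by decide) (by decide) (by decide) (by decide) (by decide) (by decide) (by decide)
            (fun f => by rw [Fin.sum_univ_four]; ring) (fun f => by rw [Fin.prod_univ_four]; ring) hE
        · exact key 2 0 1 (by decide) (by decide) (by decide) (by decide) (by decide) (by decide) (by decide)
            (fun f => by rw [Fin.sum_univ_four]; ring) (fun f => by rw [Fin.prod_univ_four]; ring) hE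
        · exact absurd rfl hi3
      have hk : |∏ j, kap (x j).1| ≤ 1 := by
        rw [abs_prod]
        exact prod_le_one (fun _ _ => abs_nonneg _) (fun _ _ => kap_abs _)
      have h1 := (Complex.abs_re_le_norm _).trans hT
      have h2 : |(∏ j, kap (x j).1) * (TT β I (fun j n => ee (-(n * gam (x j))))).re| ≤ 1 * ((p : ℝ) ^ 2 * N ^ 2) := by
        rw [abs_mul]; exact mul_le_mul hk h1 (abs_nonneg _) zero_le_one
      have := (abs_le.mp h2).1
      linarith
  refine le_trans ?_ (sum_le_sum hterm)
  rw [sum_sub_distrib, sum_ite_eq' _ _ (fun _ => Cnt β I), if_pos hx0, sum_const, nsmul_eq_mul]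
  have hc : ((Fintype.piFinset (fun _ : Fin 4 => FF p)).card : ℝ) ≤ (p : ℝ) ^ 8 := by
    rw [Fintype.card_piFinset, prod_const, card_univ, Fintype.card_fin]
    have := Nat.pow_le_pow_left (card_FF p) 4
    rw [← pow_mul] at this
    exact_mod_cast this
  have : ((Fintype.piFinset (fun _ : Fin 4 => FF p)).card : ℝ) * ((p : ℝ) ^ 2 * N ^ 2) ≤ (p : ℝ) ^ 8 * ((p : ℝ) ^ 2 * N ^ 2) := by
    gcongr
  nlinarith

end WCL

end

section

open Finset
namespace WCL

lemma gam_ne {p : ℕ} {x y : ℕ × ℕ} (hx : x ∈ FF p) (hy : y ∈ FF p) (hne : x ≠ y) :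
    ¬ ∃ k : ℤ, gam x - (1 : ℤ) * gam y = k := by
  rintro ⟨k, hk⟩
  have hq := same_q hx hy 1 (Or.inl rfl) hk
  obtain ⟨h1, -, h3, -⟩ := mem_FF hx
  obtain ⟨-, -, h4, -⟩ := mem_FF hy
  apply hne
  have h1' : (0 : ℝ) < x.1 := by exact_mod_cast h1
  unfold gam at hk
  rw [← hq] at hk h4
  push_cast at hk
  field_simp at hk
  have hk' : (x.2 : ℤ) - y.2 = x.1 * k := by
    have : (((x.2 : ℤ) - y.2 : ℤ) : ℝ) = ((x.1 * k : ℤ) : ℝ) := by push_cast; linarith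
    exact_mod_cast this
  have h0 : (x.2 : ℤ) - y.2 = 0 := Int.eq_zero_of_abs_lt_dvd (Dvd.intro k hk'.symm) (by rw [abs_lt]; constructor <;> omega)
  exact Prod.ext hq (by omega)

lemma sep_ne {p : ℕ} {x y : ℕ × ℕ} (hx : x ∈ FF p) (hy : y ∈ FF p) (hne : x ≠ y) :
    1 / ((x.1 : ℝ) * y.1) ≤ nd (gam x - gam y) := by
  have := sep_aux hx hy 1 (gam_ne hx hy hne)
  push_cast at this
  rwa [one_mul] at this

lemma tot_bound (q : ℕ) (hq : 0 < q) : (q : ℝ) / q.totient ≤ 1 + 2 * Real.log q := by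
  refine le_trans (le_of_eq ?_) (prod_pf_le q hq)
  have h := Nat.totient_mul_prod_primeFactors q
  have h' : (q.totient : ℝ) * ∏ p ∈ q.primeFactors, (p : ℝ) = q * ∏ p ∈ q.primeFactors, ((p : ℝ) - 1) := by
    have e : ∏ p ∈ q.primeFactors, ((p : ℝ) - 1) = ((∏ p ∈ q.primeFactors, (p - 1) : ℕ) : ℝ) := by
      push_cast
      refine prod_congr rfl fun p hp => ?_
      rw [Nat.cast_sub (Nat.prime_of_mem_primeFactors hp).one_le]; simp
    rw [e, ← Nat.cast_prod, ← Nat.cast_mul, ← Nat.cast_mul, h]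
  rw [prod_div_distrib]
  have h1 : (q.totient : ℝ) ≠ 0 := by exact_mod_cast (Nat.totient_pos.mpr hq).ne'
  have h2 : ∏ p ∈ q.primeFactors, ((p : ℝ) - 1) ≠ 0 := by
    rw [prod_ne_zero_iff]
    intro p hp
    have : (1 : ℝ) < p := by exact_mod_cast (Nat.prime_of_mem_primeFactors hp).one_lt
    linarith
  rw [div_eq_div_iff h1 h2]
  linarith

lemma kap_sq_sum (p : ℕ) : ∑ x ∈ FF p, kap x.1 ^ 2 ≤ (1 + 2 * Real.log p) ^ 2 * (1 + Real.log (p + 1)) := by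
  have h1 : ∑ x ∈ FF p, kap x.1 ^ 2 ≤ ∑ x ∈ (Icc 1 p ×ˢ range p).filter (fun x => x.2 < x.1), kap x.1 ^ 2 := by
    apply sum_le_sum_of_subset_of_nonneg
    · intro x hx
      unfold FF at hx
      rw [mem_filter] at hx ⊢
      exact ⟨hx.1, hx.2.1⟩
    · intro _ _ _; positivity
  refine h1.trans ?_
  rw [sum_filter, sum_product]
  have h2 : ∀ q ∈ Icc 1 p, ∑ a ∈ range p, (if a < q then kap q ^ 2 else 0) ≤ (1 + 2 * Real.log p) ^ 2 * (1 / (q : ℝ)) := by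
    intro q hq
    rw [mem_Icc] at hq
    have hq0 : (0 : ℝ) < q := by exact_mod_cast hq.1
    have hf : (0 : ℝ) < q.totient := by exact_mod_cast Nat.totient_pos.mpr hq.1
    rw [← sum_filter, sum_const, nsmul_eq_mul]
    have hc : (((range p).filter (fun a => a < q)).card : ℝ) ≤ q := by
      have : ((range p).filter (fun a => a < q)).card ≤ (range q).card := card_le_card (fun a ha => by
        rw [mem_filter] at ha; exact mem_range.mpr ha.2)
      rw [card_range] at this
      exact_mod_cast this
    have hm : |(ArithmeticFunction.moebius q : ℝ)| ≤ 1 := by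
      exact_mod_cast ArithmeticFunction.abs_moebius_le_one (n := q)
    have hk : kap q ^ 2 ≤ 1 / (q.totient : ℝ) ^ 2 := by
      unfold kap
      rw [div_pow, ← sq_abs]
      gcongr
      exact pow_le_one₀ (abs_nonneg _) hm
    have ht := tot_bound q hq.1
    have hl : Real.log q ≤ Real.log p := Real.log_le_log hq0 (by exact_mod_cast hq.2)
    have ht2 : ((q : ℝ) / q.totient) ^ 2 ≤ (1 + 2 * Real.log p) ^ 2 :=
      pow_le_pow_left₀ (by positivity) (by linarith) 2
    calc _ ≤ (q : ℝ) * (1 / (q.totient : ℝ) ^ 2) := mul_le_mul hc hk (by positivity) (by positivity)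
      _ = ((q : ℝ) / q.totient) ^ 2 * (1 / q) := by field_simp
      _ ≤ _ := by gcongr
  refine (sum_le_sum h2).trans ?_
  rw [← mul_sum]
  gcongr
  have := sum_inv_range_le (p + 1) (by omega)
  push_cast at this
  refine le_trans ?_ this
  apply sum_le_sum_of_subset_of_nonneg
  · intro q hq; rw [mem_Icc] at hq; rw [mem_range]; omega
  · intro _ _ _; positivity

theorem lamP_l2 (p a b : ℕ) : ∑ n ∈ Ioc a b, ‖lamP p n‖ ^ 2 ≤
    (b : ℝ) * ((1 + 2 * Real.log p) ^ 2 * (1 + Real.log (p + 1))) + (p : ℝ) ^ 6 := by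
  classical
  have e : ((∑ n ∈ Ioc a b, ‖lamP p n‖ ^ 2 : ℝ) : ℂ) =
      ∑ x ∈ FF p, ∑ y ∈ FF p, ((kap x.1 * kap y.1 : ℝ) : ℂ) * ∑ n ∈ Ioc a b, ee (n * (-(gam x - gam y))) := by
    push_cast
    have e1 : ∀ n : ℕ, ((‖lamP p n‖ : ℝ) : ℂ) ^ 2 = ∑ x ∈ FF p, ∑ y ∈ FF p, ((kap x.1 * kap y.1 : ℝ) : ℂ) * ee (n * (-(gam x - gam y))) := by
      intro n
      rw [← Complex.mul_conj']
      unfold lamP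
      rw [map_sum, sum_mul_sum]
      refine sum_congr rfl fun x _ => sum_congr rfl fun y _ => ?_
      rw [map_mul, ← ee_neg, Complex.conj_ofReal]
      have : (n : ℝ) * (-(gam x - gam y)) = -(n * gam x) + - -(n * gam y) := by ring
      rw [this, ee_add]; push_cast; ring
    simp only [e1]
    rw [sum_comm]
    refine sum_congr rfl fun x _ => ?_
    rw [sum_comm]
    refine sum_congr rfl fun y _ => ?_
    rw [mul_sum]; push_cast; rfl
  have e2 : ∑ n ∈ Ioc a b, ‖lamP p n‖ ^ 2 = ‖((∑ n ∈ Ioc a b, ‖lamP p n‖ ^ 2 : ℝ) : ℂ)‖ := by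
    rw [Complex.norm_real, Real.norm_of_nonneg (sum_nonneg fun _ _ => by positivity)]
  rw [e2, e]
  have hb : ∀ x ∈ FF p, ∀ y ∈ FF p, ‖((kap x.1 * kap y.1 : ℝ) : ℂ) * ∑ n ∈ Ioc a b, ee (n * (-(gam x - gam y)))‖ ≤
      (if y = x then (b : ℝ) * kap x.1 ^ 2 else 0) + (p : ℝ) ^ 2 := by
    intro x hx y hy
    rw [norm_mul, Complex.norm_real, Real.norm_eq_abs]
    by_cases h : y = x
    · subst h
      rw [if_pos rfl, ← sq, abs_of_nonneg (sq_nonneg _)]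
      have h1 := geo_trivial a b (-(gam y - gam y))
      have h2 : ((b - a : ℕ) : ℝ) ≤ b := by exact_mod_cast Nat.sub_le b a
      have h3 : (0 : ℝ) ≤ kap y.1 ^ 2 := sq_nonneg _
      have h4 : kap y.1 ^ 2 * ‖∑ n ∈ Ioc a b, ee (n * (-(gam y - gam y)))‖ ≤ kap y.1 ^ 2 * b :=
        mul_le_mul_of_nonneg_left (h1.trans h2) h3
      have : (0 : ℝ) ≤ (p : ℝ) ^ 2 := by positivity
      linarith
    · rw [if_neg h, zero_add]
      have hs := sep_ne hx hy (fun h' => h h'.symm)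
      have hg := geo_bound a b (-(gam x - gam y))
      rw [nd_neg] at hg
      obtain ⟨a1, a2, -, -⟩ := mem_FF hx
      obtain ⟨b1, b2, -, -⟩ := mem_FF hy
      have a1' : (0 : ℝ) < x.1 := by exact_mod_cast a1
      have b1' : (0 : ℝ) < y.1 := by exact_mod_cast b1
      have a2' : (x.1 : ℝ) ≤ p := by exact_mod_cast a2
      have b2' : (y.1 : ℝ) ≤ p := by exact_mod_cast b2
      have h1 : (x.1 : ℝ) * y.1 ≤ p ^ 2 := by rw [sq]; exact mul_le_mul a2' b2' b1'.le (by positivity)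
      have hk : |kap x.1 * kap y.1| ≤ 1 := by
        rw [abs_mul]; exact mul_le_one₀ (kap_abs _) (abs_nonneg _) (kap_abs _)
      have hs2 : 1 / (p : ℝ) ^ 2 ≤ nd (gam x - gam y) := le_trans (by gcongr) hs
      have hp2 : (0 : ℝ) < (p : ℝ) ^ 2 := lt_of_lt_of_le (by positivity) h1
      rw [div_le_iff₀ hp2] at hs2
      have hG : ‖∑ n ∈ Ioc a b, ee (n * (-(gam x - gam y)))‖ ≤ (p : ℝ) ^ 2 := by
        have h0 : 0 < nd (gam x - gam y) := by
          by_contra h'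
          push Not at h'
          nlinarith
        refine le_of_mul_le_mul_right (hg.trans ?_) (by positivity : 0 < 2 * nd (gam x - gam y))
        nlinarith
      calc _ ≤ 1 * (p : ℝ) ^ 2 := mul_le_mul hk hG (norm_nonneg _) zero_le_one
        _ = _ := one_mul _
  refine (norm_sum_le _ _).trans ?_
  refine (sum_le_sum fun x hx => (norm_sum_le _ _).trans (sum_le_sum fun y hy => hb x hx y hy)).trans ?_
  simp only [sum_add_distrib, sum_ite_eq', sum_const, nsmul_eq_mul]
  have h5 : ∑ x ∈ FF p, (if x ∈ FF p then (b : ℝ) * kap x.1 ^ 2 else 0) = b * ∑ x ∈ FF p, kap x.1 ^ 2 := by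
    rw [mul_sum]
    exact sum_congr rfl fun x hx => if_pos hx
  rw [h5]
  have h6 : ((FF p).card : ℝ) ≤ (p : ℝ) ^ 2 := by exact_mod_cast card_FF p
  have h7 : ((FF p).card : ℝ) * (((FF p).card : ℝ) * (p : ℝ) ^ 2) ≤ (p : ℝ) ^ 2 * ((p : ℝ) ^ 2 * (p : ℝ) ^ 2) :=
    mul_le_mul h6 (mul_le_mul_of_nonneg_right h6 (sq_nonneg _)) (mul_nonneg (Nat.cast_nonneg _) (sq_nonneg _)) (sq_nonneg _)
  have h8 := mul_le_mul_of_nonneg_left (kap_sq_sum p) (Nat.cast_nonneg (α := ℝ) b)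
  calc _ ≤ _ := add_le_add h8 h7
    _ = _ := by ring

end WCL

end

section

open Finset
namespace WCL

lemma sep_gen (a a' : ℤ) (q q' : ℕ) (hq : 0 < q) (hq' : 0 < q')
    (h : ¬ ∃ k : ℤ, (a : ℝ) / q - (a' : ℝ) / q' = k) : 1 / ((q : ℝ) * q') ≤ nd ((a : ℝ) / q - (a' : ℝ) / q') := by
  have h1' : (0 : ℝ) < q := by exact_mod_cast hq
  have h2' : (0 : ℝ) < q' := by exact_mod_cast hq'
  unfold nd
  set k := round ((a : ℝ) / q - (a' : ℝ) / q') with hk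
  have e : (a : ℝ) / q - (a' : ℝ) / q' - k = ((a * q' - a' * q - k * (q * q') : ℤ) : ℝ) / (q * q') := by
    push_cast; field_simp
  have hne : (a * q' - a' * q - k * (q * q') : ℤ) ≠ 0 := by
    intro h0
    rw [h0] at e
    exact h ⟨k, by simp at e; linarith⟩
  rw [e, abs_div, abs_of_pos (mul_pos h1' h2')]
  gcongr
  exact_mod_cast Int.one_le_abs hne

lemma same_q_gen (a a' : ℤ) (q q' : ℕ) (hq : 0 < q) (hq' : 0 < q') (c1 : IsCoprime a (q : ℤ)) (c2 : IsCoprime a' (q' : ℤ))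
    {k : ℤ} (h : (a : ℝ) / q - (a' : ℝ) / q' = k) : q = q' := by
  have h1' : (0 : ℝ) < q := by exact_mod_cast hq
  have h2' : (0 : ℝ) < q' := by exact_mod_cast hq'
  have e : a * q' - a' * q = k * (q * q') := by
    field_simp at h
    have : ((a * q' - a' * q : ℤ) : ℝ) = ((k * (q * q') : ℤ) : ℝ) := by
      push_cast; linarith
    exact_mod_cast this
  apply Nat.dvd_antisymm
  · have : (q : ℤ) ∣ a * q' := ⟨a' + k * q', by linarith⟩
    exact_mod_cast c1.symm.dvd_of_dvd_mul_left this
  · have : (q' : ℤ) ∣ a' * q := ⟨a - k * q, by linarith⟩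
    exact_mod_cast c2.symm.dvd_of_dvd_mul_left this

lemma lamP_ft (p N : ℕ) (α : ℝ) : ft (Ioc 0 N) (lamP p) α =
    ∑ x ∈ FF p, (kap x.1 : ℂ) * ∑ n ∈ Ioc 0 N, ee (n * (α - gam x)) := by
  unfold ft lamP
  simp only [sum_mul, mul_sum]
  rw [sum_comm]
  refine sum_congr rfl fun x _ => sum_congr rfl fun n _ => ?_
  rw [mul_assoc, ← ee_add]
  congr 2; ring

lemma oth_bound {p Q N : ℕ} (hpQ : 2 * p ≤ Q + 1) {α : ℝ} {a : ℤ} {q : ℕ} (hq : 0 < q) (hqQ : q ≤ Q)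
    (hα : |α - a / q| ≤ 1 / (((Q : ℝ) + 1) * q)) {x : ℕ × ℕ} (hx : x ∈ FF p)
    (h : ¬ ∃ k : ℤ, (a : ℝ) / q - gam x = k) : ‖(kap x.1 : ℂ) * ∑ n ∈ Ioc 0 N, ee (n * (α - gam x))‖ ≤ (Q : ℝ) * p := by
  obtain ⟨h1, h2, -, -⟩ := mem_FF hx
  have hq' : (0 : ℝ) < q := by exact_mod_cast hq
  have h1' : (0 : ℝ) < x.1 := by exact_mod_cast h1
  have h2' : (x.1 : ℝ) ≤ p := by exact_mod_cast h2
  have hqQ' : (q : ℝ) ≤ Q := by exact_mod_cast hqQ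
  have hpQ' : 2 * (p : ℝ) ≤ Q + 1 := by exact_mod_cast hpQ
  have hs := sep_gen a x.2 q x.1 hq h1 (by simpa [gam] using h)
  have hadd := nd_le_add ((a : ℝ) / q - gam x) (α - gam x)
  have e : (a : ℝ) / q - gam x - (α - gam x) = -(α - a / q) := by ring
  rw [e, abs_neg] at hadd
  have hs' : 1 / ((q : ℝ) * x.1) ≤ nd ((a : ℝ) / q - gam x) := by simpa [gam] using hs
  have h3 : 1 / (((Q : ℝ) + 1) * q) ≤ 1 / 2 * (1 / ((q : ℝ) * x.1)) := by
    rw [← one_div_mul_one_div, mul_comm, ← one_div_mul_one_div (q : ℝ), ← mul_assoc, mul_comm (1 / 2 : ℝ), mul_assoc]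
    refine mul_le_mul_of_nonneg_left ?_ (by positivity)
    rw [one_div_mul_one_div]
    exact one_div_le_one_div_of_le (by positivity) (by linarith)
  have h4 : 1 ≤ ((q : ℝ) * x.1) * (2 * nd (α - gam x)) := by
    have : 1 / ((q : ℝ) * x.1) ≤ 2 * nd (α - gam x) := by linarith
    rw [div_le_iff₀ (by positivity)] at this
    linarith
  have h5 : 0 < 2 * nd (α - gam x) := by
    by_contra h'
    push Not at h'
    nlinarith [mul_pos hq' h1']
  have hg := geo_bound 0 N (α - gam x)
  have h6 : ‖∑ n ∈ Ioc 0 N, ee (n * (α - gam x))‖ ≤ (q : ℝ) * x.1 := le_of_mul_le_mul_right (hg.trans h4) h5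
  have h7 : (q : ℝ) * x.1 ≤ Q * p := mul_le_mul hqQ' h2' h1'.le (by positivity)
  rw [norm_mul, Complex.norm_real, Real.norm_eq_abs]
  calc _ ≤ 1 * ((Q : ℝ) * p) := mul_le_mul (kap_abs _) (h6.trans h7) (norm_nonneg _) zero_le_one
    _ = _ := one_mul _

lemma card_bound {p : ℕ} (s : Finset (ℕ × ℕ)) (hs : s ⊆ FF p) (f : ℕ × ℕ → ℂ) (M : ℝ) (hM : 0 ≤ M) (h : ∀ x ∈ s, ‖f x‖ ≤ M) :
    ‖∑ x ∈ s, f x‖ ≤ (p : ℝ) ^ 2 * M := by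
  refine (norm_sum_le _ _).trans ((sum_le_sum h).trans ?_)
  rw [sum_const, nsmul_eq_mul]
  have : (s.card : ℝ) ≤ (p : ℝ) ^ 2 := by exact_mod_cast (card_le_card hs).trans (card_FF p)
  exact mul_le_mul_of_nonneg_right this hM

lemma ee_lip (θ : ℝ) : ‖ee θ - 1‖ ≤ 7 * |θ| := by
  unfold ee
  have := Real.norm_exp_I_mul_ofReal_sub_one_le (x := 2 * Real.pi * θ)
  rw [mul_comm Complex.I] at this
  refine this.trans ?_
  rw [Real.norm_eq_abs, abs_mul, abs_of_pos (by positivity)]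
  have := Real.pi_lt_d2
  nlinarith [abs_nonneg θ]

noncomputable abbrev LamC : ℕ → ℂ := fun n => ((ArithmeticFunction.vonMangoldt n : ℝ) : ℂ)

lemma major_aux {p Q N : ℕ} (hpQ : 2 * p ≤ Q + 1) {α : ℝ} {a : ℤ} {q : ℕ} (hq : 0 < q) (hqQ : q ≤ Q) (hqp : q ≤ p)
    (hc : IsCoprime a (q : ℤ)) (hα : |α - a / q| ≤ 1 / (((Q : ℝ) + 1) * q)) (G : ℝ)
    (hG : ∀ j : ℕ, j ≤ N → ‖∑ n ∈ Ioc 0 j, (LamC n * ee (n * ((a : ℝ) / q)) - (kap q : ℂ))‖ ≤ G) :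
    ‖ft (Ioc 0 N) (LamC - lamP p) α‖ ≤ G * (1 + 7 * (N / (Q + 1))) + (p : ℝ) ^ 2 * (Q * p) := by
  classical
  have hq' : (0 : ℝ) < q := by exact_mod_cast hq
  have hG0 : 0 ≤ G := (norm_nonneg _).trans (hG 0 (Nat.zero_le _))
  have hqz : (q : ℤ) ≠ 0 := by exact_mod_cast hq.ne'
  have hr0 : 0 ≤ a % (q : ℤ) := Int.emod_nonneg _ hqz
  have hr1 : a % (q : ℤ) < q := Int.emod_lt_of_pos _ (by exact_mod_cast hq)
  set x0 : ℕ × ℕ := (q, (a % (q : ℤ)).toNat) with hx0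
  have hx2 : ((x0.2 : ℕ) : ℤ) = a % (q : ℤ) := Int.toNat_of_nonneg hr0
  have hcop : IsCoprime ((x0.2 : ℕ) : ℤ) (q : ℤ) := by
    rw [hx2]
    have := Int.emod_add_mul_ediv a q
    have e : a % (q : ℤ) = a + q * (-(a / q)) := by linarith
    rw [e]
    exact IsCoprime.add_mul_left_left hc _
  have hxF : x0 ∈ FF p := by
    unfold FF
    rw [mem_filter, mem_product, mem_Icc, mem_range]
    have : x0.2 < q := by omega
    refine ⟨⟨⟨hq, hqp⟩, by omega⟩, this, ?_⟩
    exact Nat.isCoprime_iff_coprime.mp hcop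
  have hgam : (a : ℝ) / q - gam x0 = ((a / (q : ℤ) : ℤ) : ℝ) := by
    unfold gam
    have h1 : ((x0.2 : ℕ) : ℝ) = ((a % (q : ℤ) : ℤ) : ℝ) := by exact_mod_cast hx2
    have h2 : (a : ℝ) = ((a % (q : ℤ) : ℤ) : ℝ) + q * ((a / (q : ℤ) : ℤ) : ℝ) := by
      exact_mod_cast (Int.emod_add_mul_ediv a q).symm
    rw [h1]
    have h3 : ((x0.1 : ℕ) : ℝ) = q := rfl
    rw [h3]
    generalize ((a % (q : ℤ) : ℤ) : ℝ) = u at *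
    generalize ((a / (q : ℤ) : ℤ) : ℝ) = v at *
    rw [h2]; field_simp; ring
  have hdecomp : ft (Ioc 0 N) (LamC - lamP p) α =
      ∑ n ∈ Ioc 0 N, ee (n * (α - a / q)) * (LamC n * ee (n * ((a : ℝ) / q)) - (kap q : ℂ)) -
      ∑ x ∈ (FF p).erase x0, (kap x.1 : ℂ) * ∑ n ∈ Ioc 0 N, ee (n * (α - gam x)) := by
    have h1 : ft (Ioc 0 N) (LamC - lamP p) α = ft (Ioc 0 N) LamC α - ft (Ioc 0 N) (lamP p) α := by
      unfold ft; rw [← sum_sub_distrib]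
      refine sum_congr rfl fun n _ => ?_
      rw [Pi.sub_apply]; ring
    rw [h1, lamP_ft, ← add_sum_erase _ _ hxF]
    have h2 : (kap x0.1 : ℂ) * ∑ n ∈ Ioc 0 N, ee (n * (α - gam x0)) = ∑ n ∈ Ioc 0 N, ee (n * (α - a / q)) * (kap q : ℂ) := by
      rw [mul_sum]
      refine sum_congr rfl fun n _ => ?_
      have : (n : ℝ) * (α - gam x0) = n * (α - a / q) + (((n : ℤ) * (a / (q : ℤ)) : ℤ) : ℝ) := by
        rw [Int.cast_mul, ← hgam]; push_cast; ring
      rw [this, ee_add, ee_int]; ring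
    rw [h2]
    have h3 : ft (Ioc 0 N) LamC α = ∑ n ∈ Ioc 0 N, ee (n * (α - a / q)) * (LamC n * ee (n * ((a : ℝ) / q))) := by
      unfold ft
      refine sum_congr rfl fun n _ => ?_
      have : (n : ℝ) * α = n * (α - a / q) + n * ((a : ℝ) / q) := by ring
      rw [this, ee_add]; ring
    rw [h3]
    simp only [mul_sub, sum_sub_distrib]
    ring
  rw [hdecomp]
  refine (norm_sub_le _ _).trans (add_le_add ?_ ?_)
  · have hab := abel_bound (fun n => ee (n * (α - a / q))) (fun n => LamC n * ee (n * ((a : ℝ) / q)) - (kap q : ℂ)) 0 N G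
      (fun j _ hj => hG j hj) hG0
    refine hab.trans (mul_le_mul_of_nonneg_left (add_le_add (ee_norm _).le ?_) hG0)
    have hθ : |α - a / q| ≤ 1 / ((Q : ℝ) + 1) := by
      refine hα.trans (one_div_le_one_div_of_le (by positivity) ?_)
      have : (1 : ℝ) ≤ q := by exact_mod_cast hq
      nlinarith [(Nat.cast_nonneg Q : (0 : ℝ) ≤ Q)]
    have h1 : ∀ j ∈ Ioo 0 N, ‖ee ((j + 1 : ℕ) * (α - a / q)) - ee (j * (α - a / q))‖ ≤ 7 * (1 / ((Q : ℝ) + 1)) := by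
      intro j _
      have : ((j + 1 : ℕ) : ℝ) * (α - a / q) = j * (α - a / q) + (α - a / q) := by push_cast; ring
      rw [this, ee_add]
      have e : ee (j * (α - a / q)) * ee (α - a / q) - ee (j * (α - a / q)) = ee (j * (α - a / q)) * (ee (α - a / q) - 1) := by ring
      rw [e, norm_mul, ee_norm, one_mul]
      exact (ee_lip _).trans (by linarith)
    refine (sum_le_sum h1).trans ?_
    rw [sum_const, nsmul_eq_mul]
    have h2 : ((Ioo 0 N).card : ℝ) ≤ N := by
      have : (Ioo 0 N).card ≤ N := by rw [Nat.card_Ioo]; omega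
      exact_mod_cast this
    calc _ ≤ (N : ℝ) * (7 * (1 / ((Q : ℝ) + 1))) := mul_le_mul_of_nonneg_right h2 (by positivity)
      _ = _ := by ring
  · refine card_bound _ (erase_subset _ _) _ _ (by positivity) fun x hx => ?_
    rw [mem_erase] at hx
    refine oth_bound hpQ hq hqQ hα hx.2 ?_
    rintro ⟨k, hk⟩
    refine gam_ne hxF hx.2 (fun h => hx.1 h.symm) ⟨k - a / (q : ℤ), ?_⟩
    rw [Int.cast_sub, ← hk, ← hgam]; push_cast; ring

lemma minor_aux {p Q N : ℕ} (hpQ : 2 * p ≤ Q + 1) {α : ℝ} {a : ℤ} {q : ℕ} (hq : 0 < q) (hqQ : q ≤ Q) (hqp : p < q)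
    (hc : IsCoprime a (q : ℤ)) (hα : |α - a / q| ≤ 1 / (((Q : ℝ) + 1) * q)) (X : ℝ) (hX1 : 1 ≤ X) (hN : (N : ℝ) ≤ X) (hQX : (Q : ℝ) ≤ X) :
    ‖ft (Ioc 0 N) (LamC - lamP p) α‖ ≤ 1000 * (3 + Real.log X) ^ 3 * (X / √(p + 1) + X ^ ((5 : ℝ) / 6) + √(X * Q)) + (p : ℝ) ^ 2 * (Q * p) := by
  have hq' : (0 : ℝ) < q := by exact_mod_cast hq
  have hqQ' : (q : ℝ) ≤ Q := by exact_mod_cast hqQ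
  have h1 : ft (Ioc 0 N) (LamC - lamP p) α = ft (Ioc 0 N) LamC α - ft (Ioc 0 N) (lamP p) α := by
    unfold ft; rw [← sum_sub_distrib]
    refine sum_congr rfl fun n _ => ?_
    rw [Pi.sub_apply]; ring
  rw [h1, lamP_ft]
  refine (norm_sub_le _ _).trans (add_le_add ?_ ?_)
  · have hv := vino hq hc (hα.trans (one_div_le_one_div_of_le (by positivity) (by nlinarith))) N X hX1 hN (hqQ'.trans hQX)
    refine hv.trans ?_
    have hl : 0 ≤ Real.log X := Real.log_nonneg hX1
    have : ((p : ℝ) + 1) ≤ q := by exact_mod_cast hqp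
    gcongr
  · refine card_bound _ subset_rfl _ _ (by positivity) fun x hx => ?_
    refine oth_bound hpQ hq hqQ hα hx ?_
    rintro ⟨k, hk⟩
    obtain ⟨h1, h2, -, h3⟩ := mem_FF hx
    have := same_q_gen a x.2 q x.1 hq h1 hc (Nat.isCoprime_iff_coprime.mpr h3) (k := k) (by simpa [gam] using hk)
    omega

end WCL

end

section

open Finset
namespace WCL

noncomputable def LamPr (n : ℕ) : ℂ := if n.Prime then ((Real.log n : ℝ) : ℂ) else 0

lemma pp_bound (N : ℕ) (X : ℝ) (hX : 1 ≤ X) (hN : (N : ℝ) ≤ X) (α : ℝ) :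
    ‖ft (Ioc 0 N) (LamPr - LamC) α‖ ≤ 2 * √X * Real.log X := by
  have h1 : ‖ft (Ioc 0 N) (LamPr - LamC) α‖ ≤ Chebyshev.psi X - Chebyshev.theta X := by
    unfold ft
    refine (norm_sum_le _ _).trans ?_
    unfold Chebyshev.psi Chebyshev.theta
    rw [sum_filter, ← sum_sub_distrib]
    have hsub : Ioc 0 N ⊆ Ioc 0 ⌊X⌋₊ := Ioc_subset_Ioc_right (Nat.le_floor hN)
    have hval : ∀ n : ℕ, ‖(LamPr - LamC) n * ee (n * α)‖ = ArithmeticFunction.vonMangoldt n - (if n.Prime then Real.log n else 0) := by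
      intro n
      rw [norm_mul, ee_norm, mul_one, Pi.sub_apply]
      unfold LamPr LamC
      split_ifs with h
      · rw [ArithmeticFunction.vonMangoldt_apply_prime h]; simp
      · rw [zero_sub, norm_neg, Complex.norm_real, Real.norm_of_nonneg ArithmeticFunction.vonMangoldt_nonneg, sub_zero]
    simp only [hval]
    refine sum_le_sum_of_subset_of_nonneg hsub fun n _ _ => ?_
    rw [← hval n]; exact norm_nonneg _
  exact h1.trans (Chebyshev.psi_sub_theta_le hX)

theorem claimD : ∃ K X0 : ℝ, 0 < K ∧ 3 ≤ X0 ∧ ∀ X, X0 ≤ X → ∀ N : ℕ, (N : ℝ) ≤ X → ∀ α : ℝ,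
    ‖ft (Ioc 0 N) (LamPr - lamP ⌊Real.log X ^ 30⌋₊) α‖ ≤ K * X / Real.log X ^ 10 := by
  obtain ⟨K1, X1, hK1, hX1, hsw⟩ := sw_add 130 30
  obtain ⟨X2, hX2, h2⟩ := logpow_le 141 1 2 one_pos
  obtain ⟨X3, hX3, h3⟩ := logpow_le 15 (1 / 6) 2 (by norm_num)
  obtain ⟨X4, hX4, h4⟩ := logpow_le 11 (1 / 2) 2 (by norm_num)
  refine ⟨192000 + 8 * K1 + 3, max (max X1 X2) (max X3 X4), by positivity,
    hX1.trans ((le_max_left _ _).trans (le_max_left _ _)), fun X hX N hN α => ?_⟩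
  obtain ⟨hXX, hXX'⟩ := max_le_iff.mp hX
  obtain ⟨hx1, hx2⟩ := max_le_iff.mp hXX
  obtain ⟨hx3, hx4⟩ := max_le_iff.mp hXX'
  obtain ⟨hL2, hL1, hL141⟩ := h2 X hx2
  obtain ⟨-, -, hL15⟩ := h3 X hx3
  obtain ⟨-, -, hL11⟩ := h4 X hx4
  have hsw' := hsw X hx1
  rw [Real.rpow_one] at hL141
  rw [← Real.sqrt_eq_rpow] at hL11
  have hX0 : (3 : ℝ) ≤ X := hX1.trans hx1
  have hXpos : 0 < X := by linarith
  set L := Real.log X with hL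
  have hLpos : 0 < L := by linarith
  set p := ⌊L ^ 30⌋₊ with hp
  set Q := ⌊X / L ^ 110⌋₊ with hQ
  have hp1 : (p : ℝ) ≤ L ^ 30 := Nat.floor_le (by positivity)
  have hp2 : L ^ 30 ≤ (p : ℝ) + 1 := (Nat.lt_floor_add_one _).le
  have hQ1 : (Q : ℝ) ≤ X / L ^ 110 := Nat.floor_le (by positivity)
  have hQ2 : X / L ^ 110 ≤ (Q : ℝ) + 1 := (Nat.lt_floor_add_one _).le
  have hpow : ∀ m n : ℕ, m ≤ n → L ^ m ≤ L ^ n := fun m n h => pow_le_pow_right₀ hL1 h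
  have hdiv : ∀ m n : ℕ, m ≤ n → X / L ^ n ≤ X / L ^ m := fun m n h => by
    have := hpow m n h
    gcongr
  have hpQ : 2 * p ≤ Q + 1 := by
    have : 2 * (p : ℝ) ≤ Q + 1 := by
      refine le_trans ?_ hQ2
      rw [le_div_iff₀ (by positivity)]
      calc 2 * (p : ℝ) * L ^ 110 ≤ L * L ^ 30 * L ^ 110 := by gcongr
        _ = L ^ 141 := by ring
        _ ≤ X := hL141
    exact_mod_cast this
  have hQpos : 0 < Q := by
    rw [hQ, Nat.floor_pos, one_le_div (by positivity)]
    exact (hpow 110 141 (by norm_num)).trans hL141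
  have hQX : (Q : ℝ) ≤ X := hQ1.trans ((hdiv 0 110 (by norm_num)).trans (by simp))
  have hR : (p : ℝ) ^ 2 * (Q * p) ≤ X / L ^ 10 := by
    calc (p : ℝ) ^ 2 * (Q * p) ≤ (L ^ 30) ^ 2 * (X / L ^ 110 * L ^ 30) := by gcongr
      _ = X / L ^ 20 := by field_simp
      _ ≤ _ := hdiv 10 20 (by norm_num)
  have hA0 : 0 ≤ X / L ^ 10 := by positivity
  have hmain : ‖ft (Ioc 0 N) (LamC - lamP p) α‖ ≤ (192000 + 8 * K1 + 1) * (X / L ^ 10) := by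
    obtain ⟨r, hr1, hr2⟩ := Real.exists_rat_abs_sub_le_and_den_le α hQpos
    have hrc : IsCoprime r.num (r.den : ℤ) := by
      rw [Int.isCoprime_iff_nat_coprime, Int.natAbs_natCast]; exact r.reduced
    have hr1' : |α - (r.num : ℝ) / (r.den : ℕ)| ≤ 1 / (((Q : ℝ) + 1) * (r.den : ℕ)) := by
      rwa [Rat.cast_def] at hr1
    rcases le_or_gt r.den p with hcase | hcase
    · have hb := major_aux (N := N) hpQ r.den_pos hr2 hcase hrc hr1' (K1 * X / L ^ 130) (fun j hj =>
        hsw' r.den r.den_pos (le_trans (by exact_mod_cast hcase) hp1) r.num hrc j (le_trans (by exact_mod_cast hj) hN))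
      refine hb.trans ?_
      have h5 : (N : ℝ) / (Q + 1) ≤ L ^ 110 := by
        rw [div_le_iff₀ (by positivity)]
        rw [div_le_iff₀ (by positivity)] at hQ2
        linarith
      have h6 : (1 : ℝ) ≤ L ^ 110 := one_le_pow₀ hL1
      have h7 : K1 * X / L ^ 130 * (1 + 7 * (N / (Q + 1))) ≤ 8 * K1 * (X / L ^ 10) := by
        calc K1 * X / L ^ 130 * (1 + 7 * (N / (Q + 1))) ≤ K1 * X / L ^ 130 * (8 * L ^ 110) := by
              gcongr; linarith
          _ = 8 * K1 * (X / L ^ 20) := by field_simp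
          _ ≤ _ := by
              have := hdiv 10 20 (by norm_num)
              gcongr
      nlinarith
    · have hb := minor_aux (N := N) hpQ r.den_pos hr2 hcase hrc hr1' X (by linarith) hN hQX
      refine hb.trans ?_
      have h5 : X / √((p : ℝ) + 1) ≤ X / L ^ 15 := by
        have : L ^ 15 ≤ √((p : ℝ) + 1) := Real.le_sqrt_of_sq_le (by rw [← pow_mul]; exact hp2)
        gcongr
      have h6 : X ^ ((5 : ℝ) / 6) ≤ X / L ^ 15 := by
        rw [le_div_iff₀ (by positivity)]
        calc X ^ ((5 : ℝ) / 6) * L ^ 15 ≤ X ^ ((5 : ℝ) / 6) * X ^ ((1 : ℝ) / 6) := by gcongr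
          _ = X := by rw [← Real.rpow_add hXpos]; norm_num
      have h7 : √(X * Q) ≤ X / L ^ 15 := by
        refine le_trans ?_ (hdiv 15 55 (by norm_num))
        apply Real.sqrt_le_iff.mpr
        refine ⟨by positivity, ?_⟩
        calc X * Q ≤ X * (X / L ^ 110) := by gcongr
          _ = _ := by rw [div_pow, ← pow_mul]; ring
      have h8 : (3 + L) ^ 3 ≤ (4 * L) ^ 3 := by gcongr; linarith
      have h9 : 1000 * (3 + L) ^ 3 * (X / √((p : ℝ) + 1) + X ^ ((5 : ℝ) / 6) + √(X * Q)) ≤ 192000 * (X / L ^ 10) := by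
        calc _ ≤ 1000 * (4 * L) ^ 3 * (X / L ^ 15 + X / L ^ 15 + X / L ^ 15) := by gcongr
          _ = 192000 * (X / L ^ 12) := by field_simp; ring
          _ ≤ _ := by
              have := hdiv 10 12 (by norm_num)
              gcongr
      have : 0 ≤ K1 * (X / L ^ 10) := by positivity
      nlinarith
  have hpp := pp_bound N X (by linarith) hN α
  have hpp2 : 2 * √X * L ≤ 2 * (X / L ^ 10) := by
    rw [mul_assoc]
    refine mul_le_mul_of_nonneg_left ?_ (by norm_num)
    rw [le_div_iff₀ (by positivity)]
    calc √X * L * L ^ 10 = √X * L ^ 11 := by ring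
      _ ≤ √X * √X := by gcongr
      _ = X := Real.mul_self_sqrt hXpos.le
  have hsplit : ft (Ioc 0 N) (LamPr - lamP p) α = ft (Ioc 0 N) (LamPr - LamC) α + ft (Ioc 0 N) (LamC - lamP p) α := by
    unfold ft; rw [← sum_add_distrib]
    refine sum_congr rfl fun n _ => ?_
    simp only [Pi.sub_apply]; ring
  rw [hsplit]
  refine (norm_add_le _ _).trans ?_
  rw [mul_div_assoc]
  linarith [hpp.trans hpp2]

end WCL

end

section

open Finset
namespace WCL

noncomputable def uu (η B : ℝ) : ℕ := ⌈η * B ^ ((1 : ℝ) / 3) - B ^ ((1 : ℝ) / 3) / Real.log B⌉₊ - 1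
noncomputable def vv (η B : ℝ) : ℕ := ⌊η * B ^ ((1 : ℝ) / 3) + B ^ ((1 : ℝ) / 3) / Real.log B⌋₊

lemma mem_uv (η B : ℝ) (h : 0 < η * B ^ ((1 : ℝ) / 3) - B ^ ((1 : ℝ) / 3) / Real.log B)
    (hW : 0 ≤ B ^ ((1 : ℝ) / 3) / Real.log B) (n : ℕ) :
    n ∈ Ioc (uu η B) (vv η B) ↔ (n : ℝ) ∈ shortInterval η B := by
  unfold uu vv shortInterval
  rw [mem_Ioc, Set.mem_Icc, Nat.le_floor_iff (by linarith)]
  have h1 : 0 < ⌈η * B ^ ((1 : ℝ) / 3) - B ^ ((1 : ℝ) / 3) / Real.log B⌉₊ := Nat.ceil_pos.mpr h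
  rw [← Nat.ceil_le]
  refine and_congr_left fun _ => ?_
  omega

lemma RB_eq (β : Fin 4 → ℤ) (η : Fin 4 → ℝ) (B : ℝ)
    (h : ∀ j, 0 < η j * B ^ ((1 : ℝ) / 3) - B ^ ((1 : ℝ) / 3) / Real.log B)
    (hW : 0 ≤ B ^ ((1 : ℝ) / 3) / Real.log B) :
    (RB β η B : ℂ) = TT β (fun j => Ioc (uu (η j) B) (vv (η j) B)) (fun _ => LamPr) := by
  classical
  have hset : primeQuad β η B = ((Fintype.piFinset (fun j => Ioc (uu (η j) B) (vv (η j) B))).filter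
      (fun n => ∑ j, β j * (n j : ℤ) = 0 ∧ ∀ j, (n j).Prime) : Finset (Fin 4 → ℕ)) := by
    ext n
    rw [mem_coe, mem_filter, Fintype.mem_piFinset, Fin.sum_univ_four]
    unfold primeQuad
    rw [Set.mem_setOf_eq]
    have e := fun j => mem_uv (η j) B (h j) hW (n j)
    constructor
    · rintro ⟨h1, h2⟩
      exact ⟨fun j => (e j).mpr (h1 j).2, h2, fun j => (h1 j).1⟩
    · rintro ⟨h1, h2, h3⟩
      exact ⟨fun j => ⟨h3 j, (e j).mp (h1 j)⟩, h2⟩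
  unfold RB
  rw [hset, finsum_mem_coe_finset, sum_filter]
  unfold TT
  push_cast
  refine sum_congr rfl fun n _ => ?_
  by_cases h1 : ∑ j, β j * (n j : ℤ) = 0
  · by_cases h2 : ∀ j, (n j).Prime
    · rw [if_pos ⟨h1, h2⟩, if_pos h1, Fin.prod_univ_four]
      unfold LamPr
      rw [if_pos (h2 0), if_pos (h2 1), if_pos (h2 2), if_pos (h2 3)]
      push_cast; rfl
    · rw [if_neg (fun h => h2 h.2), if_pos h1]
      push Not at h2
      obtain ⟨j, hj⟩ := h2
      rw [prod_eq_zero (mem_univ j)]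
      · simp
      · exact if_neg hj
  · rw [if_neg (fun h => h1 h.1), if_neg h1]; simp

lemma card_int (a W : ℝ) (hW : 2 ≤ W) (ha : 0 ≤ a - W) : W ≤ ((Icc ⌈a - W⌉₊ ⌊a + W⌋₊).card : ℝ) := by
  have h1 := Nat.ceil_lt_add_one ha
  have h2 := Nat.lt_floor_add_one (a + W)
  have h3 : ⌈a - W⌉₊ ≤ ⌊a + W⌋₊ + 1 := by
    have : (⌈a - W⌉₊ : ℝ) ≤ ⌊a + W⌋₊ + 1 := by linarith
    exact_mod_cast this
  rw [Nat.card_Icc, Nat.cast_sub h3]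
  push_cast; linarith

lemma Cnt_lower (β : Fin 4 → ℤ) (hβ : ∀ j, β j = 1 ∨ β j = -1) (η : Fin 4 → ℝ)
    (hrel : (β 0 : ℝ) * η 0 + (β 1 : ℝ) * η 1 + (β 2 : ℝ) * η 2 + (β 3 : ℝ) * η 3 = 0) (B : ℝ)
    (h : ∀ j, 0 < η j * B ^ ((1 : ℝ) / 3) - B ^ ((1 : ℝ) / 3) / Real.log B)
    (hW : 8 ≤ B ^ ((1 : ℝ) / 3) / Real.log B) :
    (B ^ ((1 : ℝ) / 3) / Real.log B / 4) ^ 3 ≤ Cnt β (fun j => Ioc (uu (η j) B) (vv (η j) B)) := by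
  classical
  have hmem := fun j => mem_uv (η j) B (h j) (by linarith)
  unfold shortInterval at hmem
  set Y := B ^ ((1 : ℝ) / 3) with hY
  set W := Y / Real.log B with hWd
  set J : Fin 4 → Finset ℕ := fun j => Icc ⌈η j * Y - W / 4⌉₊ ⌊η j * Y + W / 4⌋₊ with hJ
  have hJc : ∀ j, W / 4 ≤ ((J j).card : ℝ) := fun j => card_int (η j * Y) (W / 4) (by linarith) (by have := h j; linarith)
  have hJm : ∀ j n, n ∈ J j → |(n : ℝ) - η j * Y| ≤ W / 4 := by
    intro j n hn
    rw [hJ, mem_Icc, Nat.ceil_le, Nat.le_floor_iff (by have := h j; linarith)] at hn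
    rw [abs_le]; constructor <;> linarith [hn.1, hn.2]
  have hb3 : (β 3 : ℝ) * β 3 = 1 := by rcases hβ 3 with h | h <;> rw [h] <;> norm_num
  have hb3z : β 3 * β 3 = 1 := by rcases hβ 3 with h | h <;> rw [h] <;> norm_num
  have habs : ∀ j, |(β j : ℝ)| = 1 := by intro j; rcases hβ j with h | h <;> rw [h] <;> norm_num
  have hcard : ((J 0 ×ˢ J 1 ×ˢ J 2).card : ℝ) ≤ Cnt β (fun j => Ioc (uu (η j) B) (vv (η j) B)) := by
    unfold Cnt
    rw [sum_boole]
    refine Nat.cast_le.mpr ?_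
    refine card_le_card_of_injOn (fun x : ℕ × ℕ × ℕ =>
      ![x.1, x.2.1, x.2.2, (-(β 3 * (β 0 * x.1 + β 1 * x.2.1 + β 2 * x.2.2))).toNat]) ?_ ?_
    · rintro ⟨x, y, z⟩ hx
      rw [mem_coe, mem_product, mem_product] at hx
      have a0 := hJm 0 x hx.1
      have a1 := hJm 1 y hx.2.1
      have a2 := hJm 2 z hx.2.2
      set t : ℤ := -(β 3 * (β 0 * x + β 1 * y + β 2 * z)) with ht
      have ht3 : |(t : ℝ) - η 3 * Y| ≤ 3 * (W / 4) := by
        have e : (t : ℝ) - η 3 * Y = -(β 3 * (β 0 * (x - η 0 * Y))) + -(β 3 * (β 1 * (y - η 1 * Y))) + -(β 3 * (β 2 * (z - η 2 * Y))) := by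
          rw [ht]; push_cast
          linear_combination -(β 3 : ℝ) * Y * hrel + η 3 * Y * hb3
        rw [e]
        have k : ∀ (j : Fin 4) (w : ℝ), |-((β 3 : ℝ) * (β j * w))| = |w| := by
          intro j w; rw [abs_neg, abs_mul, abs_mul, habs, habs, one_mul, one_mul]
        refine (abs_add_le _ _).trans ?_
        refine (add_le_add (abs_add_le _ _) le_rfl).trans ?_
        rw [k, k, k]; linarith
      have htpos : 0 ≤ t := by
        have : (0 : ℝ) < t := by have := (abs_le.mp ht3).1; have := h 3; linarith
        exact_mod_cast this.le
      have htn : ((t.toNat : ℕ) : ℤ) = t := Int.toNat_of_nonneg htpos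
      have htr : ((t.toNat : ℕ) : ℝ) = t := by exact_mod_cast htn
      rw [mem_coe, mem_filter, Fintype.mem_piFinset]
      have inb : ∀ (j : Fin 4) (n : ℕ), |(n : ℝ) - η j * Y| ≤ W → n ∈ Ioc (uu (η j) B) (vv (η j) B) := by
        intro j n hn
        rw [hmem j n, Set.mem_Icc]
        rw [abs_le] at hn
        constructor <;> linarith [hn.1, hn.2]
      refine ⟨?_, ?_⟩
      · intro j
        fin_cases j
        · exact inb 0 x (by linarith)
        · exact inb 1 y (by linarith)
        · exact inb 2 z (by linarith)
        · exact inb 3 t.toNat (by rw [htr]; linarith)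
      · rw [Fin.sum_univ_four]
        show β 0 * (x : ℤ) + β 1 * (y : ℤ) + β 2 * (z : ℤ) + β 3 * ((t.toNat : ℕ) : ℤ) = 0
        rw [htn, ht]
        linear_combination -(β 0 * x + β 1 * y + β 2 * z) * hb3z
    · rintro ⟨x, y, z⟩ _ ⟨x', y', z'⟩ _ hxy
      have e0 := congrFun hxy 0
      have e1 := congrFun hxy 1
      have e2 := congrFun hxy 2
      simp at e0 e1 e2
      rw [e0, e1, e2]
  refine le_trans ?_ hcard
  rw [card_product, card_product]
  push_cast
  have hw0 : 0 ≤ W / 4 := by linarith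
  calc (W / 4) ^ 3 = W / 4 * (W / 4 * (W / 4)) := by ring
    _ ≤ _ := mul_le_mul (hJc 0) (mul_le_mul (hJc 1) (hJc 2) hw0 (by positivity)) (by positivity) (by positivity)

lemma LamPr_l2 (u v : ℕ) (X : ℝ) (hX : 1 ≤ X) (hv : (v : ℝ) ≤ X) : ∑ n ∈ Ioc u v, ‖LamPr n‖ ^ 2 ≤ X * Real.log X ^ 2 := by
  have hL : 0 ≤ Real.log X := Real.log_nonneg hX
  have h1 : ∀ n ∈ Ioc u v, ‖LamPr n‖ ^ 2 ≤ Real.log X ^ 2 := by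
    intro n hn
    rw [mem_Ioc] at hn
    refine pow_le_pow_left₀ (norm_nonneg _) ?_ 2
    unfold LamPr
    split_ifs with h
    · have h1 : (1 : ℝ) ≤ n := by exact_mod_cast h.one_le
      rw [Complex.norm_real, Real.norm_of_nonneg (Real.log_nonneg h1)]
      exact Real.log_le_log (by linarith) (le_trans (by exact_mod_cast hn.2) hv)
    · simpa using hL
  refine (sum_le_sum h1).trans ?_
  rw [sum_const, nsmul_eq_mul]
  refine mul_le_mul_of_nonneg_right ?_ (by positivity)
  refine le_trans ?_ hv
  have : (Ioc u v).card ≤ v := by rw [Nat.card_Ioc]; omega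
  exact_mod_cast this

theorem TT_lower : ∃ K X0 : ℝ, 0 < K ∧ 3 ≤ X0 ∧ ∀ X, X0 ≤ X → ∀ (β : Fin 4 → ℤ), (∀ j, β j = 1 ∨ β j = -1) →
    ∀ u v : Fin 4 → ℕ, (∀ j, (v j : ℝ) ≤ X) →
    Cnt β (fun j => Ioc (u j) (v j)) - K * (X ^ 3 / Real.log X ^ 4) ≤ (TT β (fun j => Ioc (u j) (v j)) (fun _ => LamPr)).re := by
  obtain ⟨K1, X1, hK1, hX1, hD⟩ := claimD
  obtain ⟨X2, hX2, h2⟩ := logpow_le 304 1 2 one_pos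
  refine ⟨64 * (2 * K1) * 120000 ^ 2 + 1, max X1 X2, by positivity, hX1.trans (le_max_left _ _), fun X hX β hβ u v hv => ?_⟩
  obtain ⟨hx1, hx2⟩ := max_le_iff.mp hX
  obtain ⟨hL2, hL1, hLp⟩ := h2 X hx2
  rw [Real.rpow_one] at hLp
  have hX3 : 3 ≤ X := hX1.trans hx1
  have hXpos : 0 < X := by linarith
  have hDX := hD X hx1
  have hP2 := fun u v hv => LamPr_l2 u v X (by linarith) hv
  set L := Real.log X with hL
  have hLpos : 0 < L := by linarith
  set p := ⌊L ^ 30⌋₊ with hp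
  have hp1 : (p : ℝ) ≤ L ^ 30 := Nat.floor_le (by positivity)
  have hp0 : 0 < p := by rw [hp, Nat.floor_pos]; exact one_le_pow₀ hL1
  have hp0' : (0 : ℝ) < p := by exact_mod_cast hp0
  set N := ⌊X⌋₊ with hN
  have hNX : (N : ℝ) ≤ X := Nat.floor_le hXpos.le
  have hvN : ∀ j, v j ≤ N := fun j => Nat.le_floor (hv j)
  have hlogL : Real.log L ≤ L := (Real.log_le_sub_one_of_pos hLpos).trans (by linarith)
  have hlp : Real.log p ≤ 30 * L := by
    refine (Real.log_le_log hp0' hp1).trans ?_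
    rw [Real.log_pow]; push_cast; linarith
  have hlp0 : 0 ≤ Real.log p := Real.log_nonneg (by exact_mod_cast hp0)
  have hlp1 : Real.log (p + 1) ≤ 31 * L := by
    have h1 : (p : ℝ) + 1 ≤ 2 * L ^ 30 := by have := one_le_pow₀ hL1 (n := 30); linarith
    refine (Real.log_le_log (by positivity) h1).trans ?_
    rw [Real.log_mul (by norm_num) (by positivity), Real.log_pow]
    have := Real.log_two_lt_d9
    push_cast; linarith
  have hlp2 : 0 ≤ Real.log (p + 1) := Real.log_nonneg (by linarith)
  have hT : (1 + 2 * Real.log p) ^ 2 * (1 + Real.log (p + 1)) ≤ 119072 * L ^ 3 := by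
    calc _ ≤ (61 * L) ^ 2 * (32 * L) := by
          refine mul_le_mul (pow_le_pow_left₀ (by linarith) (by linarith) 2) (by linarith) (by linarith) (by positivity)
      _ = _ := by ring
  have hp6 : (p : ℝ) ^ 6 ≤ X := by
    calc (p : ℝ) ^ 6 ≤ (L ^ 30) ^ 6 := by gcongr
      _ = L ^ 180 := by ring
      _ ≤ L ^ 304 := pow_le_pow_right₀ hL1 (by norm_num)
      _ ≤ X := hLp
  have hL3 : 1 ≤ L ^ 3 := one_le_pow₀ hL1
  have hXL : X ≤ X * L ^ 3 := le_mul_of_one_le_right hXpos.le hL3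
  have hdiff := TT_diff β hβ (fun j => Ioc (u j) (v j)) LamPr (lamP p) N
    (fun j => Ioc_subset_Ioc (Nat.zero_le _) (hvN j)) (120000 * (X * L ^ 3)) (2 * K1 * (X / L ^ 10))
    (fun j => by
      refine (hP2 (u j) (v j) (hv j)).trans ?_
      have : X * L ^ 2 ≤ X * L ^ 3 := by gcongr <;> norm_num
      have : 0 ≤ X * L ^ 3 := by positivity
      linarith)
    (fun j => by
      refine (lamP_l2 p (u j) (v j)).trans ?_
      have : (v j : ℝ) * ((1 + 2 * Real.log p) ^ 2 * (1 + Real.log (p + 1))) ≤ X * (119072 * L ^ 3) :=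
        mul_le_mul (hv j) hT (mul_nonneg (sq_nonneg _) (by linarith)) hXpos.le
      have : 0 ≤ X * L ^ 3 := by positivity
      linarith)
    (by have : 0 ≤ X * L ^ 3 := by positivity
        linarith)
    (fun j α => by
      have ha := hDX (v j) (hv j) α
      rcases le_total (u j) (v j) with h | h
      · have hb := hDX (u j) (le_trans (by exact_mod_cast h) (hv j)) α
        have e : ft (Ioc (u j) (v j)) (LamPr - lamP p) α = ft (Ioc 0 (v j)) (LamPr - lamP p) α - ft (Ioc 0 (u j)) (LamPr - lamP p) α := by
          unfold ft
          rw [← sum_Ioc_consecutive _ (Nat.zero_le (u j)) h]; ring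
        show ‖ft (Ioc (u j) (v j)) (LamPr - lamP p) α‖ ≤ _
        rw [e]
        refine (norm_sub_le _ _).trans ?_
        rw [mul_div_assoc] at ha hb
        linarith
      · show ‖ft (Ioc (u j) (v j)) (LamPr - lamP p) α‖ ≤ _
        unfold ft
        rw [Ioc_eq_empty_of_le h, sum_empty, norm_zero]
        positivity)
  have hlow := TT_lamP_lower β hβ u v N hvN p hp0
  have hre := (Complex.abs_re_le_norm _).trans hdiff
  rw [Complex.sub_re, abs_le] at hre
  have he1 : 64 * (2 * K1 * (X / L ^ 10) * (120000 * (X * L ^ 3)) ^ 2) = 64 * (2 * K1) * 120000 ^ 2 * (X ^ 3 / L ^ 4) := by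
    field_simp
  have he2 : (p : ℝ) ^ 10 * N ^ 2 ≤ X ^ 3 / L ^ 4 := by
    rw [le_div_iff₀ (by positivity)]
    calc (p : ℝ) ^ 10 * N ^ 2 * L ^ 4 ≤ (L ^ 30) ^ 10 * X ^ 2 * L ^ 4 := by gcongr
      _ = X ^ 2 * L ^ 304 := by ring
      _ ≤ X ^ 2 * X := by gcongr
      _ = X ^ 3 := by ring
  rw [he1] at hre
  linarith [hre.1]

lemma final_alg (K M Y B l : ℝ) (h : Y ^ 3 = B) (hl : 0 < l) :
    K * ((M * Y) ^ 3 / (l / 3) ^ 4) = (81 * K * M ^ 3) * (B / l ^ 3) / l := by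
  rw [mul_pow, h]; field_simp; norm_num

set_option maxHeartbeats 1600000 in
theorem main_lower
    (β : Fin 4 → ℤ) (hβ : ∀ j, β j = 1 ∨ β j = -1)
    (η : Fin 4 → ℝ) (hη : ∀ j, 0 < η j)
    (hrel : (β 0 : ℝ) * η 0 + (β 1 : ℝ) * η 1 + (β 2 : ℝ) * η 2 + (β 3 : ℝ) * η 3 = 0) :
    ∃ c : ℝ, 0 < c ∧ ∃ B₀ : ℝ, ∀ B : ℝ, B₀ ≤ B →
      c * B / Real.log B ^ 3 ≤ RB β η B := by
  obtain ⟨K, X0, hK, hX0, hT⟩ := TT_lower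
  set M : ℝ := η 0 + η 1 + η 2 + η 3 + 2 with hM
  have hM2 : 2 ≤ M := by linarith [hη 0, hη 1, hη 2, hη 3]
  have hMj : ∀ j, η j + 1 ≤ M := by
    intro j; fin_cases j <;> simp <;> linarith [hη 0, hη 1, hη 2, hη 3]
  set Λ0 : ℝ := (1 / η 0 + 1 / η 1 + 1 / η 2 + 1 / η 3) + 1 with hΛ
  have hΛj : ∀ j, 1 / η j + 1 ≤ Λ0 := by
    have a0 := one_div_pos.mpr (hη 0)
    have a1 := one_div_pos.mpr (hη 1)
    have a2 := one_div_pos.mpr (hη 2)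
    have a3 := one_div_pos.mpr (hη 3)
    intro j
    fin_cases j
    · show 1 / η 0 + 1 ≤ Λ0
      linarith
    · show 1 / η 1 + 1 ≤ Λ0
      linarith
    · show 1 / η 2 + 1 ≤ Λ0
      linarith
    · show 1 / η 3 + 1 ≤ Λ0
      linarith
  obtain ⟨B1, hB1, h1⟩ := logpow_le 2 (1 / 3) (Λ0 + 8 + 128 * 81 * K * M ^ 3) (by norm_num)
  refine ⟨1 / 128, by norm_num, max B1 (X0 ^ 3), fun B hB => ?_⟩
  obtain ⟨hb1, hb2⟩ := max_le_iff.mp hB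
  obtain ⟨hLc, hL1, hLB⟩ := h1 B hb1
  have hBpos : 0 < B := by linarith
  have hY3 : (B ^ ((1 : ℝ) / 3)) ^ 3 = B := by
    rw [← Real.rpow_natCast, ← Real.rpow_mul hBpos.le]; norm_num
  have hYX0 : X0 ≤ B ^ ((1 : ℝ) / 3) := by
    rw [← hY3] at hb2
    exact le_of_pow_le_pow_left₀ (by norm_num) (by positivity) hb2
  have hlogY : Real.log (B ^ ((1 : ℝ) / 3)) = Real.log B / 3 := by
    rw [Real.log_rpow hBpos]; ring
  have hReq := RB_eq β η B
  have hCnt := Cnt_lower β hβ η hrel B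
  set Y := B ^ ((1 : ℝ) / 3) with hY
  set l := Real.log B with hl
  have hYpos : 0 < Y := by linarith
  have hlpos : 0 < l := by linarith
  have hK0 : 0 ≤ 128 * 81 * K * M ^ 3 := by positivity
  have hη' : ∀ j, 0 < η j * Y - Y / l := by
    intro j
    have h2 := hΛj j
    have h3 : 1 / η j < l := by linarith
    rw [div_lt_iff₀ (hη j)] at h3
    have h4 : Y / l < η j * Y := by
      rw [div_lt_iff₀ hlpos]
      nlinarith
    linarith
  have hl8 : 8 ≤ l := by
    have h2 := hΛj 0
    have := one_div_pos.mpr (hη 0)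
    linarith
  have hW : 8 ≤ Y / l := by
    rw [le_div_iff₀ hlpos]
    nlinarith
  have hR := hReq hη' (by linarith)
  have hC := hCnt hη' hW
  have hWY : Y / l ≤ Y := div_le_self hYpos.le hL1
  have hlow := hT (M * Y) (hYX0.trans (le_mul_of_one_le_left hYpos.le (by linarith))) β hβ (fun j => uu (η j) B) (fun j => vv (η j) B) (fun j => by
    unfold vv
    refine (Nat.floor_le ?_).trans ?_
    · have := hη' j
      have : 0 ≤ Y / l := by linarith
      linarith
    · have := mul_le_mul_of_nonneg_right (hMj j) hYpos.le
      linarith)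
  rw [← hR, Complex.ofReal_re] at hlow
  have hlogX : l / 3 ≤ Real.log (M * Y) := by
    rw [← hlogY]
    exact Real.log_le_log hYpos (le_mul_of_one_le_left hYpos.le (by linarith))
  have he : K * ((M * Y) ^ 3 / Real.log (M * Y) ^ 4) ≤ 1 / 128 * (B / l ^ 3) := by
    calc K * ((M * Y) ^ 3 / Real.log (M * Y) ^ 4) ≤ K * ((M * Y) ^ 3 / (l / 3) ^ 4) := by gcongr
      _ = (81 * K * M ^ 3) * (B / l ^ 3) / l := final_alg K M Y B l hY3 hlpos
      _ ≤ _ := by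
        rw [div_le_iff₀ hlpos]
        have h5 : 0 ≤ B / l ^ 3 := by positivity
        have h6 : 128 * 81 * K * M ^ 3 ≤ l := by
          have h2 := hΛj 0
          have := one_div_pos.mpr (hη 0)
          linarith
        nlinarith
  have hm : (Y / l / 4) ^ 3 = 1 / 64 * (B / l ^ 3) := by
    rw [div_pow, div_pow, hY3]; ring
  rw [hm] at hC
  rw [mul_div_assoc]
  have h5 : 0 ≤ B / l ^ 3 := by positivity
  linarith

end WCL

end

/-- The lower bound `R(B) ≫ B (log B)⁻³`, which follows from Lemma 2 together with
`J(B) ≫ B (log B)⁻³` and `𝔖 ≥ 1`. -/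
theorem weighted_count_lower
    (β : Fin 4 → ℤ) (hβ : ∀ j, β j = 1 ∨ β j = -1)
    (η : Fin 4 → ℝ) (hη : ∀ j, 0 < η j)
    (hrel : (β 0 : ℝ) * η 0 + (β 1 : ℝ) * η 1 + (β 2 : ℝ) * η 2 + (β 3 : ℝ) * η 3 = 0) :
    ∃ c : ℝ, 0 < c ∧ ∃ B₀ : ℝ, ∀ B : ℝ, B₀ ≤ B →
      c * B / Real.log B ^ 3 ≤ RB β η B := by
  exact WCL.main_lower β hβ η hη hrel
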